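/- Let c be a real number with 1 < c < 4109054/1999527 and c ≠ 2, let ε > 0 be fixed and sufficiently small, and for a sufficiently large integer N set P = N^{1/c} and τ = P^{1-c-ε}. Then for every X with P^{9449/10000} ≪ X ≪ P, one has |∫_{τ}^{1-τ} S(α)^4 · S(α, X) · e(-Nα) dα| ≪ P^{5-c-ε'} for some ε' > 0, where S(α, X) = Σ_{X < p ≤ 2X} (log p)·e([p^c]·α), the sum over primes p with X < p ≤ 2X. -/

import Mathlib

open scoped Classical
open Finset Real MeasureTheory

/-- `eC x = e(x) = e^{2πix}`. -/
noncomputable def eC (x : ℝ) : ℂ := Complex.exp ((2 * Real.pi * x : ℝ) * Complex.I)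

/-- `SS c P α = S(α) = Σ_{p ≤ P} (log p) e([p^c]α)`, the sum over primes `p ≤ P`. -/
noncomputable def SS (c P α : ℝ) : ℂ :=
  ∑ p ∈ (Finset.range (⌊P⌋₊ + 1)).filter Nat.Prime,
    (Real.log p : ℂ) * eC ((⌊(p : ℝ) ^ c⌋ : ℝ) * α)

/-- `SX c X α = S(α, X) = Σ_{X < p ≤ 2X} (log p) e([p^c]α)`, the sum over primes
`X < p ≤ 2X`. -/
noncomputable def SX (c X α : ℝ) : ℂ :=
  ∑ p ∈ (Finset.Ioc ⌊X⌋₊ ⌊2 * X⌋₊).filter Nat.Prime,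
    (Real.log p : ℂ) * eC ((⌊(p : ℝ) ^ c⌋ : ℝ) * α)

lemma eC_add (x y : ℝ) : eC (x + y) = eC x * eC y := by
  unfold eC; rw [← Complex.exp_add]; congr 1; push_cast; ring

lemma eC_zero : eC 0 = 1 := by simp [eC]

lemma norm_eC (x : ℝ) : ‖eC x‖ = 1 := by
  unfold eC; exact Complex.norm_exp_ofReal_mul_I _

lemma conj_eC (x : ℝ) : (starRingEnd ℂ) (eC x) = eC (-x) := by
  unfold eC; rw [← Complex.exp_conj]; congr 1
  rw [map_mul, Complex.conj_ofReal, Complex.conj_I]; push_cast; ring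

lemma eC_sub (x y : ℝ) : eC (x - y) = eC x * (starRingEnd ℂ) (eC y) := by
  rw [sub_eq_add_neg, eC_add, conj_eC]

lemma eC_int (n : ℤ) : eC n = 1 := by
  unfold eC
  rw [Complex.exp_eq_one_iff]
  exact ⟨n, by push_cast; ring⟩

lemma eC_add_int (x : ℝ) (n : ℤ) : eC (x + n) = eC x := by
  rw [eC_add, eC_int, mul_one]

lemma continuous_eC : Continuous eC := by
  unfold eC; fun_prop

lemma norm_sum_eC_neg {ι : Type*} (s : Finset ι) (f : ι → ℝ) :
    ‖∑ i ∈ s, eC (-f i)‖ = ‖∑ i ∈ s, eC (f i)‖ := by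
  rw [← Complex.norm_conj (∑ i ∈ s, eC (f i)), map_sum]
  simp only [conj_eC]

lemma norm_sum_eC_le {ι : Type*} (s : Finset ι) (f : ι → ℝ) :
    ‖∑ i ∈ s, eC (f i)‖ ≤ s.card := by
  refine (norm_sum_le _ _).trans ?_
  simp [norm_eC]

lemma eC_re (x : ℝ) : (eC x).re = Real.cos (2 * π * x) := by
  unfold eC; rw [Complex.exp_ofReal_mul_I_re]

lemma eC_im (x : ℝ) : (eC x).im = Real.sin (2 * π * x) := by
  unfold eC; rw [Complex.exp_ofReal_mul_I_im]

lemma norm_eC_sub_one (x : ℝ) : ‖eC x - 1‖ = 2 * |Real.sin (π * x)| := by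
  have h : ‖eC x - 1‖ ^ 2 = (2 * |Real.sin (π * x)|) ^ 2 := by
    rw [← Complex.normSq_eq_norm_sq, Complex.normSq_apply, mul_pow, sq_abs]
    simp only [Complex.sub_re, Complex.sub_im, Complex.one_re, Complex.one_im, eC_re, eC_im]
    rw [show 2 * π * x = 2 * (π * x) by ring, Real.cos_two_mul, Real.sin_two_mul]
    nlinarith [Real.sin_sq_add_cos_sq (π * x)]
  exact (pow_left_inj₀ (norm_nonneg _) (by positivity) two_ne_zero).1 h

lemma norm_eC_sub_one_le (x : ℝ) : ‖eC x - 1‖ ≤ 2 * π * |x| := by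
  rw [norm_eC_sub_one]
  have := Real.abs_sin_le_abs (x := π * x)
  rw [abs_mul, abs_of_pos Real.pi_pos] at this
  linarith

lemma norm_eC_sub_eC_le (x y : ℝ) : ‖eC x - eC y‖ ≤ 2 * π * |x - y| := by
  have : eC x - eC y = eC y * (eC (x - y) - 1) := by
    rw [mul_sub, ← eC_add]; simp
  rw [this, norm_mul, norm_eC, one_mul]
  exact norm_eC_sub_one_le _

lemma le_norm_eC_sub_one {x : ℝ} (h0 : 0 ≤ x) (h1 : x ≤ 1 / 2) : 4 * x ≤ ‖eC x - 1‖ := by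
  rw [norm_eC_sub_one]
  have h := Real.mul_le_sin (x := π * x) (by positivity) (by nlinarith [Real.pi_pos])
  have : 2 / π * (π * x) = 2 * x := by field_simp
  rw [this] at h
  linarith [le_abs_self (Real.sin (π * x))]

lemma inv_eC_sub_one {x : ℝ} (hs : Real.sin (π * x) ≠ 0) :
    (eC x - 1)⁻¹ = ⟨-1 / 2, -(Real.cos (π * x) / Real.sin (π * x)) / 2⟩ := by
  apply inv_eq_of_mul_eq_one_right
  apply Complex.ext
  · simp only [Complex.mul_re, Complex.sub_re, Complex.sub_im, Complex.one_re, Complex.one_im, eC_re, eC_im]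
    rw [show 2 * π * x = 2 * (π * x) by ring, Real.cos_two_mul, Real.sin_two_mul]
    field_simp
    nlinarith [Real.sin_sq_add_cos_sq (π * x)]
  · simp only [Complex.mul_im, Complex.sub_re, Complex.sub_im, Complex.one_re, Complex.one_im, eC_re, eC_im]
    rw [show 2 * π * x = 2 * (π * x) by ring, Real.cos_two_mul, Real.sin_two_mul]
    field_simp
    have := Real.sin_sq_add_cos_sq (π * x)
    have h2 : Real.sin (π * x) ^ 2 = 1 - Real.cos (π * x) ^ 2 := by linarith
    first
      | nlinarith
      | (ring_nf; rw [h2]; ring)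

lemma sum_range_abel (u v : ℕ → ℂ) (N : ℕ) :
    ∑ n ∈ range (N + 1), (u (n + 1) - u n) * v n =
      u (N + 1) * v N - u 0 * v 0 - ∑ n ∈ range N, u (n + 1) * (v (n + 1) - v n) := by
  induction N with
  | zero => simp; ring
  | succ N ih => rw [sum_range_succ, ih, sum_range_succ _ N]; ring

/-- First forward difference of a sequence. -/
def dif (f : ℕ → ℝ) : ℕ → ℝ := fun n => f (n + 1) - f n

/-- Kuzmin–Landau, for a nondecreasing difference. -/
lemma kuzmin_landau_mono (f : ℕ → ℝ) (N : ℕ) (δ : ℝ) (hδ : 0 < δ)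
    (h1 : ∀ n < N, δ ≤ dif f n) (h2 : ∀ n < N, dif f n ≤ 1 / 2)
    (hm : ∀ n, n + 1 < N → dif f n ≤ dif f (n + 1)) :
    ‖∑ n ∈ range N, eC (f n)‖ ≤ 2 / δ := by
  rcases N with _ | N
  · simp; positivity
  set v : ℕ → ℂ := fun n => (eC (dif f n) - 1)⁻¹ with hv
  have hlow : ∀ n < N + 1, 4 * δ ≤ ‖eC (dif f n) - 1‖ := fun n hn =>
    le_trans (by linarith [h1 n hn])
      (le_norm_eC_sub_one (by linarith [h1 n hn]) (h2 n hn))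
  have hne : ∀ n < N + 1, eC (dif f n) - 1 ≠ 0 := fun n hn => by
    rw [← norm_pos_iff]; linarith [hlow n hn]
  have hvn : ∀ n < N + 1, ‖v n‖ ≤ 1 / (4 * δ) := fun n hn => by
    rw [hv]; simp only [norm_inv]
    rw [inv_eq_one_div]
    exact one_div_le_one_div_of_le (by positivity) (hlow n hn)
  have hsum : ∑ n ∈ range (N + 1), eC (f n) =
      ∑ n ∈ range (N + 1), (eC (f (n + 1)) - eC (f n)) * v n := by
    refine sum_congr rfl fun n hn => ?_
    have h := hne n (mem_range.1 hn)
    have : eC (f (n + 1)) - eC (f n) = eC (f n) * (eC (dif f n) - 1) := by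
      rw [mul_sub, ← eC_add]; simp [dif]
    rw [this, hv]
    field_simp
  have hsin : ∀ n < N + 1, 0 < Real.sin (π * dif f n) := fun n hn => by
    apply Real.sin_pos_of_pos_of_lt_pi
    · exact mul_pos Real.pi_pos (by linarith [h1 n hn])
    · nlinarith [h2 n hn, Real.pi_pos]
  have hvim : ∀ n < N + 1, v n = ⟨-1 / 2, -(Real.cos (π * dif f n) / Real.sin (π * dif f n)) / 2⟩ :=
    fun n hn => inv_eC_sub_one (hsin n hn).ne'
  have hdiff : ∀ n < N, ‖v (n + 1) - v n‖ = (v (n + 1)).im - (v n).im := by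
    intro n hn
    have hre : (v (n + 1) - v n).re = 0 := by
      rw [hvim n (by omega), hvim (n + 1) (by omega)]; simp
    have hx : v (n + 1) - v n = (((v (n + 1)).im - (v n).im : ℝ) : ℂ) * Complex.I := by
      apply Complex.ext
      · rw [hre]; simp
      · simp
    rw [hx, norm_mul, Complex.norm_I, mul_one, Complex.norm_real, Real.norm_eq_abs, abs_of_nonneg]
    rw [hvim n (by omega), hvim (n + 1) (by omega)]
    have s1 := hsin n (by omega)
    have s2 := hsin (n + 1) (by omega)
    have key : Real.cos (π * dif f (n + 1)) / Real.sin (π * dif f (n + 1)) ≤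
        Real.cos (π * dif f n) / Real.sin (π * dif f n) := by
      rw [div_le_div_iff₀ s2 s1]
      have : 0 ≤ Real.sin (π * dif f (n + 1) - π * dif f n) := by
        apply Real.sin_nonneg_of_nonneg_of_le_pi
        · nlinarith [hm n (by omega), Real.pi_pos]
        · nlinarith [h1 n (by omega), h2 (n + 1) (by omega), Real.pi_pos]
      rw [Real.sin_sub] at this
      linarith
    simp only
    linarith
  rw [hsum, sum_range_abel (fun n => eC (f n)) v N]
  have hT : ‖∑ n ∈ range N, eC (f (n + 1)) * (v (n + 1) - v n)‖ ≤ 1 / (2 * δ) := by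
    refine (norm_sum_le _ _).trans ?_
    have : ∑ n ∈ range N, ‖eC (f (n + 1)) * (v (n + 1) - v n)‖ =
        ∑ n ∈ range N, ((v (n + 1)).im - (v n).im) := by
      refine sum_congr rfl fun n hn => ?_
      rw [norm_mul, norm_eC, one_mul, hdiff n (mem_range.1 hn)]
    rw [this, sum_range_sub (fun n => (v n).im)]
    have a1 := (Complex.abs_im_le_norm (v N)).trans (hvn N (by omega))
    have a2 := (Complex.abs_im_le_norm (v 0)).trans (hvn 0 (by omega))
    have e : 1 / (2 * δ) = 1 / (4 * δ) + 1 / (4 * δ) := by field_simp; norm_num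
    rw [e]
    linarith [le_abs_self (v N).im, neg_abs_le (v 0).im]
  have b1 : ‖eC (f (N + 1)) * v N‖ ≤ 1 / (4 * δ) := by
    rw [norm_mul, norm_eC, one_mul]; exact hvn N (by omega)
  have b2 : ‖eC (f 0) * v 0‖ ≤ 1 / (4 * δ) := by
    rw [norm_mul, norm_eC, one_mul]; exact hvn 0 (by omega)
  have e : 2 / δ = 1 / (4 * δ) + 1 / (4 * δ) + 1 / (2 * δ) + 1 / δ := by field_simp; norm_num
  have : 0 < 1 / δ := by positivity
  calc _ ≤ ‖eC (f (N + 1)) * v N - eC (f 0) * v 0‖ + _ := norm_sub_le _ _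
    _ ≤ (‖eC (f (N + 1)) * v N‖ + ‖eC (f 0) * v 0‖) + 1 / (2 * δ) := by
        gcongr; exact norm_sub_le _ _
    _ ≤ 2 / δ := by rw [e]; linarith

/-- Kuzmin–Landau, for a monotone difference. -/
lemma kuzmin_landau (f : ℕ → ℝ) (N : ℕ) (δ : ℝ) (hδ : 0 < δ)
    (h1 : ∀ n < N, δ ≤ dif f n) (h2 : ∀ n < N, dif f n ≤ 1 / 2)
    (hm : (∀ n < N, 0 ≤ dif (dif f) n) ∨ (∀ n < N, dif (dif f) n ≤ 0)) :
    ‖∑ n ∈ range N, eC (f n)‖ ≤ 2 / δ := by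
  rcases hm with hm | hm
  · exact kuzmin_landau_mono f N δ hδ h1 h2 fun n hn => by
      have := hm n (by omega); unfold dif at this ⊢; linarith
  · rcases N with _ | N
    · simp; positivity
    rw [← sum_range_reflect]
    have e : ∀ n ∈ range (N + 1), eC (f (N + 1 - 1 - n)) = eC (-(-f (N - n))) := fun n _ => by simp
    rw [sum_congr rfl e, norm_sum_eC_neg]
    -- extend the reflected sequence by one affine step so that all differences are controlled
    set g : ℕ → ℝ := fun n => if n ≤ N then -f (N - n) else -f 0 + dif f 0 with hg
    have e2 : ∀ n ∈ range (N + 1), eC (-f (N - n)) = eC (g n) := fun n hn => by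
      rw [hg]; simp only; rw [if_pos (by have := mem_range.1 hn; omega)]
    rw [sum_congr rfl e2]
    have hgd : ∀ n < N + 1, dif g n = if n < N then dif f (N - (n + 1)) else dif f 0 := by
      intro n hn
      by_cases h : n < N
      · simp only [dif, hg, if_pos h, if_pos (show n ≤ N by omega), if_pos (show n + 1 ≤ N by omega)]
        rw [show N - (n + 1) + 1 = N - n by omega]; ring
      · have : n = N := by omega
        subst this
        simp [dif, hg]
    apply kuzmin_landau_mono g (N + 1) δ hδ
    · intro n hn; rw [hgd n hn]; split_ifs
      · exact h1 _ (by omega)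
      · exact h1 _ (by omega)
    · intro n hn; rw [hgd n hn]; split_ifs
      · exact h2 _ (by omega)
      · exact h2 _ (by omega)
    · intro n hn
      rw [hgd n (by omega), hgd (n + 1) hn, if_pos (by omega)]
      split_ifs with h
      · have := hm (N - (n + 1 + 1)) (by omega)
        rw [show N - (n + 1) = N - (n + 1 + 1) + 1 by omega]
        unfold dif at this ⊢; linarith
      · rw [show N - (n + 1) = 0 by omega]

lemma norm_sum_sq_le {ι : Type*} (s : Finset ι) (f : ι → ℂ) :
    ‖∑ i ∈ s, f i‖ ^ 2 ≤ s.card * ∑ i ∈ s, ‖f i‖ ^ 2 := by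
  calc ‖∑ i ∈ s, f i‖ ^ 2 ≤ (∑ i ∈ s, ‖f i‖) ^ 2 := by gcongr; exact norm_sum_le _ _
    _ ≤ _ := sq_sum_le_card_mul_sum_sq

lemma sum_shift_mul_conj (z : ℕ → ℂ) (N q j k : ℕ) (hjk : j ≤ k) (hk : k < q) :
    ∑ m ∈ range (N + q), (if j ≤ m ∧ m - j < N then z (m - j) else 0) *
        (starRingEnd ℂ) (if k ≤ m ∧ m - k < N then z (m - k) else 0) =
      ∑ n ∈ range (N - (k - j)), z (n + (k - j)) * (starRingEnd ℂ) (z n) := by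
  have hsub : Ico k (k + (N - (k - j))) ⊆ range (N + q) := by
    intro m hm; rw [mem_Ico] at hm; rw [mem_range]; omega
  rw [← sum_subset hsub, sum_Ico_eq_sum_range]
  · rw [show k + (N - (k - j)) - k = N - (k - j) by omega]
    refine sum_congr rfl fun n hn => ?_
    rw [mem_range] at hn
    rw [if_pos (by omega), if_pos (by omega), show k + n - j = n + (k - j) by omega,
      show k + n - k = n by omega]
  · intro m _ hm
    rw [mem_Ico] at hm
    by_cases h1 : j ≤ m ∧ m - j < N
    · rw [if_neg (c := k ≤ m ∧ m - k < N) (by omega)]; simp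
    · rw [if_neg h1]; simp

/-- The van der Corput inequality. -/
lemma van_der_corput (z : ℕ → ℂ) (N q : ℕ) (hq : 1 ≤ q) (hz : ∀ n < N, ‖z n‖ ≤ 1) :
    q * ‖∑ n ∈ range N, z n‖ ^ 2 ≤ (N + q) * (N + 2 * ∑ r ∈ Ico 1 q,
      ‖∑ n ∈ range (N - r), z (n + r) * (starRingEnd ℂ) (z n)‖) := by
  set D : ℕ → ℝ := fun r => ‖∑ n ∈ range (N - r), z (n + r) * (starRingEnd ℂ) (z n)‖ with hD
  set W : ℕ → ℕ → ℂ := fun m j => if j ≤ m ∧ m - j < N then z (m - j) else 0 with hW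
  have hqpos : (0 : ℝ) < q := by exact_mod_cast hq
  have h1 : (q : ℂ) * ∑ n ∈ range N, z n = ∑ m ∈ range (N + q), ∑ j ∈ range q, W m j := by
    rw [sum_comm]
    have : ∀ j ∈ range q, ∑ m ∈ range (N + q), W m j = ∑ n ∈ range N, z n := by
      intro j hj
      rw [mem_range] at hj
      have hsub : Ico j (j + N) ⊆ range (N + q) := by
        intro m hm; rw [mem_Ico] at hm; rw [mem_range]; omega
      rw [← sum_subset hsub, sum_Ico_eq_sum_range]
      · rw [show j + N - j = N by omega]
        refine sum_congr rfl fun n hn => ?_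
        rw [mem_range] at hn
        simp only [hW]
        rw [if_pos (by omega), show j + n - j = n by omega]
      · intro m _ hm
        rw [mem_Ico] at hm
        simp only [hW]
        rw [if_neg (by omega)]
    rw [sum_congr rfl this]; simp
  have hc : ∀ j < q, ∀ k < q, j ≤ k →
      ‖∑ m ∈ range (N + q), W m j * (starRingEnd ℂ) (W m k)‖ = D (k - j) := by
    intro j hj k hk hjk
    simp only [hW, hD]
    rw [sum_shift_mul_conj z N q j k hjk hk]
  have hc' : ∀ j < q, ∀ k < q, k ≤ j →
      ‖∑ m ∈ range (N + q), W m j * (starRingEnd ℂ) (W m k)‖ = D (j - k) := by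
    intro j hj k hk hjk
    rw [← hc k hk j hj hjk, ← Complex.norm_conj, map_sum]
    congr 1
    refine sum_congr rfl fun m _ => ?_
    rw [map_mul, Complex.conj_conj, mul_comm]
  have hD0 : D 0 ≤ N := by
    simp only [hD]
    refine (norm_sum_le _ _).trans ?_
    calc _ ≤ ∑ n ∈ range (N - 0), (1 : ℝ) := by
          refine sum_le_sum fun n hn => ?_
          rw [mem_range] at hn
          rw [norm_mul, Complex.norm_conj]
          have := hz n (by omega)
          simp only [add_zero]
          nlinarith [norm_nonneg (z n)]
      _ = N := by simp
  have hDnn : ∀ r, 0 ≤ D r := fun r => norm_nonneg _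
  have h2 : ∑ m ∈ range (N + q), ‖∑ j ∈ range q, W m j‖ ^ 2 ≤
      q * (N + 2 * ∑ r ∈ Ico 1 q, D r) := by
    have e : ((∑ m ∈ range (N + q), ‖∑ j ∈ range q, W m j‖ ^ 2 : ℝ) : ℂ) =
        ∑ j ∈ range q, ∑ k ∈ range q,
          ∑ m ∈ range (N + q), W m j * (starRingEnd ℂ) (W m k) := by
      push_cast
      have : ∀ m, ((‖∑ j ∈ range q, W m j‖ : ℝ) : ℂ) ^ 2 =
          ∑ j ∈ range q, ∑ k ∈ range q, W m j * (starRingEnd ℂ) (W m k) := by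
        intro m
        rw [← Complex.mul_conj', map_sum, sum_mul_sum]
      simp only [this]
      rw [sum_comm]
      refine sum_congr rfl fun j _ => ?_
      rw [sum_comm]
    have hn : (∑ m ∈ range (N + q), ‖∑ j ∈ range q, W m j‖ ^ 2 : ℝ) =
        ‖((∑ m ∈ range (N + q), ‖∑ j ∈ range q, W m j‖ ^ 2 : ℝ) : ℂ)‖ := by
      rw [Complex.norm_real, Real.norm_eq_abs, abs_of_nonneg]
      positivity
    rw [hn, e]
    have hj : ∀ j ∈ range q, ‖∑ k ∈ range q,
          ∑ m ∈ range (N + q), W m j * (starRingEnd ℂ) (W m k)‖ ≤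
        N + 2 * ∑ r ∈ Ico 1 q, D r := by
      intro j hj
      rw [mem_range] at hj
      refine (norm_sum_le _ _).trans ?_
      rw [range_eq_Ico, ← sum_Ico_consecutive _ (Nat.zero_le j) hj.le,
        sum_eq_sum_Ico_succ_bot hj]
      have a1 : ∑ k ∈ Ico 0 j, ‖∑ m ∈ range (N + q), W m j * (starRingEnd ℂ) (W m k)‖ ≤
          ∑ r ∈ Ico 1 q, D r := by
        rw [← range_eq_Ico]
        rw [sum_congr rfl (fun k hk => hc' j hj k (by have := mem_range.1 hk; omega)
          (by have := mem_range.1 hk; omega))]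
        rw [← sum_range_reflect]
        have : ∑ k ∈ range j, D (j - (j - 1 - k)) = ∑ r ∈ Ico 1 (j + 1), D r := by
          rw [sum_Ico_eq_sum_range]
          refine sum_congr (by simp) fun k hk => ?_
          rw [mem_range] at hk
          congr 1; omega
        rw [this]
        exact sum_le_sum_of_subset_of_nonneg (Ico_subset_Ico le_rfl (by omega))
          fun _ _ _ => hDnn _
      have a2 : ‖∑ m ∈ range (N + q), W m j * (starRingEnd ℂ) (W m j)‖ ≤ N := by
        rw [hc j hj j hj le_rfl, Nat.sub_self]; exact hD0
      have a3 : ∑ k ∈ Ico (j + 1) q, ‖∑ m ∈ range (N + q), W m j * (starRingEnd ℂ) (W m k)‖ ≤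
          ∑ r ∈ Ico 1 q, D r := by
        rw [sum_congr rfl (fun k hk => hc j hj k (by have := mem_Ico.1 hk; omega)
          (by have := mem_Ico.1 hk; omega))]
        have : ∑ k ∈ Ico (j + 1) q, D (k - j) = ∑ r ∈ Ico 1 (q - j), D r := by
          rw [sum_Ico_eq_sum_range, sum_Ico_eq_sum_range]
          refine sum_congr (by rw [Nat.sub_sub, add_comm]) fun k hk => ?_
          congr 1; omega
        rw [this]
        exact sum_le_sum_of_subset_of_nonneg (Ico_subset_Ico le_rfl (by omega))
          fun _ _ _ => hDnn _
      simp only [← range_eq_Ico] at *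
      linarith
    refine (norm_sum_le _ _).trans ((sum_le_sum hj).trans ?_)
    rw [sum_const, card_range, nsmul_eq_mul]
  have h3 := norm_sum_sq_le (range (N + q)) (fun m => ∑ j ∈ range q, W m j)
  rw [← h1, norm_mul, card_range, mul_pow] at h3
  simp only [Complex.norm_natCast] at h3
  have h4 : (q : ℝ) * (q * ‖∑ n ∈ range N, z n‖ ^ 2) ≤
      q * ((N + q) * (N + 2 * ∑ r ∈ Ico 1 q, D r)) := by
    calc _ = (q : ℝ) ^ 2 * ‖∑ n ∈ range N, z n‖ ^ 2 := by ring
      _ ≤ _ := h3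
      _ ≤ ((N + q : ℕ) : ℝ) * (q * (N + 2 * ∑ r ∈ Ico 1 q, D r)) := by gcongr
      _ = _ := by push_cast; ring
  exact le_of_mul_le_mul_left h4 hqpos

lemma iterate_dif_succ (k : ℕ) (f : ℕ → ℝ) : dif^[k + 1] f = dif (dif^[k] f) :=
  Function.iterate_succ_apply' _ _ _

lemma iterate_dif_shift_sub (k r : ℕ) (f : ℕ → ℝ) (n : ℕ) :
    dif^[k] (fun m => f (m + r) - f m) n = ∑ i ∈ range r, dif^[k + 1] f (n + i) := by
  induction k generalizing n with
  | zero =>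
    simp only [Function.iterate_zero, id]
    rw [Function.iterate_one]
    have := Finset.sum_range_sub (fun i => f (n + i)) r
    simp only [add_zero] at this
    rw [← this]; rfl
  | succ k ih =>
    rw [iterate_dif_succ]
    simp only [dif] at ih ⊢
    rw [ih, ih, ← sum_sub_distrib]
    refine sum_congr rfl fun i _ => ?_
    rw [iterate_dif_succ (k + 1)]
    simp only [dif]
    rw [show n + 1 + i = n + i + 1 by ring]

/-- `f` has `k`-th differences in `[lam, h * lam]` and `(k+1)`-st differences of constant sign
on `[0, N)`. -/
def DifBound (k : ℕ) (h lam : ℝ) (N : ℕ) (f : ℕ → ℝ) : Prop :=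
  (∀ n < N, lam ≤ dif^[k] f n ∧ dif^[k] f n ≤ h * lam) ∧
    ((∀ n < N, 0 ≤ dif^[k + 1] f n) ∨ (∀ n < N, dif^[k + 1] f n ≤ 0))

lemma DifBound.shift_sub {k : ℕ} {h lam : ℝ} {N : ℕ} {f : ℕ → ℝ} (hf : DifBound (k + 1) h lam N f)
    (r : ℕ) : DifBound k h (r * lam) (N - r) (fun m => f (m + r) - f m) := by
  refine ⟨fun n hn => ?_, ?_⟩
  · rw [iterate_dif_shift_sub]
    have hi : ∀ i ∈ range r, n + i < N := fun i hi => by rw [mem_range] at hi; omega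
    constructor
    · have := card_nsmul_le_sum (range r) (fun i => dif^[k + 1] f (n + i)) lam
        (fun i hh => (hf.1 _ (hi i hh)).1)
      simpa using this
    · have := sum_le_card_nsmul (range r) (fun i => dif^[k + 1] f (n + i)) (h * lam)
        (fun i hh => (hf.1 _ (hi i hh)).2)
      rw [card_range, nsmul_eq_mul] at this
      linarith
  · have hi : ∀ n < N - r, ∀ i ∈ range r, n + i < N := fun n hn i hi => by
      rw [mem_range] at hi; omega
    refine hf.2.imp (fun h2 n hn => ?_) (fun h2 n hn => ?_)
    · rw [iterate_dif_shift_sub]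
      exact sum_nonneg fun i hh => h2 _ (hi n hn i hh)
    · rw [iterate_dif_shift_sub]
      exact sum_nonpos fun i hh => h2 _ (hi n hn i hh)

lemma sum_Ico_inv_le (q N : ℕ) (hq : q ≤ N) : ∑ r ∈ Ico 1 q, (1 : ℝ) / r ≤ 1 + Real.log N := by
  rcases Nat.eq_zero_or_pos N with rfl | hN
  · have : q = 0 := by omega
    subst this; simp
  calc ∑ r ∈ Ico 1 q, (1 : ℝ) / r ≤ ∑ r ∈ Icc 1 N, (1 : ℝ) / r := by
        refine sum_le_sum_of_subset_of_nonneg (fun x hx => ?_) (fun _ _ _ => by positivity)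
        rw [mem_Ico] at hx; rw [mem_Icc]; omega
    _ = (harmonic N : ℝ) := by
        rw [harmonic_eq_sum_Icc]; push_cast
        exact sum_congr rfl fun _ _ => one_div _
    _ ≤ _ := harmonic_le_one_add_log N

lemma one_le_one_add_log (N : ℕ) : (1 : ℝ) ≤ 1 + Real.log N := by
  linarith [Real.log_natCast_nonneg N]

lemma one_add_log_mono {M N : ℕ} (h : M ≤ N) : 1 + Real.log M ≤ 1 + Real.log N := by
  rcases Nat.eq_zero_or_pos M with rfl | hM
  · simpa using Real.log_natCast_nonneg N
  · have : (0 : ℝ) < M := by exact_mod_cast hM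
    have : (M : ℝ) ≤ N := by exact_mod_cast h
    gcongr

/-- The estimate furnished by the `k`-th difference test with exponents `a`, `b`. -/
def DifTest (k : ℕ) (a b : ℝ) : Prop :=
  ∀ h : ℝ, 1 ≤ h → ∃ C : ℝ, 0 < C ∧ ∀ (f : ℕ → ℝ) (N : ℕ) (lam : ℝ), 0 < lam →
    DifBound k h lam N f →
    ‖∑ n ∈ range N, eC (f n)‖ ≤
      C * (N * lam ^ a + (N : ℝ) ^ b * lam ^ (-a)) * (1 + Real.log N)

lemma correlation_eC (f : ℕ → ℝ) (r M : ℕ) :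
    ∑ n ∈ range M, eC (f (n + r)) * (starRingEnd ℂ) (eC (f n)) =
      ∑ n ∈ range M, eC (f (n + r) - f n) :=
  sum_congr rfl fun _ _ => (eC_sub _ _).symm

set_option maxHeartbeats 1000000 in
lemma difTest_two : DifTest 2 (1 / 2) 0 := by
  intro h hh
  refine ⟨40 * h, by linarith, fun f N lam hl hf => ?_⟩
  set Z := ‖∑ n ∈ range N, eC (f n)‖ with hZ
  set L := 1 + Real.log N with hL
  have hL1 : 1 ≤ L := one_le_one_add_log N
  have hZN : Z ≤ N := by simpa using norm_sum_eC_le (range N) f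
  have hZ0 : 0 ≤ Z := norm_nonneg _
  have hN0 : (0 : ℝ) ≤ N := Nat.cast_nonneg N
  have hs0 : 0 < lam ^ (1 / 2 : ℝ) := by positivity
  have hs2 : (lam ^ (1 / 2 : ℝ)) ^ 2 = lam := by
    rw [← Real.rpow_natCast, ← Real.rpow_mul hl.le]; norm_num
  have ht2 : (lam ^ (-(1 / 2) : ℝ)) = (lam ^ (1 / 2 : ℝ))⁻¹ := Real.rpow_neg hl.le _
  rw [ht2, Real.rpow_zero, one_mul]
  set s := lam ^ (1 / 2 : ℝ) with hs
  rcases lt_or_ge (1 : ℝ) (2 * h * lam) with hbig | hsmall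
  · -- large `lam`: trivial bound
    have h1 : 1 ≤ 2 * h * s := by
      by_contra hc
      push Not at hc
      have : (2 * h * s) ^ 2 < 1 := by
        rw [sq_lt_one_iff₀ (by positivity)]; exact hc
      nlinarith
    have : (0 : ℝ) ≤ s⁻¹ := by positivity
    calc Z ≤ N := hZN
      _ ≤ N * (2 * h * s) := le_mul_of_one_le_right hN0 h1
      _ ≤ 40 * h * (N * s) := by nlinarith [mul_nonneg (mul_nonneg hN0 hs0.le) (by linarith : 0 ≤ h)]
      _ ≤ 40 * h * (N * s + s⁻¹) := by gcongr; linarith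
      _ ≤ 40 * h * (N * s + s⁻¹) * L := le_mul_of_one_le_right (by positivity) hL1
  rcases Nat.eq_zero_or_pos N with hNz | hNpos
  · have : Z = 0 := by rw [hZ, hNz]; simp
    rw [this]; positivity
  set Q : ℝ := 1 / (2 * h * lam) with hQ
  have hhl : 0 < 2 * h * lam := by positivity
  have hQ1 : 1 ≤ Q := by rw [hQ, le_div_iff₀ hhl]; linarith
  set q := min N ⌊Q⌋₊ with hq
  have hq1 : 1 ≤ q := by
    rw [hq]; exact le_min hNpos (Nat.one_le_floor_iff _ |>.2 hQ1)
  have hqQ : (q : ℝ) ≤ Q := by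
    have : (q : ℝ) ≤ ⌊Q⌋₊ := by exact_mod_cast min_le_right _ _
    exact this.trans (Nat.floor_le (by linarith))
  have hqN : q ≤ N := min_le_left _ _
  have hqN' : (q : ℝ) ≤ N := by exact_mod_cast hqN
  have hq0 : (0 : ℝ) < q := by exact_mod_cast hq1
  have hD : ∀ r ∈ Ico 1 q, ‖∑ n ∈ range (N - r), eC (f (n + r)) * (starRingEnd ℂ) (eC (f n))‖ ≤
      2 / lam * (1 / r) := by
    intro r hr
    rw [mem_Ico] at hr
    have hr0 : (0 : ℝ) < r := by exact_mod_cast hr.1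
    have hrq : (r : ℝ) ≤ q := by exact_mod_cast hr.2.le
    rw [correlation_eC]
    have hg := hf.shift_sub r
    have e : 2 / lam * (1 / r) = 2 / (r * lam) := by field_simp
    rw [e]
    refine kuzmin_landau _ _ (r * lam) (by positivity) (fun n hn => ?_) (fun n hn => ?_) ?_
    · exact (hg.1 n hn).1
    · refine (hg.1 n hn).2.trans ?_
      have : r * (2 * h * lam) ≤ 1 := by
        calc r * (2 * h * lam) ≤ Q * (2 * h * lam) := by gcongr; linarith
          _ = 1 := by rw [hQ]; field_simp
      nlinarith
    · exact hg.2
  have hv := van_der_corput (fun n => eC (f n)) N q hq1 (fun _ _ => (norm_eC _).le)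
  have hS : ∑ r ∈ Ico 1 q, ‖∑ n ∈ range (N - r), eC (f (n + r)) * (starRingEnd ℂ) (eC (f n))‖ ≤
      2 / lam * L := by
    refine (sum_le_sum hD).trans ?_
    rw [← mul_sum]
    gcongr
    exact sum_Ico_inv_le q N hqN
  have hv2 : q * Z ^ 2 ≤ (2 * N) * (N + 4 * L / lam) := by
    refine hv.trans ?_
    have : (0 : ℝ) ≤ ∑ r ∈ Ico 1 q, ‖∑ n ∈ range (N - r), eC (f (n + r)) * (starRingEnd ℂ) (eC (f n))‖ :=
      sum_nonneg fun _ _ => norm_nonneg _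
    have e : 4 * L / lam = 2 * (2 / lam * L) := by ring
    rw [e]
    gcongr
    linarith
  -- the two cases for `q`
  have hfin : Z ^ 2 ≤ 40 * h * L * (N ^ 2 * lam + 1 / lam) := by
    have hamgm : (2 : ℝ) * N ≤ N ^ 2 * lam + 1 / lam := by
      have : N ^ 2 * lam + 1 / lam - 2 * N = (N * lam - 1) ^ 2 / lam := by field_simp; ring
      have h2 : 0 ≤ (N * lam - 1) ^ 2 / lam := by positivity
      linarith
    have hA0 : 0 ≤ N ^ 2 * lam := by positivity
    have hB0 : 0 ≤ 1 / lam := by positivity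
    rcases le_total N ⌊Q⌋₊ with hc | hc
    · have hqe : q = N := min_eq_left hc
      rw [hqe] at hv2 hqQ
      have hNp : (0 : ℝ) < N := by exact_mod_cast hNpos
      have h1 : Z ^ 2 ≤ 2 * (N + 4 * L / lam) := by
        have : N * Z ^ 2 ≤ N * (2 * (N + 4 * L / lam)) := by linarith
        exact le_of_mul_le_mul_left this hNp
      have h2 : 4 * L / lam = 4 * L * (1 / lam) := by ring
      rw [h2] at h1
      have h3 : (N : ℝ) ≤ L * (N ^ 2 * lam + 1 / lam) := by
        linarith [le_mul_of_one_le_left (add_nonneg hA0 hB0) hL1]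
      have h4 : L * (1 / lam) ≤ L * (N ^ 2 * lam + 1 / lam) := by gcongr; linarith
      have h5 : 0 ≤ L * (N ^ 2 * lam + 1 / lam) := by positivity
      nlinarith
    · have hqe : q = ⌊Q⌋₊ := min_eq_right hc
      have hqQ2 : Q ≤ 2 * q := by
        have := Nat.lt_floor_add_one Q
        rw [← hqe] at this
        have : (1 : ℝ) ≤ q := by exact_mod_cast hq1
        linarith
      have h1 : 1 ≤ 4 * h * lam * q := by
        have : Q * (2 * h * lam) = 1 := by rw [hQ]; field_simp
        nlinarith
      have h2 : Z ^ 2 ≤ 4 * h * lam * (q * Z ^ 2) := by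
        linarith [mul_le_mul_of_nonneg_right h1 (sq_nonneg Z)]
      have h3 : Z ^ 2 ≤ 4 * h * lam * ((2 * N) * (N + 4 * L / lam)) := by
        refine h2.trans ?_; gcongr
      have e : 4 * h * lam * ((2 * N) * (N + 4 * L / lam)) = 8 * h * (N ^ 2 * lam) + 16 * h * L * (2 * N) := by
        field_simp; ring
      rw [e] at h3
      have h4 : h * L * (2 * N) ≤ h * L * (N ^ 2 * lam + 1 / lam) := by gcongr
      have h5 : h * (N ^ 2 * lam) ≤ h * L * (N ^ 2 * lam + 1 / lam) := by
        have : h * 1 * (N ^ 2 * lam) ≤ h * L * (N ^ 2 * lam + 1 / lam) := by gcongr; linarith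
        linarith
      linarith [mul_nonneg (mul_nonneg (by linarith : 0 ≤ h) (by linarith : 0 ≤ L)) (add_nonneg hA0 hB0)]
  have hsq : N ^ 2 * lam + 1 / lam ≤ (N * s + s⁻¹) ^ 2 := by
    have : (N * s + s⁻¹) ^ 2 = N ^ 2 * s ^ 2 + 1 / s ^ 2 + 2 * N := by field_simp; ring
    rw [this, hs2]; linarith
  have hM : 1 ≤ 40 * h * L := one_le_mul_of_one_le_of_one_le (by linarith) hL1
  have : Z ^ 2 ≤ (40 * h * (N * s + s⁻¹) * L) ^ 2 := by
    calc Z ^ 2 ≤ 40 * h * L * (N ^ 2 * lam + 1 / lam) := hfin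
      _ ≤ 40 * h * L * (N * s + s⁻¹) ^ 2 := by gcongr
      _ ≤ (40 * h * L) ^ 2 * (N * s + s⁻¹) ^ 2 := by
          gcongr
          exact le_self_pow₀ hM two_ne_zero
      _ = _ := by ring
  exact (sq_le_sq₀ hZ0 (by positivity)).1 this

lemma sum_range_inv_sqrt_le (m : ℕ) :
    ∑ r ∈ range m, 1 / Real.sqrt ((r + 1 : ℕ) : ℝ) ≤ 2 * Real.sqrt m := by
  induction m with
  | zero => simp
  | succ m ih =>
    rw [sum_range_succ]
    have h0 : 0 ≤ Real.sqrt m := Real.sqrt_nonneg _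
    have h1 : Real.sqrt m ^ 2 = m := Real.sq_sqrt (Nat.cast_nonneg m)
    have h2 : Real.sqrt ((m + 1 : ℕ) : ℝ) ^ 2 = m + 1 := by
      rw [Real.sq_sqrt (by positivity)]; push_cast; ring
    have h3 : 0 < Real.sqrt ((m + 1 : ℕ) : ℝ) := Real.sqrt_pos.2 (by positivity)
    set s := Real.sqrt m
    set t := Real.sqrt ((m + 1 : ℕ) : ℝ)
    have : 1 / t ≤ 2 * t - 2 * s := by
      rw [div_le_iff₀ h3]
      nlinarith [sq_nonneg (t - s)]
    linarith

lemma sum_Ico_rpow_neg_le (q : ℕ) (a : ℝ) (ha : a ≤ 1 / 2) :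
    ∑ r ∈ Ico 1 q, (r : ℝ) ^ (-a) ≤ 2 * (q : ℝ) * (q : ℝ) ^ (-a) := by
  rcases Nat.eq_zero_or_pos q with rfl | hq
  · simp
  have hq0 : (0 : ℝ) < q := by exact_mod_cast hq
  have hs : ∑ r ∈ Ico 1 q, 1 / Real.sqrt r ≤ 2 * Real.sqrt q := by
    rw [sum_Ico_eq_sum_range]
    have := sum_range_inv_sqrt_le (q - 1)
    simp only [add_comm 1]
    refine this.trans ?_
    gcongr
    exact Nat.sub_le _ _
  have hterm : ∀ r ∈ Ico 1 q, (r : ℝ) ^ (-a) ≤ Real.sqrt q * (q : ℝ) ^ (-a) * (1 / Real.sqrt r) := by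
    intro r hr
    rw [mem_Ico] at hr
    have hr0 : (0 : ℝ) < r := by exact_mod_cast hr.1
    have hrq : (r : ℝ) ≤ q := by exact_mod_cast hr.2.le
    have hsr : 1 / Real.sqrt r = (r : ℝ) ^ (-(1 / 2) : ℝ) := by
      rw [Real.rpow_neg hr0.le, Real.sqrt_eq_rpow]; exact one_div _
    rw [hsr, Real.sqrt_eq_rpow, ← Real.rpow_add hq0]
    have : (r : ℝ) ^ (-a) = (r : ℝ) ^ (1 / 2 + -a) * (r : ℝ) ^ (-(1 / 2) : ℝ) := by
      rw [← Real.rpow_add hr0]; congr 1; ring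
    rw [this]
    gcongr
    linarith
  refine (sum_le_sum hterm).trans ?_
  rw [← mul_sum]
  calc _ ≤ Real.sqrt q * (q : ℝ) ^ (-a) * (2 * Real.sqrt q) := by gcongr
    _ = 2 * (Real.sqrt q ^ 2) * (q : ℝ) ^ (-a) := by ring
    _ = _ := by rw [Real.sq_sqrt hq0.le]

set_option maxHeartbeats 1000000 in
lemma DifTest.succ {k : ℕ} {a b : ℝ} (ha : 0 < a) (ha2 : a ≤ 1 / 2) (hb : 0 ≤ b)
    (hk : DifTest k a b) : DifTest (k + 1) (a / (2 * (1 + a))) ((1 + b) / 2) := by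
  intro h hh
  obtain ⟨C, hC, hk⟩ := hk h hh
  refine ⟨4 + 16 * C, by positivity, fun f N lam hl hf => ?_⟩
  set a' := a / (2 * (1 + a)) with ha'
  set b' := (1 + b) / 2 with hb'
  have ha'0 : 0 < a' := by positivity
  have haa : (1 - 2 * a') * a = 2 * a' := by rw [ha']; field_simp; ring
  have ha'1 : 2 * a' ≤ 1 := by
    rw [ha']; rw [show 2 * (a / (2 * (1 + a))) = a / (1 + a) by field_simp, div_le_one (by linarith)]
    linarith
  set Z := ‖∑ n ∈ range N, eC (f n)‖ with hZ
  set L := 1 + Real.log N with hL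
  have hL1 : 1 ≤ L := one_le_one_add_log N
  have hZN : Z ≤ N := by simpa using norm_sum_eC_le (range N) f
  have hZ0 : 0 ≤ Z := norm_nonneg _
  have hN0 : (0 : ℝ) ≤ N := Nat.cast_nonneg N
  -- it suffices to bound `Z` without the constant and the logarithm
  have triv : ∀ B : ℝ, 0 ≤ B → Z ≤ B → Z ≤ (4 + 16 * C) * B * L := by
    intro B hB hZB
    have h1 : B ≤ (4 + 16 * C) * B := le_mul_of_one_le_left hB (by linarith)
    exact hZB.trans (h1.trans (le_mul_of_one_le_right (by positivity) hL1))
  rcases Nat.eq_zero_or_pos N with hNz | hNpos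
  · refine triv _ (by positivity) ?_
    have : Z = 0 := by rw [hZ, hNz]; simp
    rw [this]; positivity
  have hNp : (0 : ℝ) < N := by exact_mod_cast hNpos
  have hN1 : (1 : ℝ) ≤ N := by exact_mod_cast hNpos
  rcases le_or_gt 1 lam with hbig | hsmall
  · refine triv _ (by positivity) (hZN.trans ?_)
    have h1 : 1 ≤ lam ^ a' := Real.one_le_rpow hbig ha'0.le
    have h2 : 0 ≤ (N : ℝ) ^ b' * lam ^ (-a') := by positivity
    linarith [le_mul_of_one_le_right hN0 h1]
  set Q : ℝ := lam ^ (-(2 * a')) with hQ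
  have hQ1 : 1 ≤ Q := Real.one_le_rpow_of_pos_of_le_one_of_nonpos hl hsmall.le (by linarith)
  have hQ0 : 0 < Q := by linarith
  rcases lt_or_ge (N : ℝ) Q with hNQ | hQN
  · refine triv _ (by positivity) (hZN.trans ?_)
    have h1 : (N : ℝ) = (N : ℝ) ^ b' * (N : ℝ) ^ (1 - b') := by
      rw [← Real.rpow_add hNp]; simp
    have h2 : (N : ℝ) ^ (1 - b') ≤ (N : ℝ) ^ (1 / 2 : ℝ) :=
      Real.rpow_le_rpow_of_exponent_le hN1 (by rw [hb']; linarith)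
    have h3 : (N : ℝ) ^ (1 / 2 : ℝ) ≤ Q ^ (1 / 2 : ℝ) := by gcongr
    have h4 : Q ^ (1 / 2 : ℝ) = lam ^ (-a') := by
      rw [hQ, ← Real.rpow_mul hl.le]; congr 1; ring
    have h5 : (N : ℝ) ≤ (N : ℝ) ^ b' * lam ^ (-a') := by
      calc (N : ℝ) = (N : ℝ) ^ b' * (N : ℝ) ^ (1 - b') := h1
        _ ≤ _ := by gcongr; linarith
    have h6 : 0 ≤ N * lam ^ a' := by positivity
    linarith
  set q := ⌊Q⌋₊ with hq
  have hq1 : 1 ≤ q := (Nat.one_le_floor_iff _).2 hQ1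
  have hqQ : (q : ℝ) ≤ Q := Nat.floor_le (by linarith)
  have hqQ2 : Q ≤ 2 * q := by
    have := Nat.lt_floor_add_one Q
    rw [← hq] at this
    have : (1 : ℝ) ≤ q := by exact_mod_cast hq1
    linarith
  have hqN' : (q : ℝ) ≤ N := hqQ.trans hQN
  have hq0 : (0 : ℝ) < q := by exact_mod_cast hq1
  have hD : ∀ r ∈ Ico 1 q, ‖∑ n ∈ range (N - r), eC (f (n + r)) * (starRingEnd ℂ) (eC (f n))‖ ≤
      C * L * (N * (q * lam) ^ a) + C * L * ((N : ℝ) ^ b * lam ^ (-a)) * (r : ℝ) ^ (-a) := by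
    intro r hr
    rw [mem_Ico] at hr
    have hr0 : (0 : ℝ) < r := by exact_mod_cast hr.1
    have hrq : (r : ℝ) ≤ q := by exact_mod_cast hr.2.le
    rw [correlation_eC]
    refine (hk _ _ (r * lam) (by positivity) (hf.shift_sub r)).trans ?_
    have hNr : ((N - r : ℕ) : ℝ) ≤ N := by exact_mod_cast Nat.sub_le _ _
    have hlog : 1 + Real.log ((N - r : ℕ) : ℝ) ≤ L := one_add_log_mono (Nat.sub_le _ _)
    have hlog0 : (0 : ℝ) ≤ 1 + Real.log ((N - r : ℕ) : ℝ) := by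
      linarith [one_le_one_add_log (N - r)]
    have e : (r * lam : ℝ) ^ (-a) = lam ^ (-a) * (r : ℝ) ^ (-a) := by
      rw [Real.mul_rpow hr0.le hl.le, mul_comm]
    calc _ ≤ C * (N * (q * lam) ^ a + (N : ℝ) ^ b * (r * lam) ^ (-a)) * L := by gcongr
      _ = _ := by rw [e]; ring
  have hv := van_der_corput (fun n => eC (f n)) N q hq1 (fun n _ => (norm_eC _).le)
  set T := ∑ r ∈ Ico 1 q, ‖∑ n ∈ range (N - r), eC (f (n + r)) * (starRingEnd ℂ) (eC (f n))‖ with hT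
  have hT0 : 0 ≤ T := sum_nonneg fun _ _ => norm_nonneg _
  have hS : T ≤ q * (C * L * (N * (q * lam) ^ a)) +
      C * L * ((N : ℝ) ^ b * lam ^ (-a)) * (2 * q * (q : ℝ) ^ (-a)) := by
    refine (sum_le_sum hD).trans ?_
    rw [sum_add_distrib, sum_const, Nat.card_Ico, nsmul_eq_mul, ← mul_sum]
    have : ((q - 1 : ℕ) : ℝ) ≤ q := by exact_mod_cast Nat.sub_le _ _
    exact add_le_add (mul_le_mul_of_nonneg_right this (by positivity))
      (mul_le_mul_of_nonneg_left (sum_Ico_rpow_neg_le q a ha2) (by positivity))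
  have hv2 : q * Z ^ 2 ≤ (2 * N) * (N + 2 * T) := by
    refine hv.trans ?_
    gcongr
    linarith
  have hv3 : q * Z ^ 2 ≤ q * ((2 * N) * (N / q + 2 * (C * L * (N * (q * lam) ^ a) +
      C * L * ((N : ℝ) ^ b * lam ^ (-a)) * (2 * (q : ℝ) ^ (-a))))) := by
    calc q * Z ^ 2 ≤ (2 * N) * (N + 2 * T) := hv2
      _ ≤ (2 * N) * (N + 2 * (q * (C * L * (N * (q * lam) ^ a)) +
      C * L * ((N : ℝ) ^ b * lam ^ (-a)) * (2 * q * (q : ℝ) ^ (-a)))) := by gcongr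
      _ = _ := by field_simp
  have hv4 := le_of_mul_le_mul_left hv3 hq0
  have k1 : (N : ℝ) / q ≤ 2 * (N * lam ^ (2 * a')) := by
    have : lam ^ (2 * a') * Q = 1 := by rw [hQ, ← Real.rpow_add hl]; simp
    have h1 : (1 : ℝ) ≤ lam ^ (2 * a') * (2 * q) := by
      rw [← this]; gcongr
    rw [div_le_iff₀ hq0]
    linarith [mul_le_mul_of_nonneg_left h1 hN0]
  have k2 : (q * lam : ℝ) ^ a ≤ lam ^ (2 * a') := by
    calc (q * lam : ℝ) ^ a ≤ (Q * lam) ^ a := by gcongr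
      _ = (lam ^ (1 - 2 * a')) ^ a := by
          congr 1; rw [hQ, ← Real.rpow_add_one hl.ne']; congr 1; ring
      _ = _ := by rw [← Real.rpow_mul hl.le, haa]
  have k3 : lam ^ (-a) * (q : ℝ) ^ (-a) ≤ 2 * lam ^ (-(2 * a')) := by
    have h1 : (Q * lam) ^ (-a) = lam ^ (-(2 * a')) := by
      rw [hQ, ← Real.rpow_add_one hl.ne', ← Real.rpow_mul hl.le]; congr 1; linear_combination -haa
    have h2 : (q : ℝ) ^ (-a) ≤ 2 * Q ^ (-a) := by
      have h3 : (q : ℝ) ^ (-a) ≤ (Q / 2) ^ (-a) :=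
        Real.rpow_le_rpow_of_nonpos (by positivity) (by linarith) (by linarith)
      have h4 : (Q / 2) ^ (-a) = Q ^ (-a) * 2 ^ a := by
        rw [Real.div_rpow hQ0.le (by norm_num), Real.rpow_neg (by norm_num : (0:ℝ) ≤ 2)]; field_simp
      have h5 : (2 : ℝ) ^ a ≤ 2 ^ (1 : ℝ) := Real.rpow_le_rpow_of_exponent_le (by norm_num) (by linarith)
      rw [Real.rpow_one] at h5
      calc _ ≤ _ := h3
        _ = Q ^ (-a) * 2 ^ a := h4
        _ ≤ Q ^ (-a) * 2 := by gcongr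
        _ = _ := by ring
    rw [Real.mul_rpow hQ0.le hl.le] at h1
    rw [← h1]
    calc _ ≤ lam ^ (-a) * (2 * Q ^ (-a)) := by gcongr
      _ = _ := by ring
  set u := lam ^ (2 * a') with hu
  have hu0 : 0 < u := by positivity
  have hv5 : Z ^ 2 ≤ (4 + 16 * C) * L * (N ^ 2 * u + (N : ℝ) ^ (1 + b) * Q) := by
    calc Z ^ 2 ≤ _ := hv4
      _ = 2 * N * (N / q) + 4 * C * L * N ^ 2 * ((q * lam) ^ a) +
          8 * C * L * (N * (N : ℝ) ^ b) * (lam ^ (-a) * (q : ℝ) ^ (-a)) := by ring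
      _ ≤ 2 * N * (2 * (N * u)) + 4 * C * L * N ^ 2 * u +
          8 * C * L * (N * (N : ℝ) ^ b) * (2 * Q) := by gcongr
      _ = 4 * (N ^ 2 * u) + 4 * C * L * (N ^ 2 * u) + 16 * C * L * ((N : ℝ) ^ (1 + b) * Q) := by
          rw [Real.rpow_add hNp, Real.rpow_one]; ring
      _ ≤ 4 * L * (N ^ 2 * u) + 16 * C * L * (N ^ 2 * u) + (4 + 16 * C) * L * ((N : ℝ) ^ (1 + b) * Q) := by
          have : 0 ≤ 4 * L * ((N : ℝ) ^ (1 + b) * Q) := by positivity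
          have h7 : 4 * (N ^ 2 * u) ≤ 4 * L * (N ^ 2 * u) := by
            have : 0 ≤ N ^ 2 * u := by positivity
            linarith [le_mul_of_one_le_left this hL1]
          have h8 : 4 * C * L * (N ^ 2 * u) ≤ 16 * C * L * (N ^ 2 * u) := by gcongr; norm_num
          linarith
      _ = _ := by ring
  have hsq : N ^ 2 * u + (N : ℝ) ^ (1 + b) * Q ≤ (N * lam ^ a' + (N : ℝ) ^ b' * lam ^ (-a')) ^ 2 := by
    have e1 : (lam ^ a') ^ 2 = u := by
      rw [hu, ← Real.rpow_natCast, ← Real.rpow_mul hl.le]; congr 1; push_cast; ring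
    have e2 : (lam ^ (-a')) ^ 2 = Q := by
      rw [hQ, ← Real.rpow_natCast, ← Real.rpow_mul hl.le]; congr 1; push_cast; ring
    have e3 : ((N : ℝ) ^ b') ^ 2 = (N : ℝ) ^ (1 + b) := by
      rw [← Real.rpow_natCast, ← Real.rpow_mul hN0]; congr 1; rw [hb']; push_cast; ring
    have : 0 ≤ (N * lam ^ a') * ((N : ℝ) ^ b' * lam ^ (-a')) := by positivity
    rw [add_sq, mul_pow, mul_pow, e1, e2, e3]
    linarith
  have hM : 1 ≤ (4 + 16 * C) * L := one_le_mul_of_one_le_of_one_le (by linarith) hL1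
  have : Z ^ 2 ≤ ((4 + 16 * C) * (N * lam ^ a' + (N : ℝ) ^ b' * lam ^ (-a')) * L) ^ 2 := by
    set B := N * lam ^ a' + (N : ℝ) ^ b' * lam ^ (-a')
    calc Z ^ 2 ≤ (4 + 16 * C) * L * B ^ 2 := hv5.trans (by gcongr)
      _ ≤ ((4 + 16 * C) * L) ^ 2 * B ^ 2 := by
          gcongr
          exact le_self_pow₀ hM two_ne_zero
      _ = _ := by ring
  exact (sq_le_sq₀ hZ0 (by positivity)).1 this

lemma difTest_three : DifTest 3 (1 / 6) (1 / 2) := by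
  have := difTest_two.succ (by norm_num) (by norm_num) (by norm_num)
  norm_num at this ⊢; exact this

lemma difTest_five : DifTest 5 (1 / 30) (7 / 8) := by
  have := (difTest_three.succ (by norm_num) (by norm_num) (by norm_num)).succ
    (by norm_num) (by norm_num) (by norm_num)
  norm_num at this ⊢; exact this

/-- Iterated mean value theorem for forward differences. -/
lemma exists_iterate_dif_eq (k : ℕ) : ∀ (F : ℕ → ℝ → ℝ),
    (∀ i x, 0 < x → HasDerivAt (F i) (F (i + 1) x) x) → ∀ (a : ℝ), 0 < a → ∀ n : ℕ,
    ∃ ξ, a + n ≤ ξ ∧ ξ ≤ a + n + k ∧ dif^[k] (fun m : ℕ => F 0 (a + m)) n = F k ξ := by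
  induction k with
  | zero => intro F _ a _ n; exact ⟨a + n, le_rfl, by simp, by simp⟩
  | succ k ih =>
    intro F hF a ha n
    obtain ⟨ξ, h1, h2, h3⟩ := ih (fun i x => F i (x + 1) - F i x) (fun i x hx => by
      have e1 : HasDerivAt (fun x => F i (x + 1)) (F (i + 1) (x + 1)) x :=
        (hF i (x + 1) (by linarith)).comp_add_const x 1
      exact e1.sub (hF i x hx)) a ha n
    have hξ : 0 < ξ := by have : (0 : ℝ) ≤ n := Nat.cast_nonneg n; linarith
    obtain ⟨ζ, hz, hz2⟩ := exists_hasDerivAt_eq_slope (F k) (F (k + 1)) (lt_add_one ξ)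
      (fun x hx => (hF k x (by linarith [hx.1])).continuousAt.continuousWithinAt)
      (fun x hx => hF k x (by linarith [hx.1]))
    refine ⟨ζ, by linarith [hz.1], ?_, ?_⟩
    · push_cast; linarith [hz.2]
    · rw [Function.iterate_succ_apply, hz2]
      have : dif (fun m : ℕ => F 0 (a + m)) =
          fun m : ℕ => (fun i x => F i (x + 1) - F i x) 0 (a + m) := by
        funext m; simp only [dif]; push_cast; rw [add_assoc]
      rw [this, h3]; simp

/-- The falling factorial `c (c - 1) ⋯ (c - k + 1)`. -/
noncomputable def fallFac (c : ℝ) (k : ℕ) : ℝ := ∏ i ∈ range k, (c - i)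

lemma hasDerivAt_fallFac (c y : ℝ) (i : ℕ) (x : ℝ) (hx : 0 < x) :
    HasDerivAt (fun x => y * fallFac c i * x ^ (c - i))
      (y * fallFac c (i + 1) * x ^ (c - (i + 1 : ℕ))) x := by
  have h := (Real.hasDerivAt_rpow_const (p := c - i) (Or.inl hx.ne')).const_mul (y * fallFac c i)
  refine h.congr_deriv ?_
  have e : fallFac c (i + 1) = fallFac c i * (c - i) := prod_range_succ _ _
  rw [e]
  push_cast
  rw [show c - (i + 1 : ℝ) = c - i - 1 by ring]; ring

lemma rpow_bounds {s R x Y : ℝ} (hR : 1 ≤ R) (hY : 0 < Y) (h1 : Y ≤ x) (h2 : x ≤ R * Y) :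
    R ^ (-|s|) * Y ^ s ≤ x ^ s ∧ x ^ s ≤ R ^ |s| * Y ^ s := by
  have hx : 0 < x := by linarith
  have hR0 : 0 < R := by linarith
  have e : x ^ s = (x / Y) ^ s * Y ^ s := by
    rw [Real.div_rpow hx.le hY.le]; field_simp
  have hr1 : 1 ≤ x / Y := by rw [le_div_iff₀ hY]; linarith
  have hr2 : x / Y ≤ R := by rw [div_le_iff₀ hY]; exact h2
  have hr0 : 0 < x / Y := by linarith
  rw [e]
  have hY' : 0 ≤ Y ^ s := by positivity
  constructor
  · gcongr
    calc R ^ (-|s|) ≤ (x / Y) ^ (-|s|) :=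
          Real.rpow_le_rpow_of_nonpos hr0 hr2 (by linarith [abs_nonneg s])
      _ ≤ (x / Y) ^ s := Real.rpow_le_rpow_of_exponent_le hr1 (neg_abs_le s)
  · gcongr
    calc (x / Y) ^ s ≤ (x / Y) ^ |s| := Real.rpow_le_rpow_of_exponent_le hr1 (le_abs_self s)
      _ ≤ R ^ |s| := by gcongr

lemma sum_Ioc_eq_range {M : Type*} [AddCommMonoid M] (f : ℕ → M) (A B : ℕ) :
    ∑ n ∈ Ioc A B, f n = ∑ m ∈ range (B - A), f (A + 1 + m) := by
  rw [← Finset.Ico_add_one_add_one_eq_Ioc, sum_Ico_eq_sum_range]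
  congr 2
  omega

lemma one_add_log_le (η : ℝ) (hη : 0 < η) {x : ℝ} (hx : 1 ≤ x) :
    1 + Real.log x ≤ (1 + 1 / η) * x ^ η := by
  have h1 := Real.log_le_rpow_div (by linarith : 0 ≤ x) hη
  have h2 := Real.one_le_rpow hx hη.le
  have : (1 + 1 / η) * x ^ η = x ^ η + x ^ η / η := by ring
  linarith

lemma difBound_power {c : ℝ} {k : ℕ} (hk : k + 1 ≤ 6) (y : ℝ)
    (hy : 0 < y * fallFac c k) (Y : ℝ) (hY : 1 ≤ Y) (A B : ℕ) (hA : Y ≤ A + 1) (hB : B ≤ 4 * Y) :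
    DifBound k ((10 : ℝ) ^ (2 * |c - k|))
      (y * fallFac c k * (10 ^ (-|c - k|) * Y ^ (c - k))) (B - A)
      (fun m : ℕ => y * ((A : ℝ) + 1 + m) ^ c) := by
  have hF := exists_iterate_dif_eq
  have e0 : (fun m : ℕ => y * ((A : ℝ) + 1 + m) ^ c) =
      fun m : ℕ => (fun i x => y * fallFac c i * x ^ (c - i)) 0 ((A : ℝ) + 1 + m) := by
    funext m; simp [fallFac]
  have hA0 : (0 : ℝ) < (A : ℝ) + 1 := by positivity
  have hk' : (k : ℝ) + 1 ≤ 6 := by exact_mod_cast hk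
  have hn : ∀ n < B - A, ((A : ℝ) + 1 + n) ≤ B := fun n hn => by
    have : A + 1 + n ≤ B := by omega
    exact_mod_cast this
  have key : ∀ j, j ≤ 6 → ∀ n < B - A, ∃ ξ, Y ≤ ξ ∧ ξ ≤ 10 * Y ∧
      dif^[j] (fun m : ℕ => y * ((A : ℝ) + 1 + m) ^ c) n = y * fallFac c j * ξ ^ (c - j) := by
    intro j hj n hnn
    obtain ⟨ξ, h1, h2, h3⟩ := exists_iterate_dif_eq j (fun i x => y * fallFac c i * x ^ (c - i))
      (fun i x hx => hasDerivAt_fallFac c y i x hx) ((A : ℝ) + 1) hA0 n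
    have hj' : (j : ℝ) ≤ 6 := by exact_mod_cast hj
    refine ⟨ξ, ?_, ?_, ?_⟩
    · have : (0 : ℝ) ≤ n := Nat.cast_nonneg n
      linarith
    · have := hn n hnn; linarith
    · rw [e0, h3]
  refine ⟨fun n hnn => ?_, ?_⟩
  · obtain ⟨ξ, h1, h2, h3⟩ := key k (by omega) n hnn
    have hb := rpow_bounds (s := c - k) (by norm_num : (1 : ℝ) ≤ 10) (by linarith) h1 h2
    rw [h3]
    refine ⟨mul_le_mul_of_nonneg_left hb.1 hy.le, ?_⟩
    have : (10 : ℝ) ^ (2 * |c - k|) * (y * fallFac c k * (10 ^ (-|c - k|) * Y ^ (c - k))) =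
        y * fallFac c k * (10 ^ |c - k| * Y ^ (c - k)) := by
      have : (10 : ℝ) ^ (2 * |c - k|) * 10 ^ (-|c - k|) = 10 ^ |c - k| := by
        rw [← Real.rpow_add (by norm_num)]; congr 1; ring
      rw [← this]; ring
    rw [this]
    exact mul_le_mul_of_nonneg_left hb.2 hy.le
  · rcases le_total 0 (y * fallFac c (k + 1)) with hs | hs
    · left
      intro n hnn
      obtain ⟨ξ, h1, h2, h3⟩ := key (k + 1) hk n hnn
      rw [h3]
      have : 0 < ξ := by linarith
      positivity
    · right
      intro n hnn
      obtain ⟨ξ, h1, h2, h3⟩ := key (k + 1) hk n hnn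
      rw [h3]
      have : 0 < ξ := by linarith
      exact mul_nonpos_of_nonpos_of_nonneg hs (by positivity)

lemma DifTest.power_sum {k : ℕ} {a b : ℝ} (hb : 0 ≤ b) (hb1 : b ≤ 1)
    (hT : DifTest k a b) {c : ℝ} (hff : fallFac c k ≠ 0) (hk : k + 1 ≤ 6) :
    ∃ C : ℝ, 0 < C ∧ ∀ (y Y : ℝ) (A B : ℕ), y ≠ 0 → 1 ≤ Y → Y ≤ A + 1 → (B : ℝ) ≤ 4 * Y →
      ‖∑ n ∈ Ioc A B, eC (y * (n : ℝ) ^ c)‖ ≤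
        C * (Y * (|y| * Y ^ (c - k)) ^ a + Y ^ b * (|y| * Y ^ (c - k)) ^ (-a)) * (1 + Real.log Y) := by
  obtain ⟨C, hC, hT⟩ := hT ((10 : ℝ) ^ (2 * |c - k|)) (Real.one_le_rpow (by norm_num) (by positivity))
  set κ : ℝ := |fallFac c k| * 10 ^ (-|c - k|) with hκ
  have hκ0 : 0 < κ := by have := abs_pos.2 hff; positivity
  refine ⟨C * (4 * (κ ^ a + κ ^ (-a))) * 4, by positivity, ?_⟩
  -- the case of positive `k`-th difference
  have main : ∀ (y Y : ℝ) (A B : ℕ), 0 < y * fallFac c k → 1 ≤ Y → Y ≤ A + 1 → (B : ℝ) ≤ 4 * Y →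
      ‖∑ n ∈ Ioc A B, eC (y * (n : ℝ) ^ c)‖ ≤ C * (4 * (κ ^ a + κ ^ (-a))) * 4 *
        (Y * (|y| * Y ^ (c - k)) ^ a + Y ^ b * (|y| * Y ^ (c - k)) ^ (-a)) * (1 + Real.log Y) := by
    intro y Y A B hy hY hA hB
    have hY0 : 0 < Y := by linarith
    have hlogY : 0 ≤ Real.log Y := Real.log_nonneg hY
    have hy0 : 0 < |y| := abs_pos.2 (left_ne_zero_of_mul hy.ne')
    have hd := difBound_power hk y hy Y hY A B hA hB
    have el : y * fallFac c k * (10 ^ (-|c - k|) * Y ^ (c - k)) = κ * (|y| * Y ^ (c - k)) := by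
      rw [← abs_of_pos hy, abs_mul, hκ]; ring
    rw [el] at hd
    set w := |y| * Y ^ (c - k) with hw
    have hw0 : 0 < w := by positivity
    have h1 := hT _ _ _ (by positivity) hd
    rw [sum_Ioc_eq_range]
    push_cast at h1 ⊢
    refine h1.trans ?_
    have hBA : ((B - A : ℕ) : ℝ) ≤ 4 * Y := le_trans (by exact_mod_cast Nat.sub_le _ _) hB
    have hlog : 1 + Real.log ((B - A : ℕ) : ℝ) ≤ 4 * (1 + Real.log Y) := by
      have h2 : Real.log ((B - A : ℕ) : ℝ) ≤ Real.log (4 * Y) := by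
        rcases Nat.eq_zero_or_pos (B - A) with h0 | h0
        · rw [h0]; simp only [Nat.cast_zero, Real.log_zero]
          exact Real.log_nonneg (by linarith)
        · exact Real.log_le_log (by exact_mod_cast h0) hBA
      rw [Real.log_mul (by norm_num) hY0.ne'] at h2
      have h3 : Real.log 4 ≤ 3 := by
        have := Real.log_le_sub_one_of_pos (by norm_num : (0 : ℝ) < 4); linarith
      linarith
    have hlog0 := one_le_one_add_log (B - A)
    have hb4 : ((B - A : ℕ) : ℝ) ^ b ≤ 4 * Y ^ b := by
      calc ((B - A : ℕ) : ℝ) ^ b ≤ (4 * Y) ^ b := by gcongr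
        _ = 4 ^ b * Y ^ b := Real.mul_rpow (by norm_num) hY0.le
        _ ≤ 4 ^ (1 : ℝ) * Y ^ b := by
            gcongr
            norm_num
        _ = _ := by rw [Real.rpow_one]
    rw [Real.mul_rpow hκ0.le hw0.le, Real.mul_rpow hκ0.le hw0.le]
    have p1 : 0 < κ ^ a := by positivity
    have p2 : 0 < κ ^ (-a) := by positivity
    have p3 : 0 < w ^ a := by positivity
    have p4 : 0 < w ^ (-a) := by positivity
    have p5 : 0 < Y ^ b := by positivity
    have hmid : ((B - A : ℕ) : ℝ) * (κ ^ a * w ^ a) + ((B - A : ℕ) : ℝ) ^ b * (κ ^ (-a) * w ^ (-a)) ≤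
        4 * (κ ^ a + κ ^ (-a)) * (Y * w ^ a + Y ^ b * w ^ (-a)) := by
      calc _ ≤ 4 * Y * (κ ^ a * w ^ a) + 4 * Y ^ b * (κ ^ (-a) * w ^ (-a)) := by gcongr
        _ ≤ 4 * Y * (κ ^ a * w ^ a) + 4 * Y ^ b * (κ ^ (-a) * w ^ (-a)) +
            (4 * Y * (κ ^ (-a) * w ^ a) + 4 * Y ^ b * (κ ^ a * w ^ (-a))) := by
            have : 0 ≤ 4 * Y * (κ ^ (-a) * w ^ a) + 4 * Y ^ b * (κ ^ a * w ^ (-a)) := by positivity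
            linarith
        _ = _ := by ring
    calc _ ≤ C * (4 * (κ ^ a + κ ^ (-a)) * (Y * w ^ a + Y ^ b * w ^ (-a))) * (4 * (1 + Real.log Y)) := by
          gcongr
      _ = _ := by ring
  intro y Y A B hy hY hA hB
  rcases lt_or_gt_of_ne (mul_ne_zero hy hff) with h | h
  · have := main (-y) Y A B (by linarith) hY hA hB
    rw [abs_neg] at this
    rw [← norm_sum_eC_neg]
    simpa using this
  · exact main y Y A B h hY hA hB

lemma rpow_scale {y Y c : ℝ} (hY : 0 < Y) (k : ℕ) :
    |y| * Y ^ (c - k) = |y| * Y ^ c * Y ^ (-(k : ℝ)) := by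
  rw [mul_assoc, ← Real.rpow_add hY]; rfl

lemma DifTest.power_sum_le {k : ℕ} {a b : ℝ} (ha : 0 < a) (hb : 0 ≤ b) (hb1 : b ≤ 1)
    (hT : DifTest k a b) {c : ℝ} (hff : fallFac c k ≠ 0) (hk : k + 1 ≤ 6) (u v : ℝ) :
    ∃ C : ℝ, 0 < C ∧ ∀ (y Y : ℝ) (A B : ℕ), 1 ≤ Y → Y ≤ A + 1 → (B : ℝ) ≤ 4 * Y →
      Y ^ u ≤ |y| * Y ^ c → |y| * Y ^ c ≤ Y ^ v →
      ‖∑ n ∈ Ioc A B, eC (y * (n : ℝ) ^ c)‖ ≤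
        C * (Y ^ (1 + a * (v - k)) + Y ^ (b + a * (k - u))) * (1 + Real.log Y) := by
  obtain ⟨C, hC, h⟩ := hT.power_sum hb hb1 hff hk
  refine ⟨C, hC, fun y Y A B hY hA hB h1 h2 => ?_⟩
  have hY0 : 0 < Y := by linarith
  have hy : y ≠ 0 := by
    rintro rfl
    have : 0 < Y ^ u := by positivity
    simp at h1; linarith
  refine (h y Y A B hy hY hA hB).trans ?_
  have hlog : 0 ≤ Real.log Y := Real.log_nonneg hY
  rw [rpow_scale hY0]
  have hy0 : 0 < |y| := abs_pos.2 hy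
  have e1 : Y * (|y| * Y ^ c * Y ^ (-(k : ℝ))) ^ a ≤ Y ^ (1 + a * (v - k)) := by
    calc _ ≤ Y * (Y ^ v * Y ^ (-(k : ℝ))) ^ a := by gcongr
      _ = _ := by
        rw [← Real.rpow_add hY0, ← Real.rpow_mul hY0.le, Real.rpow_add hY0, Real.rpow_one]
        congr 2; ring
  have e2 : Y ^ b * (|y| * Y ^ c * Y ^ (-(k : ℝ))) ^ (-a) ≤ Y ^ (b + a * (k - u)) := by
    calc _ ≤ Y ^ b * (Y ^ u * Y ^ (-(k : ℝ))) ^ (-a) := by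
          refine mul_le_mul_of_nonneg_left ?_ (by positivity)
          exact Real.rpow_le_rpow_of_nonpos (by positivity) (by gcongr) (by linarith)
      _ = _ := by
        rw [← Real.rpow_add hY0, ← Real.rpow_mul hY0.le, ← Real.rpow_add hY0]
        congr 1; ring
  gcongr

/-- A power saving for `∑ e(y n^c)` as soon as `|y| Y ^ c` lies in `[Y^(1/2), Y^(4.9)]`. -/
lemma exists_monomial_sum_le {c : ℝ} (h3 : fallFac c 3 ≠ 0) (h5 : fallFac c 5 ≠ 0) :
    ∃ C : ℝ, 0 < C ∧ ∀ (y Y : ℝ) (A B : ℕ), 1 ≤ Y → Y ≤ A + 1 → (B : ℝ) ≤ 4 * Y →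
      Y ^ (1 / 2 : ℝ) ≤ |y| * Y ^ c → |y| * Y ^ c ≤ Y ^ (4.9 : ℝ) →
      ‖∑ n ∈ Ioc A B, eC (y * (n : ℝ) ^ c)‖ ≤ C * Y ^ (0.997 : ℝ) := by
  obtain ⟨C3, hC3, b3⟩ := difTest_three.power_sum_le (by norm_num) (by norm_num) (by norm_num) h3
    (by norm_num) (1 / 2) 2.9
  obtain ⟨C5, hC5, b5⟩ := difTest_five.power_sum_le (by norm_num) (by norm_num) (by norm_num) h5
    (by norm_num) 2.9 4.9
  refine ⟨(C3 * 2 + C5 * 2) * (1 + 1 / 0.0003), by positivity, fun y Y A B hY hA hB hl hu => ?_⟩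
  have hY0 : 0 < Y := by linarith
  have hlog := one_add_log_le 0.0003 (by norm_num) hY
  have hlog0 : 0 ≤ Real.log Y := Real.log_nonneg hY
  have comb : ∀ D : ℝ, 0 ≤ D → D ≤ C3 * 2 + C5 * 2 → ∀ e1 e2 : ℝ, e1 ≤ 0.9967 → e2 ≤ 0.9967 →
      D / 2 * (Y ^ e1 + Y ^ e2) * (1 + Real.log Y) ≤
        (C3 * 2 + C5 * 2) * (1 + 1 / 0.0003) * Y ^ (0.997 : ℝ) := by
    intro D hD0 hD e1 e2 h1 h2
    have g1 : Y ^ e1 ≤ Y ^ (0.9967 : ℝ) := Real.rpow_le_rpow_of_exponent_le hY h1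
    have g2 : Y ^ e2 ≤ Y ^ (0.9967 : ℝ) := Real.rpow_le_rpow_of_exponent_le hY h2
    calc _ ≤ D / 2 * (Y ^ (0.9967 : ℝ) + Y ^ (0.9967 : ℝ)) * ((1 + 1 / 0.0003) * Y ^ (0.0003 : ℝ)) := by
          gcongr
      _ = D * (1 + 1 / 0.0003) * (Y ^ (0.9967 : ℝ) * Y ^ (0.0003 : ℝ)) := by ring
      _ = D * (1 + 1 / 0.0003) * Y ^ (0.997 : ℝ) := by rw [← Real.rpow_add hY0]; norm_num
      _ ≤ _ := by gcongr
  rcases le_total (|y| * Y ^ c) (Y ^ (2.9 : ℝ)) with hc | hc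
  · refine (b3 y Y A B hY hA hB hl hc).trans ?_
    have := comb (C3 * 2) (by positivity) (by linarith)
      (1 + 1 / 6 * (2.9 - (3 : ℕ))) (1 / 2 + 1 / 6 * ((3 : ℕ) - 1 / 2)) (by norm_num) (by norm_num)
    rwa [mul_div_cancel_right₀ _ (by norm_num)] at this
  · refine (b5 y Y A B hY hA hB hc hu).trans ?_
    have := comb (C5 * 2) (by positivity) (by linarith)
      (1 + 1 / 30 * (4.9 - (5 : ℕ))) (7 / 8 + 1 / 30 * ((5 : ℕ) - 2.9)) (by norm_num) (by norm_num)
    rwa [mul_div_cancel_right₀ _ (by norm_num)] at this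

lemma eC_nat_mul_fract (j : ℕ) (t : ℝ) : eC (j * t) = eC (j * Int.fract t) := by
  conv_lhs => rw [← Int.fract_add_floor t]
  rw [mul_add, show (j : ℝ) * (⌊t⌋ : ℝ) = ((j * ⌊t⌋ : ℤ) : ℝ) by push_cast; ring, eC_add_int]

lemma norm_geom_eC_mul (H : ℕ) (x : ℝ) :
    ‖∑ j ∈ range H, eC (j * x)‖ * ‖eC x - 1‖ ≤ 2 := by
  have e : ∀ j : ℕ, eC (j * x) = eC x ^ j := by
    intro j
    induction j with
    | zero => simp [eC_zero]
    | succ j ih => rw [pow_succ, ← ih, ← eC_add]; congr 1; push_cast; ring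
  simp only [e]
  rw [← norm_mul, geom_sum_mul]
  refine (norm_sub_le _ _).trans ?_
  simp only [norm_pow, norm_eC, one_pow, norm_one]
  norm_num

lemma le_norm_eC_sub_one' {x : ℝ} (h1 : |x| ≤ 1 / 2) : 4 * |x| ≤ ‖eC x - 1‖ := by
  have := le_norm_eC_sub_one (abs_nonneg x) h1
  rcases abs_choice x with h | h
  · rwa [h] at this ⊢
  · rw [h] at this ⊢
    refine this.trans (le_of_eq ?_)
    rw [← conj_eC, ← Complex.norm_conj (eC x - 1), map_sub, map_one]

/-- The normalised Fejér kernel of order `H`. -/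
noncomputable def fejer (H : ℕ) (x : ℝ) : ℝ := ‖∑ j ∈ range H, eC (j * x)‖ ^ 2 / (H : ℝ) ^ 2

lemma fejer_nonneg (H : ℕ) (x : ℝ) : 0 ≤ fejer H x := by unfold fejer; positivity

lemma fejer_fract (H : ℕ) (x : ℝ) : fejer H x = fejer H (Int.fract x) := by
  unfold fejer
  simp_rw [eC_nat_mul_fract _ x]

lemma fejer_add_int (H : ℕ) (x : ℝ) (m : ℤ) : fejer H (x + m) = fejer H x := by
  rw [fejer_fract, Int.fract_add_intCast, ← fejer_fract]

lemma fejer_eq (H : ℕ) (x : ℝ) :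
    (fejer H x : ℂ) = (∑ j ∈ range H, ∑ k ∈ range H, eC (((j : ℝ) - k) * x)) / (H : ℂ) ^ 2 := by
  unfold fejer
  push_cast
  rw [← Complex.mul_conj', map_sum, sum_mul_sum]
  congr 1
  refine sum_congr rfl fun j _ => sum_congr rfl fun k _ => ?_
  rw [sub_mul, eC_sub]

lemma fejer_mul_sq_le {H : ℕ} {x : ℝ} (hx : |x| ≤ 1 / 2) :
    fejer H x * x ^ 2 ≤ 1 / (4 * (H : ℝ) ^ 2) := by
  have h1 := norm_geom_eC_mul H x
  have h2 := le_norm_eC_sub_one' hx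
  have h3 : ‖∑ j ∈ range H, eC (j * x)‖ * (4 * |x|) ≤ 2 :=
    (mul_le_mul_of_nonneg_left h2 (norm_nonneg _)).trans h1
  have h4 : (‖∑ j ∈ range H, eC (j * x)‖ * |x|) ^ 2 ≤ (1 / 2) ^ 2 := by
    gcongr; linarith
  rw [mul_pow, sq_abs] at h4
  unfold fejer
  rcases Nat.eq_zero_or_pos H with rfl | hH
  · simp
  have hH0 : (0 : ℝ) < H := by exact_mod_cast hH
  rw [div_mul_eq_mul_div, div_le_div_iff₀ (by positivity) (by positivity)]
  nlinarith [sq_nonneg (H : ℝ)]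

lemma fejer_le_of_le {H : ℕ} (hH : 0 < H) {x d : ℝ} (hx : |x| ≤ 1 / 2) (hd : 0 < d) (hdx : d ≤ H * |x|) :
    fejer H x ≤ 1 / (4 * d ^ 2) := by
  have hH0 : (0 : ℝ) < H := by exact_mod_cast hH
  have h1 := fejer_mul_sq_le (H := H) hx
  have h2 : d ^ 2 ≤ H ^ 2 * x ^ 2 := by
    rw [← sq_abs x, ← mul_pow]; gcongr
  rw [le_div_iff₀ (by positivity)] at h1 ⊢
  calc fejer H x * (4 * d ^ 2) ≤ fejer H x * (4 * (H ^ 2 * x ^ 2)) := by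
        have := fejer_nonneg H x; gcongr
    _ = fejer H x * x ^ 2 * (4 * (H : ℝ) ^ 2) := by ring
    _ ≤ 1 := h1

lemma sum_eC_root (H : ℕ) (hH : 0 < H) (j k : ℕ) (hj : j < H) (hk : k < H) :
    ∑ a ∈ range H, eC (((j : ℝ) - k) * (-(a / H))) = if j = k then (H : ℂ) else 0 := by
  have hH0 : (H : ℝ) ≠ 0 := by positivity
  split_ifs with h
  · subst h; simp [eC_zero]
  set x : ℝ := -(((j : ℝ) - k) / H) with hx
  have e : ∀ a : ℕ, eC (((j : ℝ) - k) * (-(a / H))) = eC x ^ a := by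
    intro a
    induction a with
    | zero => simp [eC_zero]
    | succ a ih => rw [pow_succ, ← ih, ← eC_add]; congr 1; push_cast; rw [hx]; ring
  simp only [e]
  have hne : eC x ≠ 1 := by
    intro h1
    unfold eC at h1
    rw [Complex.exp_eq_one_iff] at h1
    obtain ⟨n, hn⟩ := h1
    have h2 : x = n := by
      have h3 : (x : ℂ) * (2 * π * Complex.I) = n * (2 * π * Complex.I) := by
        rw [← hn]; push_cast; ring
      have := mul_right_cancel₀ Complex.two_pi_I_ne_zero h3
      exact_mod_cast this
    have h4 : (k : ℝ) - j = n * H := by rw [← h2, hx]; field_simp; ring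
    have h5 : (k : ℤ) - j = n * H := by exact_mod_cast h4
    have h6 : (H : ℤ) ∣ (k : ℤ) - j := ⟨n, by rw [h5]; ring⟩
    have h7 := Int.eq_zero_of_abs_lt_dvd h6 (by rw [abs_lt]; constructor <;> omega)
    omega
  have hp : eC x ^ H = 1 := by
    rw [← e H, show ((j : ℝ) - k) * (-((H : ℝ) / H)) = (((k : ℤ) - j : ℤ) : ℝ) by
      rw [div_self hH0]; push_cast; ring]
    exact eC_int _
  have := geom_sum_mul (eC x) H
  rw [hp, sub_self] at this
  exact (mul_eq_zero.1 this).resolve_right (sub_ne_zero.2 hne)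

lemma sum_fejer (H : ℕ) (hH : 0 < H) (t : ℝ) : ∑ a ∈ range H, fejer H (t - a / H) = 1 := by
  have hH0 : (H : ℂ) ≠ 0 := by exact_mod_cast hH.ne'
  have : ((∑ a ∈ range H, fejer H (t - a / H) : ℝ) : ℂ) = 1 := by
    push_cast
    simp only [fejer_eq]
    rw [← sum_div, sum_comm]
    have : ∀ j ∈ range H, ∑ a ∈ range H, ∑ k ∈ range H, eC (((j : ℝ) - k) * (t - a / H)) = H := by
      intro j hj
      rw [sum_comm]
      have e : ∀ k ∈ range H, ∑ a ∈ range H, eC (((j : ℝ) - k) * (t - a / H)) =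
          if j = k then (H : ℂ) else 0 := by
        intro k hk
        have : ∀ a : ℕ, eC (((j : ℝ) - k) * (t - a / H)) =
            eC (((j : ℝ) - k) * t) * eC (((j : ℝ) - k) * (-(a / H))) := by
          intro a; rw [← eC_add]; congr 1; ring
        simp only [this]
        rw [← mul_sum, sum_eC_root H hH j k (mem_range.1 hj) (mem_range.1 hk)]
        split_ifs with h
        · subst h; simp [eC_zero]
        · simp
      rw [sum_congr rfl e]
      simp [mem_range.1 hj]
    rw [sum_congr rfl this]
    simp
    field_simp
  exact_mod_cast this

lemma sum_inv_sq_le (x : ℝ) (hx : 0 < x) (H : ℕ) :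
    ∑ a ∈ range H, 1 / (x + (a + 1)) ^ 2 ≤ 1 / x := by
  have h : ∑ a ∈ range H, 1 / (x + (a + 1)) ^ 2 ≤ 1 / x - 1 / (x + H) := by
    induction H with
    | zero => simp
    | succ n ih =>
      rw [sum_range_succ]
      push_cast
      have hn : (0 : ℝ) ≤ n := Nat.cast_nonneg n
      have : 1 / (x + (n + 1)) ^ 2 ≤ 1 / (x + n) - 1 / (x + (n + 1)) := by
        rw [div_sub_div _ _ (by positivity) (by positivity), div_le_div_iff₀ (by positivity) (by positivity)]
        nlinarith
      linarith
  have : 0 ≤ 1 / (x + H) := by positivity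
  linarith

lemma sum_inv_sq_le' (x : ℝ) (hx : 1 ≤ x) (H : ℕ) :
    ∑ a ∈ range H, 1 / (x + a) ^ 2 ≤ 1 / x + 1 / x := by
  have hx0 : 0 < x := by linarith
  cases H with
  | zero => simp; positivity
  | succ K =>
    rw [sum_range_succ']
    have h1 := sum_inv_sq_le x hx0 K
    have h3 : 1 / (x + (0 : ℕ)) ^ 2 ≤ 1 / x := by
      rw [Nat.cast_zero, add_zero]
      exact one_div_le_one_div_of_le (by linarith) (le_self_pow₀ hx (by norm_num))
    have h2 : ∑ a ∈ range K, 1 / (x + ((a + 1 : ℕ) : ℝ)) ^ 2 ≤ 1 / x := by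
      push_cast
      exact h1
    linarith

set_option maxHeartbeats 1000000 in
/-- Fejér interpolation of `t ↦ e(-α{t})` away from the integers. -/
lemma fejer_interp (M : ℕ) (hM : 8 ≤ M) (α t : ℝ) (hα : |α| ≤ 1 / 2)
    (h1 : 1 / (8 * M : ℝ) ≤ Int.fract t) (h2 : Int.fract t ≤ 1 - 1 / (8 * M : ℝ)) :
    ‖eC (-(α * Int.fract t)) - ∑ a ∈ range (M ^ 2), eC (-(α * (a / (M ^ 2 : ℕ)))) *
        (fejer (M ^ 2) (t - a / (M ^ 2 : ℕ)) : ℂ)‖ ≤ 20 / M := by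
  set H := M ^ 2 with hH
  set u := Int.fract t with hu
  have hM0 : (0 : ℝ) < M := by positivity
  have hM8 : (8 : ℝ) ≤ M := by exact_mod_cast hM
  have hHpos : 0 < H := by positivity
  have hH0 : (0 : ℝ) < H := by positivity
  have hHM : (H : ℝ) = M ^ 2 := by rw [hH]; push_cast; ring
  have hF : ∀ a : ℕ, fejer H (t - a / H) = fejer H (u - a / H) := by
    intro a
    rw [← fejer_add_int H (u - a / H) ⌊t⌋]
    congr 1
    have := Int.fract_add_floor t
    rw [← hu] at this
    linarith
  have hsum := sum_fejer H hHpos t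
  have e : eC (-(α * u)) - ∑ a ∈ range H, eC (-(α * (a / H))) * (fejer H (t - a / H) : ℂ) =
      ∑ a ∈ range H, (eC (-(α * u)) - eC (-(α * (a / H)))) * (fejer H (t - a / H) : ℂ) := by
    simp only [sub_mul, sum_sub_distrib]
    congr 1
    rw [← mul_sum]
    have : (∑ a ∈ range H, (fejer H (t - a / H) : ℂ)) = 1 := by exact_mod_cast hsum
    rw [this, mul_one]
  rw [e]
  refine (norm_sum_le _ _).trans ?_
  set x : ℝ := M / 8 with hx
  have hx0 : 1 ≤ x := by rw [hx]; linarith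
  have hxH : x = H * (1 / (8 * M)) := by rw [hx, hHM]; field_simp
  have hterm : ∀ a ∈ range H, ‖(eC (-(α * u)) - eC (-(α * (a / H)))) * (fejer H (t - a / H) : ℂ)‖ ≤
      π / 2 * (fejer H (t - a / H) / M + 1 / (4 * M ^ 3)) + 1 / 2 * (1 / (x + (H - 1 - a : ℕ) + 1) ^ 2) +
        1 / 2 * (1 / (x + a) ^ 2) := by
    intro a ha
    have ha' := mem_range.1 ha
    have haH : (a : ℝ) + 1 ≤ H := by exact_mod_cast ha'
    have hcast : ((H - 1 - a : ℕ) : ℝ) = H - 1 - a := by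
      rw [Nat.sub_sub, Nat.cast_sub (by omega)]; push_cast; ring
    rw [norm_mul, Complex.norm_real, Real.norm_eq_abs, abs_of_nonneg (fejer_nonneg _ _), hcast]
    have hf0 := fejer_nonneg H (t - a / H)
    have t1 : 0 ≤ π / 2 * (fejer H (t - a / H) / M + 1 / (4 * M ^ 3)) := by positivity
    have t2 : 0 ≤ 1 / 2 * (1 / (x + (H - 1 - a) + 1) ^ 2) := by positivity
    have t3 : 0 ≤ 1 / 2 * (1 / (x + a) ^ 2) := by positivity
    have haH1 : (a : ℝ) / H < 1 := by rw [div_lt_one hH0]; linarith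
    have haH0 : (0 : ℝ) ≤ a / H := by positivity
    have hd : ‖eC (-(α * u)) - eC (-(α * (a / H)))‖ ≤ 2 := by
      refine (norm_sub_le _ _).trans ?_
      rw [norm_eC, norm_eC]; norm_num
    have hHa : (H : ℝ) * (a / H) = a := by field_simp
    rw [hF] at hf0 t1 ⊢
    rcases le_or_gt |u - a / H| (1 / 2) with hc | hc
    · have k1 : ‖eC (-(α * u)) - eC (-(α * (a / H)))‖ ≤ π * |u - a / H| := by
        refine (norm_eC_sub_eC_le _ _).trans ?_
        have : -(α * u) - -(α * (a / H)) = -(α * (u - a / H)) := by ring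
        rw [this, abs_neg, abs_mul]
        have := mul_le_mul_of_nonneg_right hα (abs_nonneg (u - a / H))
        nlinarith [Real.pi_pos]
      have k2 := fejer_mul_sq_le (H := H) hc
      set y := u - a / H with hy
      have k3 : |y| ≤ (1 / M + M * y ^ 2) / 2 := by
        have : (1 / M + M * y ^ 2) / 2 - |y| = (M * |y| - 1) ^ 2 / (2 * M) := by
          rw [← sq_abs y]; field_simp; ring
        have h0 : 0 ≤ (M * |y| - 1) ^ 2 / (2 * M) := by positivity
        linarith
      have k4 : fejer H y * |y| ≤ (fejer H y / M + 1 / (4 * M ^ 3)) / 2 := by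
        calc fejer H y * |y| ≤ fejer H y * ((1 / M + M * y ^ 2) / 2) := by gcongr
          _ = (fejer H y / M + M * (fejer H y * y ^ 2)) / 2 := by ring
          _ ≤ (fejer H y / M + M * (1 / (4 * (H : ℝ) ^ 2))) / 2 := by gcongr
          _ = _ := by rw [hHM]; field_simp
      have k5 : ‖eC (-(α * u)) - eC (-(α * (a / H)))‖ * fejer H y ≤ π / 2 * (fejer H y / M + 1 / (4 * M ^ 3)) := by
        calc _ ≤ π * |y| * fejer H y := by gcongr
          _ = π * (fejer H y * |y|) := by ring
          _ ≤ π * ((fejer H y / M + 1 / (4 * M ^ 3)) / 2) := by gcongr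
          _ = _ := by ring
      linarith
    · have k0 : ‖eC (-(α * u)) - eC (-(α * (a / H)))‖ * fejer H (u - a / H) ≤ 2 * fejer H (u - a / H) := by
        gcongr
      have hu1 : u < 1 := Int.fract_lt_one t
      have hu0 : 0 ≤ u := Int.fract_nonneg t
      rcases lt_abs.1 hc with hc | hc
      · have k1 : fejer H (u - a / H) ≤ 1 / (4 * (x + a) ^ 2) := by
          rw [← fejer_add_int H _ (-1)]
          push_cast
          have hneg : |u - a / H + -1| = 1 - u + a / H := by
            rw [abs_of_nonpos (by linarith)]; ring
          apply fejer_le_of_le hHpos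
          · rw [hneg]; linarith
          · positivity
          · rw [hneg, hxH]
            nlinarith
        have k2 : 2 * (1 / (4 * (x + a) ^ 2)) = 1 / 2 * (1 / (x + a) ^ 2) := by
          field_simp; norm_num
        linarith
      · have k1 : fejer H (u - a / H) ≤ 1 / (4 * (x + (H - 1 - a) + 1) ^ 2) := by
          rw [← fejer_add_int H _ 1]
          push_cast
          have hpos : |u - a / H + 1| = u - a / H + 1 := abs_of_nonneg (by linarith)
          apply fejer_le_of_le hHpos
          · rw [hpos]; linarith
          · linarith
          · rw [hpos, hxH]
            nlinarith
        have k2 : 2 * (1 / (4 * (x + (H - 1 - a) + 1) ^ 2)) = 1 / 2 * (1 / (x + (H - 1 - a) + 1) ^ 2) := by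
          have : 0 < x + (H - 1 - a) + 1 := by linarith
          field_simp; norm_num
        linarith
  refine (sum_le_sum hterm).trans ?_
  rw [sum_add_distrib, sum_add_distrib, ← mul_sum, ← mul_sum, ← mul_sum, sum_add_distrib, ← sum_div,
    hsum, sum_const, card_range, nsmul_eq_mul]
  have s1 : ∑ a ∈ range H, 1 / (x + (H - 1 - a : ℕ) + 1) ^ 2 ≤ 1 / x := by
    rw [sum_range_reflect (fun a : ℕ => 1 / (x + (a : ℝ) + 1) ^ 2) H]
    simp only [add_assoc]
    exact sum_inv_sq_le x (by linarith) H
  have s2 : ∑ a ∈ range H, 1 / (x + (a : ℝ)) ^ 2 ≤ 1 / x + 1 / x := by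
    exact sum_inv_sq_le' x hx0 H
  have hx8 : 1 / x = 8 / M := by rw [hx]; field_simp
  rw [hx8] at s1 s2
  have hpi := Real.pi_lt_d2
  have e3 : (H : ℝ) * (1 / (4 * M ^ 3)) = 1 / M / 4 := by rw [hHM]; field_simp
  rw [e3]
  have hMi : 0 < 1 / (M : ℝ) := by positivity
  have e4 : (8 : ℝ) / M = 8 * (1 / M) := by ring
  have e5 : (20 : ℝ) / M = 20 * (1 / M) := by ring
  rw [e4] at s1 s2
  rw [e5]
  have e6 : (1 : ℝ) / M + 1 / M / 4 = 5 / 4 * (1 / M) := by ring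
  rw [e6]
  have e7 : π / 2 * (5 / 4 * (1 / (M : ℝ))) ≤ 3.15 / 2 * (5 / 4 * (1 / (M : ℝ))) := by gcongr
  linarith

lemma fejer_lower {M : ℕ} {x : ℝ} (hM : 1 ≤ M) (hx : M * |x| ≤ 1 / 8) : 1 / 25 ≤ fejer M x := by
  have hM0 : (0 : ℝ) < M := by exact_mod_cast hM
  have h1 : ‖∑ j ∈ range M, (eC (j * x) - 1)‖ ≤ M * (π / 4) := by
    refine (norm_sum_le _ _).trans ?_
    have : ∀ j ∈ range M, ‖eC (j * x) - 1‖ ≤ π / 4 := by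
      intro j hj
      have hj' : (j : ℝ) ≤ M := by exact_mod_cast (mem_range.1 hj).le
      refine (norm_eC_sub_one_le _).trans ?_
      rw [abs_mul, Nat.abs_cast]
      have h2 : (j : ℝ) * |x| ≤ M * |x| := by gcongr
      have h3 := mul_le_mul_of_nonneg_left (h2.trans hx) (by positivity : 0 ≤ 2 * π)
      linarith
    refine (sum_le_sum this).trans ?_
    simp
  rw [sum_sub_distrib] at h1
  simp only [sum_const, card_range, nsmul_eq_mul, mul_one] at h1
  have h2 : (M : ℝ) * (1 / 5) ≤ ‖∑ j ∈ range M, eC (j * x)‖ := by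
    have h3 := norm_sub_norm_le (M : ℂ) (∑ j ∈ range M, eC (j * x))
    rw [norm_sub_rev] at h3
    have h4 : ‖(M : ℂ)‖ = M := by simp
    rw [h4] at h3
    have h5 : (M : ℝ) * (π / 4) ≤ M * (3.15 / 4) := by
      have := Real.pi_lt_d2
      gcongr
    linarith
  unfold fejer
  rw [le_div_iff₀ (by positivity)]
  calc 1 / 25 * (M : ℝ) ^ 2 = (M * (1 / 5)) ^ 2 := by ring
    _ ≤ _ := by gcongr

/-- The points of a sequence lying near an integer, counted by exponential sums. -/
lemma card_near_int_le {ι : Type*} (s : Finset ι) (t : ι → ℝ) (M : ℕ) (hM : 1 ≤ M) (B : ℝ)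
    (hB : ∀ h : ℤ, h ≠ 0 → |h| < M → ‖∑ n ∈ s, eC (h * t n)‖ ≤ B) (hB0 : 0 ≤ B) :
    ((s.filter fun n => ¬ (1 / (8 * M : ℝ) ≤ Int.fract (t n) ∧ Int.fract (t n) ≤ 1 - 1 / (8 * M : ℝ))).card : ℝ)
      ≤ 25 * (s.card / M + B) := by
  have hM0 : (0 : ℝ) < M := by exact_mod_cast hM
  set F := s.filter fun n => ¬ (1 / (8 * M : ℝ) ≤ Int.fract (t n) ∧ Int.fract (t n) ≤ 1 - 1 / (8 * M : ℝ))
  have h1 : (F.card : ℝ) ≤ 25 * ∑ n ∈ s, fejer M (t n) := by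
    have : ∀ n ∈ F, 1 / 25 ≤ fejer M (t n) := by
      intro n hn
      have h := (mem_filter.1 hn).2
      have e : (M : ℝ) * (1 / (8 * M)) = 1 / 8 := by field_simp
      have h0 := Int.fract_nonneg (t n)
      have h9 := Int.fract_lt_one (t n)
      rw [fejer_fract]
      by_cases hc : 1 / (8 * M : ℝ) ≤ Int.fract (t n)
      · have hd : 1 - 1 / (8 * M : ℝ) < Int.fract (t n) := by
          by_contra hd
          exact h ⟨hc, not_lt.1 hd⟩
        rw [← fejer_add_int M _ (-1)]
        apply fejer_lower hM
        push_cast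
        rw [abs_of_nonpos (by linarith), ← e]
        gcongr
        linarith
      · apply fejer_lower hM
        rw [abs_of_nonneg h0, ← e]
        gcongr
        exact (not_le.1 hc).le
    have h2 := card_nsmul_le_sum F _ _ this
    have h3 : ∑ n ∈ F, fejer M (t n) ≤ ∑ n ∈ s, fejer M (t n) :=
      sum_le_sum_of_subset_of_nonneg (filter_subset _ _) fun _ _ _ => fejer_nonneg _ _
    rw [nsmul_eq_mul] at h2
    linarith
  refine h1.trans ?_
  gcongr
  have h2 : ((∑ n ∈ s, fejer M (t n) : ℝ) : ℂ) =
      (∑ j ∈ range M, ∑ k ∈ range M, ∑ n ∈ s, eC (((j : ℤ) - (k : ℤ) : ℤ) * t n)) / (M : ℂ) ^ 2 := by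
    push_cast
    simp only [fejer_eq]
    rw [← sum_div, sum_comm]
    congr 1
    refine sum_congr rfl fun j _ => ?_
    rw [sum_comm]
  have h3 : ∑ n ∈ s, fejer M (t n) =
      ‖∑ j ∈ range M, ∑ k ∈ range M, ∑ n ∈ s, eC (((j : ℤ) - (k : ℤ) : ℤ) * t n)‖ / (M : ℝ) ^ 2 := by
    rw [← abs_of_nonneg (sum_nonneg fun n _ => fejer_nonneg M (t n)), ← Real.norm_eq_abs,
      ← Complex.norm_real, h2, norm_div, norm_pow]
    simp
  rw [h3, div_le_iff₀ (by positivity)]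
  have h4 : ∀ j ∈ range M, ‖∑ k ∈ range M, ∑ n ∈ s, eC (((j : ℤ) - (k : ℤ) : ℤ) * t n)‖ ≤ s.card + M * B := by
    intro j hj
    refine (norm_sum_le _ _).trans ?_
    have : ∀ k ∈ range M, ‖∑ n ∈ s, eC (((j : ℤ) - (k : ℤ) : ℤ) * t n)‖ ≤ (if k = j then (s.card : ℝ) else 0) + B := by
      intro k hk
      split_ifs with h
      · refine (norm_sum_eC_le _ _).trans ?_
        linarith
      · rw [zero_add]
        have hj' := mem_range.1 hj
        have hk' := mem_range.1 hk
        apply hB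
        · omega
        · rw [abs_lt]; constructor <;> omega
    refine (sum_le_sum this).trans ?_
    rw [sum_add_distrib, sum_ite_eq' , if_pos hj]
    simp
  refine (norm_sum_le _ _).trans ((sum_le_sum h4).trans ?_)
  rw [sum_const, card_range, nsmul_eq_mul]
  apply le_of_eq
  field_simp

lemma norm_twisted_geom_le {H : ℕ} {α : ℝ} (hα : |α| ≤ 1 / 2) (h : ℤ) (h0 : h ≠ 0) (hH : |h| < H) :
    ‖∑ a ∈ range H, eC (-((α + h) * (a / H)))‖ ≤
      H * (1 / (h.natAbs : ℝ) + 1 / ((H - h.natAbs : ℕ) : ℝ)) := by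
  have hHp : 0 < H := by have := abs_nonneg h; omega
  have hH0 : (0 : ℝ) < H := by exact_mod_cast hHp
  set x : ℝ := -((α + h) / H) with hx
  have e : ∀ a ∈ range H, eC (-((α + h) * (a / H))) = eC (a * x) := by
    intro a _; congr 1; rw [hx]; ring
  rw [sum_congr rfl e]
  have hg := norm_geom_eC_mul H x
  set G := ‖∑ a ∈ range H, eC (a * x)‖
  have hn : (h.natAbs : ℝ) = |(h : ℝ)| := by rw [Nat.cast_natAbs]; push_cast; rfl
  have hle : h.natAbs < H := by rw [abs_lt] at hH; omega
  have hn1 : (1 : ℝ) ≤ h.natAbs := by exact_mod_cast Int.natAbs_pos.2 h0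
  have hn2 : (1 : ℝ) ≤ ((H - h.natAbs : ℕ) : ℝ) := by exact_mod_cast (by omega : 1 ≤ H - h.natAbs)
  have hn3 : ((H - h.natAbs : ℕ) : ℝ) = H - h.natAbs := by rw [Nat.cast_sub hle.le]
  have hG0 : 0 ≤ G := norm_nonneg _
  have hax : |x| = |α + h| / H := by rw [hx, abs_neg, abs_div, abs_of_pos hH0]
  have hup : |α + h| ≤ 1 / 2 + h.natAbs := by
    rw [hn]; exact (abs_add_le _ _).trans (by linarith)
  have hlo : (h.natAbs : ℝ) - 1 / 2 ≤ |α + h| := by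
    have := abs_sub_abs_le_abs_sub (h : ℝ) (-α)
    rw [hn]
    rw [abs_neg, sub_neg_eq_add, add_comm (h : ℝ)] at this
    linarith
  have key : ∀ d : ℝ, 1 ≤ d → 2 * (d / H) ≤ ‖eC x - 1‖ → G ≤ H * (1 / d) := by
    intro d hd hd2
    have h1 : G * (2 * (d / H)) ≤ 2 := (mul_le_mul_of_nonneg_left hd2 hG0).trans hg
    have h2 : G * (2 * (d / H)) = 2 * (G * d) / H := by ring
    rw [h2, div_le_iff₀ hH0] at h1
    rw [mul_one_div, le_div_iff₀ (by linarith)]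
    linarith
  rw [mul_add]
  have p1 : 0 ≤ (H : ℝ) * (1 / (h.natAbs : ℝ)) := by positivity
  have p2 : 0 ≤ (H : ℝ) * (1 / ((H - h.natAbs : ℕ) : ℝ)) := by positivity
  rcases le_or_gt |x| (1 / 2) with hc | hc
  · have := key _ hn1 (by
      refine le_trans ?_ (le_norm_eC_sub_one' hc)
      rw [hax]
      have : (h.natAbs : ℝ) ≤ 2 * |α + h| := by linarith
      calc 2 * ((h.natAbs : ℝ) / H) ≤ 2 * (2 * |α + h| / H) := by gcongr
        _ = _ := by ring)
    linarith
  · have hx1 : |x| ≤ 1 - ((H - h.natAbs : ℕ) : ℝ) / (2 * H) := by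
      rw [hax, hn3, div_le_iff₀ hH0]
      have : (1 - ((H : ℝ) - h.natAbs) / (2 * H)) * H = H - (H - h.natAbs) / 2 := by field_simp
      rw [this]
      linarith
    obtain ⟨m, hm1, hm2⟩ : ∃ m : ℤ, |x + m| ≤ 1 / 2 ∧ |x + m| = 1 - |x| := by
      have hxx : |x| ≤ 1 := by
        have : 0 ≤ ((H - h.natAbs : ℕ) : ℝ) / (2 * H) := by positivity
        linarith
      rcases le_total 0 x with h | h
      · rw [abs_of_nonneg h] at hc hxx
        have : |x + (-1 : ℤ)| = 1 - |x| := by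
          push_cast
          rw [abs_of_nonneg h, abs_of_nonpos (by linarith)]; ring
        exact ⟨-1, by rw [this, abs_of_nonneg h]; linarith, this⟩
      · rw [abs_of_nonpos h] at hc hxx
        have : |x + (1 : ℤ)| = 1 - |x| := by
          push_cast
          rw [abs_of_nonpos h, abs_of_nonneg (by linarith)]; ring
        exact ⟨1, by rw [this, abs_of_nonpos h]; linarith, this⟩
    have := key _ hn2 (by
      rw [← eC_add_int x m]
      refine le_trans ?_ (le_norm_eC_sub_one' hm1)
      rw [hm2]
      have : ((H - h.natAbs : ℕ) : ℝ) / (2 * H) ≤ 1 - |x| := by linarith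
      calc 2 * (((H - h.natAbs : ℕ) : ℝ) / H) = 4 * (((H - h.natAbs : ℕ) : ℝ) / (2 * H)) := by field_simp; norm_num
        _ ≤ _ := by gcongr)
    linarith

lemma sum_natAbs_sub_le (H : ℕ) (g : ℕ → ℝ) (hg : ∀ m, 0 ≤ g m) (j : ℕ) (hj : j < H) :
    ∑ k ∈ (range H).erase j, g (((j : ℤ) - k).natAbs) ≤ 2 * ∑ m ∈ Ico 1 H, g m := by
  rw [← sum_filter_add_sum_filter_not _ (fun k => k < j), two_mul]
  have key : ∀ F : Finset ℕ, Set.InjOn (fun k : ℕ => ((j : ℤ) - k).natAbs) F →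
      (∀ k ∈ F, ((j : ℤ) - k).natAbs ∈ Ico 1 H) →
      ∑ k ∈ F, g (((j : ℤ) - k).natAbs) ≤ ∑ m ∈ Ico 1 H, g m := by
    intro F h1 h2
    rw [← sum_image (f := g) (s := F) (g := fun k : ℕ => ((j : ℤ) - k).natAbs) h1]
    exact sum_le_sum_of_subset_of_nonneg (image_subset_iff.2 h2) fun _ _ _ => hg _
  refine add_le_add (key _ ?_ ?_) (key _ ?_ ?_)
  · intro a ha b hb hab
    simp only [coe_filter, mem_erase, mem_range, Set.mem_ofPred_eq] at ha hb hab
    omega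
  · intro k hk
    simp only [mem_filter, mem_erase, mem_range] at hk
    rw [mem_Ico]; omega
  · intro a ha b hb hab
    simp only [coe_filter, mem_erase, mem_range, Set.mem_ofPred_eq] at ha hb hab
    omega
  · intro k hk
    simp only [mem_filter, mem_erase, mem_range] at hk
    rw [mem_Ico]; omega

lemma sum_inv_add_inv_le (H : ℕ) :
    ∑ m ∈ Ico 1 H, (1 / (m : ℝ) + 1 / ((H - m : ℕ) : ℝ)) ≤ 2 * (1 + Real.log H) := by
  rw [sum_add_distrib]
  have h1 := sum_Ico_inv_le H H le_rfl
  have h2 : ∑ m ∈ Ico 1 H, 1 / ((H - m : ℕ) : ℝ) = ∑ m ∈ Ico 1 H, 1 / (m : ℝ) := by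
    rcases Nat.eq_zero_or_pos H with h | h
    · simp [h]
    · have := sum_Ico_reflect (fun m : ℕ => 1 / (m : ℝ)) 1 (m := H) (n := H) (by omega)
      rw [this]
      congr 1
      ext x; simp only [mem_Ico]; omega
  rw [h2]
  linarith

lemma eC_mul_interp (H : ℕ) (α t : ℝ) :
    eC (α * t) * ∑ a ∈ range H, eC (-(α * (a / H))) * (fejer H (t - a / H) : ℂ) =
      ∑ j ∈ range H, ∑ k ∈ range H, (∑ a ∈ range H, eC (-((α + ((j : ℤ) - k : ℤ)) * (a / H)))) *
        eC ((α + ((j : ℤ) - k : ℤ)) * t) / (H : ℂ) ^ 2 := by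
  have e : ∀ a ∈ range H, eC (α * t) * (eC (-(α * (a / H))) * (fejer H (t - a / H) : ℂ)) =
      ∑ j ∈ range H, ∑ k ∈ range H, eC (-((α + ((j : ℤ) - k : ℤ)) * (a / H))) *
        eC ((α + ((j : ℤ) - k : ℤ)) * t) / (H : ℂ) ^ 2 := by
    intro a _
    rw [fejer_eq, ← mul_assoc, mul_div_assoc', mul_sum, sum_div]
    refine sum_congr rfl fun j _ => ?_
    rw [mul_sum, sum_div]
    refine sum_congr rfl fun k _ => ?_
    rw [← eC_add, ← eC_add, ← eC_add]
    congr 2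
    push_cast
    ring
  rw [mul_sum, sum_congr rfl e, sum_comm]
  refine sum_congr rfl fun j _ => ?_
  rw [sum_comm]
  refine sum_congr rfl fun k _ => ?_
  rw [← sum_div, sum_mul]

set_option maxHeartbeats 1000000 in
/-- Exponential sums over integer parts, in terms of exponential sums over smooth phases. -/
lemma norm_sum_floor_le {ι : Type*} (s : Finset ι) (t : ι → ℝ) (w : ι → ℂ) (A₀ : ℝ)
    (hw : ∀ n ∈ s, ‖w n‖ ≤ A₀) (hA₀ : 0 ≤ A₀) (M : ℕ) (hM : 8 ≤ M) (α : ℝ) (hα : |α| ≤ 1 / 2) (B B' : ℝ)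
    (hB : ∀ h : ℤ, h ≠ 0 → |h| < (M ^ 2 : ℕ) → ‖∑ n ∈ s, w n * eC ((α + h) * t n)‖ ≤ B) (hB0 : 0 ≤ B)
    (hB' : ∀ h : ℤ, h ≠ 0 → |h| < M → ‖∑ n ∈ s, eC (h * t n)‖ ≤ B') (hB'0 : 0 ≤ B') :
    ‖∑ n ∈ s, w n * eC (⌊t n⌋ * α)‖ ≤ ‖∑ n ∈ s, w n * eC (α * t n)‖ +
      4 * (1 + Real.log (M ^ 2 : ℕ)) * B + A₀ * (20 * (s.card / M) + 50 * (s.card / M + B')) := by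
  set H := M ^ 2 with hH
  have hM0 : (0 : ℝ) < M := by positivity
  have hHpos : 0 < H := by positivity
  have hH0 : (0 : ℝ) < H := by positivity
  set D : ℤ → ℂ := fun h => ∑ n ∈ s, w n * eC ((α + h) * t n) with hD
  set q : ι → ℂ := fun n => ∑ a ∈ range H, eC (-(α * (a / H))) * (fejer H (t n - a / H) : ℂ) with hq
  have hq2 : ∀ n, ‖q n‖ ≤ 1 := by
    intro n
    refine (norm_sum_le _ _).trans ?_
    have : ∀ a ∈ range H, ‖eC (-(α * (a / H))) * (fejer H (t n - a / H) : ℂ)‖ = fejer H (t n - a / H) := by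
      intro a _
      rw [norm_mul, norm_eC, one_mul, Complex.norm_real, Real.norm_eq_abs, abs_of_nonneg (fejer_nonneg _ _)]
    rw [sum_congr rfl this, sum_fejer H hHpos]
  have e1 : ∀ n, eC (⌊t n⌋ * α) = eC (α * t n) * eC (-(α * Int.fract (t n))) := by
    intro n
    rw [← eC_add]
    congr 1
    rw [← Int.self_sub_floor]; ring
  have e2 : ∑ n ∈ s, w n * eC (⌊t n⌋ * α) = ∑ n ∈ s, w n * eC (α * t n) * q n +
      ∑ n ∈ s, w n * eC (α * t n) * (eC (-(α * Int.fract (t n))) - q n) := by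
    rw [← sum_add_distrib]
    refine sum_congr rfl fun n _ => ?_
    rw [e1]; ring
  have herr : ‖∑ n ∈ s, w n * eC (α * t n) * (eC (-(α * Int.fract (t n))) - q n)‖ ≤
      A₀ * (20 * (s.card / M) + 50 * (s.card / M + B')) := by
    refine (norm_sum_le _ _).trans ?_
    have h1 : ∀ n ∈ s, ‖w n * eC (α * t n) * (eC (-(α * Int.fract (t n))) - q n)‖ ≤
        A₀ * (20 / M + if ¬ (1 / (8 * M : ℝ) ≤ Int.fract (t n) ∧ Int.fract (t n) ≤ 1 - 1 / (8 * M : ℝ))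
          then 2 else 0) := by
      intro n hn
      rw [norm_mul, norm_mul, norm_eC, mul_one]
      refine mul_le_mul (hw n hn) ?_ (norm_nonneg _) hA₀
      by_cases hc : 1 / (8 * M : ℝ) ≤ Int.fract (t n) ∧ Int.fract (t n) ≤ 1 - 1 / (8 * M : ℝ)
      · rw [if_neg (not_not.2 hc), add_zero]
        exact fejer_interp M hM α (t n) hα hc.1 hc.2
      · rw [if_pos hc]
        have := (norm_sub_le (eC (-(α * Int.fract (t n)))) (q n)).trans (add_le_add (norm_eC _).le (hq2 n))
        have : 0 ≤ 20 / (M : ℝ) := by positivity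
        linarith
    refine (sum_le_sum h1).trans ?_
    rw [← mul_sum, sum_add_distrib, ← sum_filter, sum_const, sum_const, nsmul_eq_mul, nsmul_eq_mul]
    have h2 := card_near_int_le s t M (by omega) B' hB' hB'0
    have h3 : (s.card : ℝ) * (20 / M) = 20 * (s.card / M) := by ring
    rw [h3]
    refine mul_le_mul_of_nonneg_left ?_ hA₀
    linarith
  have hmain : ∑ n ∈ s, w n * eC (α * t n) * q n =
      (∑ j ∈ range H, ∑ k ∈ range H,
        (∑ a ∈ range H, eC (-((α + ((j : ℤ) - k : ℤ)) * (a / H)))) * D ((j : ℤ) - k)) / (H : ℂ) ^ 2 := by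
    have e3 : ∀ n, eC (α * t n) * q n = ∑ j ∈ range H, ∑ k ∈ range H,
        (∑ a ∈ range H, eC (-((α + ((j : ℤ) - k : ℤ)) * (a / H)))) * eC ((α + ((j : ℤ) - k : ℤ)) * t n) / (H : ℂ) ^ 2 :=
      fun n => eC_mul_interp H α (t n)
    have e4 : ∀ n ∈ s, w n * eC (α * t n) * q n = ∑ j ∈ range H, ∑ k ∈ range H,
        (∑ a ∈ range H, eC (-((α + ((j : ℤ) - k : ℤ)) * (a / H)))) *
          (w n * eC ((α + ((j : ℤ) - k : ℤ)) * t n)) / (H : ℂ) ^ 2 := by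
      intro n _
      rw [mul_assoc, e3, mul_sum]
      refine sum_congr rfl fun j _ => ?_
      rw [mul_sum]
      refine sum_congr rfl fun k _ => ?_
      ring
    rw [sum_congr rfl e4, sum_comm, sum_div]
    refine sum_congr rfl fun j _ => ?_
    rw [sum_comm, sum_div]
    refine sum_congr rfl fun k _ => ?_
    rw [← sum_div, ← mul_sum]
  have hdiag : ‖∑ n ∈ s, w n * eC (α * t n) * q n‖ ≤ ‖D 0‖ + 4 * (1 + Real.log H) * B := by
    rw [hmain, norm_div, norm_pow, Complex.norm_natCast, div_le_iff₀ (by positivity)]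
    have hj : ∀ j ∈ range H, ‖∑ k ∈ range H,
        (∑ a ∈ range H, eC (-((α + ((j : ℤ) - k : ℤ)) * (a / H)))) * D ((j : ℤ) - k)‖ ≤
        H * ‖D 0‖ + H * (4 * (1 + Real.log H) * B) := by
      intro j hj
      rw [← add_sum_erase _ _ hj]
      refine (norm_add_le _ _).trans (add_le_add ?_ ?_)
      · rw [sub_self, norm_mul]
        gcongr
        refine (norm_sum_le _ _).trans ?_
        simp [norm_eC]
      · refine (norm_sum_le _ _).trans ?_
        have hk : ∀ k ∈ (range H).erase j, ‖(∑ a ∈ range H, eC (-((α + ((j : ℤ) - k : ℤ)) * (a / H)))) * D ((j : ℤ) - k)‖ ≤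
            H * B * (fun m : ℕ => 1 / (m : ℝ) + 1 / ((H - m : ℕ) : ℝ)) (((j : ℤ) - k).natAbs) := by
          intro k hk
          rw [mem_erase, mem_range] at hk
          rw [mem_range] at hj
          have hlt : |(j : ℤ) - k| < H := by rw [abs_lt]; constructor <;> omega
          have hne : (j : ℤ) - k ≠ 0 := by omega
          have g1 := norm_twisted_geom_le hα _ hne hlt
          rw [norm_mul]
          calc _ ≤ _ * B := mul_le_mul g1 (hB _ hne hlt) (norm_nonneg _) (by positivity)
            _ = _ := by ring
        refine (sum_le_sum hk).trans ?_
        rw [← mul_sum]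
        have g2 := sum_natAbs_sub_le H (fun m : ℕ => 1 / (m : ℝ) + 1 / ((H - m : ℕ) : ℝ)) (fun m => by positivity) j
          (mem_range.1 hj)
        have g3 := sum_inv_add_inv_le H
        calc _ ≤ H * B * (2 * (2 * (1 + Real.log H))) := by gcongr; linarith
          _ = _ := by ring
    refine (norm_sum_le _ _).trans ((sum_le_sum hj).trans (le_of_eq ?_))
    rw [sum_const, card_range, nsmul_eq_mul]
    ring
  have hD0 : D 0 = ∑ n ∈ s, w n * eC (α * t n) := by simp [hD]
  rw [hD0] at hdiag
  rw [e2]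
  refine (norm_add_le _ _).trans ?_
  linarith

lemma card_Ioc_floor_le {Y : ℝ} (hY : 1 ≤ Y) : ((Ioc ⌊Y⌋₊ ⌊2 * Y⌋₊).card : ℝ) ≤ 2 * Y := by
  rw [Nat.card_Ioc]
  calc ((⌊2 * Y⌋₊ - ⌊Y⌋₊ : ℕ) : ℝ) ≤ (⌊2 * Y⌋₊ : ℝ) := by exact_mod_cast Nat.sub_le _ _
    _ ≤ 2 * Y := Nat.floor_le (by linarith)

lemma exists_power_sum_kuzmin_landau {c : ℝ} (hc : 1 < c) :
    ∃ C c₁ : ℝ, 0 < C ∧ 0 < c₁ ∧ ∀ (y Y : ℝ) (A B : ℕ), y ≠ 0 → 1 ≤ Y → Y ≤ A + 1 → (B : ℝ) ≤ 4 * Y →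
      |y| * Y ^ (c - 1) ≤ c₁ → ‖∑ n ∈ Ioc A B, eC (y * (n : ℝ) ^ c)‖ ≤ C / (|y| * Y ^ (c - 1)) := by
  have hf1 : fallFac c 1 = c := by simp [fallFac]
  set g : ℝ := 10 ^ (-|c - (1 : ℕ)|) with hg
  have hg0 : 0 < g := by positivity
  set h : ℝ := (10 : ℝ) ^ (2 * |c - (1 : ℕ)|) with hh
  have hh0 : 0 < h := by positivity
  refine ⟨2 / (c * g), 1 / (2 * (h * (c * g))), by positivity, by positivity, ?_⟩
  have pos : ∀ (y Y : ℝ) (A B : ℕ), 0 < y → 1 ≤ Y → Y ≤ A + 1 → (B : ℝ) ≤ 4 * Y →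
      y * Y ^ (c - 1) ≤ 1 / (2 * (h * (c * g))) →
      ‖∑ n ∈ Ioc A B, eC (y * (n : ℝ) ^ c)‖ ≤ 2 / (c * g) / (y * Y ^ (c - 1)) := by
    intro y Y A B hy hY hA hB hle
    have hY0 : 0 < Y := by linarith
    obtain ⟨d1, d2⟩ := difBound_power (c := c) (k := 1) (by norm_num) y
      (by rw [hf1]; positivity) Y hY A B hA hB
    rw [sum_Ioc_eq_range]
    have e : ∀ m : ℕ, eC (y * ((A + 1 + m : ℕ) : ℝ) ^ c) = eC (y * ((A : ℝ) + 1 + m) ^ c) := by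
      intro m; push_cast; rfl
    simp only [e]
    rw [← hg, ← hh, hf1] at d1
    simp only [Function.iterate_one, Nat.cast_one] at d1
    have hp : 0 < y * c * (g * Y ^ (c - 1)) := by positivity
    refine (kuzmin_landau (fun m : ℕ => y * ((A : ℝ) + 1 + m) ^ c) (B - A) _ hp
      (fun n hn => (d1 n hn).1) (fun n hn => (d1 n hn).2.trans ?_) d2).trans (le_of_eq ?_)
    · have h1 := mul_le_mul_of_nonneg_left hle (by positivity : 0 ≤ h * (c * g))
      calc _ = h * (c * g) * (y * Y ^ (c - 1)) := by ring
        _ ≤ _ := h1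
        _ = 1 / 2 := by field_simp
    · field_simp
  intro y Y A B hy hY hA hB hle
  rcases lt_or_gt_of_ne hy with h0 | h0
  · rw [abs_of_neg h0] at hle ⊢
    have := pos (-y) Y A B (by linarith) hY hA hB hle
    have e : ∀ n : ℕ, eC (-y * (n : ℝ) ^ c) = eC (-(y * (n : ℝ) ^ c)) := by intro n; rw [neg_mul]
    simp only [e] at this
    rwa [norm_sum_eC_neg] at this
  · rw [abs_of_pos h0] at hle ⊢
    exact pos y Y A B h0 hY hA hB hle

/-- Smooth exponential sums with a frequency of moderate size. -/
lemma exists_moderate_sum_le {c : ℝ} (hc : 1 < c) (hc' : c < 2.05502) (h3 : fallFac c 3 ≠ 0) :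
    ∃ C : ℝ, 0 < C ∧ ∀ (y Y : ℝ) (A B : ℕ), 1 ≤ Y → Y ≤ A + 1 → (B : ℝ) ≤ 4 * Y →
      1 / 2 ≤ |y| → |y| ≤ 64 * Y ^ (0.24 : ℝ) →
      ‖∑ n ∈ Ioc A B, eC (y * (n : ℝ) ^ c)‖ ≤ C * Y ^ (0.8828 : ℝ) := by
  obtain ⟨C, hC, h⟩ := difTest_three.power_sum (by norm_num) (by norm_num) h3 (by norm_num)
  refine ⟨C * (64 ^ (1 / 6 : ℝ) + (1 / 2) ^ (-(1 / 6) : ℝ)) * (1 + 1 / 0.0002), by positivity,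
    fun y Y A B hY hA hB hl hu => ?_⟩
  have hY0 : 0 < Y := by linarith
  have hy0 : 0 < |y| := by linarith
  refine (h y Y A B (abs_pos.1 hy0) hY hA hB).trans ?_
  have hlog := one_add_log_le 0.0002 (by norm_num) hY
  have hlog0 : 0 ≤ Real.log Y := Real.log_nonneg hY
  have e1 : Y * (|y| * Y ^ (c - (3 : ℕ))) ^ (1 / 6 : ℝ) ≤ 64 ^ (1 / 6 : ℝ) * Y ^ (0.8826 : ℝ) := by
    calc _ ≤ Y * (64 * Y ^ (0.24 : ℝ) * Y ^ (c - (3 : ℕ))) ^ (1 / 6 : ℝ) := by gcongr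
      _ = 64 ^ (1 / 6 : ℝ) * (Y ^ (1 : ℝ) * (Y ^ (0.24 + (c - (3 : ℕ)))) ^ (1 / 6 : ℝ)) := by
        rw [mul_assoc, ← Real.rpow_add hY0, Real.mul_rpow (by norm_num) (by positivity), Real.rpow_one]
        ring
      _ = 64 ^ (1 / 6 : ℝ) * Y ^ (1 + (0.24 + (c - (3 : ℕ))) * (1 / 6)) := by
        rw [← Real.rpow_mul hY0.le, ← Real.rpow_add hY0]
      _ ≤ _ := by
        gcongr
        push_cast; linarith
  have e2 : Y ^ (1 / 2 : ℝ) * (|y| * Y ^ (c - (3 : ℕ))) ^ (-(1 / 6) : ℝ) ≤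
      (1 / 2) ^ (-(1 / 6) : ℝ) * Y ^ (0.8826 : ℝ) := by
    calc _ ≤ Y ^ (1 / 2 : ℝ) * (1 / 2 * Y ^ (c - (3 : ℕ))) ^ (-(1 / 6) : ℝ) := by
          refine mul_le_mul_of_nonneg_left ?_ (by positivity)
          exact Real.rpow_le_rpow_of_nonpos (by positivity) (by gcongr) (by norm_num)
      _ = (1 / 2) ^ (-(1 / 6) : ℝ) * Y ^ (1 / 2 + (c - (3 : ℕ)) * (-(1 / 6))) := by
        rw [Real.mul_rpow (by norm_num) (by positivity), ← Real.rpow_mul hY0.le, Real.rpow_add hY0]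
        ring
      _ ≤ _ := by
        gcongr
        push_cast; linarith
  calc _ ≤ C * (64 ^ (1 / 6 : ℝ) * Y ^ (0.8826 : ℝ) + (1 / 2) ^ (-(1 / 6) : ℝ) * Y ^ (0.8826 : ℝ)) *
        ((1 + 1 / 0.0002) * Y ^ (0.0002 : ℝ)) := by gcongr
    _ = C * (64 ^ (1 / 6 : ℝ) + (1 / 2) ^ (-(1 / 6) : ℝ)) * (1 + 1 / 0.0002) *
        (Y ^ (0.8826 : ℝ) * Y ^ (0.0002 : ℝ)) := by ring
    _ = _ := by rw [← Real.rpow_add hY0]; norm_num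

lemma exists_minor_smooth_sum_le {c : ℝ} (hc : 1 < c) (hc' : c < 2.05502) (h3 : fallFac c 3 ≠ 0) :
    ∃ C : ℝ, 0 < C ∧ ∀ (y Y : ℝ) (A B : ℕ), 1 ≤ Y → Y ≤ A + 1 → (B : ℝ) ≤ 4 * Y → |y| ≤ 1 / 2 →
      ‖∑ n ∈ Ioc A B, eC (y * (n : ℝ) ^ c)‖ ≤ C * (Y / (1 + |y| * Y ^ c)) + C * Y ^ (0.8828 : ℝ) := by
  obtain ⟨C, hC, h⟩ := difTest_three.power_sum (by norm_num) (by norm_num) h3 (by norm_num)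
  obtain ⟨C', c₁, hC', hc₁, h'⟩ := exists_power_sum_kuzmin_landau hc
  refine ⟨(C * (1 + c₁ ^ (-(1 / 6) : ℝ)) * (1 + 1 / 0.0002)) + (2 * C' + 8),
    by positivity, fun y Y A B hY hA hB hu => ?_⟩
  have hY0 : 0 < Y := by linarith
  have hlog := one_add_log_le 0.0002 (by norm_num) hY
  have hlog0 : 0 ≤ Real.log Y := Real.log_nonneg hY
  have hsplit : |y| * Y ^ c = |y| * Y ^ (c - 1) * Y := by
    rw [mul_assoc, ← Real.rpow_add_one hY0.ne']; congr 2; ring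
  have hden : 0 < 1 + |y| * Y ^ c := by positivity
  have hD0 : 0 ≤ Y / (1 + |y| * Y ^ c) := by positivity
  have hpow0 : 0 ≤ Y ^ (0.8828 : ℝ) := by positivity
  have hK0 : 0 ≤ C * (1 + c₁ ^ (-(1 / 6) : ℝ)) * (1 + 1 / 0.0002) := by positivity
  set K := C * (1 + c₁ ^ (-(1 / 6) : ℝ)) * (1 + 1 / 0.0002)
  rcases le_or_gt (|y| * Y ^ c) 1 with hs | hs
  · have h1 : ‖∑ n ∈ Ioc A B, eC (y * (n : ℝ) ^ c)‖ ≤ 4 * Y := by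
      refine (norm_sum_eC_le _ _).trans ?_
      rw [Nat.card_Ioc]
      refine le_trans ?_ hB
      exact_mod_cast Nat.sub_le _ _
    have h2 : Y / 2 ≤ Y / (1 + |y| * Y ^ c) := by gcongr; linarith
    have h3 : 8 * (Y / (1 + |y| * Y ^ c)) ≤ (K + (2 * C' + 8)) * (Y / (1 + |y| * Y ^ c)) := by
      gcongr; linarith
    have : 0 ≤ (K + (2 * C' + 8)) * Y ^ (0.8828 : ℝ) := by positivity
    linarith
  have hy : y ≠ 0 := by
    rintro rfl
    simp at hs; linarith
  have hy0 := abs_pos.2 hy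
  rcases le_or_gt (|y| * Y ^ (c - 1)) c₁ with hl | hl
  · have h1 := h' y Y A B hy hY hA hB hl
    have h2 : C' / (|y| * Y ^ (c - 1)) ≤ 2 * C' * (Y / (1 + |y| * Y ^ c)) := by
      rw [mul_div_assoc', div_le_div_iff₀ (by positivity) hden]
      have : C' * (1 + |y| * Y ^ c) ≤ C' * (2 * (|y| * Y ^ c)) := by gcongr; linarith
      refine this.trans (le_of_eq ?_)
      rw [hsplit]; ring
    have h3 : 2 * C' * (Y / (1 + |y| * Y ^ c)) ≤ (K + (2 * C' + 8)) * (Y / (1 + |y| * Y ^ c)) := by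
      gcongr; linarith
    have : 0 ≤ (K + (2 * C' + 8)) * Y ^ (0.8828 : ℝ) := by positivity
    linarith
  · have h1 := h y Y A B hy hY hA hB
    have e0 : ∀ x : ℝ, x * Y ^ (c - (3 : ℕ)) = x * Y ^ (c - 1) * Y ^ (-2 : ℝ) := by
      intro x
      rw [mul_assoc, ← Real.rpow_add hY0]; congr 2; push_cast; ring
    have e1 : Y * (|y| * Y ^ (c - (3 : ℕ))) ^ (1 / 6 : ℝ) ≤ Y ^ (0.8826 : ℝ) := by
      calc _ ≤ Y * (1 * Y ^ (c - (3 : ℕ))) ^ (1 / 6 : ℝ) := by gcongr; linarith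
        _ = Y ^ (1 + (c - (3 : ℕ)) * (1 / 6)) := by
          rw [one_mul, ← Real.rpow_mul hY0.le, Real.rpow_add hY0, Real.rpow_one]
        _ ≤ _ := by
          apply Real.rpow_le_rpow_of_exponent_le hY
          push_cast; linarith
    have e2 : Y ^ (1 / 2 : ℝ) * (|y| * Y ^ (c - (3 : ℕ))) ^ (-(1 / 6) : ℝ) ≤
        c₁ ^ (-(1 / 6) : ℝ) * Y ^ (0.8826 : ℝ) := by
      rw [e0]
      calc _ ≤ Y ^ (1 / 2 : ℝ) * (c₁ * Y ^ (-2 : ℝ)) ^ (-(1 / 6) : ℝ) := by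
            refine mul_le_mul_of_nonneg_left ?_ (by positivity)
            exact Real.rpow_le_rpow_of_nonpos (by positivity) (by gcongr) (by norm_num)
        _ = c₁ ^ (-(1 / 6) : ℝ) * Y ^ (1 / 2 + (-2) * (-(1 / 6)) : ℝ) := by
          rw [Real.mul_rpow hc₁.le (by positivity), ← Real.rpow_mul hY0.le, Real.rpow_add hY0]
          ring
        _ ≤ _ := by
          gcongr
          norm_num
    have h2 : C * (Y * (|y| * Y ^ (c - (3 : ℕ))) ^ (1 / 6 : ℝ) +
        Y ^ (1 / 2 : ℝ) * (|y| * Y ^ (c - (3 : ℕ))) ^ (-(1 / 6) : ℝ)) * (1 + Real.log Y) ≤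
        K * Y ^ (0.8828 : ℝ) := by
      calc _ ≤ C * (Y ^ (0.8826 : ℝ) + c₁ ^ (-(1 / 6) : ℝ) * Y ^ (0.8826 : ℝ)) *
            ((1 + 1 / 0.0002) * Y ^ (0.0002 : ℝ)) := by gcongr
        _ = K * (Y ^ (0.8826 : ℝ) * Y ^ (0.0002 : ℝ)) := by ring
        _ = _ := by rw [← Real.rpow_add hY0]; norm_num
    have h3 : K * Y ^ (0.8828 : ℝ) ≤ (K + (2 * C' + 8)) * Y ^ (0.8828 : ℝ) := by
      gcongr; linarith
    have : 0 ≤ (K + (2 * C' + 8)) * (Y / (1 + |y| * Y ^ c)) := by positivity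
    linarith

lemma floor_eight_rpow {Y x : ℝ} (hY : 1 ≤ Y) (hx : 0 ≤ x) :
    8 ≤ ⌊8 * Y ^ x⌋₊ ∧ (⌊8 * Y ^ x⌋₊ : ℝ) ≤ 8 * Y ^ x ∧ Y ^ x ≤ ⌊8 * Y ^ x⌋₊ := by
  have h1 := Real.one_le_rpow hY hx
  refine ⟨Nat.le_floor (by push_cast; linarith), Nat.floor_le (by positivity), ?_⟩
  have := Nat.lt_floor_add_one (8 * Y ^ x)
  linarith

/-- The exponential sum over all integers with phases `⌊n ^ c⌋ θ`. -/
noncomputable def floorSum (c Y θ : ℝ) : ℂ :=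
  ∑ n ∈ Ioc ⌊Y⌋₊ ⌊2 * Y⌋₊, eC ((⌊(n : ℝ) ^ c⌋ : ℝ) * θ)

lemma exists_floorSum_le {c : ℝ} (hc : 1 < c) (hc' : c < 2.05502) (h3 : fallFac c 3 ≠ 0) :
    ∃ C : ℝ, 0 < C ∧ ∀ θ Y : ℝ, 1 ≤ Y → |θ| ≤ 1 / 2 →
      ‖floorSum c Y θ‖ ≤ C * (Y / (1 + |θ| * Y ^ c)) + C * Y ^ (0.8835 : ℝ) := by
  obtain ⟨C1, hC1, b1⟩ := exists_moderate_sum_le hc hc' h3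
  obtain ⟨C2, hC2, b2⟩ := exists_minor_smooth_sum_le hc hc' h3
  refine ⟨C2 + 4 * (10 * (1 + 1 / 0.0007)) * C1 + (140 + 50 * C1), by positivity, fun θ Y hY hθ => ?_⟩
  have hY0 : 0 < Y := by linarith
  obtain ⟨hM8, hMle, hMge⟩ := floor_eight_rpow (x := 0.12) hY (by norm_num)
  set M := ⌊8 * Y ^ (0.12 : ℝ)⌋₊ with hM
  have hM0 : (0 : ℝ) < M := by positivity
  have hA : Y ≤ (⌊Y⌋₊ : ℝ) + 1 := (Nat.lt_floor_add_one Y).le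
  have hB : (⌊2 * Y⌋₊ : ℝ) ≤ 4 * Y := (Nat.floor_le (by linarith)).trans (by linarith)
  have hM2 : ((M ^ 2 : ℕ) : ℝ) ≤ 64 * Y ^ (0.24 : ℝ) := by
    push_cast
    calc (M : ℝ) ^ 2 ≤ (8 * Y ^ (0.12 : ℝ)) ^ 2 := by gcongr
      _ = 64 * (Y ^ (0.12 : ℝ) * Y ^ (0.12 : ℝ)) := by ring
      _ = _ := by rw [← Real.rpow_add hY0]; norm_num
  have key : ∀ (h : ℤ) (x : ℝ), |x| ≤ 1 / 2 → h ≠ 0 → |h| < (M ^ 2 : ℕ) →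
      ‖∑ n ∈ Ioc ⌊Y⌋₊ ⌊2 * Y⌋₊, eC ((x + h) * (n : ℝ) ^ c)‖ ≤ C1 * Y ^ (0.8828 : ℝ) := by
    intro h x hx h0 hh
    have hh1 : (1 : ℝ) ≤ |(h : ℝ)| := by exact_mod_cast Int.one_le_abs h0
    have hh2 : |(h : ℝ)| + 1 ≤ ((M ^ 2 : ℕ) : ℝ) := by exact_mod_cast hh
    apply b1 _ Y _ _ hY hA hB
    · have := abs_sub_abs_le_abs_sub (h : ℝ) (-x)
      rw [abs_neg, sub_neg_eq_add, add_comm (h : ℝ)] at this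
      linarith
    · have := abs_add_le x h
      linarith
  have hfl := norm_sum_floor_le (Ioc ⌊Y⌋₊ ⌊2 * Y⌋₊) (fun n : ℕ => (n : ℝ) ^ c) (fun _ => 1) 1
    (by simp) (by norm_num) M hM8 θ hθ (C1 * Y ^ (0.8828 : ℝ)) (C1 * Y ^ (0.8828 : ℝ))
    (fun h h0 hh => by simpa using key h θ hθ h0 hh) (by positivity)
    (fun h h0 hh => by
      have := key h 0 (by simp) h0 (hh.trans_le (by exact_mod_cast Nat.le_self_pow (by norm_num) M))
      simpa using this) (by positivity)
  simp only [one_mul] at hfl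
  have h2 := b2 θ Y _ _ hY hA hB hθ
  have hs : ((Ioc ⌊Y⌋₊ ⌊2 * Y⌋₊).card : ℝ) / M ≤ 2 * Y ^ (0.8828 : ℝ) := by
    calc ((Ioc ⌊Y⌋₊ ⌊2 * Y⌋₊).card : ℝ) / M ≤ 2 * Y / Y ^ (0.12 : ℝ) := by
          gcongr; exact card_Ioc_floor_le hY
      _ = 2 * Y ^ (1 - 0.12 : ℝ) := by rw [Real.rpow_sub hY0, Real.rpow_one]; ring
      _ ≤ _ := by
        gcongr
        norm_num
  have hlogM : 1 + Real.log (M ^ 2 : ℕ) ≤ 10 * (1 + Real.log Y) := by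
    have h1 : Real.log (M ^ 2 : ℕ) ≤ Real.log (64 * Y ^ (0.24 : ℝ)) := by
      apply Real.log_le_log _ hM2
      push_cast; positivity
    rw [Real.log_mul (by norm_num) (by positivity), Real.log_rpow hY0] at h1
    have h64 : Real.log 64 ≤ 9 := by
      have := Real.log_two_lt_d9
      rw [show (64 : ℝ) = 2 ^ 6 by norm_num, Real.log_pow]
      push_cast; linarith
    have := Real.log_nonneg hY
    linarith
  have hlog := one_add_log_le 0.0007 (by norm_num) hY
  have hlog1 : 1 + Real.log (M ^ 2 : ℕ) ≤ 10 * (1 + 1 / 0.0007) * Y ^ (0.0007 : ℝ) := by linarith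
  have hmono : Y ^ (0.8828 : ℝ) ≤ Y ^ (0.8835 : ℝ) :=
    Real.rpow_le_rpow_of_exponent_le hY (by norm_num)
  have t1 : 4 * (1 + Real.log (M ^ 2 : ℕ)) * (C1 * Y ^ (0.8828 : ℝ)) ≤
      4 * (10 * (1 + 1 / 0.0007)) * C1 * Y ^ (0.8835 : ℝ) := by
    calc _ ≤ 4 * (10 * (1 + 1 / 0.0007) * Y ^ (0.0007 : ℝ)) * (C1 * Y ^ (0.8828 : ℝ)) := by gcongr
      _ = 4 * (10 * (1 + 1 / 0.0007)) * C1 * (Y ^ (0.0007 : ℝ) * Y ^ (0.8828 : ℝ)) := by ring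
      _ = _ := by rw [← Real.rpow_add hY0]; norm_num
  have t2 : C1 * Y ^ (0.8828 : ℝ) ≤ C1 * Y ^ (0.8835 : ℝ) := by gcongr
  have t3 : C2 * Y ^ (0.8828 : ℝ) ≤ C2 * Y ^ (0.8835 : ℝ) := by gcongr
  have t4 : C2 * (Y / (1 + |θ| * Y ^ c)) ≤
      (C2 + 4 * (10 * (1 + 1 / 0.0007)) * C1 + (140 + 50 * C1)) * (Y / (1 + |θ| * Y ^ c)) := by
    gcongr
    have : 0 ≤ 4 * (10 * (1 + 1 / 0.0007)) * C1 := by positivity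
    linarith
  unfold floorSum
  generalize 4 * (10 * (1 + 1 / 0.0007)) * C1 = K at *
  linarith

lemma arithmeticFunction_sub_apply (f g : ArithmeticFunction ℝ) (n : ℕ) :
    (f - g) n = f n - g n := by
  rw [sub_eq_add_neg, ArithmeticFunction.add_apply, ArithmeticFunction.neg_apply, ← sub_eq_add_neg]

open ArithmeticFunction in
/-- Restriction of an arithmetic function to arguments at most `v`. -/
noncomputable def truncAF (f : ArithmeticFunction ℝ) (v : ℕ) : ArithmeticFunction ℝ :=
  ⟨fun n => if n ≤ v then f n else 0, by simp⟩

lemma truncAF_apply (f : ArithmeticFunction ℝ) (v n : ℕ) :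
    truncAF f v n = if n ≤ v then f n else 0 := rfl

open ArithmeticFunction in
lemma vaughan_identity (u v : ℕ) :
    (ArithmeticFunction.vonMangoldt : ArithmeticFunction ℝ) =
      truncAF vonMangoldt v + truncAF (moebius : ArithmeticFunction ℝ) u * ArithmeticFunction.log
        - truncAF (moebius : ArithmeticFunction ℝ) u * truncAF vonMangoldt v * (zeta : ArithmeticFunction ℝ)
        + ((moebius : ArithmeticFunction ℝ) - truncAF (moebius : ArithmeticFunction ℝ) u) *
          ((zeta : ArithmeticFunction ℝ) * (vonMangoldt - truncAF vonMangoldt v)) := by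
  have h1 : (moebius : ArithmeticFunction ℝ) * (zeta : ArithmeticFunction ℝ) = 1 := coe_moebius_mul_coe_zeta
  have h2 : (zeta : ArithmeticFunction ℝ) * vonMangoldt = ArithmeticFunction.log := zeta_mul_vonMangoldt
  rw [← h2]
  generalize truncAF vonMangoldt v = L1
  generalize truncAF (moebius : ArithmeticFunction ℝ) u = m1
  have : ((moebius : ArithmeticFunction ℝ) - m1) * ((zeta : ArithmeticFunction ℝ) * (vonMangoldt - L1)) =
      ((moebius : ArithmeticFunction ℝ) * (zeta : ArithmeticFunction ℝ)) * (vonMangoldt - L1) -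
        m1 * ((zeta : ArithmeticFunction ℝ) * (vonMangoldt - L1)) := by ring
  rw [this, h1]
  ring

/-- A bilinear sum over the pairs `(m, k)` with `N₁ < m k ≤ N₂`. -/
noncomputable def bil (N₁ N₂ : ℕ) (F : ℕ → ℂ) (a b : ℕ → ℝ) : ℂ :=
  ∑ m ∈ Ioc 0 N₂, ∑ k ∈ Ioc (N₁ / m) (N₂ / m), (a m : ℂ) * b k * F (m * k)

lemma mem_Ioc_div {N₁ N₂ m k : ℕ} (hm : 0 < m) :
    k ∈ Ioc (N₁ / m) (N₂ / m) ↔ N₁ < m * k ∧ m * k ≤ N₂ := by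
  rw [mem_Ioc, Nat.div_lt_iff_lt_mul hm, Nat.le_div_iff_mul_le hm, mul_comm k]

lemma bil_eq (N₁ N₂ : ℕ) (F : ℕ → ℂ) (a b : ℕ → ℝ) :
    bil N₁ N₂ F a b = ∑ m ∈ Ioc 0 N₂, ∑ k ∈ Ioc 0 N₂,
      if N₁ < m * k ∧ m * k ≤ N₂ then (a m : ℂ) * b k * F (m * k) else 0 := by
  refine sum_congr rfl fun m hm => ?_
  have hm0 := (mem_Ioc.1 hm).1
  rw [← sum_filter]
  refine sum_congr ?_ fun _ _ => rfl
  ext k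
  rw [mem_Ioc_div hm0, mem_filter, mem_Ioc]
  constructor
  · rintro ⟨h1, h2⟩
    have hk : 0 < k := by
      rcases Nat.eq_zero_or_pos k with h | h
      · simp [h] at h1
      · exact h
    exact ⟨⟨hk, (Nat.le_mul_of_pos_left k hm0).trans h2⟩, h1, h2⟩
  · exact fun h => h.2

lemma bil_comm (N₁ N₂ : ℕ) (F : ℕ → ℂ) (a b : ℕ → ℝ) : bil N₁ N₂ F a b = bil N₁ N₂ F b a := by
  rw [bil_eq, bil_eq, sum_comm]
  refine sum_congr rfl fun m _ => sum_congr rfl fun k _ => ?_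
  rw [mul_comm k m, mul_comm (a k : ℂ)]

lemma sum_mul_eq_bil (N₁ N₂ : ℕ) (F : ℕ → ℂ) (f g : ArithmeticFunction ℝ) :
    ∑ n ∈ Ioc N₁ N₂, ((f * g) n : ℂ) * F n = bil N₁ N₂ F f g := by
  rw [bil_eq, ← sum_product', ← sum_filter]
  rw [← sum_fiberwise_of_maps_to (s := filter _ _) (t := Ioc N₁ N₂) (g := fun x : ℕ × ℕ => x.1 * x.2)
    (by intro x hx; rw [mem_filter] at hx; rw [mem_Ioc]; exact hx.2)]
  refine sum_congr rfl fun n hn => ?_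
  rw [mem_Ioc] at hn
  rw [ArithmeticFunction.mul_apply]
  push_cast
  rw [sum_mul]
  refine sum_congr ?_ fun x hx => ?_
  · ext ⟨x, y⟩
    simp only [Nat.mem_divisorsAntidiagonal, mem_filter, mem_product, mem_Ioc]
    constructor
    · rintro ⟨h1, h2⟩
      have hx : 0 < x := Nat.pos_of_ne_zero (by rintro rfl; simp at h1; omega)
      have hy : 0 < y := Nat.pos_of_ne_zero (by rintro rfl; simp at h1; omega)
      have h3 := Nat.le_mul_of_pos_left y hx
      have h4 := Nat.le_mul_of_pos_right x hy
      refine ⟨⟨⟨⟨hx, ?_⟩, hy, ?_⟩, ?_⟩, h1⟩ <;> omega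
    · rintro ⟨_, h⟩
      exact ⟨h, by omega⟩
  · rw [mem_filter] at hx
    rw [hx.2]

lemma bil_add_left (N₁ N₂ : ℕ) (F : ℕ → ℂ) (a a' b : ℕ → ℝ) :
    bil N₁ N₂ F (a + a') b = bil N₁ N₂ F a b + bil N₁ N₂ F a' b := by
  unfold bil
  simp only [Pi.add_apply, Complex.ofReal_add, add_mul, sum_add_distrib]

/-- The von Mangoldt sum in terms of bilinear sums. -/
lemma sum_vonMangoldt_eq (N₁ N₂ u v : ℕ) (hv : v ≤ N₁) (F : ℕ → ℂ) :
    ∑ n ∈ Ioc N₁ N₂, (ArithmeticFunction.vonMangoldt n : ℂ) * F n =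
      bil N₁ N₂ F (truncAF (ArithmeticFunction.moebius : ArithmeticFunction ℝ) u) ArithmeticFunction.log
      - bil N₁ N₂ F (truncAF (ArithmeticFunction.moebius : ArithmeticFunction ℝ) u *
          truncAF ArithmeticFunction.vonMangoldt v : ArithmeticFunction ℝ)
          (ArithmeticFunction.zeta : ArithmeticFunction ℝ)
      + bil N₁ N₂ F ((ArithmeticFunction.moebius : ArithmeticFunction ℝ) -
          truncAF (ArithmeticFunction.moebius : ArithmeticFunction ℝ) u : ArithmeticFunction ℝ)
          ((ArithmeticFunction.zeta : ArithmeticFunction ℝ) *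
            (ArithmeticFunction.vonMangoldt - truncAF ArithmeticFunction.vonMangoldt v) : ArithmeticFunction ℝ) := by
  rw [← sum_mul_eq_bil, ← sum_mul_eq_bil, ← sum_mul_eq_bil, ← sum_sub_distrib, ← sum_add_distrib]
  refine sum_congr rfl fun n hn => ?_
  rw [mem_Ioc] at hn
  have h0 : truncAF ArithmeticFunction.vonMangoldt v n = 0 := by
    rw [truncAF_apply, if_neg (by omega)]
  have h1 := congrArg (fun f : ArithmeticFunction ℝ => f n) (vaughan_identity u v)
  simp only [ArithmeticFunction.add_apply, arithmeticFunction_sub_apply, h0, zero_add] at h1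
  rw [h1]
  push_cast
  ring

lemma truncAF_moebius_mul_bound (u v m : ℕ) :
    |(truncAF (ArithmeticFunction.moebius : ArithmeticFunction ℝ) u *
          truncAF ArithmeticFunction.vonMangoldt v : ArithmeticFunction ℝ) m| ≤ Real.log m := by
  rw [ArithmeticFunction.mul_apply, ← ArithmeticFunction.vonMangoldt_sum,
    ← Nat.sum_divisorsAntidiagonal' (f := fun _ e => ArithmeticFunction.vonMangoldt e)]
  refine (abs_sum_le_sum_abs _ _).trans (sum_le_sum fun x _ => ?_)
  have hΛ := ArithmeticFunction.vonMangoldt_nonneg (n := x.2)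
  have h1 : |truncAF (ArithmeticFunction.moebius : ArithmeticFunction ℝ) u x.1| ≤ 1 := by
    rw [truncAF_apply]
    split_ifs
    · rw [ArithmeticFunction.intCoe_apply]
      exact_mod_cast ArithmeticFunction.abs_moebius_le_one
    · simp
  have h2 : |truncAF ArithmeticFunction.vonMangoldt v x.2| ≤ ArithmeticFunction.vonMangoldt x.2 := by
    rw [truncAF_apply]
    split_ifs
    · rw [abs_of_nonneg hΛ]
    · simp
  rw [abs_mul]
  calc _ ≤ 1 * ArithmeticFunction.vonMangoldt x.2 := by gcongr
    _ = _ := one_mul _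

lemma truncAF_moebius_mul_eq_zero {u v m : ℕ} (h : u * v < m) :
    (truncAF (ArithmeticFunction.moebius : ArithmeticFunction ℝ) u *
          truncAF ArithmeticFunction.vonMangoldt v : ArithmeticFunction ℝ) m = 0 := by
  rw [ArithmeticFunction.mul_apply]
  refine sum_eq_zero fun x hx => ?_
  rw [truncAF_apply, truncAF_apply]
  have hx' := (Nat.mem_divisorsAntidiagonal.1 hx).1
  split_ifs with h1 h2
  · have := Nat.mul_le_mul h1 h2
    omega
  · simp
  · simp
  · simp

lemma zeta_mul_tail_bound (v k : ℕ) :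
    |((ArithmeticFunction.zeta : ArithmeticFunction ℝ) *
            (ArithmeticFunction.vonMangoldt - truncAF ArithmeticFunction.vonMangoldt v) : ArithmeticFunction ℝ) k|
      ≤ Real.log k := by
  rw [ArithmeticFunction.mul_apply, ← ArithmeticFunction.vonMangoldt_sum,
    ← Nat.sum_divisorsAntidiagonal' (f := fun _ e => ArithmeticFunction.vonMangoldt e)]
  refine (abs_sum_le_sum_abs _ _).trans (sum_le_sum fun x _ => ?_)
  have hΛ := ArithmeticFunction.vonMangoldt_nonneg (n := x.2)
  have h1 : |(ArithmeticFunction.zeta : ArithmeticFunction ℝ) x.1| ≤ 1 := by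
    rw [ArithmeticFunction.natCoe_apply, ArithmeticFunction.zeta_apply]
    split_ifs <;> simp
  have h2 : |(ArithmeticFunction.vonMangoldt - truncAF ArithmeticFunction.vonMangoldt v) x.2| ≤
      ArithmeticFunction.vonMangoldt x.2 := by
    rw [arithmeticFunction_sub_apply, truncAF_apply]
    split_ifs
    · simp
    · rw [sub_zero, abs_of_nonneg hΛ]
  rw [abs_mul]
  calc _ ≤ 1 * ArithmeticFunction.vonMangoldt x.2 := by gcongr
    _ = _ := one_mul _

lemma zeta_mul_tail_eq_zero {v k : ℕ} (h : k ≤ v) :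
    ((ArithmeticFunction.zeta : ArithmeticFunction ℝ) *
            (ArithmeticFunction.vonMangoldt - truncAF ArithmeticFunction.vonMangoldt v) : ArithmeticFunction ℝ) k = 0 := by
  rw [ArithmeticFunction.mul_apply]
  refine sum_eq_zero fun x hx => ?_
  obtain ⟨h1, h2⟩ := Nat.mem_divisorsAntidiagonal.1 hx
  have hx0 : 0 < x.1 := Nat.pos_of_ne_zero (by intro h; rw [h] at h1; simp at h1; omega)
  have h3 := Nat.le_mul_of_pos_left x.2 hx0
  rw [arithmeticFunction_sub_apply, truncAF_apply, if_pos (by omega), sub_self, mul_zero]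

lemma moebius_tail_bound (u m : ℕ) :
    |((ArithmeticFunction.moebius : ArithmeticFunction ℝ) -
          truncAF (ArithmeticFunction.moebius : ArithmeticFunction ℝ) u : ArithmeticFunction ℝ) m| ≤ 1 := by
  rw [arithmeticFunction_sub_apply, truncAF_apply]
  split_ifs
  · simp
  · rw [sub_zero, ArithmeticFunction.intCoe_apply]
    exact_mod_cast ArithmeticFunction.abs_moebius_le_one

lemma moebius_tail_eq_zero {u m : ℕ} (h : m ≤ u) :
    ((ArithmeticFunction.moebius : ArithmeticFunction ℝ) -
          truncAF (ArithmeticFunction.moebius : ArithmeticFunction ℝ) u : ArithmeticFunction ℝ) m = 0 := by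
  rw [arithmeticFunction_sub_apply, truncAF_apply, if_pos h, sub_self]

/-- Partial summation against a nonnegative monotone weight. -/
lemma norm_sum_monotone_mul_le {A B : ℕ} (w : ℕ → ℝ) (z : ℕ → ℂ) (R : ℝ)
    (hw : ∀ k, 1 ≤ k → w k ≤ w (k + 1)) (hw1 : 0 ≤ w 1)
    (hR : ∀ A', A ≤ A' → A' ≤ B → ‖∑ k ∈ Ioc A' B, z k‖ ≤ R) (hAB : A < B) :
    ‖∑ k ∈ Ioc A B, (w k : ℂ) * z k‖ ≤ w B * R := by
  have key : ∀ d A : ℕ, A < B → B = A + d + 1 →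
      (∀ A', A ≤ A' → A' ≤ B → ‖∑ k ∈ Ioc A' B, z k‖ ≤ R) → ∀ a : ℝ, a ≤ w (A + 1) →
      ‖∑ k ∈ Ioc A B, ((w k - a : ℝ) : ℂ) * z k‖ ≤ (w B - a) * R := by
    intro d
    induction d with
    | zero =>
      intro A hA hB hR a ha
      have h := hR A le_rfl hA.le
      rw [show B = A + 1 by omega] at h ⊢
      rw [Nat.Ioc_succ_singleton, sum_singleton] at h ⊢
      rw [norm_mul, Complex.norm_real, Real.norm_of_nonneg (by linarith)]
      exact mul_le_mul_of_nonneg_left h (by linarith)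
    | succ d ih =>
      intro A hA hB hR a ha
      have h1 := ih (A + 1) (by omega) (by omega) (fun A' h1 h2 => hR A' (by omega) h2)
        (w (A + 1)) (hw _ (by omega))
      have h2 := hR A le_rfl hA.le
      have e : ∑ k ∈ Ioc A B, ((w k - a : ℝ) : ℂ) * z k =
          ((w (A + 1) - a : ℝ) : ℂ) * ∑ k ∈ Ioc A B, z k +
            ∑ k ∈ Ioc (A + 1) B, ((w k - w (A + 1) : ℝ) : ℂ) * z k := by
        have h3 : ∀ g : ℕ → ℂ, ∑ k ∈ Ioc A B, g k = g (A + 1) + ∑ k ∈ Ioc (A + 1) B, g k := by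
          intro g
          rw [← sum_Ioc_consecutive g (Nat.le_succ A) (show A + 1 ≤ B by omega),
            Nat.Ioc_succ_singleton, sum_singleton]
        rw [h3, h3, mul_add, mul_sum, add_assoc, ← sum_add_distrib]
        congr 1
        refine sum_congr rfl fun k _ => ?_
        push_cast
        ring
      rw [e]
      refine (norm_add_le _ _).trans ?_
      rw [norm_mul, Complex.norm_real, Real.norm_of_nonneg (by linarith)]
      have := mul_le_mul_of_nonneg_left h2 (show 0 ≤ w (A + 1) - a by linarith)
      linarith
  have hwn : ∀ k, 0 ≤ w (k + 1) := by
    intro k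
    induction k with
    | zero => simpa using hw1
    | succ k ih => exact ih.trans (hw _ (by omega))
  have := key (B - A - 1) A hAB (by omega) hR 0 (hwn A)
  simpa using this

lemma norm_sum_sum_sq_le {ι κ : Type*} (S : Finset ι) (T : Finset κ) (a : ι → ℝ) (A₀ : ℝ)
    (ha : ∀ m ∈ S, |a m| ≤ A₀) (z : ι → κ → ℂ) :
    ∑ k ∈ T, ‖∑ m ∈ S, (a m : ℂ) * z m k‖ ^ 2 ≤
      A₀ ^ 2 * ∑ m ∈ S, ∑ m' ∈ S, ‖∑ k ∈ T, z m k * (starRingEnd ℂ) (z m' k)‖ := by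
  have e : ((∑ k ∈ T, ‖∑ m ∈ S, (a m : ℂ) * z m k‖ ^ 2 : ℝ) : ℂ) =
      ∑ m ∈ S, ∑ m' ∈ S, (a m : ℂ) * a m' * ∑ k ∈ T, z m k * (starRingEnd ℂ) (z m' k) := by
    push_cast
    simp_rw [← Complex.mul_conj', map_sum, sum_mul_sum, mul_sum]
    rw [sum_comm]
    refine sum_congr rfl fun m _ => ?_
    rw [sum_comm]
    refine sum_congr rfl fun m' _ => sum_congr rfl fun k _ => ?_
    rw [map_mul, Complex.conj_ofReal]
    ring
  have h0 : 0 ≤ ∑ k ∈ T, ‖∑ m ∈ S, (a m : ℂ) * z m k‖ ^ 2 := sum_nonneg fun _ _ => by positivity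
  have h1 : ∑ k ∈ T, ‖∑ m ∈ S, (a m : ℂ) * z m k‖ ^ 2 =
      ‖((∑ k ∈ T, ‖∑ m ∈ S, (a m : ℂ) * z m k‖ ^ 2 : ℝ) : ℂ)‖ := by
    rw [Complex.norm_real, Real.norm_of_nonneg h0]
  rw [h1, e, mul_sum]
  refine (norm_sum_le _ _).trans (sum_le_sum fun m hm => ?_)
  rw [mul_sum]
  refine (norm_sum_le _ _).trans (sum_le_sum fun m' hm' => ?_)
  rw [norm_mul, norm_mul, Complex.norm_real, Complex.norm_real]
  have := mul_le_mul (ha m hm) (ha m' hm') (abs_nonneg _) ((abs_nonneg _).trans (ha m hm))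
  rw [Real.norm_eq_abs, Real.norm_eq_abs, sq]
  gcongr

lemma norm_bilinear_sq_le {ι κ : Type*} (S : Finset ι) (T : Finset κ) (a : ι → ℝ) (b : κ → ℝ)
    (A₀ B₀ : ℝ) (ha : ∀ m ∈ S, |a m| ≤ A₀) (hb : ∀ k ∈ T, |b k| ≤ B₀) (z : ι → κ → ℂ) :
    ‖∑ m ∈ S, ∑ k ∈ T, (a m : ℂ) * b k * z m k‖ ^ 2 ≤
      T.card * (B₀ ^ 2 * (A₀ ^ 2 *
        ∑ m ∈ S, ∑ m' ∈ S, ‖∑ k ∈ T, z m k * (starRingEnd ℂ) (z m' k)‖)) := by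
  have e : ∑ m ∈ S, ∑ k ∈ T, (a m : ℂ) * b k * z m k =
      ∑ k ∈ T, (b k : ℂ) * ∑ m ∈ S, (a m : ℂ) * z m k := by
    rw [sum_comm]
    refine sum_congr rfl fun k _ => ?_
    rw [mul_sum]
    exact sum_congr rfl fun m _ => by ring
  rw [e]
  refine (norm_sum_sq_le _ _).trans ?_
  refine mul_le_mul_of_nonneg_left ?_ (by positivity)
  refine le_trans ?_ (mul_le_mul_of_nonneg_left (norm_sum_sum_sq_le S T a A₀ ha z) (sq_nonneg B₀))
  rw [mul_sum]
  refine sum_le_sum fun k hk => ?_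
  rw [norm_mul, mul_pow, Complex.norm_real, Real.norm_eq_abs]
  have := pow_le_pow_left₀ (abs_nonneg _) (hb k hk) 2
  gcongr

lemma div_le_nat_div_add_one {Y : ℝ} {m : ℕ} : Y / m ≤ ((⌊Y⌋₊ / m : ℕ) : ℝ) + 1 := by
  rw [← Nat.floor_div_natCast]
  exact (Nat.lt_floor_add_one _).le

lemma nat_div_floor_le {Y : ℝ} (hY : 0 ≤ Y) {m : ℕ} : ((⌊Y⌋₊ / m : ℕ) : ℝ) ≤ Y / m := by
  rw [← Nat.floor_div_natCast]
  exact Nat.floor_le (by positivity)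

lemma exists_dilated_sum_le {c : ℝ} (h3 : fallFac c 3 ≠ 0) (h5 : fallFac c 5 ≠ 0) :
    ∃ C > 0, ∀ (β Y : ℝ) (m A B : ℕ), 1 ≤ Y → 1 ≤ m → (m : ℝ) ≤ Y ^ (0.2 : ℝ) →
      Y / m ≤ A + 1 → (B : ℝ) ≤ 4 * (Y / m) → Y ^ (0.9 : ℝ) ≤ |β| * Y ^ c →
      |β| * Y ^ c ≤ Y ^ (2.1 : ℝ) →
      ‖∑ k ∈ Ioc A B, eC (β * ((m * k : ℕ) : ℝ) ^ c)‖ ≤ C * (Y ^ (0.9976 : ℝ) / m) := by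
  obtain ⟨C, hC, h⟩ := exists_monomial_sum_le h3 h5
  refine ⟨C, hC, fun β Y m A B hY hm hmY hA hB hl hu => ?_⟩
  have hY0 : 0 < Y := by linarith
  have hm0 : (0:ℝ) < m := by exact_mod_cast hm
  have hm1 : (1:ℝ) ≤ m := by exact_mod_cast hm
  have hK : Y ^ (0.8:ℝ) ≤ Y / m := by
    rw [le_div_iff₀ hm0]
    calc Y ^ (0.8:ℝ) * m ≤ Y ^ (0.8:ℝ) * Y ^ (0.2:ℝ) := by gcongr
      _ = Y := by rw [← rpow_add hY0]; norm_num
  have hKY : Y / m ≤ Y := div_le_self hY0.le hm1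
  have hK1 : 1 ≤ Y / m := le_trans (one_le_rpow hY (by norm_num)) hK
  have hK0 : 0 < Y / m := by linarith
  have e : |β * (m:ℝ) ^ c| * (Y / m) ^ c = |β| * Y ^ c := by
    rw [abs_mul, abs_of_pos (rpow_pos_of_pos hm0 c), div_rpow hY0.le hm0.le]
    have := (rpow_pos_of_pos hm0 c).ne'
    field_simp
  have h1 := h (β * (m:ℝ) ^ c) (Y / m) A B hK1 hA hB (by
    rw [e]
    calc (Y / m) ^ (1/2:ℝ) ≤ Y ^ (1/2:ℝ) := by gcongr
      _ ≤ Y ^ (0.9:ℝ) := by gcongr; norm_num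
      _ ≤ _ := hl) (by
    rw [e]
    calc _ ≤ Y ^ (2.1:ℝ) := hu
      _ ≤ Y ^ (0.8 * 4.9:ℝ) := by gcongr; norm_num
      _ = (Y ^ (0.8:ℝ)) ^ (4.9:ℝ) := by rw [rpow_mul hY0.le]
      _ ≤ _ := by gcongr)
  have e2 : ∀ k ∈ Ioc A B, eC (β * ((m * k : ℕ) : ℝ) ^ c) = eC (β * (m:ℝ) ^ c * (k:ℝ) ^ c) := by
    intro k _
    rw [Nat.cast_mul, mul_rpow hm0.le (by positivity), mul_assoc]
  rw [sum_congr rfl e2]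
  refine h1.trans (mul_le_mul_of_nonneg_left ?_ hC.le)
  calc (Y / m) ^ (0.997:ℝ) = (Y / m) * (Y / m) ^ (-0.003:ℝ) := by
        conv_rhs => rw [← rpow_one_add' hK0.le (by norm_num)]
        norm_num
    _ ≤ (Y / m) * (Y ^ (0.8:ℝ)) ^ (-0.003:ℝ) := by
        gcongr (Y / m) * ?_
        exact rpow_le_rpow_of_nonpos (by positivity) hK (by norm_num)
    _ = Y ^ (0.9976:ℝ) / m := by
        rw [← rpow_mul hY0.le, div_mul_eq_mul_div]
        conv_lhs => rw [← rpow_one_add' hY0.le (by norm_num)]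
        norm_num

lemma exists_type_one_le {c : ℝ} (h3 : fallFac c 3 ≠ 0) (h5 : fallFac c 5 ≠ 0) :
    ∃ C > 0, ∀ (β Y A₀ B₀ : ℝ) (a b : ℕ → ℝ), 1 ≤ Y → Y ^ (0.9 : ℝ) ≤ |β| * Y ^ c →
      |β| * Y ^ c ≤ Y ^ (2.1 : ℝ) → (∀ m ≤ ⌊2 * Y⌋₊, |a m| ≤ A₀) →
      (∀ m : ℕ, Y ^ (0.2 : ℝ) < m → a m = 0) → (∀ k, 1 ≤ k → b k ≤ b (k + 1)) → 0 ≤ b 1 →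
      (∀ k ≤ ⌊2 * Y⌋₊, b k ≤ B₀) →
      ‖bil ⌊Y⌋₊ ⌊2 * Y⌋₊ (fun n => eC (β * (n : ℝ) ^ c)) a b‖ ≤ C * A₀ * B₀ * Y ^ (0.998 : ℝ) := by
  obtain ⟨C, hC, h⟩ := exists_dilated_sum_le h3 h5
  refine ⟨C * ((1 + 1 / 0.0004) * 2), by positivity,
    fun β Y A₀ B₀ a b hY hl hu ha ha0 hb hb1 hB => ?_⟩
  have hY0 : 0 < Y := by linarith
  have hA0 : 0 ≤ A₀ := (abs_nonneg _).trans (ha 0 (by omega))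
  have hN1 : 1 ≤ ⌊2 * Y⌋₊ := Nat.le_floor (by push_cast; linarith)
  have hB0 : 0 ≤ B₀ := hb1.trans (hB 1 hN1)
  have hN : (⌊2 * Y⌋₊ : ℝ) ≤ 2 * Y := Nat.floor_le (by linarith)
  set N := ⌊2 * Y⌋₊ with hNdef
  have hm : ∀ m ∈ Ioc 0 N, ‖∑ k ∈ Ioc (⌊Y⌋₊ / m) (N / m),
      (a m : ℂ) * b k * eC (β * ((m * k : ℕ) : ℝ) ^ c)‖ ≤
      A₀ * (B₀ * (C * (Y ^ (0.9976 : ℝ)))) * (1 / (m : ℝ)) := by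
    intro m hm
    rw [mem_Ioc] at hm
    have hm0 : (0:ℝ) < m := by exact_mod_cast hm.1
    have hnn : 0 ≤ A₀ * (B₀ * (C * (Y ^ (0.9976 : ℝ)))) * (1 / (m : ℝ)) := by positivity
    by_cases hmY : Y ^ (0.2:ℝ) < m
    · rw [sum_eq_zero (fun k _ => by rw [ha0 m hmY]; simp)]
      simpa using hnn
    rw [not_lt] at hmY
    by_cases hAB : ⌊Y⌋₊ / m < N / m
    swap
    · rw [Ioc_eq_empty hAB, sum_empty, norm_zero]
      exact hnn
    simp_rw [mul_assoc]
    rw [← mul_sum, norm_mul, Complex.norm_real, Real.norm_eq_abs]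
    refine mul_le_mul (ha m hm.2) ?_ (norm_nonneg _) hA0
    have h1 := norm_sum_monotone_mul_le b (fun k => eC (β * ((m * k : ℕ) : ℝ) ^ c))
      (C * (Y ^ (0.9976 : ℝ) / m)) hb hb1 (fun A' hA' hA'' =>
        h β Y m A' (N / m) hY hm.1 hmY
          (div_le_nat_div_add_one.trans (by
            have : ((⌊Y⌋₊ / m : ℕ) : ℝ) ≤ A' := by exact_mod_cast hA'
            linarith))
          ((nat_div_floor_le (by linarith)).trans (by
            rw [mul_div_assoc]
            have : 0 ≤ Y / m := by positivity
            linarith)) hl hu) hAB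
    refine h1.trans ?_
    have h2 : b (N / m) ≤ B₀ := hB _ (Nat.div_le_self _ _)
    calc _ ≤ B₀ * (C * (Y ^ (0.9976 : ℝ) / m)) := by gcongr
      _ = _ := by ring
  unfold bil
  refine (norm_sum_le _ _).trans ((sum_le_sum hm).trans ?_)
  rw [← mul_sum]
  have hlog : ∑ m ∈ Ioc 0 N, 1 / (m : ℝ) ≤ (1 + 1 / 0.0004) * 2 * Y ^ (0.0004:ℝ) := by
    have e : Ioc 0 N = Ico 1 (N + 1) := by ext; simp [mem_Ioc, mem_Ico]; omega
    have h1 := sum_Ico_inv_le (q := N + 1) (N := N + 1) le_rfl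
    have h2 : (1:ℝ) + log ((N + 1 : ℕ) : ℝ) ≤ 1 + log (4 * Y) := by
      gcongr
      push_cast
      linarith
    have h3 := one_add_log_le 0.0004 (by norm_num) (x := 4 * Y) (by linarith)
    rw [e]
    refine h1.trans (h2.trans (h3.trans ?_))
    rw [mul_rpow (by norm_num) hY0.le, mul_assoc]
    have : (4:ℝ) ^ (0.0004:ℝ) ≤ 4 ^ (1/2:ℝ) := by
      apply rpow_le_rpow_of_exponent_le <;> norm_num
    have h4 : (4:ℝ) ^ (1/2:ℝ) = 2 := by
      rw [← sqrt_eq_rpow, show (4:ℝ) = 2 ^ 2 by norm_num, sqrt_sq (by norm_num)]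
    rw [h4] at this
    gcongr
  calc _ ≤ A₀ * (B₀ * (C * (Y ^ (0.9976 : ℝ)))) * ((1 + 1 / 0.0004) * 2 * Y ^ (0.0004:ℝ)) := by
        gcongr
    _ = C * ((1 + 1 / 0.0004) * 2) * A₀ * B₀ * (Y ^ (0.9976 : ℝ) * Y ^ (0.0004:ℝ)) := by ring
    _ = _ := by rw [← rpow_add hY0]; norm_num

lemma rpow_sub_rpow_ge {c x y : ℝ} (hc : 1 ≤ c) (hy : 1 ≤ y) (hxy : y + 1 ≤ x) :
    y ^ (c - 1) ≤ x ^ c - y ^ c := by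
  have hx0 : 0 < x := by linarith
  have hy0 : 0 < y := by linarith
  have e1 : x ^ c = x ^ (c - 1) * x := by
    conv_rhs => rw [← rpow_add_one hx0.ne']
    ring_nf
  have e2 : y ^ c = y ^ (c - 1) * y := by
    conv_rhs => rw [← rpow_add_one hy0.ne']
    ring_nf
  have h : y ^ (c - 1) ≤ x ^ (c - 1) := rpow_le_rpow hy0.le (by linarith) (by linarith)
  have h0 : 0 ≤ y ^ (c - 1) := rpow_nonneg hy0.le _
  rw [e1, e2]
  have h1 := mul_le_mul h hxy (by linarith) (h0.trans h)
  linarith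

/-- Correlations of a monomial phase along two dilations. -/
lemma exists_correlation_le {c : ℝ} (hc : 1 < c) (hc' : c < 3) (h3 : fallFac c 3 ≠ 0) (h5 : fallFac c 5 ≠ 0) :
    ∃ C > 0, ∃ Y₀ ≥ 1, ∀ (β Y : ℝ) (M m m' A B : ℕ), Y₀ ≤ Y → Y ^ (0.09 : ℝ) ≤ M →
      (M : ℝ) ≤ 2 * Y ^ (1 / 2 : ℝ) → M < m' → m' < m → m ≤ 2 * M →
      Y / (2 * M) ≤ A + 1 → (B : ℝ) ≤ 2 * Y / M → Y ^ (0.9 : ℝ) ≤ |β| * Y ^ c →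
      |β| * Y ^ c ≤ Y ^ (2.1 : ℝ) →
      ‖∑ k ∈ Ioc A B, eC (β * ((m * k : ℕ) : ℝ) ^ c - β * ((m' * k : ℕ) : ℝ) ^ c)‖ ≤
        C * (Y / M * Y ^ (-0.0015 : ℝ)) := by
  obtain ⟨C, hC, h⟩ := exists_monomial_sum_le h3 h5
  refine ⟨C * 4 ^ (0.003:ℝ), by positivity, (4:ℝ) ^ (100:ℝ), one_le_rpow (by norm_num) (by norm_num),
    fun β Y M m m' A B hY hMl hMu hm' hmm hm hA hB hl hu => ?_⟩
  have hY1 : 1 ≤ Y := le_trans (one_le_rpow (by norm_num) (by norm_num)) hY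
  have hY0 : 0 < Y := by linarith
  have hM1 : (1:ℝ) ≤ M := le_trans (one_le_rpow hY1 (by norm_num)) hMl
  have hM0 : (0:ℝ) < M := by linarith
  have h4Y : (4:ℝ) ≤ Y ^ (0.01:ℝ) := by
    calc (4:ℝ) = ((4:ℝ) ^ (100:ℝ)) ^ (0.01:ℝ) := by rw [← rpow_mul (by norm_num)]; norm_num
      _ ≤ _ := by gcongr
  set K := Y / (2 * M) with hK
  have hKl : Y ^ (1/2:ℝ) / 4 ≤ K := by
    rw [hK, div_le_div_iff₀ (by norm_num) (by positivity)]
    have e : Y ^ (1/2:ℝ) * Y ^ (1/2:ℝ) = Y := by rw [← rpow_add hY0]; norm_num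
    have := mul_le_mul_of_nonneg_left hMu (rpow_nonneg hY0.le (1/2))
    calc Y ^ (1/2:ℝ) * (2 * M) = 2 * (Y ^ (1/2:ℝ) * M) := by ring
      _ ≤ 2 * (Y ^ (1/2:ℝ) * (2 * Y ^ (1/2:ℝ))) := by linarith
      _ = 4 * (Y ^ (1/2:ℝ) * Y ^ (1/2:ℝ)) := by ring
      _ = Y * 4 := by rw [e]; ring
  have hKl' : Y ^ (0.49:ℝ) ≤ K := by
    refine le_trans ?_ hKl
    rw [le_div_iff₀ (by norm_num)]
    calc Y ^ (0.49:ℝ) * 4 ≤ Y ^ (0.49:ℝ) * Y ^ (0.01:ℝ) := by gcongr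
      _ = _ := by rw [← rpow_add hY0]; norm_num
  have hK1 : 1 ≤ K := le_trans (one_le_rpow hY1 (by norm_num)) hKl'
  have hK0 : 0 < K := by linarith
  have hKMY : K * M * 2 = Y := by rw [hK]; field_simp
  set D := (m:ℝ) ^ c - (m':ℝ) ^ c with hD
  have hm'0 : (M:ℝ) ≤ m' := by exact_mod_cast hm'.le
  have hmm0 : (m':ℝ) + 1 ≤ m := by exact_mod_cast hmm
  have hm0 : (m:ℝ) ≤ 2 * M := by exact_mod_cast hm
  have hDl : (M:ℝ) ^ (c - 1) ≤ D :=
    le_trans (rpow_le_rpow hM0.le hm'0 (by linarith)) (rpow_sub_rpow_ge hc.le (by linarith) hmm0)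
  have hDu : D ≤ (2 * M) ^ c := by
    have h1 : (m:ℝ) ^ c ≤ (2 * M) ^ c := rpow_le_rpow (by positivity) hm0 (by linarith)
    have h2 : 0 ≤ (m':ℝ) ^ c := by positivity
    linarith
  have hD0 : 0 < D := lt_of_lt_of_le (by positivity) hDl
  have e0 : |β * D| = |β| * D := by rw [abs_mul, abs_of_pos hD0]
  have hYc : Y ^ c = K ^ c * (2 * M) ^ c := by
    rw [← mul_rpow hK0.le (by positivity), ← hKMY]; ring_nf
  have hb0 := abs_nonneg β
  have h1 := h (β * D) K A B hK1 hA (by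
    rw [hK]; refine hB.trans (le_of_eq ?_); field_simp; ring) (by
    rw [e0]
    have h2c : (2:ℝ) ^ c ≤ 8 := by
      calc (2:ℝ) ^ c ≤ 2 ^ (3:ℝ) := by gcongr; norm_num
        _ = 8 := by norm_num
    have e3 : (2 * (M:ℝ)) ^ c = 2 ^ c * ((M:ℝ) ^ (c - 1) * M) := by
      rw [mul_rpow (by norm_num) hM0.le]
      congr 1
      conv_rhs => rw [← rpow_add_one hM0.ne']
      ring_nf
    have s1 : |β| * Y ^ c ≤ 8 * M * (|β| * D * K ^ c) := by
      rw [hYc, e3]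
      calc |β| * (K ^ c * (2 ^ c * ((M:ℝ) ^ (c - 1) * M)))
          ≤ |β| * (K ^ c * (8 * (D * M))) := by gcongr
        _ = _ := by ring
    have s2 : K ^ (1/2:ℝ) * (8 * M) ≤ Y ^ (0.9:ℝ) := by
      have t1 : (M:ℝ) ≤ Y ^ (0.51:ℝ) := by
        calc (M:ℝ) ≤ 2 * Y ^ (1/2:ℝ) := hMu
          _ ≤ Y ^ (0.01:ℝ) * Y ^ (1/2:ℝ) := by gcongr; linarith
          _ = _ := by rw [← rpow_add hY0]; norm_num
      have t2 : K ^ (1/2:ℝ) * M ^ (1/2:ℝ) ≤ Y ^ (1/2:ℝ) := by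
        rw [← mul_rpow hK0.le hM0.le]
        have : 0 < K * M := by positivity
        gcongr
        linarith
      have t3 : (M:ℝ) ^ (1/2:ℝ) ≤ Y ^ (0.255:ℝ) := by
        calc (M:ℝ) ^ (1/2:ℝ) ≤ (Y ^ (0.51:ℝ)) ^ (1/2:ℝ) := by gcongr
          _ = _ := by rw [← rpow_mul hY0.le]; norm_num
      have t4 : (M:ℝ) = M ^ (1/2:ℝ) * M ^ (1/2:ℝ) := by rw [← rpow_add hM0]; norm_num
      calc K ^ (1/2:ℝ) * (8 * M) = 8 * (K ^ (1/2:ℝ) * (M ^ (1/2:ℝ) * M ^ (1/2:ℝ))) := by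
            rw [← t4]; ring
        _ = 8 * ((K ^ (1/2:ℝ) * M ^ (1/2:ℝ)) * M ^ (1/2:ℝ)) := by ring
        _ ≤ (4 * 4) * (Y ^ (1/2:ℝ) * Y ^ (0.255:ℝ)) := by gcongr; norm_num
        _ ≤ (Y ^ (0.01:ℝ) * Y ^ (0.01:ℝ)) * (Y ^ (1/2:ℝ) * Y ^ (0.255:ℝ)) := by gcongr
        _ = Y ^ (0.775:ℝ) := by rw [← rpow_add hY0, ← rpow_add hY0, ← rpow_add hY0]; norm_num
        _ ≤ _ := by gcongr; norm_num
    have s3 : K ^ (1/2:ℝ) * (8 * M) ≤ |β| * D * K ^ c * (8 * M) := by linarith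
    exact le_of_mul_le_mul_right s3 (by positivity)) (by
    rw [e0]
    calc |β| * D * K ^ c ≤ |β| * (2 * M) ^ c * K ^ c := by gcongr
      _ = |β| * Y ^ c := by rw [hYc]; ring
      _ ≤ Y ^ (2.1:ℝ) := hu
      _ ≤ Y ^ (0.49 * 4.9:ℝ) := by gcongr; norm_num
      _ = (Y ^ (0.49:ℝ)) ^ (4.9:ℝ) := by rw [rpow_mul hY0.le]
      _ ≤ _ := by gcongr)
  have e2 : ∀ k ∈ Ioc A B, eC (β * ((m * k : ℕ) : ℝ) ^ c - β * ((m' * k : ℕ) : ℝ) ^ c) =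
      eC (β * D * (k:ℝ) ^ c) := by
    intro k _
    rw [Nat.cast_mul, Nat.cast_mul, mul_rpow (by positivity) (by positivity),
      mul_rpow (by positivity) (by positivity), hD]
    ring_nf
  rw [sum_congr rfl e2]
  refine h1.trans ?_
  rw [mul_assoc]
  refine mul_le_mul_of_nonneg_left ?_ hC.le
  have hKM : K ≤ Y / M := by
    rw [le_div_iff₀ hM0]
    have : 0 < K * M := by positivity
    linarith
  calc K ^ (0.997:ℝ) = K * K ^ (-0.003:ℝ) := by
        conv_rhs => rw [← rpow_one_add' hK0.le (by norm_num)]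
        norm_num
    _ ≤ (Y / M) * (Y ^ (1/2:ℝ) / 4) ^ (-0.003:ℝ) := by
        gcongr ?_ * ?_
        exact rpow_le_rpow_of_nonpos (by positivity) hKl (by norm_num)
    _ = _ := by
        rw [div_rpow (by positivity) (by norm_num), ← rpow_mul hY0.le,
          rpow_neg (by norm_num : (0:ℝ) ≤ 4)]
        rw [show (1/2:ℝ) * -0.003 = -0.0015 by norm_num]
        field_simp

lemma exists_bilinear_block_le {c : ℝ} (hc : 1 < c) (hc' : c < 3) (h3 : fallFac c 3 ≠ 0)
    (h5 : fallFac c 5 ≠ 0) :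
    ∃ C > 0, ∃ Y₀ ≥ 1, ∀ (β Y A₀ B₀ : ℝ) (M : ℕ) (a b : ℕ → ℝ), Y₀ ≤ Y → Y ^ (0.09 : ℝ) ≤ M →
      (M : ℝ) ≤ 2 * Y ^ (1 / 2 : ℝ) → Y ^ (0.9 : ℝ) ≤ |β| * Y ^ c →
      |β| * Y ^ c ≤ Y ^ (2.1 : ℝ) → 0 ≤ A₀ → 0 ≤ B₀ → (∀ m, |a m| ≤ A₀) →
      (∀ k ≤ ⌊2 * Y⌋₊, |b k| ≤ B₀) →
      ‖∑ m ∈ Ioc M (2 * M), ∑ k ∈ Ioc (⌊Y⌋₊ / m) (⌊2 * Y⌋₊ / m),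
        (a m : ℂ) * b k * eC (β * ((m * k : ℕ) : ℝ) ^ c)‖ ≤
        C * A₀ * B₀ * Y ^ (0.99925 : ℝ) := by
  obtain ⟨C, hC, Y₀, hY₀, h⟩ := exists_correlation_le hc hc' h3 h5
  refine ⟨4 + 2 * C, by positivity, Y₀, hY₀,
    fun β Y A₀ B₀ M a b hY hMl hMu hl hu hA0 hB0 ha hb => ?_⟩
  have hY1 : 1 ≤ Y := hY₀.trans hY
  have hY0 : 0 < Y := by linarith
  have hM1 : (1:ℝ) ≤ M := le_trans (one_le_rpow hY1 (by norm_num)) hMl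
  have hM0 : (0:ℝ) < M := by linarith
  have hM0' : 0 < M := by exact_mod_cast hM0
  set N₁ := ⌊Y⌋₊
  set N₂ := ⌊2 * Y⌋₊
  have hN2 : ((N₂ / M : ℕ) : ℝ) ≤ 2 * Y / M := nat_div_floor_le (by linarith)
  set T := Ioc 0 (N₂ / M) with hT
  have hTc : (T.card : ℝ) ≤ 2 * Y / M := by rw [hT, Nat.card_Ioc, Nat.sub_zero]; exact hN2
  set z : ℕ → ℕ → ℂ := fun m k =>
    if k ∈ Ioc (N₁ / m) (N₂ / m) then eC (β * ((m * k : ℕ) : ℝ) ^ c) else 0 with hz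
  have e1 : ∀ m ∈ Ioc M (2 * M), ∑ k ∈ Ioc (N₁ / m) (N₂ / m),
      (a m : ℂ) * b k * eC (β * ((m * k : ℕ) : ℝ) ^ c) = ∑ k ∈ T, (a m : ℂ) * b k * z m k := by
    intro m hm
    rw [mem_Ioc] at hm
    have hs : Ioc (N₁ / m) (N₂ / m) ⊆ T := by
      intro k hk
      rw [mem_Ioc] at hk
      rw [hT, mem_Ioc]
      exact ⟨lt_of_le_of_lt (Nat.zero_le _) hk.1, hk.2.trans (Nat.div_le_div_left hm.1.le hM0')⟩
    rw [← sum_subset hs]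
    · refine sum_congr rfl fun k hk => ?_
      rw [hz]
      simp only [if_pos hk]
    · intro k _ hk
      rw [hz]
      simp only [if_neg hk, mul_zero]
  rw [sum_congr rfl e1]
  set E := C * (Y / M * Y ^ (-0.0015 : ℝ)) with hE
  have hE0 : 0 ≤ E := by positivity
  have hlt : ∀ m' m, M < m' → m' < m → m ≤ 2 * M →
      ‖∑ k ∈ T, z m k * (starRingEnd ℂ) (z m' k)‖ ≤ E := by
    intro m' m h1 h2 h3
    have hA : Y / (2 * M) ≤ (max (N₁ / m) (N₁ / m') : ℕ) + 1 := by
      have t1 : Y / (2 * M) ≤ Y / m := by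
        have : (m:ℝ) ≤ 2 * M := by exact_mod_cast h3
        have : (0:ℝ) < m := by exact_mod_cast (show 0 < m by omega)
        gcongr
      have t2 := div_le_nat_div_add_one (Y := Y) (m := m)
      have t3 : ((N₁ / m : ℕ) : ℝ) ≤ (max (N₁ / m) (N₁ / m') : ℕ) := by
        exact_mod_cast le_max_left _ _
      linarith
    have hB : ((min (N₂ / m) (N₂ / m') : ℕ) : ℝ) ≤ 2 * Y / M := by
      refine le_trans ?_ hN2
      exact_mod_cast (min_le_right _ _).trans (Nat.div_le_div_left h1.le hM0')
    have := h β Y M m m' _ _ hY hMl hMu h1 h2 h3 hA hB hl hu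
    rw [← hE] at this
    convert this using 2
    have hs : Ioc (max (N₁ / m) (N₁ / m')) (min (N₂ / m) (N₂ / m')) ⊆ T := by
      intro k hk
      rw [mem_Ioc] at hk
      rw [hT, mem_Ioc]
      exact ⟨lt_of_le_of_lt (Nat.zero_le _) hk.1, (hk.2.trans (min_le_right _ _)).trans (Nat.div_le_div_left h1.le hM0')⟩
    rw [← sum_subset hs]
    · refine sum_congr rfl fun k hk => ?_
      rw [mem_Ioc, max_lt_iff, le_min_iff] at hk
      rw [hz]
      simp only [mem_Ioc, if_pos (show N₁ / m < k ∧ k ≤ N₂ / m from ⟨hk.1.1, hk.2.1⟩),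
        if_pos (show N₁ / m' < k ∧ k ≤ N₂ / m' from ⟨hk.1.2, hk.2.2⟩)]
      rw [eC_sub]
    · intro k _ hk
      rw [mem_Ioc, max_lt_iff, le_min_iff] at hk
      rw [hz]
      simp only [mem_Ioc]
      by_cases q1 : N₁ / m < k ∧ k ≤ N₂ / m
      · have q2 : ¬ (N₁ / m' < k ∧ k ≤ N₂ / m') := fun q2 => hk ⟨⟨q1.1, q2.1⟩, q1.2, q2.2⟩
        rw [if_neg q2, map_zero, mul_zero]
      · rw [if_neg q1, zero_mul]
  have hpair : ∀ m ∈ Ioc M (2 * M), ∀ m' ∈ Ioc M (2 * M),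
      ‖∑ k ∈ T, z m k * (starRingEnd ℂ) (z m' k)‖ ≤ (if m = m' then 2 * Y / M else 0) + E := by
    intro m hm m' hm'
    rw [mem_Ioc] at hm hm'
    rcases lt_trichotomy m m' with q | q | q
    · rw [if_neg q.ne, zero_add]
      have := hlt m m' hm.1 q hm'.2
      rw [← Complex.norm_conj, map_sum]
      convert this using 4
      rw [map_mul, Complex.conj_conj, mul_comm]
    · rw [if_pos q]
      refine le_trans ?_ (le_trans hTc (by linarith))
      refine (norm_sum_le _ _).trans ?_
      rw [card_eq_sum_ones]
      push_cast
      have hz1 : ∀ m k, ‖z m k‖ ≤ 1 := by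
        intro m k
        rw [hz]
        dsimp only
        split_ifs
        · rw [norm_eC]
        · simp
      refine sum_le_sum fun k _ => ?_
      rw [norm_mul, Complex.norm_conj]
      exact mul_le_one₀ (hz1 _ _) (norm_nonneg _) (hz1 _ _)
    · rw [if_neg q.ne', zero_add]
      exact hlt m' m hm'.1 q hm.2
  have hsum : ∑ m ∈ Ioc M (2 * M), ∑ m' ∈ Ioc M (2 * M),
      ‖∑ k ∈ T, z m k * (starRingEnd ℂ) (z m' k)‖ ≤ M * (2 * Y / M + M * E) := by
    have hcard : ((Ioc M (2 * M)).card : ℝ) = M := by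
      rw [Nat.card_Ioc, show 2 * M - M = M by omega]
    calc _ ≤ ∑ m ∈ Ioc M (2 * M), ∑ m' ∈ Ioc M (2 * M), ((if m = m' then 2 * Y / M else 0) + E) :=
          sum_le_sum fun m hm => sum_le_sum fun m' hm' => hpair m hm m' hm'
      _ = ∑ m ∈ Ioc M (2 * M), (2 * Y / M + M * E) := by
          refine sum_congr rfl fun m hm => ?_
          rw [sum_add_distrib, sum_ite_eq, if_pos hm, sum_const, nsmul_eq_mul, hcard]
      _ = _ := by rw [sum_const, nsmul_eq_mul, hcard]
  have hmain := norm_bilinear_sq_le (Ioc M (2 * M)) T a b A₀ B₀ (fun m _ => ha m)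
    (fun k hk => hb k ((mem_Ioc.1 hk).2.trans (Nat.div_le_self _ _))) z
  have hMY : 1 / (M:ℝ) ≤ Y ^ (-0.0015:ℝ) := by
    rw [rpow_neg hY0.le, one_div]
    refine inv_anti₀ (by positivity) (le_trans ?_ hMl)
    gcongr
    norm_num
  have hfin : (T.card : ℝ) * (B₀ ^ 2 * (A₀ ^ 2 *
        ∑ m ∈ Ioc M (2 * M), ∑ m' ∈ Ioc M (2 * M), ‖∑ k ∈ T, z m k * (starRingEnd ℂ) (z m' k)‖)) ≤
      ((4 + 2 * C) * A₀ * B₀ * Y ^ (0.99925 : ℝ)) ^ 2 := by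
    have e3 : (Y ^ (0.99925 : ℝ)) ^ 2 = Y ^ 2 * Y ^ (-0.0015:ℝ) := by
      rw [← rpow_natCast, ← rpow_natCast, ← rpow_mul hY0.le, ← rpow_add hY0]
      norm_num
    calc _ ≤ (2 * Y / M) * (B₀ ^ 2 * (A₀ ^ 2 * (M * (2 * Y / M + M * E)))) := by gcongr
      _ = B₀ ^ 2 * A₀ ^ 2 * (4 * Y ^ 2 * (1 / (M:ℝ)) + 2 * C * (Y ^ 2 * Y ^ (-0.0015:ℝ))) := by
          rw [hE]; field_simp; ring
      _ ≤ B₀ ^ 2 * A₀ ^ 2 * (4 * Y ^ 2 * Y ^ (-0.0015:ℝ) + 2 * C * (Y ^ 2 * Y ^ (-0.0015:ℝ))) := by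
          gcongr
      _ = (4 + 2 * C) * (B₀ ^ 2 * A₀ ^ 2 * (Y ^ (0.99925 : ℝ)) ^ 2) := by rw [e3]; ring
      _ ≤ (4 + 2 * C) ^ 2 * (B₀ ^ 2 * A₀ ^ 2 * (Y ^ (0.99925 : ℝ)) ^ 2) := by
          refine mul_le_mul_of_nonneg_right ?_ (by positivity)
          rw [sq]
          exact le_mul_of_one_le_left (by positivity) (by linarith)
      _ = _ := by ring
  exact le_of_sq_le_sq (hmain.trans hfin) (by positivity)

lemma sum_Ioc_two_pow (g : ℕ → ℂ) (L : ℕ) :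
    ∑ m ∈ Ioc 0 (2 ^ L), g m = g 1 + ∑ i ∈ range L, ∑ m ∈ Ioc (2 ^ i) (2 * 2 ^ i), g m := by
  induction L with
  | zero => simp [show Ioc 0 1 = {1} from rfl]
  | succ L ih =>
    rw [sum_range_succ, ← add_assoc, ← ih, pow_succ, mul_comm (2 ^ L) 2,
      sum_Ioc_consecutive _ (Nat.zero_le _) (by omega)]

/-- Bilinear sums in which the first variable is confined to a middle range. -/
lemma exists_bil_le {c : ℝ} (hc : 1 < c) (hc' : c < 3) (h3 : fallFac c 3 ≠ 0)
    (h5 : fallFac c 5 ≠ 0) :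
    ∃ C > 0, ∃ Y₀ ≥ 1, ∀ (β Y A₀ B₀ : ℝ) (a b : ℕ → ℝ), Y₀ ≤ Y →
      Y ^ (0.9 : ℝ) ≤ |β| * Y ^ c →
      |β| * Y ^ c ≤ Y ^ (2.1 : ℝ) → 0 ≤ A₀ → 0 ≤ B₀ → (∀ m, |a m| ≤ A₀) →
      (∀ m : ℕ, (m : ℝ) ≤ 2 * Y ^ (0.09 : ℝ) → a m = 0) →
      (∀ m : ℕ, 2 * Y ^ (1 / 2 : ℝ) < m → a m = 0) →
      (∀ k ≤ ⌊2 * Y⌋₊, |b k| ≤ B₀) →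
      ‖bil ⌊Y⌋₊ ⌊2 * Y⌋₊ (fun n => eC (β * (n : ℝ) ^ c)) a b‖ ≤
        C * A₀ * B₀ * Y ^ (0.99935 : ℝ) := by
  obtain ⟨C, hC, Y₀, hY₀, h⟩ := exists_bilinear_block_le hc hc' h3 h5
  refine ⟨C * (4 * (1 + 1 / 0.0001)), by positivity, Y₀, hY₀,
    fun β Y A₀ B₀ a b hY hl hu hA0 hB0 ha has hal hb => ?_⟩
  have hY1 : 1 ≤ Y := hY₀.trans hY
  have hY0 : 0 < Y := by linarith
  set N₁ := ⌊Y⌋₊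
  set N₂ := ⌊2 * Y⌋₊ with hN₂
  set g : ℕ → ℂ := fun m => ∑ k ∈ Ioc (N₁ / m) (N₂ / m),
    (a m : ℂ) * b k * eC (β * ((m * k : ℕ) : ℝ) ^ c) with hg
  have hg0 : ∀ m, a m = 0 → g m = 0 := by
    intro m hm
    rw [hg]
    exact sum_eq_zero fun k _ => by rw [hm]; simp
  set L := Nat.log 2 N₂ + 1 with hL
  have hNL : N₂ ≤ 2 ^ L := (Nat.lt_pow_succ_log_self (by norm_num) N₂).le
  have hN1 : N₂ ≠ 0 := by
    have : 1 ≤ N₂ := Nat.le_floor (by push_cast; linarith)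
    omega
  have e1 : bil N₁ N₂ (fun n => eC (β * (n : ℝ) ^ c)) a b = ∑ m ∈ Ioc 0 (2 ^ L), g m := by
    unfold bil
    refine sum_subset (Ioc_subset_Ioc_right hNL) fun m hm hm' => ?_
    rw [mem_Ioc] at hm hm'
    have : N₂ < m := by omega
    rw [Nat.div_eq_of_lt this, Ioc_eq_empty (Nat.not_lt_zero _), sum_empty]
  have hg1 : g 1 = 0 := by
    apply hg0
    apply has
    have := one_le_rpow hY1 (show (0:ℝ) ≤ 0.09 by norm_num)
    push_cast
    linarith
  rw [e1, sum_Ioc_two_pow, hg1, zero_add]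
  have hblock : ∀ i ∈ range L, ‖∑ m ∈ Ioc (2 ^ i) (2 * 2 ^ i), g m‖ ≤
      C * A₀ * B₀ * Y ^ (0.99925 : ℝ) := by
    intro i _
    have hnn : 0 ≤ C * A₀ * B₀ * Y ^ (0.99925 : ℝ) := by positivity
    by_cases q1 : Y ^ (0.09:ℝ) ≤ ((2 ^ i : ℕ) : ℝ)
    · by_cases q2 : ((2 ^ i : ℕ) : ℝ) ≤ 2 * Y ^ (1/2:ℝ)
      · exact h β Y A₀ B₀ (2 ^ i) a b hY q1 q2 hl hu hA0 hB0 ha hb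
      · rw [sum_eq_zero, norm_zero]
        · exact hnn
        · intro m hm
          refine hg0 m (hal m ?_)
          have : ((2 ^ i : ℕ) : ℝ) < m := by exact_mod_cast (mem_Ioc.1 hm).1
          linarith [not_le.1 q2]
    · rw [sum_eq_zero, norm_zero]
      · exact hnn
      · intro m hm
        refine hg0 m (has m ?_)
        have : (m:ℝ) ≤ 2 * ((2 ^ i : ℕ) : ℝ) := by exact_mod_cast (mem_Ioc.1 hm).2
        linarith [not_le.1 q1]
  refine (norm_sum_le _ _).trans ((sum_le_sum hblock).trans ?_)
  rw [sum_const, card_range, nsmul_eq_mul]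
  have hLb : (L : ℝ) ≤ 4 * (1 + 1 / 0.0001) * Y ^ (0.0001:ℝ) := by
    have h1 : ((2 ^ Nat.log 2 N₂ : ℕ) : ℝ) ≤ N₂ := by exact_mod_cast Nat.pow_log_le_self 2 hN1
    have h2 : (N₂:ℝ) ≤ 2 * Y := Nat.floor_le (by linarith)
    have h3 : (Nat.log 2 N₂ : ℝ) * Real.log 2 ≤ Real.log 2 + Real.log Y := by
      rw [← Real.log_mul (by norm_num) hY0.ne', ← Real.log_pow]
      push_cast at h1
      exact Real.log_le_log (by positivity) (h1.trans h2)
    have h4 := one_add_log_le 0.0001 (by norm_num) hY1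
    have h5 := Real.log_two_gt_d9
    have h6 := Real.log_two_lt_d9
    have h7 := Real.log_nonneg hY1
    have h8 : (Nat.log 2 N₂ : ℝ) * (1/2) ≤ (Nat.log 2 N₂ : ℝ) * Real.log 2 := by
      gcongr
      linarith
    rw [hL]
    push_cast
    linarith
  calc (L:ℝ) * (C * A₀ * B₀ * Y ^ (0.99925 : ℝ))
      ≤ (4 * (1 + 1 / 0.0001) * Y ^ (0.0001:ℝ)) * (C * A₀ * B₀ * Y ^ (0.99925 : ℝ)) := by gcongr
    _ = C * (4 * (1 + 1 / 0.0001)) * A₀ * B₀ * (Y ^ (0.0001:ℝ) * Y ^ (0.99925 : ℝ)) := by ring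
    _ = _ := by rw [← rpow_add hY0]; norm_num

lemma bil_trunc_comm {Y : ℝ} (hY : 0 < Y) (N₁ : ℕ) (F : ℕ → ℂ) (a b : ℕ → ℝ) :
    bil N₁ ⌊2 * Y⌋₊ F (fun m => if (m : ℝ) ≤ 2 * Y ^ (1 / 2 : ℝ) then 0 else a m) b =
      bil N₁ ⌊2 * Y⌋₊ F (fun k => if (k : ℝ) ≤ 2 * Y ^ (1 / 2 : ℝ) then b k else 0)
        (fun m => if (m : ℝ) ≤ 2 * Y ^ (1 / 2 : ℝ) then 0 else a m) := by
  rw [bil_comm _ _ _ (fun k : ℕ => if (k : ℝ) ≤ 2 * Y ^ (1 / 2 : ℝ) then b k else 0)]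
  unfold bil
  refine sum_congr rfl fun m hm => sum_congr rfl fun k hk => ?_
  rw [mem_Ioc_div (mem_Ioc.1 hm).1] at hk
  by_cases h1 : (m : ℝ) ≤ 2 * Y ^ (1 / 2 : ℝ)
  · simp only [if_pos h1, Complex.ofReal_zero, zero_mul]
  · by_cases h2 : (k : ℝ) ≤ 2 * Y ^ (1 / 2 : ℝ)
    · simp only [if_pos h2]
    · exfalso
      have h3 : ((m * k : ℕ) : ℝ) ≤ 2 * Y := (Nat.le_floor_iff (by linarith)).1 hk.2
      push_cast at h3
      have e : Y ^ (1/2:ℝ) * Y ^ (1/2:ℝ) = Y := by rw [← rpow_add hY]; norm_num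
      have hs : 0 < Y ^ (1/2:ℝ) := rpow_pos_of_pos hY _
      rw [not_le] at h1 h2
      have h4 := mul_lt_mul'' h1 h2 (by positivity) (by positivity)
      have h5 : 2 * Y ^ (1/2:ℝ) * (2 * Y ^ (1/2:ℝ)) = 4 * Y := by
        calc _ = 4 * (Y ^ (1/2:ℝ) * Y ^ (1/2:ℝ)) := by ring
          _ = _ := by rw [e]
      linarith

lemma one_add_log_two_mul_le (η : ℝ) (hη : 0 < η) (hη1 : η ≤ 1) {Y : ℝ} (hY : 1 ≤ Y) :
    1 + Real.log (2 * Y) ≤ 2 * (1 + 1 / η) * Y ^ η := by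
  have h := one_add_log_le η hη (x := 2 * Y) (by linarith)
  rw [mul_rpow (by norm_num) (by linarith)] at h
  have h2 : (2:ℝ) ^ η ≤ 2 := by
    calc (2:ℝ) ^ η ≤ 2 ^ (1:ℝ) := by gcongr; norm_num
      _ = 2 := rpow_one 2
  have : 0 ≤ Y ^ η := by positivity
  calc _ ≤ _ := h
    _ ≤ (1 + 1 / η) * (2 * Y ^ η) := by gcongr
    _ = _ := by ring

/-- The exponential sum over prime powers with smooth phase. -/
lemma exists_vonMangoldt_sum_le_of_large {c : ℝ} (hc : 1 < c) (hc' : c < 3) (h3 : fallFac c 3 ≠ 0)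
    (h5 : fallFac c 5 ≠ 0) :
    ∃ C > 0, ∃ Y₀ ≥ 1, ∀ β Y : ℝ, Y₀ ≤ Y → Y ^ (0.9 : ℝ) ≤ |β| * Y ^ c →
      |β| * Y ^ c ≤ Y ^ (2.1 : ℝ) →
      ‖∑ n ∈ Ioc ⌊Y⌋₊ ⌊2 * Y⌋₊, (ArithmeticFunction.vonMangoldt n : ℂ) * eC (β * (n : ℝ) ^ c)‖ ≤
        C * Y ^ (0.9995 : ℝ) := by
  obtain ⟨C₁, hC₁, H₁⟩ := exists_type_one_le h3 h5
  obtain ⟨C₂, hC₂, Y₀, hY₀, H₂⟩ := exists_bil_le hc hc' h3 h5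
  refine ⟨(2 * C₁ + 2 * C₂) * (2 * (1 + 1 / 0.0001)), by positivity, max Y₀ ((2:ℝ) ^ (100:ℝ)),
    le_max_of_le_left hY₀, fun β Y hY hl hu => ?_⟩
  have hYY := (le_max_left _ _).trans hY
  have hY2 : (2:ℝ) ^ (100:ℝ) ≤ Y := (le_max_right _ _).trans hY
  have hY1 : 1 ≤ Y := hY₀.trans hYY
  have hY0 : 0 < Y := by linarith
  have h2Y : (2:ℝ) ≤ Y ^ (0.01:ℝ) := by
    calc (2:ℝ) = ((2:ℝ) ^ (100:ℝ)) ^ (0.01:ℝ) := by rw [← rpow_mul (by norm_num)]; norm_num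
      _ ≤ _ := by gcongr
  set u := ⌊Y ^ (0.1:ℝ)⌋₊ with hu'
  have hule : (u:ℝ) ≤ Y ^ (0.1:ℝ) := Nat.floor_le (by positivity)
  have huY : u ≤ ⌊Y⌋₊ := by
    refine Nat.floor_le_floor ?_
    calc Y ^ (0.1:ℝ) ≤ Y ^ (1:ℝ) := by gcongr; norm_num
      _ = Y := rpow_one Y
  set Lg := 1 + Real.log (2 * Y) with hLg
  have hlog0 : 0 ≤ Real.log (2 * Y) := Real.log_nonneg (by linarith)
  have hLg1 : 1 ≤ Lg := by linarith
  have hlogk : ∀ k : ℕ, (k:ℝ) ≤ 2 * Y → Real.log k ≤ Lg := by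
    intro k hk
    rcases Nat.eq_zero_or_pos k with h | h
    · rw [h]; simp only [Nat.cast_zero, Real.log_zero]; linarith
    · have : Real.log k ≤ Real.log (2 * Y) := Real.log_le_log (by exact_mod_cast h) hk
      linarith
  have hfl : ∀ k : ℕ, k ≤ ⌊2 * Y⌋₊ → (k:ℝ) ≤ 2 * Y := fun k hk =>
    (Nat.le_floor_iff (by linarith)).1 hk
  rw [sum_vonMangoldt_eq ⌊Y⌋₊ ⌊2 * Y⌋₊ u u huY (fun n => eC (β * (n : ℝ) ^ c))]
  have hm1 : ∀ m, |truncAF (ArithmeticFunction.moebius : ArithmeticFunction ℝ) u m| ≤ 1 := by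
    intro m
    rw [truncAF_apply]
    split_ifs
    · rw [ArithmeticFunction.intCoe_apply]
      exact_mod_cast ArithmeticFunction.abs_moebius_le_one
    · simp
  have b1 := H₁ β Y 1 Lg (truncAF (ArithmeticFunction.moebius : ArithmeticFunction ℝ) u)
    ArithmeticFunction.log hY1 hl hu (fun m _ => hm1 m) (by
      intro m hm
      rw [truncAF_apply, if_neg]
      intro hmu
      have h1 : (m:ℝ) ≤ u := by exact_mod_cast hmu
      have h2 : Y ^ (0.1:ℝ) ≤ Y ^ (0.2:ℝ) := by gcongr; norm_num
      linarith) (by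
      intro k hk
      rw [ArithmeticFunction.log_apply, ArithmeticFunction.log_apply]
      exact Real.log_le_log (by exact_mod_cast hk) (by push_cast; linarith)) (by
      rw [ArithmeticFunction.log_apply]; simp) (fun k hk => by
      rw [ArithmeticFunction.log_apply]; exact hlogk k (hfl k hk))
  have b2 := H₁ β Y Lg 1 (truncAF (ArithmeticFunction.moebius : ArithmeticFunction ℝ) u *
          truncAF ArithmeticFunction.vonMangoldt u : ArithmeticFunction ℝ)
    (ArithmeticFunction.zeta : ArithmeticFunction ℝ) hY1 hl hu
    (fun m hm => (truncAF_moebius_mul_bound u u m).trans (hlogk m (hfl m hm))) (by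
      intro m hm
      apply truncAF_moebius_mul_eq_zero
      have h1 : ((u * u : ℕ) : ℝ) < m := by
        push_cast
        refine lt_of_le_of_lt ?_ hm
        calc (u:ℝ) * u ≤ Y ^ (0.1:ℝ) * Y ^ (0.1:ℝ) := by gcongr
          _ = Y ^ (0.2:ℝ) := by rw [← rpow_add hY0]; norm_num
      exact_mod_cast h1) (by
      intro k hk
      rw [ArithmeticFunction.natCoe_apply, ArithmeticFunction.natCoe_apply,
        ArithmeticFunction.zeta_apply_ne (by omega), ArithmeticFunction.zeta_apply_ne (by omega)])
      (by rw [ArithmeticFunction.natCoe_apply]; positivity) (by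
      intro k hk
      rw [ArithmeticFunction.natCoe_apply, ArithmeticFunction.zeta_apply]
      split_ifs <;> simp)
  set a : ℕ → ℝ := ⇑((ArithmeticFunction.moebius : ArithmeticFunction ℝ) -
          truncAF (ArithmeticFunction.moebius : ArithmeticFunction ℝ) u : ArithmeticFunction ℝ) with ha
  set b : ℕ → ℝ := ⇑((ArithmeticFunction.zeta : ArithmeticFunction ℝ) *
            (ArithmeticFunction.vonMangoldt - truncAF ArithmeticFunction.vonMangoldt u) : ArithmeticFunction ℝ) with hb
  have ha1 : ∀ m, |a m| ≤ 1 := moebius_tail_bound u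
  have hu9 : ∀ m : ℕ, (m : ℝ) ≤ 2 * Y ^ (0.09 : ℝ) → m ≤ u := by
    intro m hm
    refine Nat.le_floor (hm.trans ?_)
    calc 2 * Y ^ (0.09:ℝ) ≤ Y ^ (0.01:ℝ) * Y ^ (0.09:ℝ) := by gcongr
      _ = _ := by rw [← rpow_add hY0]; norm_num
  have ha0 : ∀ m : ℕ, (m : ℝ) ≤ 2 * Y ^ (0.09 : ℝ) → a m = 0 := fun m hm =>
    moebius_tail_eq_zero (hu9 m hm)
  have hb0 : ∀ m : ℕ, (m : ℝ) ≤ 2 * Y ^ (0.09 : ℝ) → b m = 0 := fun m hm =>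
    zeta_mul_tail_eq_zero (hu9 m hm)
  have hbb : ∀ k, |b k| ≤ Real.log k := zeta_mul_tail_bound u
  have b3 := H₂ β Y 1 Lg (fun m => if (m : ℝ) ≤ 2 * Y ^ (1 / 2 : ℝ) then a m else 0) b hYY hl hu
    zero_le_one (by linarith) (by
      intro m
      split_ifs
      · exact ha1 m
      · simp) (by
      intro m hm
      rw [ha0 m hm, ite_self]) (by
      intro m hm
      rw [if_neg (not_le.2 hm)]) (fun k hk => (hbb k).trans (hlogk k (hfl k hk)))
  have hsq : 2 * Y ^ (1/2:ℝ) ≤ 2 * Y := by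
    have : Y ^ (1/2:ℝ) ≤ Y ^ (1:ℝ) := by gcongr; norm_num
    rw [rpow_one] at this
    linarith
  have b4 := H₂ β Y Lg 1 (fun k => if (k : ℝ) ≤ 2 * Y ^ (1 / 2 : ℝ) then b k else 0)
    (fun m => if (m : ℝ) ≤ 2 * Y ^ (1 / 2 : ℝ) then 0 else a m) hYY hl hu
    (by linarith) zero_le_one (by
      intro m
      split_ifs with q
      · exact (hbb m).trans (hlogk m (q.trans hsq))
      · rw [abs_zero]; linarith) (by
      intro m hm
      rw [hb0 m hm, ite_self]) (by
      intro m hm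
      rw [if_neg (not_le.2 hm)]) (by
      intro k _
      split_ifs
      · simp
      · exact ha1 k)
  have hsplit : bil ⌊Y⌋₊ ⌊2 * Y⌋₊ (fun n => eC (β * (n : ℝ) ^ c)) a b =
      bil ⌊Y⌋₊ ⌊2 * Y⌋₊ (fun n => eC (β * (n : ℝ) ^ c))
        (fun m => if (m : ℝ) ≤ 2 * Y ^ (1 / 2 : ℝ) then a m else 0) b +
      bil ⌊Y⌋₊ ⌊2 * Y⌋₊ (fun n => eC (β * (n : ℝ) ^ c))
        (fun k => if (k : ℝ) ≤ 2 * Y ^ (1 / 2 : ℝ) then b k else 0)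
        (fun m => if (m : ℝ) ≤ 2 * Y ^ (1 / 2 : ℝ) then 0 else a m) := by
    rw [← bil_trunc_comm hY0, ← bil_add_left]
    congr 1
    funext m
    rw [Pi.add_apply]
    split_ifs <;> simp
  rw [hsplit]
  have hpow : Y ^ (0.998:ℝ) ≤ Y ^ (0.99935:ℝ) := by gcongr; norm_num
  have hLgY := one_add_log_two_mul_le 0.0001 (by norm_num) (by norm_num) hY1
  rw [← hLg] at hLgY
  generalize bil ⌊Y⌋₊ ⌊2 * Y⌋₊ (fun n => eC (β * (n : ℝ) ^ c)) _ _ = x₁ at b1 ⊢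
  generalize bil ⌊Y⌋₊ ⌊2 * Y⌋₊ (fun n => eC (β * (n : ℝ) ^ c)) _ _ = x₂ at b2 ⊢
  generalize bil ⌊Y⌋₊ ⌊2 * Y⌋₊ (fun n => eC (β * (n : ℝ) ^ c)) _ _ = x₃ at b3 ⊢
  generalize bil ⌊Y⌋₊ ⌊2 * Y⌋₊ (fun n => eC (β * (n : ℝ) ^ c)) _ _ = x₄ at b4 ⊢
  have htri : ‖x₁ - x₂ + (x₃ + x₄)‖ ≤ (‖x₁‖ + ‖x₂‖) + (‖x₃‖ + ‖x₄‖) :=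
    (norm_add_le _ _).trans (add_le_add (norm_sub_le _ _) (norm_add_le _ _))
  calc _ ≤ (‖x₁‖ + ‖x₂‖) + (‖x₃‖ + ‖x₄‖) := htri
    _ ≤ (C₁ * 1 * Lg * Y ^ (0.998:ℝ) + C₁ * Lg * 1 * Y ^ (0.998:ℝ)) +
        (C₂ * 1 * Lg * Y ^ (0.99935:ℝ) + C₂ * Lg * 1 * Y ^ (0.99935:ℝ)) :=
        add_le_add (add_le_add b1 b2) (add_le_add b3 b4)
    _ = 2 * C₁ * Lg * Y ^ (0.998:ℝ) + 2 * C₂ * Lg * Y ^ (0.99935:ℝ) := by ring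
    _ ≤ 2 * C₁ * Lg * Y ^ (0.99935:ℝ) + 2 * C₂ * Lg * Y ^ (0.99935:ℝ) := by gcongr
    _ = (2 * C₁ + 2 * C₂) * Lg * Y ^ (0.99935:ℝ) := by ring
    _ ≤ (2 * C₁ + 2 * C₂) * (2 * (1 + 1 / 0.0001) * Y ^ (0.0001:ℝ)) * Y ^ (0.99935:ℝ) := by gcongr
    _ = (2 * C₁ + 2 * C₂) * (2 * (1 + 1 / 0.0001)) * (Y ^ (0.0001:ℝ) * Y ^ (0.99935:ℝ)) := by ring
    _ = (2 * C₁ + 2 * C₂) * (2 * (1 + 1 / 0.0001)) * Y ^ (0.99945:ℝ) := by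
        rw [← rpow_add hY0]; norm_num
    _ ≤ _ := by gcongr; norm_num

lemma exists_vonMangoldt_sum_le {c : ℝ} (hc : 1 < c) (hc' : c < 3) (h3 : fallFac c 3 ≠ 0)
    (h5 : fallFac c 5 ≠ 0) :
    ∃ C > 0, ∀ β Y : ℝ, 1 ≤ Y → Y ^ (0.9 : ℝ) ≤ |β| * Y ^ c →
      |β| * Y ^ c ≤ Y ^ (2.1 : ℝ) →
      ‖∑ n ∈ Ioc ⌊Y⌋₊ ⌊2 * Y⌋₊, (ArithmeticFunction.vonMangoldt n : ℂ) * eC (β * (n : ℝ) ^ c)‖ ≤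
        C * Y ^ (0.9995 : ℝ) := by
  obtain ⟨C, hC, Y₀, hY₀, h⟩ := exists_vonMangoldt_sum_le_of_large hc hc' h3 h5
  refine ⟨C + 4 * Y₀ ^ 2, by positivity, fun β Y hY hl hu => ?_⟩
  have hp : 1 ≤ Y ^ (0.9995 : ℝ) := one_le_rpow hY (by norm_num)
  rcases le_total Y₀ Y with hYY | hYY
  · refine (h β Y hYY hl hu).trans ?_
    gcongr
    have : 0 ≤ 4 * Y₀ ^ 2 := by positivity
    linarith
  · have h1 : ∀ n ∈ Ioc ⌊Y⌋₊ ⌊2 * Y⌋₊,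
        ‖(ArithmeticFunction.vonMangoldt n : ℂ) * eC (β * (n : ℝ) ^ c)‖ ≤ 2 * Y := by
      intro n hn
      rw [norm_mul, norm_eC, mul_one, Complex.norm_real,
        Real.norm_of_nonneg ArithmeticFunction.vonMangoldt_nonneg]
      have h2 := (Nat.le_floor_iff (by linarith)).1 (mem_Ioc.1 hn).2
      have h3 := ArithmeticFunction.vonMangoldt_le_log (n := n)
      have h4 := Real.log_le_self (Nat.cast_nonneg (α := ℝ) n)
      linarith
    refine (norm_sum_le _ _).trans ((sum_le_card_nsmul _ _ _ h1).trans ?_)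
    rw [nsmul_eq_mul]
    have h5 := card_Ioc_floor_le hY
    calc _ ≤ (2 * Y) * (2 * Y) := by gcongr
      _ ≤ (2 * Y₀) * (2 * Y₀) := by gcongr
      _ = 4 * Y₀ ^ 2 := by ring
      _ ≤ (C + 4 * Y₀ ^ 2) * 1 := by linarith
      _ ≤ _ := by gcongr

lemma norm_SX_le (c α : ℝ) {Y : ℝ} (hY : 0 ≤ Y) : ‖SX c Y α‖ ≤ 4 * Y := by
  unfold SX
  refine (norm_sum_le _ _).trans ?_
  have h1 : ∀ p ∈ (Ioc ⌊Y⌋₊ ⌊2 * Y⌋₊).filter Nat.Prime,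
      ‖(Real.log p : ℂ) * eC ((⌊(p : ℝ) ^ c⌋ : ℝ) * α)‖ = Real.log p := by
    intro p _
    rw [norm_mul, norm_eC, mul_one, Complex.norm_real,
      Real.norm_of_nonneg (Real.log_natCast_nonneg p)]
  rw [sum_congr rfl h1]
  have h2 := Chebyshev.theta_le_log4_mul_x (x := 2 * Y) (by linarith)
  have h3 : Real.log 4 ≤ 2 := by
    have := Real.log_two_lt_d9
    rw [show (4 : ℝ) = 2 ^ 2 by norm_num, Real.log_pow]
    push_cast; linarith
  calc _ ≤ Chebyshev.theta (2 * Y) := by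
        unfold Chebyshev.theta
        refine sum_le_sum_of_subset_of_nonneg ?_ fun p _ _ => Real.log_natCast_nonneg p
        exact filter_subset_filter _ (Ioc_subset_Ioc_left (Nat.zero_le _))
    _ ≤ Real.log 4 * (2 * Y) := h2
    _ ≤ 2 * (2 * Y) := by gcongr
    _ = _ := by ring

lemma norm_SX_sub_vonMangoldt_sum_le (c α : ℝ) {Y : ℝ} (hY : 1 ≤ Y) :
    ‖SX c Y α - ∑ n ∈ Ioc ⌊Y⌋₊ ⌊2 * Y⌋₊,
      (ArithmeticFunction.vonMangoldt n : ℂ) * eC ((⌊(n : ℝ) ^ c⌋ : ℝ) * α)‖ ≤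
      2 * √(2 * Y) * Real.log (2 * Y) := by
  have e : SX c Y α - ∑ n ∈ Ioc ⌊Y⌋₊ ⌊2 * Y⌋₊,
      (ArithmeticFunction.vonMangoldt n : ℂ) * eC ((⌊(n : ℝ) ^ c⌋ : ℝ) * α) =
      - ∑ n ∈ (Ioc ⌊Y⌋₊ ⌊2 * Y⌋₊).filter (fun n => ¬ n.Prime),
      (ArithmeticFunction.vonMangoldt n : ℂ) * eC ((⌊(n : ℝ) ^ c⌋ : ℝ) * α) := by
    have h := sum_filter_add_sum_filter_not (Ioc ⌊Y⌋₊ ⌊2 * Y⌋₊) (fun n => n.Prime)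
      (fun n => (ArithmeticFunction.vonMangoldt n : ℂ) * eC ((⌊(n : ℝ) ^ c⌋ : ℝ) * α))
    have h' : SX c Y α = ∑ n ∈ (Ioc ⌊Y⌋₊ ⌊2 * Y⌋₊).filter (fun n => n.Prime),
        (ArithmeticFunction.vonMangoldt n : ℂ) * eC ((⌊(n : ℝ) ^ c⌋ : ℝ) * α) := by
      unfold SX
      refine sum_congr rfl fun p hp => ?_
      rw [ArithmeticFunction.vonMangoldt_apply_prime (mem_filter.1 hp).2]
    rw [← h, h']
    ring
  rw [e, norm_neg]
  refine (norm_sum_le _ _).trans ?_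
  refine le_trans ?_ (Chebyshev.psi_sub_theta_le (x := 2 * Y) (by linarith))
  rw [Chebyshev.psi_sub_theta_eq_sum_not_prime]
  have h1 : ∀ n ∈ (Ioc ⌊Y⌋₊ ⌊2 * Y⌋₊).filter (fun n => ¬ n.Prime),
      ‖(ArithmeticFunction.vonMangoldt n : ℂ) * eC ((⌊(n : ℝ) ^ c⌋ : ℝ) * α)‖ =
        ArithmeticFunction.vonMangoldt n := by
    intro p _
    rw [norm_mul, norm_eC, mul_one, Complex.norm_real,
      Real.norm_of_nonneg ArithmeticFunction.vonMangoldt_nonneg]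
  rw [sum_congr rfl h1]
  refine sum_le_sum_of_subset_of_nonneg ?_ fun p _ _ => ArithmeticFunction.vonMangoldt_nonneg
  exact filter_subset_filter _ (Ioc_subset_Ioc_left (Nat.zero_le _))

lemma exists_SX_le_of_large {c : ℝ} (hc : 1 < c) (hc' : c < 2.05502) (h3 : fallFac c 3 ≠ 0)
    (h5 : fallFac c 5 ≠ 0) :
    ∃ C > 0, ∀ α Y : ℝ, (65:ℝ) ^ (50:ℝ) ≤ Y → Y ^ (0.9 - c) ≤ |α| → |α| ≤ 1 / 2 →
      ‖SX c Y α‖ ≤ C * Y ^ (0.9996 : ℝ) := by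
  obtain ⟨C₁, hC₁, H₁⟩ := exists_moderate_sum_le hc hc' h3
  obtain ⟨C₂, hC₂, H₂⟩ := exists_vonMangoldt_sum_le hc (by linarith) h3 h5
  set K : ℝ := 2 * (1 + 1 / 0.0001) with hK
  have hK0 : 0 < K := by positivity
  refine ⟨C₂ + 40 * K * C₂ + K * (140 + 50 * C₁) + 4 * K, by positivity, fun α Y hY hl hα => ?_⟩
  have hY1 : 1 ≤ Y := le_trans (one_le_rpow (by norm_num) (by norm_num)) hY
  have hY0 : 0 < Y := by linarith
  have h65 : (65:ℝ) ≤ Y ^ (0.02:ℝ) := by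
    calc (65:ℝ) = ((65:ℝ) ^ (50:ℝ)) ^ (0.02:ℝ) := by rw [← rpow_mul (by norm_num)]; norm_num
      _ ≤ _ := by gcongr
  obtain ⟨hM8, hMle, hMge⟩ := floor_eight_rpow (x := 0.01) hY1 (by norm_num)
  set M := ⌊8 * Y ^ (0.01 : ℝ)⌋₊ with hM
  have hM0 : (0 : ℝ) < M := by positivity
  have hA : Y ≤ (⌊Y⌋₊ : ℝ) + 1 := (Nat.lt_floor_add_one Y).le
  have hB : (⌊2 * Y⌋₊ : ℝ) ≤ 4 * Y := (Nat.floor_le (by linarith)).trans (by linarith)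
  have hM2 : ((M ^ 2 : ℕ) : ℝ) ≤ 64 * Y ^ (0.02 : ℝ) := by
    push_cast
    calc (M : ℝ) ^ 2 ≤ (8 * Y ^ (0.01 : ℝ)) ^ 2 := by gcongr
      _ = 64 * (Y ^ (0.01 : ℝ) * Y ^ (0.01 : ℝ)) := by ring
      _ = _ := by rw [← Real.rpow_add hY0]; norm_num
  have hLg := one_add_log_two_mul_le 0.0001 (by norm_num) (by norm_num) hY1
  rw [← hK] at hLg
  have hlog0 : 0 ≤ Real.log (2 * Y) := Real.log_nonneg (by linarith)
  set Lg := 1 + Real.log (2 * Y) with hLgdef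
  have hcY : Y ^ (0.9 : ℝ) ≤ |α| * Y ^ c := by
    calc Y ^ (0.9:ℝ) = Y ^ (0.9 - c) * Y ^ c := by rw [← rpow_add hY0]; ring_nf
      _ ≤ _ := by gcongr
  have hhalf : Y ^ (0.9:ℝ) ≤ (1 / 2) * Y ^ c := hcY.trans (by gcongr)
  have hup : ∀ x : ℝ, |x| ≤ 65 * Y ^ (0.02:ℝ) → |x| * Y ^ c ≤ Y ^ (2.1:ℝ) := by
    intro x hx
    calc |x| * Y ^ c ≤ (65 * Y ^ (0.02:ℝ)) * Y ^ c := by gcongr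
      _ ≤ (Y ^ (0.02:ℝ) * Y ^ (0.02:ℝ)) * Y ^ c := by gcongr
      _ = Y ^ (0.02 + 0.02 + c) := by rw [← rpow_add hY0, ← rpow_add hY0]
      _ ≤ _ := by gcongr; linarith
  have keyW : ∀ h : ℤ, h ≠ 0 → |h| < (M ^ 2 : ℕ) → ‖∑ n ∈ Ioc ⌊Y⌋₊ ⌊2 * Y⌋₊,
      (ArithmeticFunction.vonMangoldt n : ℂ) * eC ((α + h) * (n : ℝ) ^ c)‖ ≤
      C₂ * Y ^ (0.9995 : ℝ) := by
    intro h h0 hh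
    have hh1 : (1 : ℝ) ≤ |(h : ℝ)| := by exact_mod_cast Int.one_le_abs h0
    have hh2 : |(h : ℝ)| + 1 ≤ ((M ^ 2 : ℕ) : ℝ) := by exact_mod_cast hh
    apply H₂ _ Y hY1
    · refine hhalf.trans ?_
      have := abs_sub_abs_le_abs_sub (h : ℝ) (-α)
      rw [abs_neg, sub_neg_eq_add, add_comm (h : ℝ)] at this
      gcongr
      linarith
    · refine hup _ ((abs_add_le α h).trans ?_)
      linarith
  have keyI : ∀ h : ℤ, h ≠ 0 → |h| < M → ‖∑ n ∈ Ioc ⌊Y⌋₊ ⌊2 * Y⌋₊, eC (h * (n : ℝ) ^ c)‖ ≤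
      C₁ * Y ^ (0.8828 : ℝ) := by
    intro h h0 hh
    have hh1 : (1 : ℝ) ≤ |(h : ℝ)| := by exact_mod_cast Int.one_le_abs h0
    have hh2 : |(h : ℝ)| ≤ (M : ℝ) := by exact_mod_cast hh.le
    apply H₁ _ Y _ _ hY1 hA hB (by linarith)
    calc |(h:ℝ)| ≤ M := hh2
      _ ≤ 8 * Y ^ (0.01:ℝ) := hMle
      _ ≤ 64 * Y ^ (0.24:ℝ) := by
        gcongr
        · norm_num
        · norm_num
  have hfl := norm_sum_floor_le (Ioc ⌊Y⌋₊ ⌊2 * Y⌋₊) (fun n : ℕ => (n : ℝ) ^ c)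
    (fun n => (ArithmeticFunction.vonMangoldt n : ℂ)) Lg (by
      intro n hn
      rw [Complex.norm_real, Real.norm_of_nonneg ArithmeticFunction.vonMangoldt_nonneg]
      have hn' := mem_Ioc.1 hn
      have h2 := (Nat.le_floor_iff (by linarith)).1 hn'.2
      have h4 := Real.log_le_log (by exact_mod_cast (Nat.zero_le _).trans_lt hn'.1) h2
      have h3 := ArithmeticFunction.vonMangoldt_le_log (n := n)
      linarith) (by linarith) M hM8 α hα (C₂ * Y ^ (0.9995 : ℝ)) (C₁ * Y ^ (0.8828 : ℝ))
    keyW (by positivity) keyI (by positivity)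
  have hmain := H₂ α Y hY1 hcY (hup α (by linarith))
  have hs : ((Ioc ⌊Y⌋₊ ⌊2 * Y⌋₊).card : ℝ) / M ≤ 2 * Y ^ (0.99 : ℝ) := by
    calc ((Ioc ⌊Y⌋₊ ⌊2 * Y⌋₊).card : ℝ) / M ≤ 2 * Y / Y ^ (0.01 : ℝ) := by
          gcongr; exact card_Ioc_floor_le hY1
      _ = 2 * Y ^ (1 - 0.01 : ℝ) := by rw [Real.rpow_sub hY0, Real.rpow_one]; ring
      _ = _ := by norm_num
  have hlogM : 1 + Real.log (M ^ 2 : ℕ) ≤ 10 * Lg := by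
    have h1 : Real.log (M ^ 2 : ℕ) ≤ Real.log (64 * Y ^ (0.02 : ℝ)) := by
      apply Real.log_le_log _ hM2
      push_cast; positivity
    rw [Real.log_mul (by norm_num) (by positivity), Real.log_rpow hY0] at h1
    have h64 : Real.log 64 ≤ 9 := by
      have := Real.log_two_lt_d9
      rw [show (64 : ℝ) = 2 ^ 6 by norm_num, Real.log_pow]
      push_cast; linarith
    have h5 := Real.log_nonneg hY1
    have h6 : Real.log Y ≤ Real.log (2 * Y) := Real.log_le_log hY0 (by linarith)
    linarith
  have hp1 : Y ^ (0.9995:ℝ) ≤ Y ^ (0.9996:ℝ) := by gcongr; norm_num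
  have hp2 : Y ^ (0.8828:ℝ) ≤ Y ^ (0.99:ℝ) := by gcongr; norm_num
  have hp3 : Y ^ (0.0001:ℝ) * Y ^ (0.9995:ℝ) = Y ^ (0.9996:ℝ) := by rw [← rpow_add hY0]; norm_num
  have hp4 : Y ^ (0.0001:ℝ) * Y ^ (0.99:ℝ) ≤ Y ^ (0.9996:ℝ) := by
    rw [← rpow_add hY0]; gcongr; norm_num
  have t1 : 4 * (1 + Real.log (M ^ 2 : ℕ)) * (C₂ * Y ^ (0.9995 : ℝ)) ≤
      40 * K * C₂ * Y ^ (0.9996:ℝ) := by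
    calc _ ≤ 4 * (10 * (K * Y ^ (0.0001:ℝ))) * (C₂ * Y ^ (0.9995 : ℝ)) := by
          gcongr; linarith
      _ = 40 * K * C₂ * (Y ^ (0.0001:ℝ) * Y ^ (0.9995 : ℝ)) := by ring
      _ = _ := by rw [hp3]
  have t2 : Lg * (20 * (((Ioc ⌊Y⌋₊ ⌊2 * Y⌋₊).card : ℝ) / M) +
      50 * (((Ioc ⌊Y⌋₊ ⌊2 * Y⌋₊).card : ℝ) / M + C₁ * Y ^ (0.8828 : ℝ))) ≤
      K * (140 + 50 * C₁) * Y ^ (0.9996:ℝ) := by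
    calc _ ≤ (K * Y ^ (0.0001:ℝ)) * (20 * (2 * Y ^ (0.99 : ℝ)) +
          50 * (2 * Y ^ (0.99 : ℝ) + C₁ * Y ^ (0.99 : ℝ))) := by gcongr
      _ = K * (140 + 50 * C₁) * (Y ^ (0.0001:ℝ) * Y ^ (0.99:ℝ)) := by ring
      _ ≤ _ := by gcongr
  have t3 : 2 * √(2 * Y) * Real.log (2 * Y) ≤ 4 * K * Y ^ (0.9996:ℝ) := by
    have h1 : √(2 * Y) ≤ 2 * Y ^ (1/2:ℝ) := by
      rw [sqrt_mul (by norm_num), sqrt_eq_rpow Y]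
      have : √2 ≤ 2 := by rw [sqrt_le_left (by norm_num)]; norm_num
      gcongr
    have h2 : Real.log (2 * Y) ≤ K * Y ^ (0.0001:ℝ) := by linarith
    calc _ ≤ 2 * (2 * Y ^ (1/2:ℝ)) * (K * Y ^ (0.0001:ℝ)) := by gcongr
      _ = 4 * K * (Y ^ (1/2:ℝ) * Y ^ (0.0001:ℝ)) := by ring
      _ ≤ _ := by
        rw [← rpow_add hY0]
        gcongr
        norm_num
  have t4 : C₂ * Y ^ (0.9995:ℝ) ≤ C₂ * Y ^ (0.9996:ℝ) := by gcongr
  have hpp := norm_SX_sub_vonMangoldt_sum_le c α hY1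
  have hfin := norm_sub_norm_le (SX c Y α) (∑ n ∈ Ioc ⌊Y⌋₊ ⌊2 * Y⌋₊,
      (ArithmeticFunction.vonMangoldt n : ℂ) * eC ((⌊(n : ℝ) ^ c⌋ : ℝ) * α))
  have e : (C₂ + 40 * K * C₂ + K * (140 + 50 * C₁) + 4 * K) * Y ^ (0.9996 : ℝ) =
      C₂ * Y ^ (0.9996 : ℝ) + 40 * K * C₂ * Y ^ (0.9996 : ℝ) +
        K * (140 + 50 * C₁) * Y ^ (0.9996 : ℝ) + 4 * K * Y ^ (0.9996 : ℝ) := by ring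
  rw [e]
  linarith

/-- The minor arc estimate for the prime exponential sum. -/
lemma exists_SX_le {c : ℝ} (hc : 1 < c) (hc' : c < 2.05502) (h3 : fallFac c 3 ≠ 0)
    (h5 : fallFac c 5 ≠ 0) :
    ∃ C > 0, ∀ α Y : ℝ, 1 ≤ Y → Y ^ (0.9 - c) ≤ |α| → |α| ≤ 1 / 2 →
      ‖SX c Y α‖ ≤ C * Y ^ (0.9996 : ℝ) := by
  obtain ⟨C, hC, h⟩ := exists_SX_le_of_large hc hc' h3 h5
  refine ⟨C + 4 * (65:ℝ) ^ (50:ℝ), by positivity, fun α Y hY hl hα => ?_⟩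
  rcases le_total ((65:ℝ) ^ (50:ℝ)) Y with q | q
  · refine (h α Y q hl hα).trans ?_
    have : 0 ≤ 4 * (65:ℝ) ^ (50:ℝ) := by positivity
    gcongr
    linarith
  · have h1 := one_le_rpow hY (show (0:ℝ) ≤ 0.9996 by norm_num)
    calc _ ≤ 4 * Y := norm_SX_le c α (by linarith)
      _ ≤ 4 * (65:ℝ) ^ (50:ℝ) * 1 := by linarith
      _ ≤ (C + 4 * (65:ℝ) ^ (50:ℝ)) * Y ^ (0.9996 : ℝ) := by
        gcongr
        linarith

lemma eC_zero_or_int_integral (m : ℤ) :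
    ∫ x in (0 : ℝ)..1, eC (m * x) = if m = 0 then 1 else 0 := by
  split_ifs with h
  · simp [h, eC_zero]
  · have hm : (2 * π * m * Complex.I : ℂ) ≠ 0 := by
      have : (m : ℂ) ≠ 0 := by exact_mod_cast h
      have h2 : (π : ℂ) ≠ 0 := by exact_mod_cast pi_ne_zero
      simp [this, h2]
    have h1 : ∀ x : ℝ, eC (m * x) = Complex.exp ((2 * π * m * Complex.I : ℂ) * x) := by
      intro x
      unfold eC
      congr 1
      push_cast
      ring
    simp_rw [h1]
    rw [integral_exp_mul_complex hm]
    have h2 : Complex.exp ((2 * π * m * Complex.I : ℂ) * (1 : ℝ)) = 1 := by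
      rw [← h1, mul_one, eC_int]
    rw [h2]
    simp

/-- The half-open unit cube. -/
def unitCube : Set (Fin 4 → ℝ) := Set.univ.pi fun _ => Set.Ioc 0 1

lemma lintegral_eq_tsum_unitCube (f : (Fin 4 → ℝ) → ENNReal) :
    ∫⁻ y, f y = ∑' m : Fin 4 → ℤ, ∫⁻ y in unitCube, f (y + fun j => (m j : ℝ)) := by
  set s : (Fin 4 → ℤ) → Set (Fin 4 → ℝ) :=
    fun m => Set.univ.pi fun j => Set.Ioc (m j : ℝ) (m j + 1) with hs
  have hcov : (⋃ m, s m) = Set.univ := by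
    refine Set.eq_univ_of_forall fun y => Set.mem_iUnion.2 ⟨fun j => ⌈y j⌉ - 1, ?_⟩
    intro j _
    push_cast
    constructor
    · linarith [Int.ceil_lt_add_one (y j)]
    · linarith [Int.le_ceil (y j)]
  have hdis : Pairwise (Function.onFun Disjoint s) := by
    intro m m' hmm
    refine Set.disjoint_left.2 fun y hy hy' => hmm ?_
    funext j
    have h1 := hy j trivial
    have h2 := hy' j trivial
    have h3 : (m j : ℝ) < m' j + 1 := h1.1.trans_le h2.2
    have h4 : (m' j : ℝ) < m j + 1 := h2.1.trans_le h1.2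
    norm_cast at h3 h4
    omega
  rw [← setLIntegral_univ, ← hcov,
    lintegral_iUnion (fun m => MeasurableSet.univ_pi fun _ => measurableSet_Ioc) hdis]
  refine tsum_congr fun m => ?_
  have hp := measurePreserving_add_right (volume : Measure (Fin 4 → ℝ)) (fun j => (m j : ℝ))
  rw [← hp.setLIntegral_comp_preimage_emb (MeasurableEquiv.addRight _).measurableEmbedding]
  congr 2
  ext y
  simp only [unitCube, Set.mem_preimage, Set.mem_pi, Set.mem_univ, Set.mem_Ioc, Pi.add_apply,
    true_implies]
  refine forall_congr' fun j => ?_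
  constructor <;> rintro ⟨h1, h2⟩ <;> constructor <;> linarith

lemma integral_unitCube_eC (n : Fin 4 → ℤ) :
    ∫ y in unitCube, eC (∑ j, (n j : ℝ) * y j) = if n = 0 then 1 else 0 := by
  have h1 : ∀ y : Fin 4 → ℝ, eC (∑ j, (n j : ℝ) * y j) = ∏ j, eC ((n j : ℝ) * y j) := by
    intro y
    simp only [Fin.sum_univ_four, Fin.prod_univ_four, eC_add]
  simp_rw [h1]
  unfold unitCube
  rw [volume_pi, Measure.restrict_pi_pi,
    integral_fintype_prod_eq_prod (fun j x => eC ((n j : ℝ) * x))]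
  have h2 : ∀ j, ∫ x in Set.Ioc (0 : ℝ) 1, eC ((n j : ℝ) * x) = if n j = 0 then 1 else 0 := by
    intro j
    rw [← intervalIntegral.integral_of_le zero_le_one, eC_zero_or_int_integral]
  simp_rw [h2]
  by_cases h : n = 0
  · simp [h]
  · rw [if_neg h]
    obtain ⟨j, hj⟩ := Function.ne_iff.1 h
    exact prod_eq_zero (mem_univ j) (if_neg hj)

lemma integrableOn_unitCube_of_continuous {E : Type*} [NormedAddCommGroup E]
    {f : (Fin 4 → ℝ) → E} (hf : Continuous f) : IntegrableOn f unitCube := by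
  have hc : IsCompact (Set.univ.pi fun _ : Fin 4 => Set.Icc (0 : ℝ) 1) :=
    isCompact_univ_pi fun _ => isCompact_Icc
  exact (hf.continuousOn.integrableOn_compact hc).mono_set
    (Set.pi_mono fun _ _ => Set.Ioc_subset_Icc_self)

lemma continuous_eC_dot (n : Fin 4 → ℤ) :
    Continuous fun y : Fin 4 → ℝ => eC (∑ j, (n j : ℝ) * y j) :=
  continuous_eC.comp (by fun_prop)

lemma integral_unitCube_norm_sq (B : Finset (Fin 4 → ℤ)) :
    ∫ y in unitCube, ‖∑ n ∈ B, eC (∑ j, (n j : ℝ) * y j)‖ ^ 2 = B.card := by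
  have h1 : ∀ y : Fin 4 → ℝ, ((‖∑ n ∈ B, eC (∑ j, (n j : ℝ) * y j)‖ ^ 2 : ℝ) : ℂ) =
      ∑ n ∈ B, ∑ m ∈ B, eC (∑ j, ((n - m) j : ℝ) * y j) := by
    intro y
    push_cast
    rw [← Complex.mul_conj', map_sum, sum_mul_sum]
    refine sum_congr rfl fun n _ => sum_congr rfl fun m _ => ?_
    rw [← eC_sub]
    congr 1
    rw [← sum_sub_distrib]
    refine sum_congr rfl fun j _ => ?_
    simp only [Pi.sub_apply]
    push_cast
    ring
  have h2 : ((∫ y in unitCube, ‖∑ n ∈ B, eC (∑ j, (n j : ℝ) * y j)‖ ^ 2 : ℝ) : ℂ) = B.card := by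
    rw [← integral_complex_ofReal]
    simp_rw [h1]
    rw [integral_finsetSum _ fun n _ => ?_]
    · have h3 : ∀ n ∈ B, ∫ y in unitCube, ∑ m ∈ B, eC (∑ j, ((n - m) j : ℝ) * y j) = 1 := by
        intro n hn
        rw [integral_finsetSum _ fun m _ =>
          integrableOn_unitCube_of_continuous (continuous_eC_dot _)]
        simp_rw [integral_unitCube_eC, sub_eq_zero]
        rw [sum_ite_eq, if_pos hn]
      rw [sum_congr rfl h3]
      simp
    · exact integrableOn_unitCube_of_continuous
        (continuous_finsetSum _ fun m _ => continuous_eC_dot _)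
  exact_mod_cast h2

lemma lintegral_unitCube_norm_sq (B : Finset (Fin 4 → ℤ)) :
    ∫⁻ y in unitCube, ENNReal.ofReal (‖∑ n ∈ B, eC (∑ j, (n j : ℝ) * y j)‖ ^ 2) = B.card := by
  rw [← ofReal_integral_eq_lintegral_ofReal, integral_unitCube_norm_sq]
  · simp
  · refine integrableOn_unitCube_of_continuous ?_
    exact (continuous_norm.comp (continuous_finsetSum _ fun m _ => continuous_eC_dot _)).pow 2
  · exact Filter.Eventually.of_forall fun y => by positivity

lemma setLIntegral_norm_sq_le (S : Set (Fin 4 → ℝ)) (hS : MeasurableSet S) (B D : Finset (Fin 4 → ℤ))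
    (hD : ∀ k : Fin 4 → ℤ, ∀ y ∈ S, ∀ z ∈ S, (∀ j, (k j : ℝ) = y j - z j) → k ∈ D) :
    ∫⁻ y in S, ENNReal.ofReal (‖∑ n ∈ B, eC (∑ j, (n j : ℝ) * y j)‖ ^ 2) ≤ D.card * B.card := by
  set f : (Fin 4 → ℝ) → ENNReal :=
    fun y => ENNReal.ofReal (‖∑ n ∈ B, eC (∑ j, (n j : ℝ) * y j)‖ ^ 2) with hf
  have hfm : Measurable f := by
    refine ENNReal.measurable_ofReal.comp ?_
    exact ((continuous_norm.comp
      (continuous_finsetSum _ fun m _ => continuous_eC_dot _)).pow 2).measurable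
  have hper : ∀ (y : Fin 4 → ℝ) (m : Fin 4 → ℤ), f (y + fun j => (m j : ℝ)) = f y := by
    intro y m
    simp only [hf]
    congr 4
    funext n
    have : (∑ j, (n j : ℝ) * ((y + fun j => (m j : ℝ)) j)) =
        (∑ j, (n j : ℝ) * y j) + ((∑ j, n j * m j : ℤ) : ℝ) := by
      push_cast
      rw [← sum_add_distrib]
      refine sum_congr rfl fun j _ => ?_
      simp only [Pi.add_apply]
      ring
    rw [this, eC_add, eC_int, mul_one]
  rw [← lintegral_indicator hS, lintegral_eq_tsum_unitCube]
  have h1 : ∀ m : Fin 4 → ℤ, ∫⁻ y in unitCube, S.indicator f (y + fun j => (m j : ℝ)) =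
      ∫⁻ y in unitCube, S.indicator 1 (y + fun j => (m j : ℝ)) * f y := by
    intro m
    refine lintegral_congr fun y => ?_
    by_cases h : (y + fun j => (m j : ℝ)) ∈ S
    · rw [Set.indicator_of_mem h, Set.indicator_of_mem h, hper, Pi.one_apply, one_mul]
    · rw [Set.indicator_of_notMem h, Set.indicator_of_notMem h, zero_mul]
  have hmeas : ∀ m : Fin 4 → ℤ,
      Measurable fun y : Fin 4 → ℝ => S.indicator (1 : (Fin 4 → ℝ) → ENNReal)
        (y + fun j => (m j : ℝ)) := by
    intro m
    exact (measurable_one.indicator hS).comp (measurable_add_const _)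
  rw [tsum_congr h1]
  rw [← lintegral_tsum fun m =>
    (show Measurable fun y => S.indicator (1 : (Fin 4 → ℝ) → ENNReal)
      (y + fun j => (m j : ℝ)) * f y from (hmeas m).mul hfm).aemeasurable]
  simp_rw [ENNReal.tsum_mul_right]
  have h2 : ∀ y : Fin 4 → ℝ, ∑' m : Fin 4 → ℤ, S.indicator (1 : (Fin 4 → ℝ) → ENNReal)
      (y + fun j => (m j : ℝ)) ≤ D.card := by
    intro y
    by_cases hy : ∃ m₀ : Fin 4 → ℤ, (y + fun j => (m₀ j : ℝ)) ∈ S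
    · obtain ⟨m₀, hm₀⟩ := hy
      rw [tsum_eq_sum (s := D.image fun k => m₀ + k)]
      · calc _ ≤ ∑ m ∈ D.image fun k => m₀ + k, (1 : ENNReal) := by
              refine sum_le_sum fun m _ => ?_
              exact Set.indicator_le (s := S) (g := 1) (fun _ _ => le_rfl) _
          _ = ((D.image fun k => m₀ + k).card : ENNReal) := by simp
          _ ≤ D.card := by exact_mod_cast card_image_le
      · intro m hm
        refine Set.indicator_of_notMem (fun h => hm ?_) _
        refine mem_image.2 ⟨m - m₀, hD _ _ h _ hm₀ fun j => ?_, by abel⟩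
        simp only [Pi.add_apply, Pi.sub_apply]
        push_cast
        ring
    · push Not at hy
      have : ∀ m : Fin 4 → ℤ, S.indicator (1 : (Fin 4 → ℝ) → ENNReal)
          (y + fun j => (m j : ℝ)) = 0 := fun m => Set.indicator_of_notMem (hy m) _
      simp [this]
  calc _ ≤ ∫⁻ y in unitCube, (D.card : ENNReal) * f y := lintegral_mono fun y => by
        gcongr
        exact h2 y
    _ = D.card * ∫⁻ y in unitCube, f y := lintegral_const_mul _ hfm
    _ = _ := by rw [lintegral_unitCube_norm_sq]

/-- Lattice points in a box, counted through the lattice points of a dual box. -/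
lemma card_mul_abs_det_le (A : Matrix (Fin 4) (Fin 4) ℝ) (R : Fin 4 → ℝ) (hR : ∀ i, 0 < R i)
    (B D : Finset (Fin 4 → ℤ))
    (hB : ∀ n ∈ B, ∀ i, |∑ j, A i j * n j| ≤ R i)
    (hD : ∀ (k : Fin 4 → ℤ) (c : Fin 4 → ℝ), (∀ i, |c i| * R i ≤ 1 / 16) →
      (∀ j, (k j : ℝ) = ∑ i, c i * A i j) → k ∈ D) :
    (B.card : ℝ) * |A.det| ≤ 2 ^ 18 * (∏ i, R i) * D.card := by
  set Q : Set (Fin 4 → ℝ) := Set.univ.pi fun i => Set.Ioo (-(1 / (32 * R i))) (1 / (32 * R i))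
    with hQ
  set T := Matrix.toLin' A.transpose with hT
  have hTapp : ∀ c j, T c j = ∑ i, c i * A i j := by
    intro c j
    rw [hT, Matrix.toLin'_apply, Matrix.mulVec_eq_sum]
    simp [Finset.sum_apply]
  set S := T '' Q with hSdef
  rcases eq_or_ne A.det 0 with h0 | h0
  · rw [h0]
    have : 0 ≤ ∏ i, R i := prod_nonneg fun i _ => (hR i).le
    simp only [abs_zero, mul_zero]
    positivity
  have hdet : LinearMap.det T = A.det := by
    rw [hT, LinearMap.det_toLin', Matrix.det_transpose]
  have hSvol : volume S = ENNReal.ofReal (|A.det| * ∏ i, (1 / (16 * R i))) := by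
    rw [hSdef, Measure.addHaar_image_linearMap, hdet, hQ, Real.volume_pi_Ioo,
      ENNReal.ofReal_mul (abs_nonneg _), ENNReal.ofReal_prod_of_nonneg]
    · congr 2
      funext i
      congr 1
      have := (hR i).ne'
      field_simp
      ring
    · intro i _
      have := hR i
      positivity
  have hSo : IsOpen S := by
    have hQo : IsOpen Q := isOpen_set_pi Set.finite_univ fun _ _ => isOpen_Ioo
    have hu : IsUnit (LinearMap.det T) := by rw [hdet]; exact isUnit_iff_ne_zero.2 h0
    have h3 : Function.Surjective T := by
      have := LinearMap.isUnit_iff_isUnit_det T |>.2 hu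
      exact ((Module.End.isUnit_iff T).1 this).2
    exact T.isOpenMap_of_finiteDimensional h3 _ hQo
  have hlow : ∀ y ∈ S, (B.card : ℝ) ^ 2 / 4 ≤ ‖∑ n ∈ B, eC (∑ j, (n j : ℝ) * y j)‖ ^ 2 := by
    rintro y ⟨c, hc, rfl⟩
    have h1 : ∀ n ∈ B, (1 / 2 : ℝ) ≤ (eC (∑ j, (n j : ℝ) * T c j)).re := by
      intro n hn
      have h2 : (∑ j, (n j : ℝ) * T c j) = ∑ i, c i * ∑ j, A i j * n j := by
        simp_rw [hTapp, mul_sum]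
        rw [sum_comm]
        refine sum_congr rfl fun i _ => sum_congr rfl fun j _ => by ring
      have h3 : |∑ j, (n j : ℝ) * T c j| ≤ 1 / 8 := by
        rw [h2]
        calc _ ≤ ∑ i, |c i * ∑ j, A i j * n j| := abs_sum_le_sum_abs _ _
          _ ≤ ∑ i : Fin 4, (1 / 32 : ℝ) := by
              refine sum_le_sum fun i _ => ?_
              rw [abs_mul]
              have h4 : |c i| ≤ 1 / (32 * R i) := (abs_lt.2 (hc i trivial)).le
              calc _ ≤ 1 / (32 * R i) * R i :=
                    mul_le_mul h4 (hB n hn i) (abs_nonneg _) (by have := hR i; positivity)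
                _ = _ := by have := (hR i).ne'; field_simp
          _ = 1 / 8 := by simp; norm_num
      rw [eC_re]
      set x := ∑ j, (n j : ℝ) * T c j
      have h5 : |2 * π * x| ≤ π / 4 := by
        rw [abs_mul, abs_of_pos (by positivity : (0 : ℝ) < 2 * π)]
        calc _ ≤ 2 * π * (1 / 8) := by gcongr
          _ = _ := by ring
      rw [← Real.cos_abs]
      have h6 := Real.cos_le_cos_of_nonneg_of_le_pi (abs_nonneg _) (by linarith [pi_pos]) h5
      refine le_trans ?_ h6
      rw [Real.cos_pi_div_four]
      have : (1 : ℝ) ≤ √2 := Real.le_sqrt_of_sq_le (by norm_num)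
      linarith
    have h2 : (B.card : ℝ) / 2 ≤ ‖∑ n ∈ B, eC (∑ j, (n j : ℝ) * T c j)‖ := by
      refine le_trans ?_ (Complex.re_le_norm _)
      rw [Complex.re_sum]
      calc (B.card : ℝ) / 2 = ∑ n ∈ B, (1 / 2 : ℝ) := by simp; ring
        _ ≤ _ := sum_le_sum h1
    calc (B.card : ℝ) ^ 2 / 4 = ((B.card : ℝ) / 2) ^ 2 := by ring
      _ ≤ _ := by gcongr
  have hup := setLIntegral_norm_sq_le S hSo.measurableSet B D (by
    rintro k _ ⟨c, hc, rfl⟩ _ ⟨c', hc', rfl⟩ hk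
    refine hD k (c - c') (fun i => ?_) fun j => ?_
    · have h4 : |c i| ≤ 1 / (32 * R i) := (abs_lt.2 (hc i trivial)).le
      have h5 : |c' i| ≤ 1 / (32 * R i) := (abs_lt.2 (hc' i trivial)).le
      have h6 : |(c - c') i| ≤ 1 / (16 * R i) := by
        calc _ ≤ |c i| + |c' i| := abs_sub _ _
          _ ≤ 1 / (32 * R i) + 1 / (32 * R i) := add_le_add h4 h5
          _ = _ := by have := (hR i).ne'; field_simp; norm_num
      calc _ ≤ 1 / (16 * R i) * R i := by gcongr; exact (hR i).le
        _ = _ := by have := (hR i).ne'; field_simp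
    · rw [hk, ← Pi.sub_apply, ← map_sub, hTapp])
  have h7 : ENNReal.ofReal ((B.card : ℝ) ^ 2 / 4 * (|A.det| * ∏ i, (1 / (16 * R i)))) ≤
      ENNReal.ofReal (D.card * B.card) := by
    calc _ = ENNReal.ofReal ((B.card : ℝ) ^ 2 / 4) * volume S := by
          rw [hSvol, ENNReal.ofReal_mul (by positivity)]
      _ = ∫⁻ _ in S, ENNReal.ofReal ((B.card : ℝ) ^ 2 / 4) := by
          rw [lintegral_const, Measure.restrict_apply_univ]
      _ ≤ _ := setLIntegral_mono' hSo.measurableSet fun y hy =>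
          ENNReal.ofReal_le_ofReal (hlow y hy)
      _ ≤ _ := hup
      _ = _ := by rw [ENNReal.ofReal_mul (by positivity)]; simp
  rw [ENNReal.ofReal_le_ofReal_iff (by positivity)] at h7
  have hprod : ∏ i, (1 / (16 * R i)) = 1 / (2 ^ 16 * ∏ i, R i) := by
    simp only [Fin.prod_univ_four]
    have := fun i => (hR i).ne'
    have h0 := this 0
    have h1 := this 1
    have h2 := this 2
    have h3 := this 3
    field_simp
    norm_num
  rw [hprod] at h7
  have hP : 0 < ∏ i, R i := prod_pos fun i _ => hR i
  set V := ∏ i, R i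
  rcases Nat.eq_zero_or_pos B.card with hb | hb
  · rw [hb]
    simp only [CharP.cast_eq_zero, zero_mul]
    positivity
  have hb' : (0 : ℝ) < B.card := by exact_mod_cast hb
  have h8 : (B.card : ℝ) ^ 2 / 4 * (|A.det| * (1 / (2 ^ 16 * V))) =
      B.card * |A.det| / (2 ^ 18 * V) * B.card := by
    field_simp
    norm_num
  rw [h8] at h7
  have h9 := le_of_mul_le_mul_right h7 hb'
  rw [div_le_iff₀ (by positivity)] at h9
  linarith

lemma rpow_mem_Icc_inv {K x : ℝ} (p : ℝ) (hK : 1 ≤ K) (hx : x ∈ Set.Icc K⁻¹ K) :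
    x ^ p ∈ Set.Icc (K ^ |p|)⁻¹ (K ^ |p|) := by
  have hK0 : 0 < K := by linarith
  have hx0 : 0 < x := (inv_pos.2 hK0).trans_le hx.1
  have key : ∀ y ∈ Set.Icc K⁻¹ K, ∀ q : ℝ, 0 ≤ q → y ^ q ∈ Set.Icc (K ^ q)⁻¹ (K ^ q) := by
    intro y hy q hq
    have hy0 : 0 < y := (inv_pos.2 hK0).trans_le hy.1
    refine ⟨?_, rpow_le_rpow hy0.le hy.2 hq⟩
    rw [← inv_rpow hK0.le]
    exact rpow_le_rpow (inv_pos.2 hK0).le hy.1 hq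
  rcases le_total 0 p with hp | hp
  · rw [abs_of_nonneg hp]
    exact key x hx p hp
  · rw [abs_of_nonpos hp]
    have h := key x hx (-p) (by linarith)
    have e : x ^ p = (x ^ (-p))⁻¹ := by rw [rpow_neg hx0.le, inv_inv]
    have h0 : 0 < x ^ (-p) := rpow_pos_of_pos hx0 _
    rw [e]
    refine ⟨inv_anti₀ h0 h.2, ?_⟩
    have := inv_anti₀ (by positivity) h.1
    rwa [inv_inv] at this

lemma exists_rpow_lipschitz (p : ℝ) {K : ℝ} (hK : 1 ≤ K) :
    ∃ C > 0, ∀ x ∈ Set.Icc K⁻¹ K, ∀ y ∈ Set.Icc K⁻¹ K, |y ^ p - x ^ p| ≤ C * |y - x| := by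
  have hK0 : 0 < K := by linarith
  refine ⟨|p| * K ^ |p - 1| + 1, by positivity, fun x hx y hy => ?_⟩
  have h := (convex_Icc K⁻¹ K).norm_image_sub_le_of_norm_hasDerivWithin_le (f := fun t => t ^ p)
    (f' := fun t => p * t ^ (p - 1)) (C := |p| * K ^ |p - 1| + 1) (fun t ht => ?_) (fun t ht => ?_)
    hx hy
  · simpa [Real.norm_eq_abs] using h
  · have ht0 : 0 < t := (inv_pos.2 hK0).trans_le ht.1
    exact (Real.hasDerivAt_rpow_const (Or.inl ht0.ne')).hasDerivWithinAt
  · have ht0 : 0 < t := (inv_pos.2 hK0).trans_le ht.1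
    rw [Real.norm_eq_abs, abs_mul, abs_of_pos (rpow_pos_of_pos ht0 _)]
    have := mul_le_mul_of_nonneg_left (rpow_mem_Icc_inv (p - 1) hK ht).2 (abs_nonneg p)
    linarith

lemma exists_rpow_taylor (p : ℝ) {K : ℝ} (hK : 1 ≤ K) :
    ∃ C > 0, ∀ x ∈ Set.Icc K⁻¹ K, ∀ y ∈ Set.Icc K⁻¹ K,
      |y ^ p - x ^ p - p * x ^ (p - 1) * (y - x)| ≤ C * (y - x) ^ 2 := by
  have hK0 : 0 < K := by linarith
  obtain ⟨C, hC, H⟩ := exists_rpow_lipschitz (p - 1) hK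
  refine ⟨|p| * C + 1, by positivity, fun x hx y hy => ?_⟩
  have hsub : Set.uIcc x y ⊆ Set.Icc K⁻¹ K := Set.uIcc_subset_Icc hx hy
  have h := (convex_uIcc x y).norm_image_sub_le_of_norm_hasDerivWithin_le
    (f := fun t => t ^ p - p * x ^ (p - 1) * t)
    (f' := fun t => p * t ^ (p - 1) - p * x ^ (p - 1) * 1) (C := (|p| * C + 1) * |y - x|)
    (fun t ht => ?_) (fun t ht => ?_) Set.left_mem_uIcc Set.right_mem_uIcc
  · rw [Real.norm_eq_abs, Real.norm_eq_abs] at h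
    rw [← sq_abs (y - x), sq, ← mul_assoc]
    refine le_trans (le_of_eq ?_) h
    congr 1
    ring
  · have ht0 : 0 < t := (inv_pos.2 hK0).trans_le (hsub ht).1
    exact ((Real.hasDerivAt_rpow_const (Or.inl ht0.ne')).sub
      ((hasDerivAt_id t).const_mul _)).hasDerivWithinAt
  · have h1 := H x hx t (hsub ht)
    have h2 : |t - x| ≤ |y - x| := Set.abs_sub_left_of_mem_uIcc ht
    rw [Real.norm_eq_abs, mul_one, ← mul_sub, abs_mul]
    calc |p| * |t ^ (p - 1) - x ^ (p - 1)| ≤ |p| * (C * |y - x|) := by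
          gcongr
          exact h1.trans (by gcongr)
      _ = |p| * C * |y - x| := by ring
      _ ≤ _ := by gcongr; linarith

lemma exists_rpow_inv_lipschitz {p : ℝ} (hp : p ≠ 0) {K : ℝ} (hK : 1 ≤ K) :
    ∃ C > 0, ∀ x ∈ Set.Icc K⁻¹ K, ∀ y ∈ Set.Icc K⁻¹ K, |y - x| ≤ C * |y ^ p - x ^ p| := by
  have hK0 : 0 < K := by linarith
  obtain ⟨C, hC, H⟩ := exists_rpow_lipschitz p⁻¹ (K := K ^ |p|) (one_le_rpow hK (abs_nonneg _))
  refine ⟨C, hC, fun x hx y hy => ?_⟩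
  have h := H _ (rpow_mem_Icc_inv p hK hx) _ (rpow_mem_Icc_inv p hK hy)
  rwa [rpow_rpow_inv ((inv_pos.2 hK0).le.trans hy.1) hp,
    rpow_rpow_inv ((inv_pos.2 hK0).le.trans hx.1) hp] at h

lemma Icc_inv_subset {K L : ℝ} (hK : 0 < K) (h : K ≤ L) :
    Set.Icc K⁻¹ K ⊆ Set.Icc L⁻¹ L :=
  Set.Icc_subset_Icc (inv_anti₀ hK h) h

lemma mem_Icc_inv_two_mul {K x h : ℝ} (hK : 1 ≤ K) (hx : x ∈ Set.Icc K⁻¹ K)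
    (hh : |h| ≤ (2 * K)⁻¹) : x + h ∈ Set.Icc (2 * K)⁻¹ (2 * K) := by
  have h1 := abs_le.1 hh
  have h2 : (2 * K)⁻¹ = K⁻¹ / 2 := by rw [mul_inv]; ring
  have h3 : K⁻¹ ≤ 1 := inv_le_one_of_one_le₀ hK
  rw [h2] at h1 ⊢
  exact ⟨by linarith [hx.1], by linarith [hx.2]⟩

/-- Linearisation of the four-term form at an approximate zero. -/
lemma exists_tangent_bound {p : ℝ} (hp : 1 < p) {Λ B : ℝ} (hΛ : 1 ≤ Λ) (hB : 0 < B) :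
    ∃ C > 0, ∃ K ≥ 1, ∃ ρ₀ > 0, ∀ x ∈ Set.Icc Λ⁻¹ Λ, ∀ y ∈ Set.Icc Λ⁻¹ Λ, ∀ z ∈ Set.Icc Λ⁻¹ Λ,
      ∀ s t ρ : ℝ, 0 < ρ → ρ ≤ ρ₀ → |x - s| ≤ ρ → |y - t| ≤ ρ →
      |x ^ p + y ^ p - 1 - z ^ p| ≤ B * ρ ^ 2 →
      s ∈ Set.Icc K⁻¹ K ∧ t ∈ Set.Icc K⁻¹ K ∧ ∃ w ∈ Set.Icc K⁻¹ K, s ^ p + t ^ p = 1 + w ^ p ∧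
        |s ^ (p - 1) * x + t ^ (p - 1) * y - 1 - w ^ (p - 1) * z| ≤ C * ρ ^ 2 := by
  have hΛ0 : 0 < Λ := by linarith
  have hp0 : 0 < p := by linarith
  obtain ⟨Cl, hCl, HL⟩ := exists_rpow_lipschitz p (K := 2 * Λ) (by linarith)
  have hΛp : 1 ≤ Λ ^ p := one_le_rpow hΛ hp0.le
  set K₃ : ℝ := (2 * Λ ^ p) ^ |p⁻¹| with hK₃
  have hK₃1 : 1 ≤ K₃ := one_le_rpow (by linarith) (abs_nonneg _)
  set K : ℝ := 2 * Λ * K₃ with hKdef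
  have hK1 : 2 * Λ ≤ K := le_mul_of_one_le_right (by linarith) hK₃1
  have hK2 : K₃ ≤ K := le_mul_of_one_le_left (by linarith) (by linarith)
  have hK : 1 ≤ K := by linarith
  obtain ⟨C', hC', HI⟩ := exists_rpow_inv_lipschitz hp0.ne' hK
  obtain ⟨CT, hCT, HT⟩ := exists_rpow_taylor p hK
  set G : ℝ := 2 * Cl + B with hG
  have hG0 : 0 < G := by positivity
  refine ⟨(2 * CT + CT * (C' * G) ^ 2 + B) / p, by positivity, K, hK,
    min ((2 * Λ)⁻¹) (min 1 ((Λ ^ p)⁻¹ / (2 * G))), by positivity,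
    fun x hx y hy z hz s t ρ hρ hρ₀ hxs hyt hF => ?_⟩
  have hρ1 : ρ ≤ (2 * Λ)⁻¹ := hρ₀.trans (min_le_left _ _)
  have hρ2 : ρ ≤ 1 := hρ₀.trans ((min_le_right _ _).trans (min_le_left _ _))
  have hρ3 : ρ ≤ (Λ ^ p)⁻¹ / (2 * G) := hρ₀.trans ((min_le_right _ _).trans (min_le_right _ _))
  have near : ∀ x ∈ Set.Icc Λ⁻¹ Λ, ∀ s, |x - s| ≤ ρ → s ∈ Set.Icc (2 * Λ)⁻¹ (2 * Λ) := by
    intro x hx s hs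
    have := mem_Icc_inv_two_mul hΛ hx (h := s - x) (by rw [abs_sub_comm]; exact hs.trans hρ1)
    rwa [add_sub_cancel] at this
  have sub1 := Icc_inv_subset (by linarith : 0 < 2 * Λ) hK1
  have sub0 := Icc_inv_subset hΛ0 (by linarith : Λ ≤ 2 * Λ)
  have hs := near x hx s hxs
  have ht := near y hy t hyt
  have hz' := sub1 (sub0 hz)
  have hx' := sub1 (sub0 hx)
  have hy' := sub1 (sub0 hy)
  have h1 := HL s hs x (sub0 hx)
  have h2 := HL t ht y (sub0 hy)
  have hW : |z ^ p - (s ^ p + t ^ p - 1)| ≤ G * ρ := by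
    have e : z ^ p - (s ^ p + t ^ p - 1) =
        (x ^ p - s ^ p) + (y ^ p - t ^ p) - (x ^ p + y ^ p - 1 - z ^ p) := by ring
    rw [e]
    calc _ ≤ |x ^ p - s ^ p| + |y ^ p - t ^ p| + |x ^ p + y ^ p - 1 - z ^ p| :=
          (abs_sub _ _).trans (by gcongr; exact abs_add_le _ _)
      _ ≤ Cl * ρ + Cl * ρ + B * ρ ^ 2 := by
          refine add_le_add (add_le_add (h1.trans (by gcongr)) (h2.trans (by gcongr))) hF
      _ ≤ Cl * ρ + Cl * ρ + B * ρ := by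
          have : ρ ^ 2 ≤ ρ := by rw [sq]; exact mul_le_of_le_one_left hρ.le hρ2
          gcongr
      _ = _ := by rw [hG]; ring
  set W := s ^ p + t ^ p - 1 with hWdef
  have hzp := rpow_mem_Icc_inv p hΛ hz
  rw [abs_of_pos hp0] at hzp
  have hGρ : G * ρ ≤ (Λ ^ p)⁻¹ / 2 := by
    calc _ ≤ G * ((Λ ^ p)⁻¹ / (2 * G)) := by gcongr
      _ = _ := by field_simp
  have hW2 : W ∈ Set.Icc (2 * Λ ^ p)⁻¹ (2 * Λ ^ p) := by
    have e : (2 * Λ ^ p)⁻¹ = (Λ ^ p)⁻¹ / 2 := by rw [mul_inv]; ring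
    have h3 : (Λ ^ p)⁻¹ ≤ 1 := inv_le_one_of_one_le₀ hΛp
    have h4 := abs_le.1 (hW.trans hGρ)
    rw [e]
    exact ⟨by linarith [hzp.1], by linarith [hzp.2]⟩
  have hW0 : 0 < W := (by positivity : (0 : ℝ) < (2 * Λ ^ p)⁻¹).trans_le hW2.1
  have hw := rpow_mem_Icc_inv p⁻¹ (by linarith) hW2
  have hw' := Icc_inv_subset (by linarith) hK2 hw
  have hwp : (W ^ p⁻¹) ^ p = W := rpow_inv_rpow hW0.le hp0.ne'
  set w := W ^ p⁻¹ with hwdef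
  refine ⟨sub1 hs, sub1 ht, w, hw', by rw [hwp, hWdef]; ring, ?_⟩
  have h3 := HI w hw' z hz'
  rw [hwp] at h3
  have h3' : |z - w| ≤ C' * G * ρ := by
    calc _ ≤ C' * (G * ρ) := h3.trans (by gcongr)
      _ = _ := by ring
  have t1 := HT s (sub1 hs) x hx'
  have t2 := HT t (sub1 ht) y hy'
  have t3 := HT w hw' z hz'
  have q1 : (x - s) ^ 2 ≤ ρ ^ 2 := sq_le_sq' (by linarith [(abs_le.1 hxs).1]) (abs_le.1 hxs).2
  have q2 : (y - t) ^ 2 ≤ ρ ^ 2 := sq_le_sq' (by linarith [(abs_le.1 hyt).1]) (abs_le.1 hyt).2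
  have q3 : (z - w) ^ 2 ≤ (C' * G * ρ) ^ 2 :=
    sq_le_sq' (by linarith [(abs_le.1 h3').1]) (abs_le.1 h3').2
  have pos : ∀ u ∈ Set.Icc K⁻¹ K, u ^ (p - 1) * u = u ^ p := by
    intro u hu
    have hu0 : 0 < u := (inv_pos.2 (by linarith)).trans_le hu.1
    rw [← rpow_add_one hu0.ne']; norm_num
  have es := pos s (sub1 hs)
  have et := pos t (sub1 ht)
  have ew := pos w hw'
  rw [hwp] at ew t3
  have key : p * (s ^ (p - 1) * x + t ^ (p - 1) * y - 1 - w ^ (p - 1) * z) =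
      (x ^ p + y ^ p - 1 - z ^ p) - (x ^ p - s ^ p - p * s ^ (p - 1) * (x - s))
      - (y ^ p - t ^ p - p * t ^ (p - 1) * (y - t))
      + (z ^ p - W - p * w ^ (p - 1) * (z - w)) := by
    have : s ^ p = W + 1 - t ^ p := by rw [hWdef]; ring
    linear_combination p * es + p * et - p * ew + (p - 1) * this
  rw [div_mul_eq_mul_div, le_div_iff₀ hp0]
  have habs : |s ^ (p - 1) * x + t ^ (p - 1) * y - 1 - w ^ (p - 1) * z| * p =
      |p * (s ^ (p - 1) * x + t ^ (p - 1) * y - 1 - w ^ (p - 1) * z)| := by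
    rw [abs_mul, abs_of_pos hp0, mul_comm]
  rw [habs, key]
  calc _ ≤ |x ^ p + y ^ p - 1 - z ^ p| + |x ^ p - s ^ p - p * s ^ (p - 1) * (x - s)|
      + |y ^ p - t ^ p - p * t ^ (p - 1) * (y - t)|
      + |z ^ p - W - p * w ^ (p - 1) * (z - w)| :=
        (abs_add_le _ _).trans (by
          gcongr
          exact (abs_sub _ _).trans (by gcongr; exact abs_sub _ _))
    _ ≤ B * ρ ^ 2 + CT * ρ ^ 2 + CT * ρ ^ 2 + CT * (C' * G * ρ) ^ 2 := by
        refine add_le_add (add_le_add (add_le_add hF (t1.trans ?_)) (t2.trans ?_)) (t3.trans ?_)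
        all_goals gcongr
    _ = _ := by ring

lemma exists_dual_bound (q : ℝ) {K : ℝ} (hK : 1 ≤ K) :
    ∃ C > 0, ∃ κ > 0, κ ≤ 1 ∧ κ ≤ (2 * K)⁻¹ ∧ ∀ a ∈ Set.Icc K⁻¹ K, ∀ b ∈ Set.Icc K⁻¹ K,
      ∀ g ∈ Set.Icc K⁻¹ K, a ^ q + b ^ q = 1 + g ^ q → ∀ u v z : ℝ,
      |u| ≤ κ → |v| ≤ κ → |z| ≤ κ →
      |a ^ (q - 1) * u + b ^ (q - 1) * v - z| ≤ 1 / 2 ∧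
      |(a + u) ^ q + (b + v) ^ q - (1 + (a ^ (q - 1) * u + b ^ (q - 1) * v - z)) ^ q - g ^ q| ≤
        C * (u ^ 2 + v ^ 2 + |z|) := by
  have hK0 : 0 < K := by linarith
  obtain ⟨CT, hCT, HT⟩ := exists_rpow_taylor q (K := 2 * K) (by linarith)
  set M : ℝ := K ^ |q - 1| with hM
  have hM1 : 1 ≤ M := one_le_rpow hK (abs_nonneg _)
  have hκ2 : (2 * K * (2 * M + 1))⁻¹ ≤ (2 * K)⁻¹ := by
    apply inv_anti₀ (by positivity)
    exact le_mul_of_one_le_right (by positivity) (by linarith)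
  have hK2 : (2 * K)⁻¹ ≤ 1 := inv_le_one_of_one_le₀ (by linarith)
  refine ⟨CT * (1 + 3 * M ^ 2) + 3 * CT + |q|, by positivity, (2 * K * (2 * M + 1))⁻¹,
    by positivity, hκ2.trans hK2, hκ2, fun a ha b hb g hg hab u v z hu hv hz => ?_⟩
  set κ := (2 * K * (2 * M + 1))⁻¹ with hκ
  have hκ0 : 0 < κ := by positivity
  have ha' := (rpow_mem_Icc_inv (q - 1) hK ha).2
  have hb' := (rpow_mem_Icc_inv (q - 1) hK hb).2
  have ha0 : 0 < a ^ (q - 1) := rpow_pos_of_pos ((inv_pos.2 hK0).trans_le ha.1) _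
  have hb0 : 0 < b ^ (q - 1) := rpow_pos_of_pos ((inv_pos.2 hK0).trans_le hb.1) _
  set s := a ^ (q - 1) with hs
  set t := b ^ (q - 1) with ht
  set h := s * u + t * v - z with hh
  have e1 : |s * u| ≤ M * |u| := by
    rw [abs_mul, abs_of_pos ha0]; gcongr
  have e2 : |t * v| ≤ M * |v| := by
    rw [abs_mul, abs_of_pos hb0]; gcongr
  have hh1 : |h| ≤ M * |u| + M * |v| + |z| :=
    (abs_sub _ _).trans (by gcongr; exact (abs_add_le _ _).trans (add_le_add e1 e2))
  have hh2 : |h| ≤ (2 * K)⁻¹ := by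
    calc _ ≤ M * κ + M * κ + κ := hh1.trans (by gcongr)
      _ = (2 * M + 1) * κ := by ring
      _ = _ := by rw [hκ]; field_simp
  have hh3 : |h| ≤ 1 / 2 := by
    refine hh2.trans ?_
    rw [← one_div]
    exact one_div_le_one_div_of_le (by norm_num) (by linarith)
  refine ⟨hh3, ?_⟩
  have sub := Icc_inv_subset hK0 (by linarith : K ≤ 2 * K)
  have h1mem : (1 : ℝ) ∈ Set.Icc K⁻¹ K := ⟨inv_le_one_of_one_le₀ hK, hK⟩
  have t1 := HT a (sub ha) (a + u) (mem_Icc_inv_two_mul hK ha (hu.trans hκ2))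
  have t2 := HT b (sub hb) (b + v) (mem_Icc_inv_two_mul hK hb (hv.trans hκ2))
  have t3 := HT 1 (sub h1mem) (1 + h) (mem_Icc_inv_two_mul hK h1mem hh2)
  rw [add_sub_cancel_left] at t1 t2 t3
  rw [one_rpow, one_rpow, mul_one] at t3
  rw [← hs] at t1
  rw [← ht] at t2
  have key : (a + u) ^ q + (b + v) ^ q - (1 + h) ^ q - g ^ q =
      ((a + u) ^ q - a ^ q - q * s * u) + ((b + v) ^ q - b ^ q - q * t * v)
      - ((1 + h) ^ q - 1 - q * h) + q * z := by
    rw [hh]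
    linear_combination hab
  have hz1 : z ^ 2 ≤ |z| := by
    rw [← sq_abs, sq]
    exact mul_le_of_le_one_left (abs_nonneg _) (hz.trans (hκ2.trans hK2))
  have hsq : h ^ 2 ≤ 3 * M ^ 2 * (u ^ 2 + v ^ 2) + 3 * |z| := by
    calc h ^ 2 = |h| ^ 2 := (sq_abs _).symm
      _ ≤ (M * |u| + M * |v| + |z|) ^ 2 := by gcongr
      _ ≤ 3 * ((M * |u|) ^ 2 + (M * |v|) ^ 2 + |z| ^ 2) := by
          linarith [sq_nonneg (M * |u| - M * |v|), sq_nonneg (M * |u| - |z|),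
            sq_nonneg (M * |v| - |z|)]
      _ = 3 * M ^ 2 * (u ^ 2 + v ^ 2) + 3 * z ^ 2 := by
          rw [mul_pow, mul_pow, sq_abs, sq_abs, sq_abs]; ring
      _ ≤ _ := by linarith
  rw [key]
  calc _ ≤ |(a + u) ^ q - a ^ q - q * s * u| + |(b + v) ^ q - b ^ q - q * t * v|
      + |(1 + h) ^ q - 1 - q * h| + |q * z| :=
        (abs_add_le _ _).trans (by
          gcongr
          exact (abs_sub _ _).trans (by gcongr; exact abs_add_le _ _))
    _ ≤ CT * u ^ 2 + CT * v ^ 2 + CT * h ^ 2 + |q| * |z| := by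
        rw [abs_mul]; gcongr
    _ ≤ CT * u ^ 2 + CT * v ^ 2 + CT * (3 * M ^ 2 * (u ^ 2 + v ^ 2) + 3 * |z|) + |q| * |z| := by
        gcongr
    _ ≤ _ := by
        have n1 : 0 ≤ (3 * CT + |q|) * (u ^ 2 + v ^ 2) := by positivity
        have n2 : 0 ≤ CT * (1 + 3 * M ^ 2) * |z| := by positivity
        linarith

/-- Quadruples of integers of size about `Y` which nearly solve
`n₀ ^ p + n₁ ^ p = n₂ ^ p + n₃ ^ p`. -/
noncomputable def quadSet (p Λ Y δ : ℝ) : Finset (Fin 4 → ℤ) :=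
  (Fintype.piFinset fun _ => Icc 1 ⌊Λ * Y⌋).filter fun n =>
    (∀ i, Y ≤ Λ * n i) ∧
      |(n 0 : ℝ) ^ p + (n 1 : ℝ) ^ p - (n 2 : ℝ) ^ p - (n 3 : ℝ) ^ p| ≤ δ * Y ^ (p - 1)

lemma mem_quadSet {p Λ Y δ : ℝ} {n : Fin 4 → ℤ} :
    n ∈ quadSet p Λ Y δ ↔ (∀ i, 1 ≤ n i ∧ (n i : ℝ) ≤ Λ * Y ∧ Y ≤ Λ * n i) ∧
      |(n 0 : ℝ) ^ p + (n 1 : ℝ) ^ p - (n 2 : ℝ) ^ p - (n 3 : ℝ) ^ p| ≤ δ * Y ^ (p - 1) := by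
  unfold quadSet
  simp only [mem_filter, Fintype.mem_piFinset, mem_Icc, Int.le_floor]
  constructor
  · rintro ⟨h1, h2, h3⟩
    exact ⟨fun i => ⟨(h1 i).1, (h1 i).2, h2 i⟩, h3⟩
  · rintro ⟨h1, h3⟩
    exact ⟨fun i => ⟨(h1 i).1, (h1 i).2.1⟩, fun i => (h1 i).2.2, h3⟩

lemma exists_dual_point_of_pos {p q : ℝ} (hpq : p.HolderConjugate q) {K : ℝ} (hK : 1 ≤ K) :
    ∃ M₀ ≥ 1, ∃ C > 0, ∃ K' ≥ 1, ∀ s ∈ Set.Icc K⁻¹ K, ∀ t ∈ Set.Icc K⁻¹ K, ∀ w ∈ Set.Icc K⁻¹ K,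
      s ^ p + t ^ p = 1 + w ^ p → ∀ M ≥ M₀, ∀ Y δ r : ℝ, 0 < δ → δ ≤ 1 → 1 ≤ r → r ≤ Y →
      r ^ 2 = δ * Y → ∀ c : Fin 4 → ℝ, |c 0| * (M * r) ≤ 1 / 16 → |c 1| * (M * r) ≤ 1 / 16 →
      |c 2| * (M * Y) ≤ 1 / 16 → |c 3| * (M * δ) ≤ 1 / 16 → 0 < c 3 →
      ∀ m : Fin 4 → ℤ, (m 0 : ℝ) = c 0 + c 3 * s ^ (p - 1) → (m 1 : ℝ) = c 1 + c 3 * t ^ (p - 1) →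
      (m 2 : ℝ) = s * c 0 + t * c 1 - c 2 + c 3 → (m 3 : ℝ) = c 3 * w ^ (p - 1) →
      ∃ h : ℕ, (2 : ℝ) ^ h ≤ K' / δ ∧ m ∈ quadSet q K' (2 ^ h) (C / (δ * 2 ^ h * Y)) ∧
        |s ^ (p - 1) * m 2 - m 0| ≤ C / r ∧ |t ^ (p - 1) * m 2 - m 1| ≤ C / r := by
  have hp1 : 0 < p - 1 := by linarith [hpq.lt]
  have hK0 : 0 < K := by linarith
  set L : ℝ := K ^ |p - 1| with hL
  have hL1 : 1 ≤ L := one_le_rpow hK (abs_nonneg _)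
  have hL0 : 0 < L := by linarith
  obtain ⟨CD, hCD, κ, hκ, hκ1, hκL, HD⟩ := exists_dual_bound q hL1
  set Z : ℝ := (2 * L) ^ |q - 2| with hZ
  have hZ0 : 0 < Z := by positivity
  refine ⟨max 1 (L / κ), le_max_left _ _, 3 * CD * Z * (2 * L) + (L * (2 * K + 1) + 1),
    by positivity, 4 * L ^ 2, by nlinarith, fun s hs t ht w hw hstw M hM Y δ r hδ hδ1 hr hrY hrδ c
    hc0 hc1 hc2 hc3 hpos m hm0 hm1 hm2 hm3 => ?_⟩
  have hM1 : 1 ≤ M := (le_max_left _ _).trans hM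
  have hM2 : L / κ ≤ M := (le_max_right _ _).trans hM
  have hY1 : 1 ≤ Y := hr.trans hrY
  have hY0 : 0 < Y := by linarith
  have hr0 : 0 < r := by linarith
  have mem : ∀ x ∈ Set.Icc K⁻¹ K, x ^ (p - 1) ∈ Set.Icc L⁻¹ L ∧ (x ^ (p - 1)) ^ q = x ^ p ∧
      (x ^ (p - 1)) ^ (q - 1) = x := by
    intro x hx
    have hx0 : 0 ≤ x := (inv_pos.2 hK0).le.trans hx.1
    refine ⟨rpow_mem_Icc_inv _ hK hx, ?_, ?_⟩
    · rw [← rpow_mul hx0, hpq.sub_one_mul_conj]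
    · rw [← rpow_mul hx0]
      have : (p - 1) * (q - 1) = 1 := by
        have := hpq.sub_one_mul_conj
        have h2 := hpq.mul_eq_add
        linarith
      rw [this, rpow_one]
  obtain ⟨ha, haq, has⟩ := mem s hs
  obtain ⟨hb, hbq, hbt⟩ := mem t ht
  obtain ⟨hg, hgq, -⟩ := mem w hw
  set a := s ^ (p - 1)
  set b := t ^ (p - 1)
  set g := w ^ (p - 1)
  set T := c 3 with hT
  rw [abs_of_pos hpos] at hc3
  have hTδ : T * δ ≤ 1 := by
    have : T * δ * 1 ≤ T * δ * M := mul_le_mul_of_nonneg_left hM1 (by positivity)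
    linarith
  have hg0 : 0 < g := (inv_pos.2 hL0).trans_le hg.1
  have hm3pos : 1 ≤ m 3 := by
    have : (0 : ℝ) < m 3 := by rw [hm3]; positivity
    exact_mod_cast this
  have hm3r : (1 : ℝ) ≤ m 3 := by exact_mod_cast hm3pos
  have hTL : 1 ≤ T * L := by
    calc (1 : ℝ) ≤ T * g := by rw [← hm3]; exact hm3r
      _ ≤ _ := mul_le_mul_of_nonneg_left hg.2 hpos.le
  have small : ∀ (x R : ℝ), 1 ≤ R → |x| * (M * R) ≤ 1 / 16 →
      |x / T| ≤ κ ∧ |x / T| ≤ 1 / (R * T) := by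
    intro x R hR hx
    have hR0 : 0 < R := by linarith
    have hxR : |x| * R ≤ 1 := by
      have : |x| * R * 1 ≤ |x| * R * M := mul_le_mul_of_nonneg_left hM1 (by positivity)
      linarith
    rw [abs_div, abs_of_pos hpos]
    refine ⟨?_, ?_⟩
    · rw [div_le_iff₀ hpos]
      have h1 : |x| * (L / κ) ≤ 1 := by
        calc |x| * (L / κ) ≤ |x| * M := by gcongr
          _ ≤ |x| * (M * R) := by gcongr; exact le_mul_of_one_le_right (by linarith) hR
          _ ≤ 1 := by linarith
      have h2 : |x| * L ≤ κ := by
        rwa [← mul_div_assoc, div_le_one hκ] at h1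
      have h3 : |x| * L ≤ κ * T * L := by
        calc |x| * L ≤ κ * 1 := by linarith
          _ ≤ κ * (T * L) := by gcongr
          _ = _ := by ring
      exact le_of_mul_le_mul_right h3 hL0
    · rw [div_le_div_iff₀ hpos (by positivity)]
      calc |x| * (R * T) = |x| * R * T := by ring
        _ ≤ 1 * T := by gcongr
  obtain ⟨hu1, hu2⟩ := small (c 0) r hr hc0
  obtain ⟨hv1, hv2⟩ := small (c 1) r hr hc1
  obtain ⟨hz1, hz2⟩ := small (c 2) Y hY1 hc2
  set u := c 0 / T with hu
  set v := c 1 / T with hv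
  set z := c 2 / T with hz
  have ec0 : c 0 = T * u := by rw [hu]; field_simp
  have ec1 : c 1 = T * v := by rw [hv]; field_simp
  have ec2 : c 2 = T * z := by rw [hz]; field_simp
  obtain ⟨hh, hF⟩ := HD a ha b hb g hg (by rw [haq, hbq, hgq, hstw]) u v z hu1 hv1 hz1
  rw [has, hbt] at hh hF
  have em0 : (m 0 : ℝ) = T * (a + u) := by rw [hm0, ec0]; ring
  have em1 : (m 1 : ℝ) = T * (b + v) := by rw [hm1, ec1]; ring
  have em2 : (m 2 : ℝ) = T * (1 + (s * u + t * v - z)) := by rw [hm2, ec0, ec1, ec2]; ring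
  have b0 := mem_Icc_inv_two_mul hL1 ha (hu1.trans hκL)
  have b1 := mem_Icc_inv_two_mul hL1 hb (hv1.trans hκL)
  have b2 : 1 + (s * u + t * v - z) ∈ Set.Icc (2 * L)⁻¹ (2 * L) := by
    have h1 := abs_le.1 hh
    have h2 : (2 * L)⁻¹ ≤ 1 / 2 := by
      rw [← one_div]; exact one_div_le_one_div_of_le (by norm_num) (by linarith)
    exact ⟨by linarith, by linarith⟩
  have b3 := Icc_inv_subset hL0 (by linarith : L ≤ 2 * L) hg
  have h2L : 0 < (2 * L)⁻¹ := by positivity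
  obtain ⟨h, hlo, hhi⟩ : ∃ h : ℕ, (2 : ℝ) ^ h ≤ m 3 ∧ (m 3 : ℝ) ≤ 2 * 2 ^ h := by
    have hn0 : (m 3).toNat ≠ 0 := by omega
    have e : ((m 3).toNat : ℝ) = m 3 := by
      have : ((m 3).toNat : ℤ) = m 3 := Int.toNat_of_nonneg (by omega)
      exact_mod_cast this
    refine ⟨Nat.log 2 (m 3).toNat, ?_, ?_⟩
    · rw [← e]; exact_mod_cast Nat.pow_log_le_self 2 hn0
    · rw [← e]
      have := (Nat.lt_pow_succ_log_self (b := 2) (by norm_num) (m 3).toNat).le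
      rw [pow_succ, mul_comm] at this
      exact_mod_cast this
  set H : ℝ := 2 ^ h with hH
  have hH0 : 0 < H := by positivity
  have hT1 : T ≤ 2 * L * H := by
    have h1 : T * L⁻¹ ≤ m 3 := by rw [hm3]; exact mul_le_mul_of_nonneg_left hg.1 hpos.le
    rw [← div_eq_mul_inv, div_le_iff₀ hL0] at h1
    calc T ≤ m 3 * L := h1
      _ ≤ 2 * H * L := by gcongr
      _ = _ := by ring
  have hT2 : H ≤ T * L := hlo.trans (by rw [hm3]; exact mul_le_mul_of_nonneg_left hg.2 hpos.le)
  have hsize : ∀ x ∈ Set.Icc (2 * L)⁻¹ (2 * L), 0 < T * x ∧ T * x ≤ 4 * L ^ 2 * H ∧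
      H ≤ 4 * L ^ 2 * (T * x) := by
    intro x hx
    have hx0 : 0 < x := h2L.trans_le hx.1
    refine ⟨by positivity, ?_, ?_⟩
    · calc T * x ≤ 2 * L * H * (2 * L) := mul_le_mul hT1 hx.2 hx0.le (by positivity)
        _ = _ := by ring
    · calc H ≤ T * L := hT2
        _ = 2 * L ^ 2 * (T * (2 * L)⁻¹) := by field_simp
        _ ≤ 2 * L ^ 2 * (T * x) := by gcongr; exact hx.1
        _ ≤ _ := by
          have : 0 ≤ L ^ 2 * (T * x) := by positivity
          linarith
  have hx : ∀ i, ∃ x ∈ Set.Icc (2 * L)⁻¹ (2 * L), (m i : ℝ) = T * x := by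
    intro i
    fin_cases i
    · exact ⟨_, b0, em0⟩
    · exact ⟨_, b1, em1⟩
    · exact ⟨_, b2, em2⟩
    · exact ⟨_, b3, hm3⟩
  have hrT : 0 < r * T := by positivity
  refine ⟨h, ?_, mem_quadSet.2 ⟨fun i => ?_, ?_⟩, ?_⟩
  · have hL4 : L ≤ 4 * L ^ 2 := by
      have : L * 1 ≤ L * L := by gcongr
      rw [sq]; linarith
    calc H ≤ T * L := hT2
      _ ≤ (1 / δ) * (4 * L ^ 2) := by
          gcongr
          rw [le_div_iff₀ hδ]; exact hTδ
      _ = _ := by ring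
  · obtain ⟨x, hx1, hx2⟩ := hx i
    obtain ⟨h1, h2, h3⟩ := hsize x hx1
    rw [← hx2] at h1 h2 h3
    exact ⟨by exact_mod_cast h1, h2, h3⟩
  · have x0 : 0 ≤ a + u := h2L.le.trans b0.1
    have x1 : 0 ≤ b + v := h2L.le.trans b1.1
    have x2 : 0 ≤ 1 + (s * u + t * v - z) := h2L.le.trans b2.1
    have e : (m 0 : ℝ) ^ q + (m 1 : ℝ) ^ q - (m 2 : ℝ) ^ q - (m 3 : ℝ) ^ q =
        T ^ q * ((a + u) ^ q + (b + v) ^ q - (1 + (s * u + t * v - z)) ^ q - g ^ q) := by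
      rw [em0, em1, em2, hm3, mul_rpow hpos.le x0, mul_rpow hpos.le x1, mul_rpow hpos.le x2,
        mul_rpow hpos.le hg0.le]
      ring
    have hTq : 0 < T ^ q := rpow_pos_of_pos hpos _
    rw [e, abs_mul, abs_of_pos hTq]
    have hD : 0 < δ * Y * T ^ 2 := by positivity
    have hsq : ∀ x : ℝ, |x| ≤ 1 / (r * T) → x ^ 2 ≤ 1 / (δ * Y * T ^ 2) := by
      intro x hx
      calc x ^ 2 = |x| ^ 2 := (sq_abs x).symm
        _ ≤ (1 / (r * T)) ^ 2 := by gcongr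
        _ = _ := by rw [div_pow, mul_pow, hrδ]; norm_num
    have hz3 : |z| ≤ 1 / (δ * Y * T ^ 2) := by
      refine hz2.trans (one_div_le_one_div_of_le hD ?_)
      calc δ * Y * T ^ 2 = Y * T * (T * δ) := by ring
        _ ≤ Y * T * 1 := by gcongr
        _ = _ := by ring
    have hTH : T ^ (q - 2) ≤ Z * H ^ (q - 2) := by
      have h1 : T / H ∈ Set.Icc (2 * L)⁻¹ (2 * L) := by
        refine ⟨?_, ?_⟩
        · rw [le_div_iff₀ hH0, inv_mul_le_iff₀ (by positivity)]
          linarith [mul_pos hpos hL0]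
        · rw [div_le_iff₀ hH0]; exact hT1
      have h2 := (rpow_mem_Icc_inv (q - 2) (by linarith) h1).2
      rwa [div_rpow hpos.le hH0.le, div_le_iff₀ (rpow_pos_of_pos hH0 _)] at h2
    have eT : T ^ q = T ^ (q - 2) * T ^ 2 := by
      rw [← rpow_natCast T 2, ← rpow_add hpos]; norm_num
    have eH : H ^ (q - 1) = H ^ (q - 2) * H := by
      rw [← rpow_add_one hH0.ne']; ring_nf
    calc _ ≤ T ^ q * (CD * (u ^ 2 + v ^ 2 + |z|)) := by gcongr
      _ ≤ T ^ q * (CD * (1 / (δ * Y * T ^ 2) + 1 / (δ * Y * T ^ 2) + 1 / (δ * Y * T ^ 2))) := by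
          have := hsq u hu2
          have := hsq v hv2
          gcongr
      _ = 3 * CD * T ^ (q - 2) / (δ * Y) := by rw [eT]; field_simp; ring
      _ ≤ 3 * CD * (Z * H ^ (q - 2)) / (δ * Y) := by gcongr
      _ = 3 * CD * Z / (δ * H * Y) * H ^ (q - 1) := by rw [eH]; field_simp
      _ ≤ _ := by
          have : 3 * CD * Z * 1 ≤ 3 * CD * Z * (2 * L) := by gcongr; linarith
          have h5 : 0 ≤ L * (2 * K + 1) + 1 := by positivity
          gcongr
          linarith
  · have hs0 : 0 < s := (inv_pos.2 hK0).trans_le hs.1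
    have ht0 : 0 < t := (inv_pos.2 hK0).trans_le ht.1
    have hz3 : |z| ≤ 1 / (r * T) := hz2.trans (by gcongr)
    have hh' : |s * u + t * v - z| ≤ (2 * K + 1) * (1 / (r * T)) := by
      calc _ ≤ |s * u| + |t * v| + |z| := (abs_sub _ _).trans (by gcongr; exact abs_add_le _ _)
        _ ≤ K * (1 / (r * T)) + K * (1 / (r * T)) + 1 / (r * T) := by
            rw [abs_mul, abs_mul, abs_of_pos hs0, abs_of_pos ht0]
            gcongr
            · exact hs.2
            · exact ht.2
        _ = _ := by ring
    have cell : ∀ x ∈ Set.Icc L⁻¹ L, ∀ y, |y| ≤ 1 / (r * T) →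
        |x * (T * (1 + (s * u + t * v - z))) - T * (x + y)| ≤
          (3 * CD * Z * (2 * L) + (L * (2 * K + 1) + 1)) / r := by
      intro x hx y hy
      have hx0 : 0 < x := (inv_pos.2 hL0).trans_le hx.1
      have e : x * (T * (1 + (s * u + t * v - z))) - T * (x + y) =
        T * (x * (s * u + t * v - z) - y) := by ring
      rw [e, abs_mul, abs_of_pos hpos]
      calc _ ≤ T * (L * ((2 * K + 1) * (1 / (r * T))) + 1 / (r * T)) := by
            gcongr
            refine (abs_sub _ _).trans ?_
            rw [abs_mul, abs_of_pos hx0]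
            gcongr
            exact hx.2
        _ = (L * (2 * K + 1) + 1) / r := by field_simp
        _ ≤ _ := by
          have : 0 ≤ 3 * CD * Z * (2 * L) := by positivity
          refine div_le_div_of_nonneg_right ?_ hr0.le
          linarith
    rw [em2, em0, em1]
    exact ⟨cell a ha u hu2, cell b hb v hv2⟩

/-- Integer points of the dual box are `0` or come from near solutions with the dual exponent. -/
lemma exists_dual_point {p q : ℝ} (hpq : p.HolderConjugate q) {K : ℝ} (hK : 1 ≤ K) :
    ∃ M₀ ≥ 1, ∃ C > 0, ∃ K' ≥ 1, ∀ s ∈ Set.Icc K⁻¹ K, ∀ t ∈ Set.Icc K⁻¹ K, ∀ w ∈ Set.Icc K⁻¹ K,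
      s ^ p + t ^ p = 1 + w ^ p → ∀ M ≥ M₀, ∀ Y δ r : ℝ, 0 < δ → δ ≤ 1 → 1 ≤ r → r ≤ Y →
      r ^ 2 = δ * Y → ∀ c : Fin 4 → ℝ, |c 0| * (M * r) ≤ 1 / 16 → |c 1| * (M * r) ≤ 1 / 16 →
      |c 2| * (M * Y) ≤ 1 / 16 → |c 3| * (M * δ) ≤ 1 / 16 →
      ∀ k : Fin 4 → ℤ, (k 0 : ℝ) = c 0 + c 3 * s ^ (p - 1) → (k 1 : ℝ) = c 1 + c 3 * t ^ (p - 1) →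
      (k 2 : ℝ) = -s * c 0 - t * c 1 + c 2 - c 3 → (k 3 : ℝ) = -(c 3 * w ^ (p - 1)) →
      k = 0 ∨ ∃ m : Fin 4 → ℤ,
        (k = ![m 0, m 1, -m 2, -m 3] ∨ k = -![m 0, m 1, -m 2, -m 3]) ∧
        ∃ h : ℕ, (2 : ℝ) ^ h ≤ K' / δ ∧ m ∈ quadSet q K' (2 ^ h) (C / (δ * 2 ^ h * Y)) ∧
        |s ^ (p - 1) * m 2 - m 0| ≤ C / r ∧ |t ^ (p - 1) * m 2 - m 1| ≤ C / r := by
  obtain ⟨M₀, hM₀, C, hC, K', hK', H⟩ := exists_dual_point_of_pos hpq hK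
  have hK0 : 0 < K := by linarith
  refine ⟨max M₀ K, hM₀.le.trans (le_max_left _ _), C, hC, K', hK', fun s hs t ht w hw hstw M hM Y δ r hδ hδ1
    hr hrY hrδ c hc0 hc1 hc2 hc3 k hk0 hk1 hk2 hk3 => ?_⟩
  have hM1 : M₀ ≤ M := (le_max_left _ _).trans hM
  have hMK : K ≤ M := (le_max_right _ _).trans hM
  have hs0 : 0 < s := (inv_pos.2 hK0).trans_le hs.1
  have ht0 : 0 < t := (inv_pos.2 hK0).trans_le ht.1
  rcases lt_trichotomy (c 3) 0 with h | h | h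
  · right
    obtain ⟨h, hm⟩ := H s hs t ht w hw hstw M hM1 Y δ r hδ hδ1 hr hrY hrδ (-c)
      (by simpa using hc0) (by simpa using hc1) (by simpa using hc2) (by simpa using hc3)
      (by simpa using h) ![-k 0, -k 1, k 2, k 3]
      (by simp [hk0]; ring) (by simp [hk1]; ring) (by simp [hk2]; ring) (by simp [hk3])
    refine ⟨_, Or.inr ?_, h, hm⟩
    funext i
    fin_cases i <;> simp
  · left
    have hr0 : 0 < r := by linarith
    have hY0 : 0 < Y := by linarith
    rw [h, zero_mul] at hk0 hk1 hk3
    have hMr : K ≤ M * r := hMK.trans (le_mul_of_one_le_right (by linarith) hr)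
    have hMY : 1 ≤ M * Y := by
      calc (1 : ℝ) ≤ M * 1 := by linarith
        _ ≤ _ := by gcongr; exacts [by linarith, hr.trans hrY]
    have b0 : |c 0| * K ≤ 1 / 16 := (mul_le_mul_of_nonneg_left hMr (abs_nonneg _)).trans hc0
    have b1 : |c 1| * K ≤ 1 / 16 := (mul_le_mul_of_nonneg_left hMr (abs_nonneg _)).trans hc1
    have b2 : |c 2| ≤ 1 / 16 :=
      (le_mul_of_one_le_right (abs_nonneg _) hMY).trans hc2
    have zero : ∀ n : ℤ, |(n : ℝ)| < 1 → n = 0 := by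
      intro n hn
      have : |n| < 1 := by exact_mod_cast hn
      exact Int.abs_lt_one_iff.1 this
    have z0 : k 0 = 0 := zero _ (by
      rw [hk0, add_zero]
      have := le_mul_of_one_le_right (abs_nonneg (c 0)) hK
      linarith)
    have z1 : k 1 = 0 := zero _ (by
      rw [hk1, add_zero]
      have := le_mul_of_one_le_right (abs_nonneg (c 1)) hK
      linarith)
    have z3 : k 3 = 0 := zero _ (by rw [hk3]; simp)
    have z2 : k 2 = 0 := zero _ (by
      rw [hk2, h, sub_zero]
      have e1 : |-s * c 0| ≤ 1 / 16 := by
        rw [abs_mul, abs_neg, abs_of_pos hs0, mul_comm]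
        exact (mul_le_mul_of_nonneg_left hs.2 (abs_nonneg _)).trans b0
      have e2 : |t * c 1| ≤ 1 / 16 := by
        rw [abs_mul, abs_of_pos ht0, mul_comm]
        exact (mul_le_mul_of_nonneg_left ht.2 (abs_nonneg _)).trans b1
      calc |-s * c 0 - t * c 1 + c 2| ≤ |-s * c 0| + |t * c 1| + |c 2| :=
            (abs_add_le _ _).trans (by gcongr; exact abs_sub _ _)
        _ < 1 := by linarith)
    funext i
    fin_cases i <;> simp [z0, z1, z2, z3]
  · right
    obtain ⟨h, hm⟩ := H s hs t ht w hw hstw M hM1 Y δ r hδ hδ1 hr hrY hrδ c hc0 hc1 hc2 hc3 h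
      ![k 0, k 1, -k 2, -k 3]
      (by simp [hk0]) (by simp [hk1]) (by simp [hk2]; ring) (by simp [hk3])
    refine ⟨_, Or.inl ?_, h, hm⟩
    funext i
    fin_cases i <;> simp

lemma card_le_of_abs_sub_le (S : Finset ℕ) {D : ℝ} (hD : 0 ≤ D)
    (h : ∀ i ∈ S, ∀ j ∈ S, |(i : ℝ) - j| ≤ D) : (S.card : ℝ) ≤ D + 1 := by
  rcases S.eq_empty_or_nonempty with rfl | hne
  · simp; linarith
  · have hsub : S ⊆ Icc (S.min' hne) (S.min' hne + ⌊D⌋₊) := by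
      intro i hi
      have h1 := S.min'_le i hi
      refine mem_Icc.2 ⟨h1, ?_⟩
      have h2 := (abs_le.1 (h i hi _ (S.min'_mem hne))).2
      have h3 : ((i - S.min' hne : ℕ) : ℝ) ≤ D := by rw [Nat.cast_sub h1]; exact h2
      have h4 := Nat.le_floor h3
      omega
    have h1 := card_le_card hsub
    rw [Nat.card_Icc] at h1
    have h2 : S.card ≤ ⌊D⌋₊ + 1 := by omega
    calc (S.card : ℝ) ≤ (⌊D⌋₊ : ℝ) + 1 := by exact_mod_cast h2
      _ ≤ _ := by gcongr; exact Nat.floor_le hD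

lemma exists_card_cells_le {p : ℝ} (hp : 1 < p) {K C K' : ℝ} (hK : 1 ≤ K) (hC : 0 < C)
    (hK' : 1 ≤ K') :
    ∃ G > 0, ∀ (I : Finset ℕ) (ρ r δ H a b : ℝ), 0 < ρ → 0 < r → 0 < δ → r * ρ = δ → 0 < H →
      H ≤ K' / δ → H ≤ K' * b → (∀ i ∈ I, (i : ℝ) * ρ ∈ Set.Icc K⁻¹ K) →
      ((I.filter fun i : ℕ => |((i : ℝ) * ρ) ^ (p - 1) * b - a| ≤ C / r).card : ℝ) ≤
        G / (δ * H) := by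
  obtain ⟨Ci, hCi, HI⟩ := exists_rpow_inv_lipschitz (p := p - 1) (by linarith) hK
  refine ⟨Ci * (2 * C * K') + K', by positivity,
    fun I ρ r δ H a b hρ hr hδ hrρ hH hHδ hHb hI => ?_⟩
  have hb : 0 < b := by
    by_contra hb
    have : K' * b ≤ 0 := mul_nonpos_of_nonneg_of_nonpos (by linarith) (not_lt.1 hb)
    linarith
  have h1 := card_le_of_abs_sub_le (I.filter fun i : ℕ => |((i : ℝ) * ρ) ^ (p - 1) * b - a| ≤ C / r)
    (D := Ci * (2 * C * K') / (δ * H)) (by positivity) (by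
      intro i hi j hj
      rw [mem_filter] at hi hj
      have h2 := HI _ (hI j hj.1) _ (hI i hi.1)
      rw [← sub_mul, abs_mul, abs_of_pos hρ] at h2
      have h3 : |((i : ℝ) * ρ) ^ (p - 1) - ((j : ℝ) * ρ) ^ (p - 1)| * b ≤ 2 * C / r := by
        calc _ = |(((i : ℝ) * ρ) ^ (p - 1) * b - a) - (((j : ℝ) * ρ) ^ (p - 1) * b - a)| := by
              rw [sub_sub_sub_cancel_right, ← sub_mul, abs_mul, abs_of_pos hb]
          _ ≤ C / r + C / r := (abs_sub _ _).trans (add_le_add hi.2 hj.2)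
          _ = _ := by ring
      have h4 : |((i : ℝ) * ρ) ^ (p - 1) - ((j : ℝ) * ρ) ^ (p - 1)| ≤ 2 * C * K' / (r * H) := by
        rw [← le_div_iff₀ hb] at h3
        refine h3.trans ?_
        rw [div_div, div_le_div_iff₀ (by positivity) (by positivity)]
        calc 2 * C * (r * H) ≤ 2 * C * (r * (K' * b)) := by gcongr
          _ = _ := by ring
      have h5 : |(i : ℝ) - j| * ρ ≤ Ci * (2 * C * K' / (r * H)) := h2.trans (by gcongr)
      rw [← le_div_iff₀ hρ] at h5
      refine h5.trans (le_of_eq ?_)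
      rw [← hrρ]
      field_simp)
  refine h1.trans ?_
  rw [add_div]
  gcongr
  rw [le_div_iff₀ (by positivity)]
  rw [le_div_iff₀ hδ] at hHδ
  linarith

/-- The matrix of the box attached to a cell. -/
noncomputable def cellMatrix (p s t w : ℝ) : Matrix (Fin 4) (Fin 4) ℝ :=
  !![1, 0, -s, 0; 0, 1, -t, 0; 0, 0, 1, 0; s ^ (p - 1), t ^ (p - 1), -1, -w ^ (p - 1)]

lemma det_cellMatrix (p s t w : ℝ) : (cellMatrix p s t w).det = -w ^ (p - 1) := by
  unfold cellMatrix
  simp [Matrix.det_succ_row_zero, Fin.sum_univ_succ, Fin.succAbove]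

lemma sum_cellMatrix_mul (p s t w : ℝ) (x : Fin 4 → ℝ) :
    (fun i => ∑ j, cellMatrix p s t w i j * x j) = ![x 0 - s * x 2, x 1 - t * x 2, x 2,
      s ^ (p - 1) * x 0 + t ^ (p - 1) * x 1 - x 2 - w ^ (p - 1) * x 3] := by
  funext i
  unfold cellMatrix
  fin_cases i <;> simp [Fin.sum_univ_four] <;> ring

lemma sum_mul_cellMatrix (p s t w : ℝ) (c : Fin 4 → ℝ) :
    (fun j => ∑ i, c i * cellMatrix p s t w i j) = ![c 0 + c 3 * s ^ (p - 1),
      c 1 + c 3 * t ^ (p - 1), -s * c 0 - t * c 1 + c 2 - c 3, -(c 3 * w ^ (p - 1))] := by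
  funext i
  unfold cellMatrix
  fin_cases i <;> simp [Fin.sum_univ_four]
  ring

/-- Points of `quadSet` in one cell, bounded through the dual points. -/
lemma exists_card_cell_le {p q : ℝ} (hpq : p.HolderConjugate q) {Λ : ℝ} (hΛ : 1 ≤ Λ) :
    ∃ K ≥ 1, ∃ G > 0, ∃ C > 0, ∃ K' ≥ 1, ∃ ρ₀ > 0, ∀ Y δ r ρ : ℝ, 0 < δ → δ ≤ 1 → 1 ≤ r → r ≤ Y →
      r ^ 2 = δ * Y → ρ = r / Y → ρ ≤ ρ₀ → ∀ i j : ℕ,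
      ∀ B : Finset (Fin 4 → ℤ), (∀ n ∈ B, n ∈ quadSet p Λ Y δ ∧
        ⌊(n 0 : ℝ) / n 2 / ρ⌋₊ = i ∧ ⌊(n 1 : ℝ) / n 2 / ρ⌋₊ = j) → B.Nonempty →
      (i : ℝ) * ρ ∈ Set.Icc K⁻¹ K ∧ (j : ℝ) * ρ ∈ Set.Icc K⁻¹ K ∧
      (B.card : ℝ) ≤ G * (δ * Y) ^ 2 * (1 + ∑ h ∈ range (Nat.log 2 ⌊K' / δ⌋₊ + 1),
        (((quadSet q K' (2 ^ h) (C / (δ * 2 ^ h * Y))).filter fun m =>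
          |((i : ℝ) * ρ) ^ (p - 1) * m 2 - m 0| ≤ C / r ∧
          |((j : ℝ) * ρ) ^ (p - 1) * m 2 - m 1| ≤ C / r).card : ℝ)) := by
  have hΛ0 : 0 < Λ := by linarith
  obtain ⟨CB, hCB, K, hK, ρ₀, hρ₀, HB⟩ := exists_tangent_bound hpq.lt (Λ := Λ ^ 2) (B := Λ ^ p)
    (one_le_pow₀ hΛ) (by positivity)
  obtain ⟨M₀, hM₀, C, hC, K', hK', HD⟩ := exists_dual_point hpq hK
  have hK0 : 0 < K := by linarith
  set M : ℝ := max M₀ (max Λ (Λ * CB)) with hM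
  have hMM : M₀ ≤ M := le_max_left _ _
  have hMΛ : Λ ≤ M := (le_max_left _ _).trans (le_max_right _ _)
  have hMC : Λ * CB ≤ M := (le_max_right _ _).trans (le_max_right _ _)
  have hM0 : 0 < M := by linarith
  set L : ℝ := K ^ |p - 1| with hL
  have hL0 : 0 < L := by positivity
  refine ⟨K, hK, 2 ^ 18 * M ^ 4 * L * 2, by positivity, C, hC, K', hK', ρ₀, hρ₀,
    fun Y δ r ρ hδ hδ1 hr hrY hrδ hρ hρρ i j B hB hne => ?_⟩
  have hr0 : 0 < r := by linarith
  have hY0 : 0 < Y := by linarith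
  have hρ0 : 0 < ρ := by rw [hρ]; positivity
  have hρ2 : ρ ^ 2 = δ / Y := by rw [hρ, div_pow, hrδ]; field_simp
  have hρY : ρ * Y = r := by rw [hρ]; field_simp
  have near : ∀ x : ℝ, 0 ≤ x → |x - (⌊x / ρ⌋₊ : ℝ) * ρ| ≤ ρ := by
    intro x hx
    have h1 := Nat.floor_le (div_nonneg hx hρ0.le)
    have h2 := (Nat.lt_floor_add_one (x / ρ)).le
    rw [le_div_iff₀ hρ0] at h1
    rw [div_le_iff₀ hρ0] at h2
    rw [abs_le]
    constructor <;> linarith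
  have hn : ∀ n ∈ B, 0 < (n 2 : ℝ) ∧ (n 2 : ℝ) ≤ Λ * Y ∧
      |(n 0 : ℝ) / n 2 - i * ρ| ≤ ρ ∧ |(n 1 : ℝ) / n 2 - j * ρ| ≤ ρ ∧
      (i : ℝ) * ρ ∈ Set.Icc K⁻¹ K ∧ (j : ℝ) * ρ ∈ Set.Icc K⁻¹ K ∧ ∃ w ∈ Set.Icc K⁻¹ K,
      ((i : ℝ) * ρ) ^ p + ((j : ℝ) * ρ) ^ p = 1 + w ^ p ∧
      |((i : ℝ) * ρ) ^ (p - 1) * ((n 0 : ℝ) / n 2) + ((j : ℝ) * ρ) ^ (p - 1) * ((n 1 : ℝ) / n 2) - 1 -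
        w ^ (p - 1) * ((n 3 : ℝ) / n 2)| ≤ CB * ρ ^ 2 := by
    intro n hnB
    obtain ⟨hq, hi, hj⟩ := hB n hnB
    obtain ⟨h1, h2⟩ := mem_quadSet.1 hq
    have pos : ∀ l, 0 < (n l : ℝ) := fun l => by
      have := (h1 l).1
      exact_mod_cast this
    have rat : ∀ l, (n l : ℝ) / n 2 ∈ Set.Icc (Λ ^ 2)⁻¹ (Λ ^ 2) := by
      intro l
      have a1 := (h1 l).2
      have a2 := (h1 2).2
      constructor
      · rw [le_div_iff₀ (pos 2), inv_mul_le_iff₀ (by positivity)]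
        calc (n 2 : ℝ) ≤ Λ * Y := a2.1
          _ ≤ Λ * (Λ * n l) := by gcongr; exact a1.2
          _ = _ := by ring
      · rw [div_le_iff₀ (pos 2)]
        calc (n l : ℝ) ≤ Λ * Y := a1.1
          _ ≤ Λ * (Λ * n 2) := by gcongr; exact a2.2
          _ = _ := by ring
    have near0 := near _ (div_nonneg (pos 0).le (pos 2).le)
    have near1 := near _ (div_nonneg (pos 1).le (pos 2).le)
    rw [hi] at near0
    rw [hj] at near1
    have hform : |((n 0 : ℝ) / n 2) ^ p + ((n 1 : ℝ) / n 2) ^ p - 1 - ((n 3 : ℝ) / n 2) ^ p| ≤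
        Λ ^ p * ρ ^ 2 := by
      have hnp : 0 < (n 2 : ℝ) ^ p := rpow_pos_of_pos (pos 2) _
      have e : ((n 0 : ℝ) / n 2) ^ p + ((n 1 : ℝ) / n 2) ^ p - 1 - ((n 3 : ℝ) / n 2) ^ p =
          ((n 0 : ℝ) ^ p + (n 1 : ℝ) ^ p - (n 2 : ℝ) ^ p - (n 3 : ℝ) ^ p) / (n 2 : ℝ) ^ p := by
        rw [div_rpow (pos 0).le (pos 2).le, div_rpow (pos 1).le (pos 2).le,
          div_rpow (pos 3).le (pos 2).le]
        field_simp
      rw [e, abs_div, abs_of_pos hnp, div_le_iff₀ hnp]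
      refine h2.trans ?_
      have h3 : Y ^ p ≤ Λ ^ p * (n 2 : ℝ) ^ p := by
        rw [← mul_rpow hΛ0.le (pos 2).le]
        exact rpow_le_rpow hY0.le (h1 2).2.2 hpq.pos.le
      rw [hρ2, rpow_sub_one hY0.ne']
      calc δ * (Y ^ p / Y) ≤ δ * (Λ ^ p * (n 2 : ℝ) ^ p / Y) := by gcongr
        _ = _ := by ring
    obtain ⟨c1, c2, w, c3, c4, c5⟩ := HB _ (rat 0) _ (rat 1) _ (rat 3) _ _ ρ hρ0 hρρ near0 near1
      hform
    exact ⟨pos 2, (h1 2).2.1, near0, near1, c1, c2, w, c3, c4, c5⟩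
  obtain ⟨n₀, hn₀⟩ := hne
  obtain ⟨-, -, -, -, hs, ht, w, hw, hstw, -⟩ := hn n₀ hn₀
  refine ⟨hs, ht, ?_⟩
  set s := (i : ℝ) * ρ with hsdef
  set t := (j : ℝ) * ρ with htdef
  have hw0 : 0 < w := (inv_pos.2 hK0).trans_le hw.1
  set E : ℕ → Finset (Fin 4 → ℤ) := fun h => (quadSet q K' (2 ^ h) (C / (δ * 2 ^ h * Y))).filter
    fun m => |s ^ (p - 1) * m 2 - m 0| ≤ C / r ∧ |t ^ (p - 1) * m 2 - m 1| ≤ C / r with hE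
  set U := (range (Nat.log 2 ⌊K' / δ⌋₊ + 1)).biUnion E with hU
  set φ : (Fin 4 → ℤ) → (Fin 4 → ℤ) := fun m => ![m 0, m 1, -m 2, -m 3] with hφ
  set D : Finset (Fin 4 → ℤ) := insert 0 (U.image φ ∪ U.image fun m => -φ m) with hD
  have hR : ∀ l, 0 < (![M * r, M * r, M * Y, M * δ] : Fin 4 → ℝ) l := by
    intro l
    fin_cases l <;> simp <;> positivity
  have key := card_mul_abs_det_le (cellMatrix p s t w) ![M * r, M * r, M * Y, M * δ] hR B D ?_ ?_
  · rw [det_cellMatrix, abs_neg, abs_of_pos (rpow_pos_of_pos hw0 _)] at key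
    have hcard : (D.card : ℝ) ≤ 2 * (1 + ∑ h ∈ range (Nat.log 2 ⌊K' / δ⌋₊ + 1),
        ((E h).card : ℝ)) := by
      have h1 : D.card ≤ (U.card + U.card) + 1 := by
        refine (card_insert_le _ _).trans ?_
        gcongr
        exact (card_union_le _ _).trans (add_le_add card_image_le card_image_le)
      have h2 : U.card ≤ ∑ h ∈ range (Nat.log 2 ⌊K' / δ⌋₊ + 1), (E h).card := card_biUnion_le
      have h3 : (D.card : ℝ) ≤ (U.card + U.card) + 1 := by exact_mod_cast h1
      have h4 : (U.card : ℝ) ≤ ∑ h ∈ range (Nat.log 2 ⌊K' / δ⌋₊ + 1), ((E h).card : ℝ) := by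
        exact_mod_cast h2
      linarith
    have hwL : L⁻¹ ≤ w ^ (p - 1) := (rpow_mem_Icc_inv (p - 1) hK hw).1
    have hprod : ∏ l, (![M * r, M * r, M * Y, M * δ] : Fin 4 → ℝ) l = M ^ 4 * (δ * Y) ^ 2 := by
      simp only [Fin.prod_univ_four]
      simp
      linear_combination M ^ 4 * Y * δ * hrδ
    rw [hprod] at key
    have h5 : (B.card : ℝ) * L⁻¹ ≤ 2 ^ 18 * (M ^ 4 * (δ * Y) ^ 2) * D.card :=
      (mul_le_mul_of_nonneg_left hwL (Nat.cast_nonneg _)).trans key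
    rw [← div_eq_mul_inv, div_le_iff₀ hL0] at h5
    refine h5.trans ?_
    calc _ ≤ 2 ^ 18 * (M ^ 4 * (δ * Y) ^ 2) * (2 * (1 + ∑ h ∈ range (Nat.log 2 ⌊K' / δ⌋₊ + 1),
        ((E h).card : ℝ))) * L := by gcongr
      _ = _ := by ring
  · intro n hnB
    obtain ⟨p2, q2, near0, near1, -, -, w', hw', hstw', hlin⟩ := hn n hnB
    have hww : w' = w := by
      have h1 : w' ^ p = w ^ p := by linarith
      exact (rpow_left_inj ((inv_pos.2 hK0).le.trans hw'.1) hw0.le hpq.pos.ne').1 h1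
    rw [hww] at hlin
    have hbox : ∀ x σ : ℝ, |x / n 2 - σ| ≤ ρ → |x - σ * n 2| ≤ M * r := by
      intro x σ hx
      have e : x - σ * n 2 = (x / n 2 - σ) * n 2 := by field_simp
      rw [e, abs_mul, abs_of_pos p2]
      calc _ ≤ ρ * (Λ * Y) := by gcongr
        _ = Λ * r := by rw [← hρY]; ring
        _ ≤ _ := by gcongr
    have h3 : |s ^ (p - 1) * n 0 + t ^ (p - 1) * n 1 - n 2 - w ^ (p - 1) * n 3| ≤ M * δ := by
      have e : s ^ (p - 1) * n 0 + t ^ (p - 1) * n 1 - n 2 - w ^ (p - 1) * n 3 =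
          (s ^ (p - 1) * ((n 0 : ℝ) / n 2) + t ^ (p - 1) * ((n 1 : ℝ) / n 2) - 1 -
            w ^ (p - 1) * ((n 3 : ℝ) / n 2)) * n 2 := by field_simp
      rw [e, abs_mul, abs_of_pos p2]
      calc _ ≤ CB * ρ ^ 2 * (Λ * Y) := by gcongr
        _ = Λ * CB * δ := by rw [hρ2]; field_simp
        _ ≤ _ := by gcongr
    intro l
    rw [congrFun (sum_cellMatrix_mul p s t w fun j => (n j : ℝ)) l]
    fin_cases l
    · exact hbox _ _ near0
    · exact hbox _ _ near1
    · show |(n 2 : ℝ)| ≤ M * Y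
      rw [abs_of_pos p2]
      exact q2.trans (by gcongr)
    · exact h3
  · intro k c hc hk
    have e := sum_mul_cellMatrix p s t w c
    have hk' : ∀ l, (k l : ℝ) = _ := fun l => (hk l).trans (congrFun e l)
    rcases HD s hs t ht w hw hstw M hMM Y δ r hδ hδ1 hr hrY hrδ c (hc 0) (hc 1) (hc 2) (hc 3) k
      (hk' 0) (hk' 1) (hk' 2) (hk' 3) with h0 | ⟨m, hkm, h, hh, hm, hm0, hm1⟩
    · rw [h0]; exact mem_insert_self _ _
    · have hmU : m ∈ U := by
        refine mem_biUnion.2 ⟨h, ?_, mem_filter.2 ⟨hm, hm0, hm1⟩⟩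
        rw [mem_range, Nat.lt_succ_iff]
        refine Nat.le_log_of_pow_le (by norm_num) (Nat.le_floor ?_)
        push_cast
        exact hh
      refine mem_insert_of_mem (mem_union.2 ?_)
      rcases hkm with rfl | rfl
      · exact Or.inl (mem_image_of_mem φ hmU)
      · exact Or.inr (mem_image_of_mem (fun m => -φ m) hmU)

lemma two_pow_le_of_mem_range_log {x : ℝ} (hx : 1 ≤ x) {h : ℕ}
    (hh : h ∈ range (Nat.log 2 ⌊x⌋₊ + 1)) : (2 : ℝ) ^ h ≤ x := by
  rw [mem_range, Nat.lt_succ_iff] at hh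
  have h0 : ⌊x⌋₊ ≠ 0 := (Nat.floor_pos.2 hx).ne'
  have h1 : 2 ^ h ≤ ⌊x⌋₊ := (Nat.pow_le_pow_right (by norm_num) hh).trans (Nat.pow_log_le_self 2 h0)
  have h2 : ((2 ^ h : ℕ) : ℝ) ≤ ⌊x⌋₊ := by exact_mod_cast h1
  push_cast at h2
  exact h2.trans (Nat.floor_le (by linarith))

lemma sum_product_card_filter {α : Type*} (I : Finset ℕ) (S : Finset α) (A : ℕ → α → Prop) (B : ℕ → α → Prop) :
    ∑ x ∈ I ×ˢ I, ((S.filter fun m => A x.1 m ∧ B x.2 m).card : ℝ) =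
      ∑ m ∈ S, ((I.filter fun i => A i m).card : ℝ) * ((I.filter fun i => B i m).card : ℝ) := by
  simp only [card_filter]
  push_cast
  rw [sum_comm]
  refine sum_congr rfl fun m _ => ?_
  rw [sum_mul_sum, sum_product]
  refine sum_congr rfl fun i _ => sum_congr rfl fun j _ => ?_
  by_cases h1 : A i m <;> by_cases h2 : B j m <;> simp [h1, h2]

lemma mul_cell_sum_le {x T i k G' A G Z : ℝ} (hg : 0 ≤ G * Z) (hx : 0 ≤ x) (hT : 0 ≤ T)
    (hi : i ^ 2 ≤ 4 * k ^ 2 * x) (hA : A ≤ G' ^ 2 * T) :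
    G * Z * (i * i * 1 + A) ≤ G * (4 * k ^ 2 + G' ^ 2) * Z * (x + T) := by
  have h1 : 0 ≤ 4 * k ^ 2 * T := by positivity
  have h2 : 0 ≤ G' ^ 2 * x := by positivity
  have h3 : i * i * 1 + A ≤ (4 * k ^ 2 + G' ^ 2) * (x + T) := by
    rw [sq i] at hi
    linarith
  calc _ ≤ G * Z * ((4 * k ^ 2 + G' ^ 2) * (x + T)) := mul_le_mul_of_nonneg_left h3 hg
    _ = _ := by ring

set_option maxHeartbeats 1000000 in
lemma exists_card_quadSet_le {p q : ℝ} (hpq : p.HolderConjugate q) {Λ : ℝ} (hΛ : 1 ≤ Λ) :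
    ∃ G > 0, ∃ C > 0, ∃ K' ≥ 1, ∃ ρ₀ > 0, ∀ Y δ : ℝ, 0 < δ → δ ≤ 1 → 1 ≤ δ * Y →
      δ ≤ ρ₀ * Y →
      ((quadSet p Λ Y δ).card : ℝ) ≤ G * (δ * Y) ^ 2 * (Y / δ +
        ∑ h ∈ range (Nat.log 2 ⌊K' / δ⌋₊ + 1),
          ((quadSet q K' (2 ^ h) (C / (δ * 2 ^ h * Y))).card : ℝ) * (1 / (δ * 2 ^ h)) ^ 2) := by
  obtain ⟨K, hK, G, hG, C, hC, K', hK', ρ₀, hρ₀, HC⟩ := exists_card_cell_le hpq hΛ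
  obtain ⟨G', hG', HG⟩ := exists_card_cells_le (p := p) hpq.lt hK hC hK'
  refine ⟨G * (4 * K ^ 2 + G' ^ 2), by positivity, C, hC, K', hK', ρ₀ ^ 2, by positivity,
    fun Y δ hδ hδ1 hδY hδρ => ?_⟩
  have hY1 : 1 ≤ Y := by
    by_contra hY
    push Not at hY
    have h1 : δ * Y < δ * 1 := mul_lt_mul_of_pos_left hY hδ
    linarith
  have hY0 : 0 < Y := by linarith
  have hK0 : 0 < K := by linarith
  set r : ℝ := √(δ * Y) with hr
  have hr2 : r ^ 2 = δ * Y := Real.sq_sqrt (by positivity)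
  have hr1 : 1 ≤ r := Real.one_le_sqrt.2 hδY
  have hr0 : 0 < r := by linarith
  have hrY : r ≤ Y := by
    rw [hr, Real.sqrt_le_left hY0.le, sq]
    exact mul_le_mul_of_nonneg_right (hδ1.trans hY1) hY0.le
  obtain ⟨ρ, hρ⟩ : ∃ ρ, ρ = r / Y := ⟨_, rfl⟩
  have hρ0 : 0 < ρ := by rw [hρ]; positivity
  have hρ1 : ρ ≤ 1 := by rw [hρ]; exact div_le_one_of_le₀ hrY hY0.le
  have hρ2 : ρ ^ 2 = δ / Y := by rw [hρ, div_pow, hr2]; field_simp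
  have hρρ : ρ ≤ ρ₀ := by
    refine le_of_sq_le_sq ?_ hρ₀.le
    rw [hρ2, div_le_iff₀ hY0]
    exact hδρ
  have hrρ : r * ρ = δ := by rw [hρ, ← mul_div_assoc, ← sq, hr2]; field_simp
  set S := quadSet p Λ Y δ with hS
  set cell : (Fin 4 → ℤ) → ℕ × ℕ := fun n =>
    (⌊(n 0 : ℝ) / n 2 / ρ⌋₊, ⌊(n 1 : ℝ) / n 2 / ρ⌋₊) with hcell
  set I : Finset ℕ := (range (⌊K / ρ⌋₊ + 1)).filter fun i => (i : ℝ) * ρ ∈ Set.Icc K⁻¹ K with hI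
  have memI : ∀ i : ℕ, (i : ℝ) * ρ ∈ Set.Icc K⁻¹ K → i ∈ I := by
    intro i hi
    rw [hI, mem_filter, mem_range, Nat.lt_succ_iff]
    refine ⟨Nat.le_floor ?_, hi⟩
    rw [le_div_iff₀ hρ0]
    exact hi.2
  have hIcard : (I.card : ℝ) ^ 2 ≤ 4 * K ^ 2 * (Y / δ) := by
    have h1 : (I.card : ℝ) ≤ 2 * (K / ρ) := by
      have h2 : I.card ≤ ⌊K / ρ⌋₊ + 1 := by
        refine (card_filter_le _ _).trans ?_
        rw [card_range]
      have h3 : (I.card : ℝ) ≤ (⌊K / ρ⌋₊ : ℝ) + 1 := by exact_mod_cast h2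
      have h4 : (⌊K / ρ⌋₊ : ℝ) ≤ K / ρ := Nat.floor_le (by positivity)
      have h5 : 1 ≤ K / ρ := by rw [le_div_iff₀ hρ0]; linarith
      linarith
    calc (I.card : ℝ) ^ 2 ≤ (2 * (K / ρ)) ^ 2 := by gcongr
      _ = 4 * K ^ 2 / ρ ^ 2 := by rw [mul_pow, div_pow]; ring
      _ = _ := by rw [hρ2, div_div_eq_mul_div, mul_div_assoc]
  have fiber : ∀ x : ℕ × ℕ, ∀ n ∈ S.filter fun n => cell n = x, n ∈ quadSet p Λ Y δ ∧
      ⌊(n 0 : ℝ) / n 2 / ρ⌋₊ = x.1 ∧ ⌊(n 1 : ℝ) / n 2 / ρ⌋₊ = x.2 := by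
    intro x n hn
    rw [mem_filter] at hn
    exact ⟨hn.1, congrArg Prod.fst hn.2, congrArg Prod.snd hn.2⟩
  have maps : ∀ n ∈ S, cell n ∈ I ×ˢ I := by
    intro n hn
    obtain ⟨h1, h2, -⟩ := HC Y δ r ρ hδ hδ1 hr1 hrY hr2 hρ hρρ (cell n).1 (cell n).2 _
      (fiber (cell n)) ⟨n, mem_filter.2 ⟨hn, rfl⟩⟩
    exact mem_product.2 ⟨memI _ h1, memI _ h2⟩
  set R := range (Nat.log 2 ⌊K' / δ⌋₊ + 1) with hR
  set Q : ℕ → Finset (Fin 4 → ℤ) := fun h => quadSet q K' (2 ^ h) (C / (δ * 2 ^ h * Y)) with hQ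
  have hfib : ∀ x ∈ I ×ˢ I, ((S.filter fun n => cell n = x).card : ℝ) ≤
      G * (δ * Y) ^ 2 * (1 + ∑ h ∈ R, (((Q h).filter fun m =>
          |((x.1 : ℝ) * ρ) ^ (p - 1) * m 2 - m 0| ≤ C / r ∧
          |((x.2 : ℝ) * ρ) ^ (p - 1) * m 2 - m 1| ≤ C / r).card : ℝ)) := by
    intro x _
    rcases (S.filter fun n => cell n = x).eq_empty_or_nonempty with he | hne
    · rw [he, card_empty, Nat.cast_zero]
      exact mul_nonneg (mul_nonneg hG.le (sq_nonneg _))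
        (add_nonneg zero_le_one (sum_nonneg fun _ _ => Nat.cast_nonneg _))
    · exact (HC Y δ r ρ hδ hδ1 hr1 hrY hr2 hρ hρρ x.1 x.2 _ (fiber x) hne).2.2
  have hK'δ : 1 ≤ K' / δ := by rw [le_div_iff₀ hδ]; linarith
  have hsum : ∀ h ∈ R, ∑ x ∈ I ×ˢ I, (((Q h).filter fun m =>
          |((x.1 : ℝ) * ρ) ^ (p - 1) * m 2 - m 0| ≤ C / r ∧
          |((x.2 : ℝ) * ρ) ^ (p - 1) * m 2 - m 1| ≤ C / r).card : ℝ) ≤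
      G' ^ 2 * (((Q h).card : ℝ) * (1 / (δ * 2 ^ h)) ^ 2) := by
    intro h hh
    rw [sum_product_card_filter I (Q h)
      (fun i m => |((i : ℝ) * ρ) ^ (p - 1) * m 2 - m 0| ≤ C / r)
      (fun i m => |((i : ℝ) * ρ) ^ (p - 1) * m 2 - m 1| ≤ C / r)]
    have hmem : ∀ m ∈ Q h, ∀ a : ℝ,
        ((I.filter fun i : ℕ => |((i : ℝ) * ρ) ^ (p - 1) * m 2 - a| ≤ C / r).card : ℝ) ≤
          G' / (δ * 2 ^ h) := by
      intro m hm a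
      exact HG I ρ r δ (2 ^ h) a (m 2) hρ0 hr0 hδ hrρ (by positivity)
        (two_pow_le_of_mem_range_log hK'δ hh) ((mem_quadSet.1 hm).1 2).2.2
        fun i hi => (mem_filter.1 hi).2
    calc _ ≤ ∑ m ∈ Q h, G' / (δ * 2 ^ h) * (G' / (δ * 2 ^ h)) :=
          sum_le_sum fun m hm => mul_le_mul (hmem m hm _) (hmem m hm _) (Nat.cast_nonneg _)
            (by positivity)
      _ = _ := by rw [sum_const, nsmul_eq_mul]; ring
  have htot : (S.card : ℝ) = ∑ x ∈ I ×ˢ I, ((S.filter fun n => cell n = x).card : ℝ) := by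
    rw [card_eq_sum_card_fiberwise maps]
    push_cast
    rfl
  rw [htot]
  refine (sum_le_sum hfib).trans ?_
  rw [← mul_sum, sum_add_distrib, sum_comm, sum_const, card_product, nsmul_eq_mul]
  push_cast
  have hs := sum_le_sum hsum
  rw [← mul_sum] at hs
  exact mul_cell_sum_le (mul_nonneg hG.le (sq_nonneg (δ * Y))) (by positivity)
    (sum_nonneg fun _ _ => mul_nonneg (Nat.cast_nonneg _) (sq_nonneg _)) hIcard hs

/-- Uniform bound for the number of near solutions, with an `Y ^ β` loss. -/
def QuadBound (p β : ℝ) : Prop :=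
  ∀ Λ ≥ 1, ∃ C > 0, ∀ Y ≥ 1, ∀ δ : ℝ, 0 < δ → δ ≤ 1 →
    ((quadSet p Λ Y δ).card : ℝ) ≤ C * (δ * Y ^ 3 + Y ^ (2 + β))

lemma card_quadSet_le (p δ : ℝ) {Λ Y : ℝ} (hΛY : 0 ≤ Λ * Y) :
    ((quadSet p Λ Y δ).card : ℝ) ≤ (Λ * Y) ^ 4 := by
  have h1 : (quadSet p Λ Y δ).card ≤ ⌊Λ * Y⌋.toNat ^ 4 := by
    refine (card_filter_le _ _).trans ?_
    simp
  have h0 : 0 ≤ ⌊Λ * Y⌋ := Int.floor_nonneg.2 hΛY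
  have h2 : ((⌊Λ * Y⌋.toNat : ℕ) : ℝ) ≤ Λ * Y := by
    have h3 : ((⌊Λ * Y⌋.toNat : ℤ) : ℝ) = (⌊Λ * Y⌋ : ℝ) := by rw [Int.toNat_of_nonneg h0]
    rw [← Int.cast_natCast, h3]
    exact Int.floor_le _
  calc ((quadSet p Λ Y δ).card : ℝ) ≤ ((⌊Λ * Y⌋.toNat : ℕ) : ℝ) ^ 4 := by exact_mod_cast h1
    _ ≤ _ := by gcongr

lemma quadSet_mono (p Λ : ℝ) {Y δ δ' : ℝ} (hY : 0 ≤ Y) (h : δ ≤ δ') :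
    quadSet p Λ Y δ ⊆ quadSet p Λ Y δ' := by
  intro n hn
  rw [mem_quadSet] at hn ⊢
  refine ⟨hn.1, hn.2.trans ?_⟩
  have : 0 ≤ Y ^ (p - 1) := rpow_nonneg hY _
  gcongr

lemma quadBound_two (p : ℝ) : QuadBound p 2 := by
  intro Λ hΛ
  refine ⟨Λ ^ 4, by positivity, fun Y hY δ hδ _ => ?_⟩
  have hY0 : (0 : ℝ) < Y := by linarith
  refine (card_quadSet_le p δ (by positivity)).trans ?_
  rw [mul_pow]
  have e : Y ^ ((2 : ℝ) + 2) = Y ^ 4 := by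
    rw [show (2 : ℝ) + 2 = ((4 : ℕ) : ℝ) by norm_num, rpow_natCast]
  rw [e]
  gcongr
  have : 0 ≤ δ * Y ^ 3 := by positivity
  linarith

lemma QuadBound.mono {p β β' : ℝ} (h : QuadBound p β) (hβ : β ≤ β') : QuadBound p β' := by
  intro Λ hΛ
  obtain ⟨C, hC, H⟩ := h Λ hΛ
  refine ⟨C, hC, fun Y hY δ hδ hδ1 => (H Y hY δ hδ hδ1).trans ?_⟩
  gcongr

lemma card_range_log_le {η x : ℝ} (hη : 0 < η) (hx : 1 ≤ x) :
    ((range (Nat.log 2 ⌊x⌋₊ + 1)).card : ℝ) ≤ 2 * ((1 + 1 / η) * x ^ η) := by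
  have h1 := two_pow_le_of_mem_range_log hx (h := Nat.log 2 ⌊x⌋₊) (by simp)
  have h2 := Real.log_le_log (by positivity) h1
  rw [Real.log_pow] at h2
  have h3 : (Nat.log 2 ⌊x⌋₊ : ℝ) * (1 / 2) ≤ Nat.log 2 ⌊x⌋₊ * Real.log 2 := by
    gcongr
    linarith [Real.log_two_gt_d9]
  have h4 := one_add_log_le η hη hx
  rw [card_range]
  push_cast
  linarith

lemma QuadBound.improve {p q β : ℝ} (hpq : p.HolderConjugate q) (hβ : 0 < β) (hβ2 : β ≤ 2)
    (hq : QuadBound q β) : QuadBound p (2 * β / (2 + β)) := by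
  intro Λ hΛ
  have hΛ0 : 0 < Λ := by linarith
  obtain ⟨G, hG, C, hC, K', hK', ρ₀, hρ₀, HG⟩ := exists_card_quadSet_le hpq hΛ
  obtain ⟨Cq, hCq, HQ⟩ := hq K' hK'
  set s : ℝ := 2 * β / (2 + β) with hs
  have hs0 : 0 < s := by positivity
  have hs1 : s ≤ 1 := by rw [hs, div_le_one (by positivity)]; linarith
  set η : ℝ := β ^ 2 / (2 + β) with hη
  have hη0 : 0 < η := by positivity
  have hηs : η + β * (1 - s) = s := by
    rw [hη, hs]
    field_simp
    ring
  have hη2 : η ≤ 2 * s := by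
    have : 0 ≤ β * (1 - s) := mul_nonneg hβ.le (by linarith)
    linarith
  have hK0 : 0 < K' := by linarith
  set Y₀ : ℝ := max (1 / ρ₀) (C ^ (1 / s)) with hY₀
  have hY₀0 : 0 < Y₀ := lt_max_of_lt_left (by positivity)
  set N₁ : ℝ := 2 * ((1 + 1 / η) * K' ^ η) with hN₁
  have hN₁0 : 0 < N₁ := by positivity
  refine ⟨(Λ * Y₀) ^ 4 + G * (1 + N₁ * (Cq * (C + K' ^ β))), by positivity,
    fun Y hY δ₀ hδ₀ hδ₀1 => ?_⟩
  have hY0 : (0 : ℝ) < Y := by linarith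
  rcases lt_or_ge Y Y₀ with hlt | hge
  · refine (card_quadSet_le p δ₀ (by positivity)).trans ?_
    have h1 : 1 ≤ Y ^ (2 + s) := one_le_rpow hY (by linarith)
    have h2 : 0 ≤ δ₀ * Y ^ 3 := by positivity
    have h3 : (Λ * Y) ^ 4 ≤ (Λ * Y₀) ^ 4 := by gcongr
    calc (Λ * Y) ^ 4 ≤ ((Λ * Y₀) ^ 4 + 0) * 1 := by rw [add_zero, mul_one]; exact h3
      _ ≤ _ := by
        gcongr
        · positivity
        · linarith
  have hge1 : 1 / ρ₀ ≤ Y := (le_max_left _ _).trans hge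
  have hge2 : C ≤ Y ^ s := by
    have h1 : C ^ (1 / s) ≤ Y := (le_max_right _ _).trans hge
    calc C = (C ^ (1 / s)) ^ s := by
          rw [← rpow_mul hC.le, one_div_mul_cancel hs0.ne', rpow_one]
      _ ≤ _ := rpow_le_rpow (by positivity) h1 hs0.le
  obtain ⟨δ, hδdef⟩ : ∃ δ, δ = max δ₀ (Y ^ (-(1 - s))) := ⟨_, rfl⟩
  have hδ0 : 0 < δ := hδdef ▸ lt_max_of_lt_left hδ₀
  have hδ1 : δ ≤ 1 := hδdef ▸ max_le hδ₀1 (rpow_le_one_of_one_le_of_nonpos hY (by linarith))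
  have hδY : Y ^ (-(1 - s)) ≤ δ := hδdef ▸ le_max_right _ _
  have hδinv : 1 / δ ≤ Y ^ (1 - s) := by
    rw [rpow_neg hY0.le] at hδY
    rw [one_div]
    exact inv_le_of_inv_le₀ (by positivity) hδY
  have hδle : δ * Y ^ 3 ≤ δ₀ * Y ^ 3 + Y ^ (2 + s) := by
    have h1 : δ ≤ δ₀ + Y ^ (-(1 - s)) :=
      hδdef ▸ max_le_add_of_nonneg hδ₀.le (rpow_nonneg hY0.le _)
    calc _ ≤ (δ₀ + Y ^ (-(1 - s))) * Y ^ 3 := by gcongr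
      _ = δ₀ * Y ^ 3 + Y ^ (-(1 - s)) * Y ^ ((3 : ℕ) : ℝ) := by rw [rpow_natCast]; ring
      _ = _ := by
        rw [← rpow_add hY0]
        congr 2
        push_cast
        ring
  have hsδ : Y ^ s ≤ δ * Y := by
    calc Y ^ s = Y ^ (-(1 - s)) * Y := by
          nth_rewrite 3 [← rpow_one Y]
          rw [← rpow_add hY0]
          congr 1
          ring
      _ ≤ _ := by gcongr
  have h1δ : 1 ≤ δ * Y := (one_le_rpow hY hs0.le).trans hsδ
  have hρY : δ ≤ ρ₀ * Y := by
    rw [div_le_iff₀ hρ₀] at hge1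
    linarith
  have hK'δ : 1 ≤ K' / δ := by rw [le_div_iff₀ hδ0]; linarith
  have hmain := HG Y δ hδ0 hδ1 h1δ hρY
  have hmono : ((quadSet p Λ Y δ₀).card : ℝ) ≤ (quadSet p Λ Y δ).card := by
    exact_mod_cast card_le_card (quadSet_mono p Λ hY0.le (hδdef ▸ le_max_left _ _))
  refine hmono.trans (hmain.trans ?_)
  have hterm : ∀ h ∈ range (Nat.log 2 ⌊K' / δ⌋₊ + 1),
      ((quadSet q K' (2 ^ h) (C / (δ * 2 ^ h * Y))).card : ℝ) * (1 / (δ * 2 ^ h)) ^ 2 ≤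
        Cq * (C + K' ^ β) * Y ^ (β * (1 - s)) / δ ^ 2 := by
    intro h hh
    have hH := two_pow_le_of_mem_range_log hK'δ hh
    obtain ⟨H, hHdef⟩ : ∃ H : ℝ, H = 2 ^ h := ⟨_, rfl⟩
    have hH1 : 1 ≤ H := hHdef ▸ one_le_pow₀ (by norm_num)
    rw [← hHdef] at hH ⊢
    have hH0 : 0 < H := by linarith
    have hd : C / (δ * H * Y) ≤ 1 := by
      rw [div_le_one (by positivity)]
      calc C ≤ δ * Y * 1 := by linarith
        _ ≤ δ * Y * H := by gcongr
        _ = _ := by ring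
    have h1 := HQ H hH1 _ (by positivity) hd
    have h2 : H ^ β ≤ K' ^ β * Y ^ (β * (1 - s)) := by
      calc H ^ β ≤ (K' * Y ^ (1 - s)) ^ β := by
            refine rpow_le_rpow hH0.le (hH.trans ?_) hβ.le
            rw [div_eq_mul_one_div]
            gcongr
        _ = _ := by
            rw [mul_rpow hK0.le (by positivity), ← rpow_mul hY0.le, mul_comm β]
    have h3 : C / (δ * Y) ≤ C * Y ^ (β * (1 - s)) := by
      calc C / (δ * Y) ≤ C / 1 := by gcongr
        _ = C * 1 := by ring
        _ ≤ _ := by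
          gcongr
          exact one_le_rpow hY (mul_nonneg hβ.le (by linarith))
    have h4 : H ^ (2 + β) = H ^ 2 * H ^ β := by rw [rpow_add hH0, rpow_two]
    calc _ ≤ Cq * (C / (δ * H * Y) * H ^ 3 + H ^ (2 + β)) * (1 / (δ * H)) ^ 2 := by gcongr
      _ = Cq * (C / (δ * Y) + H ^ β) / δ ^ 2 := by
        rw [h4]
        field_simp
      _ ≤ Cq * (C * Y ^ (β * (1 - s)) + K' ^ β * Y ^ (β * (1 - s))) / δ ^ 2 := by gcongr
      _ = _ := by ring
  have hcount : ((range (Nat.log 2 ⌊K' / δ⌋₊ + 1)).card : ℝ) ≤ N₁ * Y ^ η := by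
    refine (card_range_log_le hη0 hK'δ).trans ?_
    have h1 : (K' / δ) ^ η ≤ K' ^ η * Y ^ η := by
      rw [← mul_rpow hK0.le hY0.le]
      refine rpow_le_rpow (by positivity) ?_ hη0.le
      rw [div_eq_mul_one_div]
      refine mul_le_mul_of_nonneg_left (hδinv.trans ?_) hK0.le
      nth_rewrite 2 [← rpow_one Y]
      exact rpow_le_rpow_of_exponent_le hY (by linarith)
    calc _ ≤ 2 * ((1 + 1 / η) * (K' ^ η * Y ^ η)) := by gcongr
      _ = _ := by rw [hN₁]; ring
  have hsum := sum_le_card_nsmul _ _ _ hterm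
  rw [nsmul_eq_mul] at hsum
  have hsum2 := hsum.trans (mul_le_mul_of_nonneg_right hcount (by positivity))
  have hpow : Y ^ η * Y ^ (β * (1 - s)) * Y ^ 2 = Y ^ (2 + s) := by
    rw [← rpow_add hY0, hηs, ← rpow_two, ← rpow_add hY0, add_comm]
  have hY3 : 0 ≤ δ₀ * Y ^ 3 := by positivity
  have hYs : 0 ≤ Y ^ (2 + s) := by positivity
  calc _ ≤ G * (δ * Y) ^ 2 * (Y / δ +
        N₁ * Y ^ η * (Cq * (C + K' ^ β) * Y ^ (β * (1 - s)) / δ ^ 2)) := by gcongr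
    _ = G * (δ * Y ^ 3 + N₁ * (Cq * (C + K' ^ β)) * (Y ^ η * Y ^ (β * (1 - s)) * Y ^ 2)) := by
      field_simp
    _ ≤ G * ((δ₀ * Y ^ 3 + Y ^ (2 + s)) + N₁ * (Cq * (C + K' ^ β)) * (δ₀ * Y ^ 3 + Y ^ (2 + s))) := by
      rw [hpow]
      gcongr
      linarith
    _ = (0 + G * (1 + N₁ * (Cq * (C + K' ^ β)))) * (δ₀ * Y ^ 3 + Y ^ (2 + s)) := by ring
    _ ≤ _ := by
      gcongr
      positivity

lemma quadBound {p κ : ℝ} (hp : 1 < p) (hκ : 0 < κ) : QuadBound p κ := by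
  have H : ∀ k : ℕ, ∀ p : ℝ, 1 < p → QuadBound p (2 / (k + 1)) := by
    intro k
    induction k with
    | zero => intro p _; simpa using quadBound_two p
    | succ k ih =>
      intro p hp
      have hpq := Real.HolderConjugate.conjExponent hp
      have h1 := (ih _ hpq.symm.lt).improve hpq (by positivity) (by
        rw [div_le_iff₀ (by positivity)]
        have : (0 : ℝ) ≤ k := Nat.cast_nonneg _
        linarith)
      convert h1 using 1
      push_cast
      field_simp
  obtain ⟨k, hk⟩ := exists_nat_gt (2 / κ)
  refine (H k p hp).mono ?_
  rw [div_lt_iff₀ hκ] at hk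
  rw [div_le_iff₀ (by positivity)]
  linarith

lemma integral_norm_sq_sum_eC {ι : Type*} (U : Finset ι) (b : ι → ℝ) (g : ι → ℤ) :
    ∫ x in (0 : ℝ)..1, ‖∑ i ∈ U, (b i : ℂ) * eC (g i * x)‖ ^ 2 =
      ∑ i ∈ U, ∑ j ∈ U, if g i = g j then b i * b j else 0 := by
  have h1 : ∀ x : ℝ, ((‖∑ i ∈ U, (b i : ℂ) * eC (g i * x)‖ ^ 2 : ℝ) : ℂ) =
      ∑ i ∈ U, ∑ j ∈ U, ((b i * b j : ℝ) : ℂ) * eC (((g i - g j : ℤ) : ℝ) * x) := by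
    intro x
    push_cast
    rw [← Complex.mul_conj', map_sum, sum_mul_sum]
    refine sum_congr rfl fun i _ => sum_congr rfl fun j _ => ?_
    rw [map_mul, Complex.conj_ofReal, sub_mul, eC_sub]
    ring
  have h2 : ((∫ x in (0 : ℝ)..1, ‖∑ i ∈ U, (b i : ℂ) * eC (g i * x)‖ ^ 2 : ℝ) : ℂ) =
      ((∑ i ∈ U, ∑ j ∈ U, if g i = g j then b i * b j else 0 : ℝ) : ℂ) := by
    rw [← intervalIntegral.integral_ofReal]
    simp_rw [h1]
    have hcont : ∀ i j, Continuous fun x : ℝ =>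
        ((b i * b j : ℝ) : ℂ) * eC (((g i - g j : ℤ) : ℝ) * x) := fun i j =>
      continuous_const.mul (continuous_eC.comp (by fun_prop))
    rw [intervalIntegral.integral_finsetSum fun i _ =>
      (continuous_finsetSum _ fun j _ => hcont i j).intervalIntegrable _ _]
    simp only [Complex.ofReal_sum]
    refine sum_congr rfl fun i _ => ?_
    rw [intervalIntegral.integral_finsetSum fun j _ => (hcont i j).intervalIntegrable _ _]
    refine sum_congr rfl fun j _ => ?_
    rw [intervalIntegral.integral_const_mul, eC_zero_or_int_integral]
    by_cases h : g i = g j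
    · simp [h]
    · have : g i - g j ≠ 0 := sub_ne_zero.2 h
      simp [h, this]
  exact_mod_cast h2

lemma continuous_SX (c Y : ℝ) : Continuous (SX c Y) := by
  unfold SX
  exact continuous_finsetSum _ fun p _ =>
    continuous_const.mul (continuous_eC.comp (by fun_prop))

lemma mem_dyadic {Y : ℝ} {n : ℕ} (h : n ∈ Ioc ⌊Y⌋₊ ⌊2 * Y⌋₊) :
    1 ≤ (n : ℤ) ∧ ((n : ℤ) : ℝ) ≤ 2 * Y ∧ Y ≤ 2 * ((n : ℤ) : ℝ) := by
  rw [mem_Ioc] at h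
  have h1 := Nat.lt_of_floor_lt h.1
  have h2 : 1 ≤ n := by omega
  have h3 := (Nat.le_floor_iff' (by omega)).1 h.2
  refine ⟨by exact_mod_cast h2, by exact_mod_cast h3, ?_⟩
  have h4 : (0 : ℝ) ≤ n := n.cast_nonneg
  rw [Int.cast_natCast]
  linarith

lemma card_dyadic_quad_le {c Y δ : ℝ} (hδ : 2 ≤ δ * Y ^ (c - 1)) (T : Finset ℕ)
    (hT : T ⊆ Ioc ⌊Y⌋₊ ⌊2 * Y⌋₊) :
    ((((T ×ˢ T) ×ˢ (T ×ˢ T)).filter fun z => ⌊(z.1.1 : ℝ) ^ c⌋ + ⌊(z.1.2 : ℝ) ^ c⌋ =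
      ⌊(z.2.1 : ℝ) ^ c⌋ + ⌊(z.2.2 : ℝ) ^ c⌋).card) ≤ (quadSet c 2 Y δ).card := by
  refine card_le_card_of_injOn
    (fun z => ![(z.1.1 : ℤ), (z.1.2 : ℤ), (z.2.1 : ℤ), (z.2.2 : ℤ)]) ?_ ?_
  · rintro ⟨⟨a, b⟩, d, e⟩ hz
    rw [mem_coe, mem_filter, mem_product, mem_product, mem_product] at hz
    obtain ⟨⟨⟨ha, hb⟩, hd, he⟩, heq⟩ := hz
    rw [mem_coe, mem_quadSet]
    constructor
    · intro i
      fin_cases i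
      exacts [mem_dyadic (hT ha), mem_dyadic (hT hb), mem_dyadic (hT hd), mem_dyadic (hT he)]
    · have e1 : (⌊(a : ℝ) ^ c⌋ : ℝ) + ⌊(b : ℝ) ^ c⌋ = ⌊(d : ℝ) ^ c⌋ + ⌊(e : ℝ) ^ c⌋ := by
        exact_mod_cast heq
      have := Int.floor_le ((a : ℝ) ^ c)
      have := Int.floor_le ((b : ℝ) ^ c)
      have := Int.floor_le ((d : ℝ) ^ c)
      have := Int.floor_le ((e : ℝ) ^ c)
      have := (Int.lt_floor_add_one ((a : ℝ) ^ c)).le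
      have := (Int.lt_floor_add_one ((b : ℝ) ^ c)).le
      have := (Int.lt_floor_add_one ((d : ℝ) ^ c)).le
      have := (Int.lt_floor_add_one ((e : ℝ) ^ c)).le
      refine le_trans ?_ hδ
      simp only [Matrix.cons_val, Int.cast_natCast]
      rw [abs_le]
      constructor <;> linarith
  · rintro ⟨⟨a, b⟩, d, e⟩ _ ⟨⟨a', b'⟩, d', e'⟩ _ h
    simp only at h
    have h0 := congrFun h 0
    have h1 := congrFun h 1
    have h2 := congrFun h 2
    have h3 := congrFun h 3
    simp only [Matrix.cons_val, Nat.cast_inj] at h0 h1 h2 h3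
    simp [h0, h1, h2, h3]

lemma integral_norm_SX_pow_four_le {c Y δ L : ℝ} (hδ : 2 ≤ δ * Y ^ (c - 1))
    (hL : Real.log (2 * Y) ≤ L) (hY : 1 ≤ Y) :
    ∫ x in (0 : ℝ)..1, ‖SX c Y x‖ ^ 4 ≤ L ^ 4 * (quadSet c 2 Y δ).card := by
  have hL0 : 0 ≤ L := (Real.log_nonneg (by linarith)).trans hL
  set T := (Ioc ⌊Y⌋₊ ⌊2 * Y⌋₊).filter Nat.Prime with hT
  have h1 : ∀ x, ‖SX c Y x‖ ^ 4 = ‖∑ z ∈ T ×ˢ T, ((Real.log z.1 * Real.log z.2 : ℝ) : ℂ) *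
      eC (((⌊(z.1 : ℝ) ^ c⌋ + ⌊(z.2 : ℝ) ^ c⌋ : ℤ) : ℝ) * x)‖ ^ 2 := by
    intro x
    rw [show ‖SX c Y x‖ ^ 4 = ‖SX c Y x * SX c Y x‖ ^ 2 by rw [norm_mul]; ring]
    congr 2
    unfold SX
    rw [sum_mul_sum, sum_product]
    refine sum_congr rfl fun i _ => sum_congr rfl fun j _ => ?_
    push_cast
    rw [add_mul, eC_add]
    ring
  simp_rw [h1]
  rw [integral_norm_sq_sum_eC]
  have hlog : ∀ n ∈ T, 0 ≤ Real.log n ∧ Real.log n ≤ L := by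
    intro n hn
    have h2 := mem_dyadic (mem_filter.1 hn).1
    have h3 : (1 : ℝ) ≤ n := by exact_mod_cast h2.1
    exact ⟨Real.log_nonneg h3, (Real.log_le_log (by linarith) (by exact_mod_cast h2.2.1)).trans hL⟩
  have h2 : ∀ i ∈ T ×ˢ T, Real.log i.1 * Real.log i.2 ∈ Set.Icc 0 (L ^ 2) := by
    intro i hi
    obtain ⟨h3, h4⟩ := mem_product.1 hi
    refine ⟨mul_nonneg (hlog _ h3).1 (hlog _ h4).1, ?_⟩
    rw [sq]
    exact mul_le_mul (hlog _ h3).2 (hlog _ h4).2 (hlog _ h4).1 hL0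
  have h3 : (((((T ×ˢ T) ×ˢ (T ×ˢ T)).filter fun z => ⌊(z.1.1 : ℝ) ^ c⌋ + ⌊(z.1.2 : ℝ) ^ c⌋ =
      ⌊(z.2.1 : ℝ) ^ c⌋ + ⌊(z.2.2 : ℝ) ^ c⌋).card : ℕ) : ℝ) ≤ (quadSet c 2 Y δ).card := by
    exact_mod_cast card_dyadic_quad_le hδ T (filter_subset _ _)
  refine le_trans ?_ (mul_le_mul_of_nonneg_left h3 (by positivity))
  rw [← sum_product', card_filter]
  push_cast
  rw [mul_sum]
  refine sum_le_sum fun z hz => ?_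
  obtain ⟨h4, h5⟩ := mem_product.1 hz
  by_cases h : ⌊(z.1.1 : ℝ) ^ c⌋ + ⌊(z.1.2 : ℝ) ^ c⌋ = ⌊(z.2.1 : ℝ) ^ c⌋ + ⌊(z.2.2 : ℝ) ^ c⌋
  · rw [if_pos h, if_pos h]
    calc _ ≤ L ^ 2 * L ^ 2 := mul_le_mul (h2 _ h4).2 (h2 _ h5).2 (h2 _ h5).1 (by positivity)
      _ = _ := by ring
  · rw [if_neg h, if_neg h, mul_zero]

lemma exists_integral_norm_SX_pow_four_le {c κ : ℝ} (hc : 1 < c) (hκ : 0 < κ) :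
    ∃ C > 0, ∀ Y ≥ 1, ∫ x in (0 : ℝ)..1, ‖SX c Y x‖ ^ 4 ≤ C * (Y ^ (4 - c + κ) + Y ^ (2 + κ)) := by
  obtain ⟨C, hC, H⟩ := quadBound hc (half_pos hκ) 2 (by norm_num)
  set Y₀ : ℝ := 2 ^ (1 / (c - 1)) with hY₀
  have hc0 : 0 < c - 1 := by linarith
  set B : ℝ := (1 + 1 / (κ / 8)) ^ 4 * 2 ^ (κ / 2) with hB
  have hB0 : 0 < B := by positivity
  refine ⟨(4 * Y₀) ^ 4 + B * C * 2, by positivity, fun Y hY => ?_⟩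
  have hY0 : (0 : ℝ) < Y := by linarith
  have p1 : 0 ≤ Y ^ (4 - c + κ) := by positivity
  have p2 : 1 ≤ Y ^ (2 + κ) := one_le_rpow hY (by linarith)
  rcases lt_or_ge Y Y₀ with hlt | hge
  · have h1 : ∫ x in (0 : ℝ)..1, ‖SX c Y x‖ ^ 4 ≤ ∫ x in (0 : ℝ)..1, (4 * Y₀) ^ 4 := by
      refine intervalIntegral.integral_mono_on zero_le_one
        (((continuous_SX c Y).norm.pow 4).intervalIntegrable _ _)
        (continuous_const.intervalIntegrable _ _) fun x _ => ?_
      gcongr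
      exact (norm_SX_le c x hY0.le).trans (by linarith)
    rw [intervalIntegral.integral_const, sub_zero, one_smul] at h1
    calc _ ≤ ((4 * Y₀) ^ 4 + 0) * (0 + 1) := by rw [add_zero, zero_add, mul_one]; exact h1
      _ ≤ _ := by gcongr; positivity
  · have h2 : 2 ≤ Y ^ (c - 1) := by
      calc (2 : ℝ) = Y₀ ^ (c - 1) := by
            rw [hY₀, ← rpow_mul (by norm_num), one_div_mul_cancel hc0.ne', rpow_one]
        _ ≤ _ := rpow_le_rpow (by positivity) hge hc0.le
    have hpos : 0 < Y ^ (c - 1) := by positivity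
    have h3 := integral_norm_SX_pow_four_le (c := c) (δ := 2 / Y ^ (c - 1))
      (L := (1 + 1 / (κ / 8)) * (2 * Y) ^ (κ / 8)) (by rw [div_mul_cancel₀ _ hpos.ne'])
      (by linarith [one_add_log_le (κ / 8) (by positivity) (x := 2 * Y) (by linarith)]) hY
    have h4 := H Y hY (2 / Y ^ (c - 1)) (by positivity) ((div_le_one hpos).2 h2)
    have e1 : ((1 + 1 / (κ / 8)) * (2 * Y) ^ (κ / 8)) ^ 4 = B * Y ^ (κ / 2) := by
      rw [mul_pow, ← rpow_natCast, ← rpow_natCast, ← rpow_mul (by positivity),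
        mul_rpow (by norm_num) hY0.le, hB, ← rpow_natCast]
      push_cast
      rw [show κ / 8 * 4 = κ / 2 by ring]
      ring
    have e2 : 2 / Y ^ (c - 1) * Y ^ 3 = 2 * Y ^ (4 - c) := by
      rw [show 4 - c = ((3 : ℕ) : ℝ) - (c - 1) by push_cast; ring,
        rpow_sub hY0 ((3 : ℕ) : ℝ), rpow_natCast]
      ring
    rw [e1] at h3
    rw [e2] at h4
    refine h3.trans ((mul_le_mul_of_nonneg_left h4 (by positivity)).trans ?_)
    have e3 : Y ^ (κ / 2) * Y ^ (2 + κ / 2) = Y ^ (2 + κ) := by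
      rw [← rpow_add hY0]; congr 1; ring
    have e4 : Y ^ (κ / 2) * Y ^ (4 - c) ≤ Y ^ (4 - c + κ) := by
      rw [← rpow_add hY0]
      exact rpow_le_rpow_of_exponent_le hY (by linarith)
    calc _ = B * C * (2 * (Y ^ (κ / 2) * Y ^ (4 - c)) + Y ^ (κ / 2) * Y ^ (2 + κ / 2)) := by ring
      _ ≤ B * C * (2 * Y ^ (4 - c + κ) + 2 * Y ^ (2 + κ)) := by
        rw [e3]
        gcongr
        linarith
      _ = (0 + B * C * 2) * (Y ^ (4 - c + κ) + Y ^ (2 + κ)) := by ring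
      _ ≤ _ := by
        gcongr
        positivity

lemma integrable_restrict_of_continuous {V : Type*} [NormedAddCommGroup V] {E : Set ℝ}
    (hE : E ⊆ Set.Icc 0 1) {f : ℝ → V} (hf : Continuous f) :
    Integrable f (volume.restrict E) :=
  (hf.continuousOn.integrableOn_compact isCompact_Icc).mono_set hE

lemma integrable_prod_restrict_of_continuous {V : Type*} [NormedAddCommGroup V] {E : Set ℝ}
    (hE : E ⊆ Set.Icc 0 1) {f : ℝ × ℝ → V} (hf : Continuous f) :
    Integrable f ((volume.restrict E).prod (volume.restrict E)) := by
  rw [Measure.prod_restrict]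
  exact (hf.continuousOn.integrableOn_compact (isCompact_Icc.prod isCompact_Icc)).mono_set
    (Set.prod_mono hE hE)

/-- Duality bound for a large-values integral of an exponential sum. -/
lemma sq_integral_norm_sq_le {E : Set ℝ} (hEm : MeasurableSet E) (hE : E ⊆ Set.Icc 0 1)
    {T W : Finset ℕ} (hTW : T ⊆ W) (a F : ℕ → ℝ) {f : ℝ → ℂ}
    (hf : f = fun x => ∑ n ∈ T, (a n : ℂ) * eC (F n * x)) {k : ℝ → ℝ} (hk : Continuous k) {U κ : ℝ}
    (hk1 : ∀ x ∈ E, ∀ y ∈ E, ‖∑ n ∈ W, eC (F n * (x - y))‖ ≤ k (x - y) + U)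
    (hk2 : ∀ x ∈ E, ∫ y in E, k (x - y) ≤ κ) (hk3 : ∀ y ∈ E, ∫ x in E, k (x - y) ≤ κ) (hk0 : ∀ x, 0 ≤ k x) :
    (∫ x in E, ‖f x‖ ^ 2) ^ 2 ≤ (∑ n ∈ T, a n ^ 2) *
      (κ * (∫ x in E, ‖f x‖ ^ 2) + U * (∫ x in E, ‖f x‖) ^ 2) := by
  have hfc : Continuous f := by
    rw [hf]
    exact continuous_finsetSum _ fun n _ =>
      continuous_const.mul (continuous_eC.comp (by fun_prop))
  have heC : ∀ n, Continuous fun x : ℝ => eC (F n * x) := fun n =>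
    continuous_eC.comp (by fun_prop)
  set μ := volume.restrict E with hμ
  set h : ℕ → ℂ := fun n => ∫ x, (starRingEnd ℂ) (f x) * eC (F n * x) ∂μ with hh
  have hconj : Continuous fun x => (starRingEnd ℂ) (f x) := Complex.continuous_conj.comp hfc
  have i2 : ∀ {g : ℝ × ℝ → ℝ}, Continuous g → Integrable g (μ.prod μ) := fun hg =>
    integrable_prod_restrict_of_continuous hE hg
  have hI : ((∫ x, ‖f x‖ ^ 2 ∂μ : ℝ) : ℂ) = ∑ n ∈ T, (a n : ℂ) * h n := by
    rw [← integral_complex_ofReal]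
    have e : ∀ x, ((‖f x‖ ^ 2 : ℝ) : ℂ) =
        ∑ n ∈ T, (a n : ℂ) * ((starRingEnd ℂ) (f x) * eC (F n * x)) := by
      intro x
      push_cast
      rw [← Complex.conj_mul']
      nth_rewrite 2 [hf]
      rw [mul_sum]
      refine sum_congr rfl fun n _ => by ring
    refine (integral_congr_ae (Filter.Eventually.of_forall e)).trans ?_
    rw [integral_finsetSum]
    · refine sum_congr rfl fun n _ => ?_
      rw [integral_const_mul]
    · intro n _
      exact integrable_restrict_of_continuous hE (continuous_const.mul (hconj.mul (heC n)))
  have hI0 : 0 ≤ ∫ x, ‖f x‖ ^ 2 ∂μ := integral_nonneg fun x => by positivity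
  have h1 : ∫ x, ‖f x‖ ^ 2 ∂μ ≤ ∑ n ∈ T, |a n| * ‖h n‖ := by
    have := norm_sum_le T fun n => (a n : ℂ) * h n
    rw [← hI, Complex.norm_real, Real.norm_of_nonneg hI0] at this
    refine this.trans (le_of_eq (sum_congr rfl fun n _ => ?_))
    rw [norm_mul, Complex.norm_real, Real.norm_eq_abs]
  have h2 : (∫ x, ‖f x‖ ^ 2 ∂μ) ^ 2 ≤ (∑ n ∈ T, a n ^ 2) * ∑ n ∈ W, ‖h n‖ ^ 2 := by
    calc _ ≤ (∑ n ∈ T, |a n| * ‖h n‖) ^ 2 := by gcongr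
      _ ≤ (∑ n ∈ T, |a n| ^ 2) * ∑ n ∈ T, ‖h n‖ ^ 2 := sum_mul_sq_le_sq_mul_sq _ _ _
      _ = (∑ n ∈ T, a n ^ 2) * ∑ n ∈ T, ‖h n‖ ^ 2 := by simp_rw [sq_abs]
      _ ≤ _ := mul_le_mul_of_nonneg_left
        (sum_le_sum_of_subset_of_nonneg hTW fun _ _ _ => sq_nonneg _)
        (sum_nonneg fun _ _ => sq_nonneg _)
  refine h2.trans (mul_le_mul_of_nonneg_left ?_ (sum_nonneg fun _ _ => sq_nonneg _))
  have h3 : ((∑ n ∈ W, ‖h n‖ ^ 2 : ℝ) : ℂ) = ∫ z, (starRingEnd ℂ) (f z.1) * f z.2 *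
      ∑ n ∈ W, eC (F n * (z.1 - z.2)) ∂(μ.prod μ) := by
    have e1 : ∀ n, ((‖h n‖ ^ 2 : ℝ) : ℂ) = ∫ z, ((starRingEnd ℂ) (f z.1) * eC (F n * z.1)) *
        (f z.2 * eC (-(F n * z.2))) ∂(μ.prod μ) := by
      intro n
      rw [integral_prod_mul (μ := μ) (ν := μ) (fun x => (starRingEnd ℂ) (f x) * eC (F n * x))
        fun x => f x * eC (-(F n * x))]
      push_cast
      rw [← Complex.mul_conj']
      congr 1
      rw [hh, ← integral_conj]
      refine integral_congr_ae (Filter.Eventually.of_forall fun x => ?_)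
      simp only [map_mul, Complex.conj_conj, conj_eC]
    push_cast
    have e2 : ∑ n ∈ W, ((‖h n‖ : ℂ)) ^ 2 = ∑ n ∈ W, ∫ z, ((starRingEnd ℂ) (f z.1) * eC (F n * z.1)) *
        (f z.2 * eC (-(F n * z.2))) ∂(μ.prod μ) :=
      sum_congr rfl fun n _ => by rw [← e1]; push_cast; rfl
    rw [e2, ← integral_finsetSum]
    · refine integral_congr_ae (Filter.Eventually.of_forall fun z => ?_)
      simp only
      rw [mul_sum]
      refine sum_congr rfl fun n _ => ?_
      rw [mul_sub, sub_eq_add_neg, eC_add]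
      ring
    · intro n _
      exact integrable_prod_restrict_of_continuous hE
        (((hconj.comp continuous_fst).mul ((heC n).comp continuous_fst)).mul
          ((hfc.comp continuous_snd).mul (continuous_eC.comp (by fun_prop))))
  have hF2 : Continuous fun x => ‖f x‖ ^ 2 := hfc.norm.pow 2
  have hkc : Continuous fun z : ℝ × ℝ => k (z.1 - z.2) := hk.comp (by fun_prop)
  have c1 : Continuous fun z : ℝ × ℝ => ‖f z.1‖ ^ 2 * k (z.1 - z.2) :=
    (hF2.comp continuous_fst).mul hkc
  have c2 : Continuous fun z : ℝ × ℝ => ‖f z.2‖ ^ 2 * k (z.1 - z.2) :=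
    (hF2.comp continuous_snd).mul hkc
  have c3 : Continuous fun z : ℝ × ℝ => ‖f z.1‖ * ‖f z.2‖ :=
    (hfc.norm.comp continuous_fst).mul (hfc.norm.comp continuous_snd)
  have h4 : ∑ n ∈ W, ‖h n‖ ^ 2 ≤ ∫ z, (1 / 2 * (‖f z.1‖ ^ 2 * k (z.1 - z.2)) +
      1 / 2 * (‖f z.2‖ ^ 2 * k (z.1 - z.2))) + U * (‖f z.1‖ * ‖f z.2‖) ∂(μ.prod μ) := by
    have e3 : ‖((∑ n ∈ W, ‖h n‖ ^ 2 : ℝ) : ℂ)‖ = ∑ n ∈ W, ‖h n‖ ^ 2 := by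
      rw [Complex.norm_real, Real.norm_of_nonneg (sum_nonneg fun _ _ => sq_nonneg _)]
    rw [← e3, h3]
    refine norm_integral_le_of_norm_le
      (((i2 (c1.const_mul _)).add (i2 (c2.const_mul _))).add (i2 (c3.const_mul _))) ?_
    rw [hμ, Measure.prod_restrict]
    filter_upwards [ae_restrict_mem (hEm.prod hEm)] with z hz
    have b1 := hk1 z.1 hz.1 z.2 hz.2
    rw [norm_mul, norm_mul, RCLike.norm_conj]
    have b2 : 0 ≤ ‖f z.1‖ * ‖f z.2‖ := by positivity
    have b3 : ‖f z.1‖ * ‖f z.2‖ * k (z.1 - z.2) ≤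
        (1 / 2 * ‖f z.1‖ ^ 2 + 1 / 2 * ‖f z.2‖ ^ 2) * k (z.1 - z.2) := by
      refine mul_le_mul_of_nonneg_right ?_ (hk0 _)
      have := sq_nonneg (‖f z.1‖ - ‖f z.2‖)
      rw [sub_sq] at this
      linarith
    have b4 := mul_le_mul_of_nonneg_left b1 b2
    linarith
  refine h4.trans ?_
  have c12 : Continuous fun z : ℝ × ℝ => 1 / 2 * (‖f z.1‖ ^ 2 * k (z.1 - z.2)) +
      1 / 2 * (‖f z.2‖ ^ 2 * k (z.1 - z.2)) := (c1.const_mul _).add (c2.const_mul _)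
  rw [integral_add (i2 c12) (i2 (c3.const_mul _)),
    integral_add (i2 (c1.const_mul _)) (i2 (c2.const_mul _)), integral_const_mul,
    integral_const_mul, integral_const_mul,
    integral_prod_mul (μ := μ) (ν := μ) (fun x => ‖f x‖) fun x => ‖f x‖,
    integral_prod _ (i2 c1), integral_prod_symm _ (i2 c2)]
  have h5 : ∫ x, ∫ y, ‖f x‖ ^ 2 * k (x - y) ∂μ ∂μ ≤ κ * ∫ x, ‖f x‖ ^ 2 ∂μ := by
    rw [← integral_const_mul]
    refine setIntegral_mono_on (i2 c1).integral_prod_left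
      ((integrable_restrict_of_continuous hE hF2).const_mul κ) hEm fun x hx => ?_
    rw [integral_const_mul, mul_comm κ]
    exact mul_le_mul_of_nonneg_left (hk2 x hx) (by positivity)
  have h6 : ∫ y, ∫ x, ‖f y‖ ^ 2 * k (x - y) ∂μ ∂μ ≤ κ * ∫ x, ‖f x‖ ^ 2 ∂μ := by
    rw [← integral_const_mul]
    refine setIntegral_mono_on (i2 c2).integral_prod_right
      ((integrable_restrict_of_continuous hE hF2).const_mul κ) hEm fun x hx => ?_
    rw [integral_const_mul, mul_comm κ]
    exact mul_le_mul_of_nonneg_left (hk3 x hx) (by positivity)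
  simp only at h5 h6 ⊢
  rw [sq (∫ x, ‖f x‖ ∂μ)]
  linarith

/-- A smooth majorant of `1 / (1 + |u| * Z)`. -/
noncomputable def bump (Z u : ℝ) : ℝ := (√(1 + (u * Z) ^ 2))⁻¹

lemma bump_nonneg (Z u : ℝ) : 0 ≤ bump Z u := inv_nonneg.2 (Real.sqrt_nonneg _)

lemma bump_neg (Z u : ℝ) : bump Z (-u) = bump Z u := by
  unfold bump
  congr 3
  ring

lemma continuous_bump (Z : ℝ) : Continuous (bump Z) := by
  unfold bump
  refine Continuous.inv₀ (by fun_prop) fun u => ?_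
  have : 0 < 1 + (u * Z) ^ 2 := by positivity
  exact (Real.sqrt_pos.2 this).ne'

lemma one_div_le_bump {Z : ℝ} (hZ : 0 < Z) (u : ℝ) : 1 / (1 + |u| * Z) ≤ bump Z u := by
  unfold bump
  rw [← one_div]
  have h0 : 0 < √(1 + (u * Z) ^ 2) := Real.sqrt_pos.2 (by positivity)
  refine one_div_le_one_div_of_le h0 ?_
  have h1 : 0 ≤ |u| * Z := by positivity
  rw [Real.sqrt_le_left (by positivity), ← sq_abs (u * Z), abs_mul, abs_of_pos hZ]
  rw [add_sq]
  linarith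

lemma arsinh_le_one_add_log {x : ℝ} (hx : 1 ≤ x) : Real.arsinh x ≤ 1 + Real.log (3 * x) := by
  unfold Real.arsinh
  have h1 : √(1 + x ^ 2) ≤ 1 + x := by
    rw [Real.sqrt_le_left (by linarith), add_sq]
    linarith
  have h2 : Real.log (x + √(1 + x ^ 2)) ≤ Real.log (3 * x) := by
    refine Real.log_le_log ?_ (by linarith)
    have := Real.sqrt_nonneg (1 + x ^ 2)
    linarith
  linarith

lemma integral_bump_sub_le {Z u : ℝ} (hZ : 0 < Z) (h1 : -1 ≤ u) (h2 : u ≤ 2) :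
    ∫ y in (0 : ℝ)..1, bump Z (u - y) ≤ 2 * Real.arsinh (2 * Z) / Z := by
  have hd : ∀ y ∈ Set.uIcc (0 : ℝ) 1,
      HasDerivAt (fun y => -(Real.arsinh ((u - y) * Z) / Z)) (bump Z (u - y)) y := by
    intro y _
    have h3 : HasDerivAt (fun y : ℝ => (u - y) * Z) (-Z) y := by
      have := ((hasDerivAt_id y).const_sub u).mul_const Z
      simpa using this
    have h4 := (((Real.hasDerivAt_arsinh ((u - y) * Z)).comp y h3).div_const Z).neg
    refine h4.congr_deriv ?_
    unfold bump
    field_simp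
  rw [intervalIntegral.integral_eq_sub_of_hasDerivAt hd
    (((continuous_bump Z).comp (by fun_prop)).intervalIntegrable _ _)]
  have h5 : Real.arsinh ((u - 0) * Z) ≤ Real.arsinh (2 * Z) := by
    rw [Real.arsinh_le_arsinh]
    gcongr
    linarith
  have h6 : -Real.arsinh ((u - 1) * Z) ≤ Real.arsinh (2 * Z) := by
    rw [← Real.arsinh_neg, Real.arsinh_le_arsinh]
    calc -((u - 1) * Z) = (1 - u) * Z := by ring
      _ ≤ _ := by
        gcongr
        linarith
  calc _ = (Real.arsinh ((u - 0) * Z) + -Real.arsinh ((u - 1) * Z)) / Z := by ring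
    _ ≤ (Real.arsinh (2 * Z) + Real.arsinh (2 * Z)) / Z := by gcongr
    _ = _ := by ring

/-- A majorant of `1 / (1 + ‖u‖ * Z)`, with the distance to the nearest integer, on `[-1, 1]`. -/
noncomputable def bumps (Z u : ℝ) : ℝ := bump Z (u + 1) + bump Z u + bump Z (u - 1)

lemma bumps_neg (Z u : ℝ) : bumps Z (-u) = bumps Z u := by
  unfold bumps
  rw [← bump_neg Z (u + 1), ← bump_neg Z (u - 1), bump_neg Z u, neg_add', neg_sub', sub_neg_eq_add]
  ring

lemma bumps_nonneg (Z u : ℝ) : 0 ≤ bumps Z u :=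
  add_nonneg (add_nonneg (bump_nonneg _ _) (bump_nonneg _ _)) (bump_nonneg _ _)

lemma continuous_bumps (Z : ℝ) : Continuous (bumps Z) :=
  (((continuous_bump Z).comp (by fun_prop)).add (continuous_bump Z)).add
    ((continuous_bump Z).comp (by fun_prop))

lemma setIntegral_bumps_le {Z : ℝ} (hZ : 0 < Z) {E : Set ℝ} (hE : E ⊆ Set.Icc 0 1) {x : ℝ}
    (hx : x ∈ E) : ∫ y in E, bumps Z (x - y) ≤ 6 * Real.arsinh (2 * Z) / Z := by
  have hx' := hE hx
  have hc : Continuous fun y => bumps Z (x - y) := (continuous_bumps Z).comp (by fun_prop)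
  have h1 : ∫ y in E, bumps Z (x - y) ≤ ∫ y in Set.Icc (0 : ℝ) 1, bumps Z (x - y) :=
    setIntegral_mono_set (hc.continuousOn.integrableOn_compact isCompact_Icc)
      (Filter.Eventually.of_forall fun y => bumps_nonneg _ _) hE.eventuallyLE
  refine h1.trans ?_
  rw [integral_Icc_eq_integral_Ioc, ← intervalIntegral.integral_of_le zero_le_one]
  have hi : ∀ u : ℝ, IntervalIntegrable (fun y => bump Z (u - y)) volume 0 1 := fun u =>
    ((continuous_bump Z).comp (by fun_prop)).intervalIntegrable _ _
  have e : ∀ y, bumps Z (x - y) = bump Z (x + 1 - y) + bump Z (x - y) + bump Z (x - 1 - y) := by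
    intro y
    unfold bumps
    rw [sub_add_eq_add_sub, sub_right_comm]
  simp_rw [e]
  rw [intervalIntegral.integral_add ((hi _).add (hi _)) (hi _),
    intervalIntegral.integral_add (hi _) (hi _)]
  have a1 := integral_bump_sub_le hZ (u := x + 1) (by linarith [hx'.1]) (by linarith [hx'.2])
  have a2 := integral_bump_sub_le hZ (u := x) (by linarith [hx'.1]) (by linarith [hx'.2])
  have a3 := integral_bump_sub_le hZ (u := x - 1) (by linarith [hx'.1]) (by linarith [hx'.2])
  have e2 : 6 * Real.arsinh (2 * Z) / Z = 2 * Real.arsinh (2 * Z) / Z +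
    2 * Real.arsinh (2 * Z) / Z + 2 * Real.arsinh (2 * Z) / Z := by ring
  rw [e2]
  exact add_le_add (add_le_add a1 a2) a3

lemma floorSum_add_int (c Y θ : ℝ) (m : ℤ) : floorSum c Y (θ + m) = floorSum c Y θ := by
  unfold floorSum
  refine sum_congr rfl fun n _ => ?_
  rw [mul_add]
  have e : (⌊(n : ℝ) ^ c⌋ : ℝ) * (m : ℝ) = ((⌊(n : ℝ) ^ c⌋ * m : ℤ) : ℝ) := by push_cast; rfl
  rw [e, eC_add_int]

lemma norm_floorSum_le_bumps {c Y C U θ : ℝ} (hC : 0 ≤ C) (hY : 0 < Y)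
    (h : ∀ θ, |θ| ≤ 1 / 2 → ‖floorSum c Y θ‖ ≤ C * (Y / (1 + |θ| * Y ^ c)) + U) (hθ : |θ| ≤ 1) :
    ‖floorSum c Y θ‖ ≤ C * Y * bumps (Y ^ c) θ + U := by
  have hZ : 0 < Y ^ c := by positivity
  have hCY : 0 ≤ C * Y := by positivity
  have main : ∀ m : ℤ, |θ + m| ≤ 1 / 2 → ‖floorSum c Y θ‖ ≤ C * Y * bump (Y ^ c) (θ + m) + U := by
    intro m hm
    have h1 := h _ hm
    rw [floorSum_add_int] at h1
    have h2 := mul_le_mul_of_nonneg_left (one_div_le_bump hZ (θ + m)) hCY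
    calc _ ≤ _ := h1
      _ = C * Y * (1 / (1 + |θ + m| * Y ^ c)) + U := by ring
      _ ≤ _ := by linarith
  have b1 := mul_nonneg hCY (bump_nonneg (Y ^ c) (θ + 1))
  have b2 := mul_nonneg hCY (bump_nonneg (Y ^ c) θ)
  have b3 := mul_nonneg hCY (bump_nonneg (Y ^ c) (θ - 1))
  unfold bumps
  rw [mul_add, mul_add]
  rw [abs_le] at hθ
  rcases le_or_gt θ (-(1 / 2)) with h1 | h1
  · have := main 1 (by rw [abs_le]; push_cast; constructor <;> linarith)
    push_cast at this
    linarith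
  · rcases le_or_gt θ (1 / 2) with h2 | h2
    · have := main 0 (by rw [abs_le]; push_cast; constructor <;> linarith)
      push_cast at this
      rw [add_zero] at this
      linarith
    · have := main (-1) (by rw [abs_le]; push_cast; constructor <;> linarith)
      push_cast at this
      rw [← sub_eq_add_neg] at this
      linarith

lemma exists_sum_log_sq_le : ∃ D > 0, ∀ Y : ℝ, 1 ≤ Y →
    ∑ p ∈ (Ioc ⌊Y⌋₊ ⌊2 * Y⌋₊).filter Nat.Prime, Real.log p ^ 2 ≤ D * Y ^ (1.000125 : ℝ) := by
  refine ⟨2 * ((1 + 1 / 0.0000625) * 2) ^ 2, by norm_num, fun Y hY => ?_⟩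
  have hY0 : 0 < Y := by linarith
  have hL : Real.log (2 * Y) ≤ (1 + 1 / 0.0000625) * 2 * Y ^ (0.0000625 : ℝ) := by
    have h1 := one_add_log_le 0.0000625 (by norm_num) (by linarith : 1 ≤ 2 * Y)
    have h2 : (2 * Y) ^ (0.0000625 : ℝ) ≤ 2 * Y ^ (0.0000625 : ℝ) := by
      rw [mul_rpow (by norm_num) hY0.le]
      gcongr
      exact Real.rpow_le_self_of_one_le (by norm_num) (by norm_num)
    nlinarith
  have hterm : ∀ p ∈ (Ioc ⌊Y⌋₊ ⌊2 * Y⌋₊).filter Nat.Prime, Real.log p ^ 2 ≤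
      ((1 + 1 / 0.0000625) * 2 * Y ^ (0.0000625 : ℝ)) ^ 2 := by
    intro p hp
    obtain ⟨h1, h2, -⟩ := mem_dyadic (mem_of_mem_filter p hp)
    have h3 : (1 : ℝ) ≤ p := by exact_mod_cast h1
    have h4 : (p : ℝ) ≤ 2 * Y := by exact_mod_cast h2
    have h5 := Real.log_nonneg h3
    have h6 := Real.log_le_log (by linarith) h4
    gcongr
    exact h6.trans hL
  refine (sum_le_card_nsmul _ _ _ hterm).trans ?_
  rw [nsmul_eq_mul]
  have hcard : (#((Ioc ⌊Y⌋₊ ⌊2 * Y⌋₊).filter Nat.Prime) : ℝ) ≤ 2 * Y :=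
    le_trans (by exact_mod_cast card_filter_le _ _) (card_Ioc_floor_le hY)
  have e : (Y ^ (0.0000625 : ℝ)) ^ 2 * Y = Y ^ (1.000125 : ℝ) := by
    rw [← Real.rpow_natCast, ← Real.rpow_mul hY0.le, ← Real.rpow_add_one hY0.ne']
    norm_num
  calc _ ≤ 2 * Y * ((1 + 1 / 0.0000625) * 2 * Y ^ (0.0000625 : ℝ)) ^ 2 := by gcongr
    _ = 2 * ((1 + 1 / 0.0000625) * 2) ^ 2 * ((Y ^ (0.0000625 : ℝ)) ^ 2 * Y) := by ring
    _ = _ := by rw [e]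

lemma exists_arsinh_le {c : ℝ} (hc : 1 < c) (hc' : c < 2.05502) : ∃ D > 0, ∀ Y : ℝ, 1 ≤ Y →
    Y * (6 * Real.arsinh (2 * Y ^ c) / Y ^ c) ≤ D * Y ^ (1 - c + 0.000125) := by
  refine ⟨6 * ((1 + 1 / 0.00005) * 6), by norm_num, fun Y hY => ?_⟩
  have hY0 : 0 < Y := by linarith
  have hYc : 1 ≤ Y ^ c := Real.one_le_rpow hY (by linarith)
  have h1 := arsinh_le_one_add_log (x := 2 * Y ^ c) (by linarith)
  have h2 := one_add_log_le 0.00005 (by norm_num) (x := 3 * (2 * Y ^ c)) (by linarith)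
  have h3 : (3 * (2 * Y ^ c)) ^ (0.00005 : ℝ) ≤ 6 * Y ^ (0.000125 : ℝ) := by
    rw [← mul_assoc, mul_rpow (by norm_num) (by positivity), ← Real.rpow_mul hY0.le]
    have a1 : (3 * 2 : ℝ) ^ (0.00005 : ℝ) ≤ 3 * 2 :=
      Real.rpow_le_self_of_one_le (by norm_num) (by norm_num)
    have a2 : Y ^ (c * 0.00005) ≤ Y ^ (0.000125 : ℝ) :=
      Real.rpow_le_rpow_of_exponent_le hY (by linarith)
    calc _ ≤ (3 * 2) * Y ^ (0.000125 : ℝ) := by gcongr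
      _ = _ := by norm_num
  have h4 : Real.arsinh (2 * Y ^ c) ≤ (1 + 1 / 0.00005) * (6 * Y ^ (0.000125 : ℝ)) :=
    h1.trans (h2.trans (by gcongr))
  have e : Y ^ (1 - c + 0.000125) = Y * Y ^ (0.000125 : ℝ) / Y ^ c := by
    rw [Real.rpow_add hY0, Real.rpow_sub hY0, Real.rpow_one]
    ring
  rw [e]
  calc _ ≤ Y * (6 * ((1 + 1 / 0.00005) * (6 * Y ^ (0.000125 : ℝ))) / Y ^ c) := by gcongr
    _ = _ := by ring

lemma le_of_sq_le_self_bound {I J V A κ U : ℝ} (hI : 0 ≤ I) (hV : 0 < V) (hA : 0 ≤ A)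
    (hJ0 : 0 ≤ J) (hκ : 0 ≤ κ) (hJ : V * J ≤ I) (h : I ^ 2 ≤ A * (κ * I + U * J ^ 2))
    (hb : A * U ≤ V ^ 2 / 2) : I ≤ 2 * (A * κ) := by
  have h1 : (V * J) ^ 2 ≤ I ^ 2 := by gcongr
  have h2 : A * U * J ^ 2 ≤ I ^ 2 / 2 := by
    calc A * U * J ^ 2 ≤ V ^ 2 / 2 * J ^ 2 := by gcongr
      _ = (V * J) ^ 2 / 2 := by ring
      _ ≤ _ := by linarith
  have h3 : I * I ≤ 2 * (A * κ) * I := by nlinarith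
  rcases hI.eq_or_lt with h0 | h0
  · rw [← h0]
    positivity
  · exact le_of_mul_le_mul_right h3 h0

/-- The points of `[0, 1]` where `SX c Y` is large. -/
def largeSet (c Y : ℝ) : Set ℝ := {x ∈ Set.Icc 0 1 | Y ^ (0.942 : ℝ) ≤ ‖SX c Y x‖}

lemma largeSet_subset (c Y : ℝ) : largeSet c Y ⊆ Set.Icc 0 1 := fun _ hx => hx.1

lemma measurableSet_largeSet (c Y : ℝ) : MeasurableSet (largeSet c Y) :=
  measurableSet_Icc.inter (measurableSet_le measurable_const (continuous_SX c Y).norm.measurable)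

lemma exists_integral_largeSet_le {c : ℝ} (hc : 1 < c) (hc' : c < 2.05502)
    (h3 : fallFac c 3 ≠ 0) : ∃ C > 0, ∃ Y₁ ≥ 1, ∀ Y ≥ Y₁,
      ∫ x in largeSet c Y, ‖SX c Y x‖ ^ 2 ≤ C * Y ^ (2 - c + 0.0005) := by
  obtain ⟨C, hC, hF⟩ := exists_floorSum_le hc hc' h3
  obtain ⟨D, hD, hlog⟩ := exists_sum_log_sq_le
  obtain ⟨G, hG, hars⟩ := exists_arsinh_le hc hc'
  refine ⟨2 * (D * (C * G)), by positivity, max 1 ((2 * (D * C)) ^ (4000 : ℝ)), le_max_left _ _,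
    fun Y hY => ?_⟩
  have hY1 : 1 ≤ Y := (le_max_left _ _).trans hY
  have hY2 := (le_max_right 1 ((2 * (D * C)) ^ (4000 : ℝ))).trans hY
  have hY0 : 0 < Y := by linarith
  have hZ : 0 < Y ^ c := Real.rpow_pos_of_pos hY0 c
  have hE := largeSet_subset c Y
  have hEm := measurableSet_largeSet c Y
  set E := largeSet c Y with hEdef
  set T := (Ioc ⌊Y⌋₊ ⌊2 * Y⌋₊).filter Nat.Prime with hT
  set κ := C * (G * Y ^ (1 - c + 0.000125)) with hκ
  set U := C * Y ^ (0.8835 : ℝ) with hU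
  have hk2 : ∀ x ∈ E, ∫ y in E, C * Y * bumps (Y ^ c) (x - y) ≤ κ := by
    intro x hx
    rw [integral_const_mul]
    have h1 := setIntegral_bumps_le hZ hE hx
    have h2 := hars Y hY1
    calc _ ≤ C * Y * (6 * Real.arsinh (2 * Y ^ c) / Y ^ c) := by gcongr
      _ = C * (Y * (6 * Real.arsinh (2 * Y ^ c) / Y ^ c)) := by ring
      _ ≤ _ := by
        rw [hκ]
        gcongr
  have hk3 : ∀ y ∈ E, ∫ x in E, C * Y * bumps (Y ^ c) (x - y) ≤ κ := by
    intro y hy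
    refine le_trans (le_of_eq ?_) (hk2 y hy)
    congr 1
    funext x
    rw [← bumps_neg, neg_sub]
  have hk1 : ∀ x ∈ E, ∀ y ∈ E, ‖∑ n ∈ Ioc ⌊Y⌋₊ ⌊2 * Y⌋₊,
      eC ((fun n : ℕ => ((⌊(n : ℝ) ^ c⌋ : ℤ) : ℝ)) n * (x - y))‖ ≤
      (fun u => C * Y * bumps (Y ^ c) u) (x - y) + U := by
    intro x hx y hy
    have hx' := hE hx
    have hy' := hE hy
    exact norm_floorSum_le_bumps hC.le hY0 (fun θ hθ => hF θ Y hY1 hθ)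
      (by rw [abs_le]; constructor <;> linarith [hx'.1, hx'.2, hy'.1, hy'.2])
  have hf : SX c Y = fun x => ∑ n ∈ T, ((Real.log n : ℝ) : ℂ) *
      eC ((fun n : ℕ => ((⌊(n : ℝ) ^ c⌋ : ℤ) : ℝ)) n * x) := rfl
  have main := sq_integral_norm_sq_le hEm hE (filter_subset _ _) (fun n : ℕ => Real.log n)
    (fun n : ℕ => ((⌊(n : ℝ) ^ c⌋ : ℤ) : ℝ)) hf
    (continuous_const.mul (continuous_bumps (Y ^ c))) hk1 hk2 hk3
    (fun x => mul_nonneg (mul_nonneg hC.le hY0.le) (bumps_nonneg _ _))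
  have hA := hlog Y hY1
  rw [← hT] at hA
  have hcont := continuous_SX c Y
  have hI0 : 0 ≤ ∫ x in E, ‖SX c Y x‖ ^ 2 := integral_nonneg fun x => by positivity
  have hJ0 : 0 ≤ ∫ x in E, ‖SX c Y x‖ := integral_nonneg fun x => norm_nonneg _
  have hκ0 : 0 ≤ κ := by positivity
  have hU0 : 0 ≤ U := by positivity
  have main2 : (∫ x in E, ‖SX c Y x‖ ^ 2) ^ 2 ≤ D * Y ^ (1.000125 : ℝ) *
      (κ * (∫ x in E, ‖SX c Y x‖ ^ 2) + U * (∫ x in E, ‖SX c Y x‖) ^ 2) :=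
    main.trans (mul_le_mul_of_nonneg_right hA
      (add_nonneg (mul_nonneg hκ0 hI0) (mul_nonneg hU0 (sq_nonneg _))))
  have hJ : Y ^ (0.942 : ℝ) * (∫ x in E, ‖SX c Y x‖) ≤ ∫ x in E, ‖SX c Y x‖ ^ 2 := by
    rw [← integral_const_mul]
    refine setIntegral_mono_on
      (integrable_restrict_of_continuous hE (continuous_const.mul hcont.norm))
      (integrable_restrict_of_continuous hE (hcont.norm.pow 2)) hEm fun x hx => ?_
    rw [sq]
    exact mul_le_mul_of_nonneg_right hx.2 (norm_nonneg _)
  have hb : D * Y ^ (1.000125 : ℝ) * U ≤ (Y ^ (0.942 : ℝ)) ^ 2 / 2 := by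
    have e1 : Y ^ (1.000125 : ℝ) * Y ^ (0.8835 : ℝ) * Y ^ (0.000375 : ℝ) =
        (Y ^ (0.942 : ℝ)) ^ 2 := by
      rw [← Real.rpow_natCast, ← Real.rpow_mul hY0.le, ← Real.rpow_add hY0, ← Real.rpow_add hY0]
      norm_num
    have e2 : 2 * (D * C) ≤ Y ^ (0.000375 : ℝ) := by
      have p0 : 0 ≤ 2 * (D * C) := by positivity
      calc 2 * (D * C) = ((2 * (D * C)) ^ (4000 : ℝ)) ^ (0.00025 : ℝ) := by
            rw [← Real.rpow_mul p0]
            norm_num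
        _ ≤ Y ^ (0.00025 : ℝ) := by gcongr
        _ ≤ _ := Real.rpow_le_rpow_of_exponent_le hY1 (by norm_num)
    rw [← e1, hU]
    have p1 : 0 ≤ Y ^ (1.000125 : ℝ) * Y ^ (0.8835 : ℝ) := by positivity
    have := mul_le_mul_of_nonneg_left e2 p1
    linarith
  have fin := le_of_sq_le_self_bound hI0 (by positivity) (by positivity) hJ0 hκ0 hJ main2 hb
  refine fin.trans ?_
  have e3 : Y ^ (1.000125 : ℝ) * Y ^ (1 - c + 0.000125) ≤ Y ^ (2 - c + 0.0005) := by
    rw [← Real.rpow_add hY0]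
    exact Real.rpow_le_rpow_of_exponent_le hY1 (by linarith)
  calc 2 * (D * Y ^ (1.000125 : ℝ) * κ) =
      2 * (D * (C * G)) * (Y ^ (1.000125 : ℝ) * Y ^ (1 - c + 0.000125)) := by
        rw [hκ]
        ring
    _ ≤ _ := by gcongr

lemma exists_integral_largeSet_le_of_one_le {c : ℝ} (hc : 1 < c) (hc' : c < 2.05502)
    (h3 : fallFac c 3 ≠ 0) : ∃ C > 0, ∀ Y ≥ 1,
      ∫ x in largeSet c Y, ‖SX c Y x‖ ^ 2 ≤ C * Y ^ (2 - c + 0.0005) := by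
  obtain ⟨C, hC, Y₁, hY₁, H⟩ := exists_integral_largeSet_le hc hc' h3
  refine ⟨max C ((4 * Y₁) ^ 2 * Y₁), lt_max_of_lt_left hC, fun Y hY => ?_⟩
  have hY0 : 0 < Y := by linarith
  have hp : 0 < Y ^ (2 - c + 0.0005) := Real.rpow_pos_of_pos hY0 _
  rcases le_or_gt Y₁ Y with h | h
  · exact (H Y h).trans (mul_le_mul_of_nonneg_right (le_max_left _ _) hp.le)
  · have h1 : ∫ x in largeSet c Y, ‖SX c Y x‖ ^ 2 ≤ (4 * Y₁) ^ 2 := by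
      calc ∫ x in largeSet c Y, ‖SX c Y x‖ ^ 2 ≤ ∫ _x in largeSet c Y, (4 * Y₁) ^ 2 := by
            refine integral_mono
              (integrable_restrict_of_continuous (largeSet_subset c Y) ((continuous_SX c Y).norm.pow 2))
              (integrable_restrict_of_continuous (largeSet_subset c Y) continuous_const) fun x => ?_
            have := norm_SX_le c x hY0.le
            have h4 : ‖SX c Y x‖ ≤ 4 * Y₁ := by linarith
            exact pow_le_pow_left₀ (norm_nonneg _) h4 2
        _ ≤ ∫ _x in Set.Icc (0 : ℝ) 1, (4 * Y₁) ^ 2 :=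
            setIntegral_mono_set (continuous_const.continuousOn.integrableOn_compact isCompact_Icc)
              (Filter.Eventually.of_forall fun y => sq_nonneg _) (largeSet_subset c Y).eventuallyLE
        _ = _ := by simp
    have h2 : 1 ≤ Y₁ * Y ^ (2 - c + 0.0005) := by
      have a1 : Y ^ (-1 : ℝ) ≤ Y ^ (2 - c + 0.0005) :=
        Real.rpow_le_rpow_of_exponent_le hY (by linarith)
      rw [Real.rpow_neg_one] at a1
      calc 1 = Y * Y⁻¹ := (mul_inv_cancel₀ hY0.ne').symm
        _ ≤ _ := by gcongr
    calc _ ≤ (4 * Y₁) ^ 2 := h1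
      _ ≤ (4 * Y₁) ^ 2 * (Y₁ * Y ^ (2 - c + 0.0005)) := le_mul_of_one_le_right (sq_nonneg _) h2
      _ = (4 * Y₁) ^ 2 * Y₁ * Y ^ (2 - c + 0.0005) := by ring
      _ ≤ _ := mul_le_mul_of_nonneg_right (le_max_right _ _) hp.le

lemma exists_integral_pow_five_le {c : ℝ} (hc : 1 < c) (hc' : c < 2.05502)
    (h3 : fallFac c 3 ≠ 0) : ∃ C > 0, ∀ Y ≥ 1, ∀ m : Set ℝ, MeasurableSet m → m ⊆ Set.Icc 0 1 →
      ∀ s ≥ 0, (∀ x ∈ m, ‖SX c Y x‖ ≤ s) → ∫ x in m, ‖SX c Y x‖ ^ 5 ≤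
        C * (Y ^ (0.942 : ℝ) * (Y ^ (4 - c + 0.001) + Y ^ (2 + 0.001 : ℝ)) +
          s ^ 3 * Y ^ (2 - c + 0.0005)) := by
  obtain ⟨C₁, hC₁, H₁⟩ := exists_integral_largeSet_le_of_one_le hc hc' h3
  obtain ⟨C₂, hC₂, H₂⟩ := exists_integral_norm_SX_pow_four_le hc (by norm_num : (0 : ℝ) < 0.001)
  refine ⟨C₁ + C₂, by positivity, fun Y hY m hm hm1 s hs hsup => ?_⟩
  have hY0 : 0 < Y := by linarith
  have hcont := (continuous_SX c Y).norm
  have hE := largeSet_subset c Y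
  have hEm := measurableSet_largeSet c Y
  have b1 := H₁ Y hY
  have b2 := H₂ Y hY
  rw [intervalIntegral.integral_of_le zero_le_one, ← integral_Icc_eq_integral_Ioc] at b2
  have i4 : Integrable (fun x => Y ^ (0.942 : ℝ) * ‖SX c Y x‖ ^ 4) (volume.restrict m) :=
    integrable_restrict_of_continuous hm1 (continuous_const.mul (hcont.pow 4))
  have i2 : Integrable ((largeSet c Y).indicator fun x => s ^ 3 * ‖SX c Y x‖ ^ 2)
      (volume.restrict m) :=
    (integrable_restrict_of_continuous hm1 (continuous_const.mul (hcont.pow 2))).indicator hEm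
  have i5 : Integrable (fun x => ‖SX c Y x‖ ^ 5) (volume.restrict m) :=
    integrable_restrict_of_continuous hm1 (hcont.pow 5)
  have step : ∫ x in m, ‖SX c Y x‖ ^ 5 ≤ ∫ x in m, (Y ^ (0.942 : ℝ) * ‖SX c Y x‖ ^ 4 +
      (largeSet c Y).indicator (fun x => s ^ 3 * ‖SX c Y x‖ ^ 2) x) := by
    refine setIntegral_mono_on i5 (i4.add i2) hm fun x hx => ?_
    have n0 := norm_nonneg (SX c Y x)
    by_cases hxE : x ∈ largeSet c Y
    · rw [Set.indicator_of_mem hxE]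
      have := hsup x hx
      have q : ‖SX c Y x‖ ^ 3 ≤ s ^ 3 := pow_le_pow_left₀ n0 this 3
      have q2 : 0 ≤ Y ^ (0.942 : ℝ) * ‖SX c Y x‖ ^ 4 := by positivity
      calc ‖SX c Y x‖ ^ 5 = ‖SX c Y x‖ ^ 3 * ‖SX c Y x‖ ^ 2 := by ring
        _ ≤ s ^ 3 * ‖SX c Y x‖ ^ 2 := by gcongr
        _ ≤ _ := by linarith
    · rw [Set.indicator_of_notMem hxE, add_zero]
      have : ‖SX c Y x‖ ≤ Y ^ (0.942 : ℝ) := by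
        by_contra! hlt
        exact hxE ⟨hm1 hx, hlt.le⟩
      calc ‖SX c Y x‖ ^ 5 = ‖SX c Y x‖ * ‖SX c Y x‖ ^ 4 := by ring
        _ ≤ _ := by gcongr
  rw [integral_add i4 i2, integral_const_mul, setIntegral_indicator hEm, integral_const_mul] at step
  have c4 : ∫ x in m, ‖SX c Y x‖ ^ 4 ≤ ∫ x in Set.Icc (0 : ℝ) 1, ‖SX c Y x‖ ^ 4 :=
    setIntegral_mono_set ((hcont.pow 4).continuousOn.integrableOn_compact isCompact_Icc)
      (Filter.Eventually.of_forall fun y => by positivity) hm1.eventuallyLE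
  have c2 : ∫ x in m ∩ largeSet c Y, ‖SX c Y x‖ ^ 2 ≤ ∫ x in largeSet c Y, ‖SX c Y x‖ ^ 2 :=
    setIntegral_mono_set (integrable_restrict_of_continuous hE (hcont.pow 2))
      (Filter.Eventually.of_forall fun y => by positivity) Set.inter_subset_right.eventuallyLE
  have p1 : 0 ≤ Y ^ (0.942 : ℝ) := by positivity
  have p2 : 0 ≤ s ^ 3 := by positivity
  have e1 := mul_le_mul_of_nonneg_left (c4.trans b2) p1
  have e2 := mul_le_mul_of_nonneg_left (c2.trans b1) p2
  have p3 : 0 ≤ C₁ * (Y ^ (0.942 : ℝ) * (Y ^ (4 - c + 0.001) + Y ^ (2 + 0.001 : ℝ))) := by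
    positivity
  have p4 : 0 ≤ C₂ * (s ^ 3 * Y ^ (2 - c + 0.0005)) := by positivity
  calc _ ≤ _ := step
    _ ≤ _ := add_le_add e1 e2
    _ ≤ _ := by linarith

lemma SX_sub_one (c Y α : ℝ) : SX c Y (α - 1) = SX c Y α := by
  unfold SX
  refine sum_congr rfl fun n _ => ?_
  have e : (⌊(n : ℝ) ^ c⌋ : ℝ) * (α - 1) = (⌊(n : ℝ) ^ c⌋ : ℝ) * α + ((-⌊(n : ℝ) ^ c⌋ : ℤ) : ℝ) := by
    push_cast
    ring
  rw [e, eC_add_int]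

lemma exists_integral_minor_le {c : ℝ} (hc : 1 < c) (hc' : c < 2.05502) (h3 : fallFac c 3 ≠ 0)
    (h5 : fallFac c 5 ≠ 0) {A : ℝ} (hA : 1 ≤ A) :
    ∃ C > 0, ∀ P ≥ 1, ∀ ε > 0, ε ≤ 0.01 → ∀ Y, 1 ≤ Y → Y ≤ A * P →
      ∫ x in Set.Icc (P ^ (1 - c - ε)) (1 - P ^ (1 - c - ε)), ‖SX c Y x‖ ^ 5 ≤
        C * P ^ (5 - c - 0.0007) := by
  obtain ⟨C₁, hC₁, H₁⟩ := exists_integral_pow_five_le hc hc' h3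
  obtain ⟨C₀, hC₀, H₀⟩ := exists_SX_le hc hc' h3 h5
  refine ⟨C₁ * ((2 + C₀ ^ 3) * A ^ (5 - c - 0.0007) + 64), by positivity,
    fun P hP ε hε hε' Y hY hYA => ?_⟩
  have hP0 : 0 < P := by linarith
  have hY0 : 0 < Y := by linarith
  set τ := P ^ (1 - c - ε) with hτ
  have hτ0 : 0 < τ := Real.rpow_pos_of_pos hP0 _
  have hm : Set.Icc τ (1 - τ) ⊆ Set.Icc 0 1 := Set.Icc_subset_Icc hτ0.le (by linarith)
  have hYe : Y ^ (5 - c - 0.0007) ≤ A ^ (5 - c - 0.0007) * P ^ (5 - c - 0.0007) := by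
    rw [← Real.mul_rpow (by linarith) hP0.le]
    exact Real.rpow_le_rpow hY0.le hYA (by linarith)
  have t1 : Y ^ (0.942 : ℝ) * (Y ^ (4 - c + 0.001) + Y ^ (2 + 0.001 : ℝ)) ≤
      2 * Y ^ (5 - c - 0.0007) := by
    rw [mul_add, ← Real.rpow_add hY0, ← Real.rpow_add hY0, two_mul]
    exact add_le_add (Real.rpow_le_rpow_of_exponent_le hY (by linarith))
      (Real.rpow_le_rpow_of_exponent_le hY (by linarith))
  have hPe : 0 ≤ P ^ (5 - c - 0.0007) := by positivity
  have hAe : 0 ≤ A ^ (5 - c - 0.0007) := by positivity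
  suffices hs : ∃ s ≥ 0, (∀ x ∈ Set.Icc τ (1 - τ), ‖SX c Y x‖ ≤ s) ∧ s ^ 3 * Y ^ (2 - c + 0.0005) ≤
      (C₀ ^ 3 * A ^ (5 - c - 0.0007) + 64) * P ^ (5 - c - 0.0007) by
    obtain ⟨s, hs0, hs1, hs2⟩ := hs
    have := H₁ Y hY _ measurableSet_Icc hm s hs0 hs1
    refine this.trans ?_
    rw [mul_assoc]
    refine mul_le_mul_of_nonneg_left ?_ hC₁.le
    linarith
  rcases le_or_gt (P ^ (0.99 : ℝ)) Y with h | h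
  · refine ⟨C₀ * Y ^ (0.9996 : ℝ), by positivity, fun x hx => ?_, ?_⟩
    · have hlow : Y ^ (0.9 - c) ≤ τ := by
        calc Y ^ (0.9 - c) ≤ (P ^ (0.99 : ℝ)) ^ (0.9 - c) :=
              Real.rpow_le_rpow_of_nonpos (by positivity) h (by linarith)
          _ = P ^ (0.99 * (0.9 - c)) := (Real.rpow_mul hP0.le _ _).symm
          _ ≤ τ := Real.rpow_le_rpow_of_exponent_le hP (by linarith)
      rcases le_or_gt x (1 / 2) with hx2 | hx2
      · have e : |x| = x := abs_of_pos (hτ0.trans_le hx.1)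
        exact H₀ x Y hY (by rw [e]; exact hlow.trans hx.1) (by rw [e]; exact hx2)
      · have e : |x - 1| = 1 - x := by
          rw [abs_sub_comm, abs_of_nonneg]
          linarith [hx.2]
        rw [← SX_sub_one]
        exact H₀ (x - 1) Y hY (by rw [e]; linarith [hx.2]) (by rw [e]; linarith)
    · have e : (C₀ * Y ^ (0.9996 : ℝ)) ^ 3 * Y ^ (2 - c + 0.0005) =
          C₀ ^ 3 * Y ^ (5 - c - 0.0007) := by
        rw [mul_pow, ← Real.rpow_natCast, ← Real.rpow_natCast (Y ^ _), ← Real.rpow_mul hY0.le,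
          mul_assoc, ← Real.rpow_add hY0]
        congr 2
        norm_num
        ring
      rw [e]
      have := mul_le_mul_of_nonneg_left hYe (pow_nonneg hC₀.le 3)
      linarith
  · refine ⟨4 * Y, by positivity, fun x _ => norm_SX_le c x hY0.le, ?_⟩
    have e : (4 * Y) ^ 3 * Y ^ (2 - c + 0.0005) = 64 * Y ^ (5 - c + 0.0005) := by
      rw [mul_pow, ← Real.rpow_natCast Y, mul_assoc, ← Real.rpow_add hY0]
      norm_num
      ring_nf
    rw [e]
    have h6 : Y ^ (5 - c + 0.0005) ≤ P ^ (5 - c - 0.0007) := by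
      calc Y ^ (5 - c + 0.0005) ≤ (P ^ (0.99 : ℝ)) ^ (5 - c + 0.0005) :=
            Real.rpow_le_rpow hY0.le h.le (by linarith)
        _ = P ^ (0.99 * (5 - c + 0.0005)) := (Real.rpow_mul hP0.le _ _).symm
        _ ≤ _ := Real.rpow_le_rpow_of_exponent_le hP (by linarith)
    have h7 : 0 ≤ C₀ ^ 3 * A ^ (5 - c - 0.0007) * P ^ (5 - c - 0.0007) := by positivity
    linarith

lemma SS_eq_add_SX (c α : ℝ) {P : ℝ} (hP : 0 ≤ P) :
    SS c P α = SS c (P / 2) α + SX c (P / 2) α := by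
  unfold SS SX
  rw [mul_div_cancel₀ P two_ne_zero, ← sum_union]
  · congr 1
    rw [← filter_union]
    congr 1
    have h : ⌊P / 2⌋₊ ≤ ⌊P⌋₊ := Nat.floor_mono (by linarith)
    ext n
    simp only [mem_union, Finset.mem_range, mem_Ioc]
    omega
  · rw [disjoint_left]
    intro n h1 h2
    have h3 := mem_range.1 (mem_of_mem_filter n h1)
    have h4 := mem_Ioc.1 (mem_of_mem_filter n h2)
    omega

lemma SS_eq_sum_SX (c α : ℝ) {P : ℝ} (hP : 0 ≤ P) (n : ℕ) :
    SS c P α = SS c (P / 2 ^ n) α + ∑ i ∈ range n, SX c (P / 2 ^ (i + 1)) α := by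
  induction n with
  | zero => simp
  | succ n ih =>
    rw [ih, SS_eq_add_SX c α (by positivity : 0 ≤ P / 2 ^ n), sum_range_succ, div_div, ← pow_succ]
    ring

lemma SS_eq_zero (c α : ℝ) {P : ℝ} (hP : P < 2) : SS c P α = 0 := by
  unfold SS
  refine sum_eq_zero fun p hp => ?_
  obtain ⟨h1, h2⟩ := mem_filter.1 hp
  have h3 : ⌊P⌋₊ < 2 := (Nat.floor_lt' two_ne_zero).2 (by exact_mod_cast hP)
  have := h2.two_le
  have := mem_range.1 h1
  omega

lemma exists_dyadic_count : ∃ K > 0, ∀ P : ℝ, 1 ≤ P → ∃ n : ℕ, (n : ℝ) ≤ K * P ^ (0.00002 : ℝ) ∧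
    (2 : ℝ) ^ n ≤ P ∧ P / 2 ^ n < 2 := by
  refine ⟨2 * (1 + 1 / 0.00002), by norm_num, fun P hP => ⟨Nat.log 2 ⌊P⌋₊, ?_⟩⟩
  have hf : ⌊P⌋₊ ≠ 0 := (Nat.floor_pos.2 hP).ne'
  have h1 : (2 : ℝ) ^ Nat.log 2 ⌊P⌋₊ ≤ P :=
    le_trans (by exact_mod_cast Nat.pow_log_le_self 2 hf) (Nat.floor_le (by linarith))
  refine ⟨?_, h1, ?_⟩
  · have h2 := Real.log_le_log (by positivity) h1
    rw [Real.log_pow] at h2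
    have h3 := one_add_log_le 0.00002 (by norm_num) hP
    have h4 : (Nat.log 2 ⌊P⌋₊ : ℝ) * (1 / 2) ≤ (Nat.log 2 ⌊P⌋₊ : ℝ) * Real.log 2 := by
      gcongr
      linarith [Real.log_two_gt_d9]
    linarith
  · rw [div_lt_iff₀ (by positivity), ← pow_succ']
    exact (Nat.lt_floor_add_one P).trans_le
      (by exact_mod_cast Nat.lt_pow_succ_log_self one_lt_two _)

lemma norm_SS_pow_five_le (c α : ℝ) {P : ℝ} (hP : 0 ≤ P) {n : ℕ} (hn : P / 2 ^ n < 2) :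
    ‖SS c P α‖ ^ 5 ≤ (n : ℝ) ^ 4 * ∑ i ∈ range n, ‖SX c (P / 2 ^ (i + 1)) α‖ ^ 5 := by
  rw [SS_eq_sum_SX c α hP n, SS_eq_zero c α hn, zero_add]
  rcases n.eq_zero_or_pos with rfl | h
  · simp
  · have h1 := pow_sum_div_card_le_sum_pow (s := range n)
      (f := fun i => ‖SX c (P / 2 ^ (i + 1)) α‖) (fun i _ => norm_nonneg _) 4
    rw [card_range, div_le_iff₀ (by positivity), mul_comm] at h1
    refine le_trans ?_ h1
    gcongr
    exact norm_sum_le _ _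

lemma continuous_SS (c P : ℝ) : Continuous (SS c P) :=
  continuous_finsetSum _ fun _ _ => continuous_const.mul (continuous_eC.comp (by fun_prop))

lemma pow_four_mul_le {a b : ℝ} (ha : 0 ≤ a) (hb : 0 ≤ b) : a ^ 4 * b ≤ a ^ 5 + b ^ 5 := by
  rcases le_total a b with h | h
  · have h1 : a ^ 4 ≤ b ^ 4 := pow_le_pow_left₀ ha h 4
    have h2 := mul_le_mul_of_nonneg_right h1 hb
    have h3 := pow_nonneg ha 5
    calc a ^ 4 * b ≤ b ^ 4 * b := h2
      _ = b ^ 5 := by ring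
      _ ≤ _ := by linarith
  · have h2 := mul_le_mul_of_nonneg_left h (pow_nonneg ha 4)
    have h3 := pow_nonneg hb 5
    calc a ^ 4 * b ≤ a ^ 4 * a := h2
      _ = a ^ 5 := by ring
      _ ≤ _ := by linarith

lemma exists_norm_integral_le {c : ℝ} (hc : 1 < c) (hc' : c < 2.05502) (h3 : fallFac c 3 ≠ 0)
    (h5 : fallFac c 5 ≠ 0) {A : ℝ} (hA : 1 ≤ A) :
    ∃ C > 0, ∀ P ≥ 1, ∀ ε > 0, ε ≤ 0.01 → P ^ (1 - c - ε) ≤ 1 / 2 → ∀ X, 1 ≤ X → X ≤ A * P → ∀ t,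
      ‖∫ α in (P ^ (1 - c - ε))..(1 - P ^ (1 - c - ε)),
        (SS c P α) ^ 4 * SX c X α * eC (t * α)‖ ≤ C * P ^ (5 - c - 0.0006) := by
  obtain ⟨C, hC, H⟩ := exists_integral_minor_le hc hc' h3 h5 hA
  obtain ⟨K, hK, HK⟩ := exists_dyadic_count
  refine ⟨(K ^ 5 + 1) * C, by positivity, fun P hP ε hε hε' hτ X hX hXA t => ?_⟩
  obtain ⟨n, hn1, hn2, hn3⟩ := HK P hP
  have hP0 : 0 < P := by linarith
  set τ := P ^ (1 - c - ε) with hτdef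
  have hτ0 : 0 < τ := Real.rpow_pos_of_pos hP0 _
  have hm : Set.Icc τ (1 - τ) ⊆ Set.Icc 0 1 := Set.Icc_subset_Icc hτ0.le (by linarith)
  have hi : ∀ Y, Integrable (fun x => ‖SX c Y x‖ ^ 5) (volume.restrict (Set.Icc τ (1 - τ))) :=
    fun Y => integrable_restrict_of_continuous hm ((continuous_SX c Y).norm.pow 5)
  have hsum : Integrable (fun x => (n : ℝ) ^ 4 *
      ∑ i ∈ range n, ‖SX c (P / 2 ^ (i + 1)) x‖ ^ 5) (volume.restrict (Set.Icc τ (1 - τ))) :=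
    (integrable_finsetSum _ fun i _ => hi _).const_mul _
  have key : ∫ x in Set.Icc τ (1 - τ), ‖(SS c P x) ^ 4 * SX c X x * eC (t * x)‖ ≤
      ∫ x in Set.Icc τ (1 - τ), ((n : ℝ) ^ 4 * ∑ i ∈ range n, ‖SX c (P / 2 ^ (i + 1)) x‖ ^ 5 +
        ‖SX c X x‖ ^ 5) := by
    refine integral_mono ?_ (hsum.add (hi X)) fun x => ?_
    · exact integrable_restrict_of_continuous hm ((((continuous_SS c P).pow 4).mul
        (continuous_SX c X)).mul (continuous_eC.comp (by fun_prop))).norm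
    · have h1 := norm_SS_pow_five_le c x hP0.le hn3
      have h2 := pow_four_mul_le (norm_nonneg (SS c P x)) (norm_nonneg (SX c X x))
      simp only [norm_mul, norm_pow, norm_eC, mul_one]
      linarith
  rw [integral_add hsum (hi X), integral_const_mul, integral_finsetSum _ fun i _ => hi _] at key
  have hpiece : ∀ i ∈ range n, ∫ x in Set.Icc τ (1 - τ), ‖SX c (P / 2 ^ (i + 1)) x‖ ^ 5 ≤
      C * P ^ (5 - c - 0.0007) := by
    intro i hin
    have hle : (2 : ℝ) ^ (i + 1) ≤ P :=
      le_trans (pow_le_pow_right₀ one_le_two (mem_range.1 hin)) hn2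
    refine H P hP ε hε hε' _ ((one_le_div (by positivity)).2 hle) ?_
    have : P / 2 ^ (i + 1) ≤ P := div_le_self hP0.le (one_le_pow₀ one_le_two)
    exact this.trans (le_mul_of_one_le_left hP0.le hA)
  have hs := sum_le_card_nsmul _ _ _ hpiece
  rw [card_range, nsmul_eq_mul] at hs
  have hX5 := H P hP ε hε hε' X hX hXA
  have hn5 : (n : ℝ) ^ 5 ≤ K ^ 5 * P ^ (0.0001 : ℝ) := by
    have := pow_le_pow_left₀ (Nat.cast_nonneg n) hn1 5
    rw [mul_pow, ← Real.rpow_natCast (P ^ _), ← Real.rpow_mul hP0.le] at this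
    norm_num at this ⊢
    exact this
  have hone : 1 ≤ P ^ (0.0001 : ℝ) := Real.one_le_rpow hP (by norm_num)
  have he : P ^ (0.0001 : ℝ) * P ^ (5 - c - 0.0007) = P ^ (5 - c - 0.0006) := by
    rw [← Real.rpow_add hP0]
    congr 1
    ring
  have hPe : 0 ≤ C * P ^ (5 - c - 0.0007) := by positivity
  calc _ ≤ ∫ x in τ..(1 - τ), ‖(SS c P x) ^ 4 * SX c X x * eC (t * x)‖ :=
        intervalIntegral.norm_integral_le_integral_norm (by linarith)
    _ = ∫ x in Set.Icc τ (1 - τ), ‖(SS c P x) ^ 4 * SX c X x * eC (t * x)‖ := by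
        rw [intervalIntegral.integral_of_le (by linarith), integral_Icc_eq_integral_Ioc]
    _ ≤ (n : ℝ) ^ 4 * (n * (C * P ^ (5 - c - 0.0007))) + C * P ^ (5 - c - 0.0007) := by
        refine key.trans (add_le_add ?_ hX5)
        exact mul_le_mul_of_nonneg_left hs (by positivity)
    _ = ((n : ℝ) ^ 5 + 1) * (C * P ^ (5 - c - 0.0007)) := by ring
    _ ≤ (K ^ 5 * P ^ (0.0001 : ℝ) + P ^ (0.0001 : ℝ)) * (C * P ^ (5 - c - 0.0007)) :=
        mul_le_mul_of_nonneg_right (add_le_add hn5 hone) hPe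
    _ = (K ^ 5 + 1) * C * (P ^ (0.0001 : ℝ) * P ^ (5 - c - 0.0007)) := by ring
    _ = _ := by rw [he]

lemma fallFac_ne_zero {c : ℝ} (hc : 1 < c) (hc' : c < 3) (hc2 : c ≠ 2) (k : ℕ) :
    fallFac c k ≠ 0 := by
  unfold fallFac
  rw [prod_ne_zero_iff]
  intro i _ h
  have h1 : c = i := by linarith
  have h2 : 1 < i := by exact_mod_cast h1 ▸ hc
  have h3 : i < 3 := by exact_mod_cast h1 ▸ hc'
  have h4 : i = 2 := by omega
  rw [h4] at h1
  exact hc2 (by exact_mod_cast h1)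

theorem stmt_19 (c : ℝ) (hc1 : 1 < c) (hc2 : c < 4109054 / 1999527) (hc3 : c ≠ 2) :
    ∃ ε₀ > 0, ∀ ε : ℝ, 0 < ε → ε ≤ ε₀ → ∀ A : ℝ, 0 < A →
      ∃ ε' > 0, ∃ C > 0, ∃ N₀ : ℕ, ∀ N : ℕ, N₀ ≤ N →
        ∀ P τ : ℝ, P = (N : ℝ) ^ (1 / c) → τ = P ^ (1 - c - ε) →
          ∀ X : ℝ, A⁻¹ * P ^ ((9449 : ℝ) / 10000) ≤ X → X ≤ A * P →
            ‖∫ α in τ..(1 - τ), (SS c P α) ^ 4 * SX c X α * eC (-(N : ℝ) * α)‖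
              ≤ C * P ^ (5 - c - ε') := by
  have hc' : c < 2.05502 := hc2.trans (by norm_num)
  refine ⟨0.01, by norm_num, fun ε hε hε' A hA => ⟨0.0006, by norm_num, ?_⟩⟩
  obtain ⟨C, hC, H⟩ := exists_norm_integral_le hc1 hc' (fallFac_ne_zero hc1 (by linarith) hc3 3)
    (fallFac_ne_zero hc1 (by linarith) hc3 5) (le_max_right A 1)
  refine ⟨C, hC, ?_⟩
  have hlim : Filter.Tendsto (fun N : ℕ => (N : ℝ) ^ (1 / c)) Filter.atTop Filter.atTop :=
    (tendsto_rpow_atTop (by positivity)).comp tendsto_natCast_atTop_atTop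
  have e1 := hlim.eventually (Filter.eventually_ge_atTop 1)
  have e2 := ((tendsto_rpow_atTop (by norm_num : (0 : ℝ) < 9449 / 10000)).comp hlim).eventually
    (Filter.eventually_ge_atTop A)
  have e3 := ((tendsto_rpow_neg_atTop (by linarith : 0 < c - 1)).comp hlim).eventually
    (eventually_le_nhds (by norm_num : (0 : ℝ) < 1 / 2))
  obtain ⟨N₀, hN₀⟩ := Filter.eventually_atTop.1 (e1.and (e2.and e3))
  refine ⟨N₀, fun N hN P τ hP hτ X hX1 hX2 => ?_⟩
  obtain ⟨b1, b2, b3⟩ := hN₀ N hN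
  simp only [Function.comp_apply] at b2 b3
  rw [← hP] at b1 b2 b3
  have hP0 : 0 < P := by linarith
  have hτ' : P ^ (1 - c - ε) ≤ 1 / 2 :=
    (Real.rpow_le_rpow_of_exponent_le b1 (by linarith)).trans b3
  have hX : 1 ≤ X := by
    refine le_trans ?_ hX1
    rw [inv_mul_eq_div]
    exact (one_le_div hA).2 b2
  rw [hτ]
  exact H P b1 ε hε hε' hτ' X hX (hX2.trans (by gcongr; exact le_max_left _ _)) _
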